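/- Let D ⊆ ℝ² × (0,∞) be a set of Hausdorff dimension strictly greater than 1 (with respect to the Euclidean metric on ℝ² × ℝ), and let B ⊆ ℝ² be a Borel set such that for every (x, r) ∈ D the circle Metric.sphere x r intersects B in a set of positive 1-dimensional Hausdorff measure, i.e. μH¹(B ∩ Metric.sphere x r) > 0. Then B has positive Lebesgue measure. (Wolff's theorem.) -/

import Mathlib

open MeasureTheory Metric

namespace Wolff

section Moments
variable {α : Type*} [MeasurableSpace α]

/-- moments of `g` against `s^b t^β` -/
noncomputable def mom (μ : Measure α) (s t : α → ℝ) (g : α → ℂ) (b β : ℕ) : ℂ :=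
  ∫ x, g x * ((s x : ℂ) ^ b * (t x : ℂ) ^ β) ∂μ

/-- the coordinates are bounded -/
structure SM (μ : Measure α) (s t : α → ℝ) : Prop where
  ms : Measurable s
  mt : Measurable t
  bs : ∀ᵐ x ∂μ, |s x| ≤ 1
  bt : ∀ᵐ x ∂μ, |t x| ≤ 1 / 2

/-- the maximal moment is at most `C` -/
def HB (μ : Measure α) (s t : α → ℝ) (g : α → ℂ) (b : ℕ) (C : ℝ) : Prop :=
  ∀ m β, ‖mom μ s t g (b + m) β‖ ≤ 4 ^ m * C

structure MulBd (μ : Measure α) (s t : α → ℝ) (q : α → ℂ) (A : ℝ) : Prop where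
  meas : AEStronglyMeasurable q μ
  bdd : ∃ M, ∀ᵐ x ∂μ, ‖q x‖ ≤ M
  nonneg : 0 ≤ A
  bound : ∀ g, Integrable g μ → ∀ b C, HB μ s t g b C → HB μ s t (fun x => g x * q x) b (A * C)

variable {μ : Measure α} {s t : α → ℝ}

theorem HB.nonneg {g : α → ℂ} {b : ℕ} {C : ℝ} (h : HB μ s t g b C) : 0 ≤ C := by
  have := h 0 0
  have h2 := norm_nonneg (mom μ s t g (b + 0) 0)
  simpa using h2.trans this

theorem HB.mono {g : α → ℂ} {b : ℕ} {C C' : ℝ} (h : HB μ s t g b C) (hC : C ≤ C') :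
    HB μ s t g b C' := fun m β => (h m β).trans (by gcongr)

theorem SM.integrable_mul (hst : SM μ s t) {g : α → ℂ} (hg : Integrable g μ) (b β : ℕ) :
    Integrable (fun x => g x * ((s x : ℂ) ^ b * (t x : ℂ) ^ β)) μ := by
  refine hg.mul_bdd (c := 1) ?_ ?_
  · have := hst.ms; have := hst.mt
    apply Measurable.aestronglyMeasurable
    fun_prop
  · filter_upwards [hst.bs, hst.bt] with x h1 h2
    rw [norm_mul, norm_pow, norm_pow, Complex.norm_real, Complex.norm_real, Real.norm_eq_abs,
      Real.norm_eq_abs]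
    have h3 : |t x| ≤ 1 := by linarith
    calc |s x| ^ b * |t x| ^ β ≤ 1 * 1 := by
          gcongr
          · exact pow_le_one₀ (abs_nonneg _) h1
          · exact pow_le_one₀ (abs_nonneg _) h3
      _ = 1 := by norm_num

theorem MulBd.integrable {q : α → ℂ} {A : ℝ} (hq : MulBd μ s t q A) {g : α → ℂ}
    (hg : Integrable g μ) : Integrable (fun x => g x * q x) μ := by
  obtain ⟨M, hM⟩ := hq.bdd
  exact hg.mul_bdd hq.meas hM

theorem MulBd.mono {q : α → ℂ} {A A' : ℝ} (hq : MulBd μ s t q A) (h : A ≤ A') :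
    MulBd μ s t q A' :=
  ⟨hq.meas, hq.bdd, hq.nonneg.trans h, fun g hg b C hC =>
    (hq.bound g hg b C hC).mono (mul_le_mul_of_nonneg_right h hC.nonneg)⟩

theorem mulBd_s (hst : SM μ s t) : MulBd μ s t (fun x => (s x : ℂ)) 4 := by
  refine ⟨?_, ⟨1, ?_⟩, by norm_num, ?_⟩
  · have := hst.ms
    exact Measurable.aestronglyMeasurable (by fun_prop)
  · filter_upwards [hst.bs] with x h1
    simpa using h1
  · intro g hg b C hC m β
    have := hC (m + 1) β
    have e : mom μ s t (fun x => g x * (s x : ℂ)) (b + m) β = mom μ s t g (b + (m + 1)) β := by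
      unfold mom
      congr 1; ext x; rw [← add_assoc, pow_succ]; ring
    rw [e]
    calc _ ≤ _ := this
      _ = _ := by ring

theorem mulBd_t (hst : SM μ s t) : MulBd μ s t (fun x => (t x : ℂ)) 1 := by
  refine ⟨?_, ⟨1, ?_⟩, by norm_num, ?_⟩
  · have := hst.mt
    exact Measurable.aestronglyMeasurable (by fun_prop)
  · filter_upwards [hst.bt] with x h1
    have : |t x| ≤ 1 := by linarith
    simpa using this
  · intro g hg b C hC m β
    have := hC m (β + 1)
    have e : mom μ s t (fun x => g x * (t x : ℂ)) (b + m) β = mom μ s t g (b + m) (β + 1) := by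
      unfold mom
      congr 1; ext x; rw [pow_succ]; ring
    rw [e]
    calc _ ≤ _ := this
      _ = _ := by ring

theorem mulBd_const (c : ℂ) : MulBd μ s t (fun _ => c) ‖c‖ := by
  refine ⟨by fun_prop, ⟨‖c‖, by simp⟩, by positivity, ?_⟩
  intro g hg b C hC m β
  have := hC m β
  have e : mom μ s t (fun x => g x * c) (b + m) β = c * mom μ s t g (b + m) β := by
    unfold mom
    rw [← integral_const_mul]
    congr 1; ext x; ring
  rw [e, norm_mul]
  calc _ ≤ ‖c‖ * (4 ^ m * C) := by gcongr
    _ = _ := by ring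

theorem MulBd.add (hst : SM μ s t) {q q' : α → ℂ} {A A' : ℝ} (hq : MulBd μ s t q A)
    (hq' : MulBd μ s t q' A') :
    MulBd μ s t (fun x => q x + q' x) (A + A') := by
  obtain ⟨M, hM⟩ := hq.bdd
  obtain ⟨M', hM'⟩ := hq'.bdd
  refine ⟨hq.meas.add hq'.meas, ⟨M + M', ?_⟩, add_nonneg hq.nonneg hq'.nonneg, ?_⟩
  · filter_upwards [hM, hM'] with x h1 h2
    exact (norm_add_le _ _).trans (add_le_add h1 h2)
  · intro g hg b C hC m β
    have h1 := hq.bound g hg b C hC m β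
    have h2 := hq'.bound g hg b C hC m β
    have e : mom μ s t (fun x => g x * (q x + q' x)) (b + m) β =
        mom μ s t (fun x => g x * q x) (b + m) β + mom μ s t (fun x => g x * q' x) (b + m) β := by
      unfold mom
      rw [← integral_add (hst.integrable_mul (hq.integrable hg) _ _)
        (hst.integrable_mul (hq'.integrable hg) _ _)]
      congr 1; ext x; ring
    rw [e]
    calc _ ≤ _ := norm_add_le _ _
      _ ≤ 4 ^ m * (A * C) + 4 ^ m * (A' * C) := add_le_add h1 h2
      _ = _ := by ring

theorem MulBd.mul {q q' : α → ℂ} {A A' : ℝ} (hq : MulBd μ s t q A)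
    (hq' : MulBd μ s t q' A') :
    MulBd μ s t (fun x => q x * q' x) (A * A') := by
  obtain ⟨M, hM⟩ := hq.bdd
  obtain ⟨M', hM'⟩ := hq'.bdd
  refine ⟨hq.meas.mul hq'.meas, ⟨|M| * |M'|, ?_⟩, mul_nonneg hq.nonneg hq'.nonneg, ?_⟩
  · filter_upwards [hM, hM'] with x h1 h2
    rw [norm_mul]
    gcongr
    · exact h1.trans (le_abs_self _)
    · exact h2.trans (le_abs_self _)
  · intro g hg b C hC
    have h1 := hq.bound g hg b C hC
    have h2 := hq'.bound _ (hq.integrable hg) b _ h1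
    simp only [mul_assoc] at h2
    refine HB.mono h2 (le_of_eq ?_)
    ring

theorem MulBd.const_mul {q : α → ℂ} {A : ℝ} (hq : MulBd μ s t q A) (c : ℂ) :
    MulBd μ s t (fun x => c * q x) (‖c‖ * A) := (mulBd_const c).mul hq

theorem MulBd.pow {q : α → ℂ} {A : ℝ} (hq : MulBd μ s t q A) (n : ℕ) :
    MulBd μ s t (fun x => q x ^ n) (A ^ n) := by
  induction n with
  | zero => simpa using (mulBd_const (μ := μ) (s := s) (t := t) 1)
  | succ n ih => simpa [pow_succ] using ih.mul hq

theorem MulBd.congr {q q' : α → ℂ} {A : ℝ} (hq : MulBd μ s t q A) (h : q =ᵐ[μ] q') :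
    MulBd μ s t q' A := by
  obtain ⟨M, hM⟩ := hq.bdd
  refine ⟨hq.meas.congr h, ⟨M, ?_⟩, hq.nonneg, ?_⟩
  · filter_upwards [hM, h] with x h1 h2
    rwa [← h2]
  · intro g hg b C hC m β
    have := hq.bound g hg b C hC m β
    have e : mom μ s t (fun x => g x * q' x) (b + m) β = mom μ s t (fun x => g x * q x) (b + m) β := by
      apply integral_congr_ae
      filter_upwards [h] with x h2
      rw [h2]
    rwa [e]

theorem MulBd.exp_sub_one (hst : SM μ s t) {q : α → ℂ} {A : ℝ} (hq : MulBd μ s t q A) :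
    MulBd μ s t (fun x => Complex.exp (q x) - 1) (Real.exp A - 1) := by
  obtain ⟨M, hM⟩ := hq.bdd
  refine ⟨?_, ⟨Real.exp M + 1, ?_⟩, ?_, ?_⟩
  · have := hq.meas
    exact (Complex.continuous_exp.comp_aestronglyMeasurable this).sub (by fun_prop)
  · filter_upwards [hM] with x h1
    refine (norm_sub_le _ _).trans ?_
    rw [norm_one]
    gcongr
    exact (Complex.norm_exp_le_exp_norm _).trans (Real.exp_le_exp.2 h1)
  · have := Real.add_one_le_exp A
    linarith [hq.nonneg]
  · intro g hg b C hC m β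
    set F : ℕ → α → ℂ := fun n x =>
      (g x * (q x ^ (n + 1) / ((n + 1).factorial : ℂ))) * ((s x : ℂ) ^ (b + m) * (t x : ℂ) ^ β) with hF
    have hmb : ∀ n : ℕ, MulBd μ s t (fun x => q x ^ (n + 1) / ((n + 1).factorial : ℂ))
        (A ^ (n + 1) / ((n + 1).factorial : ℝ)) := by
      intro n
      have := (hq.pow (n + 1)).const_mul (1 / ((n + 1).factorial : ℂ))
      have e : ‖(1 / ((n + 1).factorial : ℂ))‖ * A ^ (n + 1) = A ^ (n + 1) / ((n + 1).factorial : ℝ) := by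
        rw [norm_div, norm_one, Complex.norm_natCast]; ring
      rw [e] at this
      refine this.congr (Filter.Eventually.of_forall fun x => ?_)
      simp only; ring
    have hFint : ∀ n, Integrable (F n) μ := fun n =>
      hst.integrable_mul ((hmb n).integrable hg) _ _
    have hbd : ∀ n, ∀ᵐ x ∂μ, ‖F n x‖ ≤ ‖g x‖ * (|M| ^ (n + 1) / ((n + 1).factorial : ℝ)) := by
      intro n
      filter_upwards [hM, hst.bs, hst.bt] with x h1 h2 h3
      simp only [hF, norm_mul, norm_div, norm_pow, Complex.norm_natCast, Complex.norm_real,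
        Real.norm_eq_abs]
      have h3 : |t x| ≤ 1 := by linarith
      have h4 : |s x| ^ (b + m) * |t x| ^ β ≤ 1 * 1 := by
          gcongr
          · exact pow_le_one₀ (abs_nonneg _) h2
          · exact pow_le_one₀ (abs_nonneg _) h3
      have h5 : ‖q x‖ ^ (n + 1) ≤ |M| ^ (n + 1) := by
        gcongr
        exact h1.trans (le_abs_self _)
      calc _ ≤ ‖g x‖ * (‖q x‖ ^ (n + 1) / ((n + 1).factorial : ℝ)) * (1 * 1) := by gcongr
        _ ≤ _ := by
          rw [mul_one, mul_one]
          gcongr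
    have hsumM : Summable fun n : ℕ => |M| ^ (n + 1) / ((n + 1).factorial : ℝ) :=
      (summable_nat_add_iff (f := fun n : ℕ => |M| ^ n / (n.factorial : ℝ)) 1).2
        (Real.summable_pow_div_factorial _)
    have hsumA : HasSum (fun n : ℕ => A ^ (n + 1) / ((n + 1).factorial : ℝ)) (Real.exp A - 1) := by
      have h1 : HasSum (fun n : ℕ => A ^ n / (n.factorial : ℝ)) (Real.exp A) := by
        rw [Real.exp_eq_exp_ℝ]
        exact NormedSpace.expSeries_div_hasSum_exp A
      have := (hasSum_nat_add_iff' 1).2 h1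
      simpa using this
    have hS : Summable fun n => ∫ x, ‖F n x‖ ∂μ := by
      refine Summable.of_nonneg_of_le (fun n => by positivity) (fun n => ?_)
        (hsumM.mul_left (∫ x, ‖g x‖ ∂μ))
      rw [← integral_mul_const]
      exact integral_mono_ae (hFint n).norm (hg.norm.mul_const _) (hbd n)
    have hs := hasSum_integral_of_summable_integral_norm hFint hS
    have e : ∫ x, ∑' n, F n x ∂μ = mom μ s t (fun x => g x * (Complex.exp (q x) - 1)) (b + m) β := by
      unfold mom
      congr 1; ext x
      have h1 : HasSum (fun n : ℕ => q x ^ n / (n.factorial : ℂ)) (Complex.exp (q x)) := by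
        rw [Complex.exp_eq_exp_ℂ]
        exact NormedSpace.expSeries_div_hasSum_exp (q x)
      have h2 := (hasSum_nat_add_iff' 1).2 h1
      have h3 := ((h2.mul_left (g x)).mul_right ((s x : ℂ) ^ (b + m) * (t x : ℂ) ^ β)).tsum_eq
      simpa [hF] using h3
    rw [e] at hs
    have hb : ∀ n, ‖∫ x, F n x ∂μ‖ ≤ 4 ^ m * (A ^ (n + 1) / ((n + 1).factorial : ℝ) * C) := fun n =>
      (hmb n).bound g hg b C hC m β
    have hs2 : HasSum (fun n : ℕ => 4 ^ m * (A ^ (n + 1) / ((n + 1).factorial : ℝ) * C))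
        (4 ^ m * ((Real.exp A - 1) * C)) := (hsumA.mul_right C).mul_left _
    rw [← hs.tsum_eq]
    exact tsum_of_norm_bounded hs2 hb

theorem MulBd.exp (hst : SM μ s t) {q : α → ℂ} {A : ℝ} (hq : MulBd μ s t q A) :
    MulBd μ s t (fun x => Complex.exp (q x)) (Real.exp A) := by
  have := (hq.exp_sub_one hst).add hst (mulBd_const 1)
  simpa using this

end Moments
end Wolff

open MeasureTheory Metric

namespace Wolff

noncomputable def nrm (ξ : ℝ × ℝ) : ℝ := √(ξ.1 ^ 2 + ξ.2 ^ 2)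
noncomputable def ww (ξ : ℝ × ℝ) : ℝ := (nrm ξ + ξ.1) / 2
noncomputable def kk (ξ : ℝ × ℝ) : ℝ := ξ.2 / (nrm ξ + ξ.1)
noncomputable def ss (R ν : ℝ) (ξ : ℝ × ℝ) : ℝ := (ww ξ - R) / (ν * R)
noncomputable def tt (c h : ℝ) (ξ : ℝ × ℝ) : ℝ := (kk ξ - c) / (2 * h)
def cap (R ν c h : ℝ) : Set (ℝ × ℝ) :=
  {ξ | 0 < ξ.1 ∧ R ≤ ww ξ ∧ ww ξ < (1 + ν) * R ∧ c - h ≤ kk ξ ∧ kk ξ < c + h}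
noncomputable def phase (z : ℝ × ℝ × ℝ) (ξ : ℝ × ℝ) : ℝ :=
  ww ξ * (z.1 + z.2.1 * kk ξ + z.2.2 * kk ξ ^ 2)
noncomputable def gz (G : ℝ × ℝ → ℂ) (z : ℝ × ℝ × ℝ) (ξ : ℝ × ℝ) : ℂ :=
  G ξ * Complex.exp (Complex.I * phase z ξ)
noncomputable def TT (R c h : ℝ) (v : ℝ × ℝ × ℝ) : ℝ × ℝ × ℝ :=
  (R * (v.1 + v.2.1 * c + v.2.2 * c ^ 2), 2 * R * h * (v.2.1 + 2 * c * v.2.2), 4 * R * h ^ 2 * v.2.2)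
noncomputable def PP (ν : ℝ) (y : ℝ × ℝ × ℝ) : ℝ :=
  4 * ν * |y.1| + (1 + 4 * ν) * (|y.2.1| + |y.2.2|)
/-- moments on a cap -/
noncomputable def uu (R ν : ℝ) (G : ℝ × ℝ → ℂ) (c h : ℝ) (b β : ℕ) (z : ℝ × ℝ × ℝ) : ℂ :=
  mom (volume.restrict (cap R ν c h)) (ss R ν) (tt c h) (gz G z) b β
/-- maximal moments bound on a cap -/
def HC (R ν : ℝ) (G : ℝ × ℝ → ℂ) (c h : ℝ) (b : ℕ) (z : ℝ × ℝ × ℝ) (C : ℝ) : Prop :=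
  HB (volume.restrict (cap R ν c h)) (ss R ν) (tt c h) (gz G z) b C
def MB (R ν c h : ℝ) (q : ℝ × ℝ → ℂ) (A : ℝ) : Prop :=
  MulBd (volume.restrict (cap R ν c h)) (ss R ν) (tt c h) q A

theorem continuous_nrm : Continuous nrm := by unfold nrm; fun_prop
theorem measurable_nrm : Measurable nrm := continuous_nrm.measurable
theorem measurable_ww : Measurable ww := by
  have := measurable_nrm; unfold ww; fun_prop
theorem measurable_kk : Measurable kk := by
  have := measurable_nrm; unfold kk; fun_prop
theorem measurable_ss (R ν : ℝ) : Measurable (ss R ν) := by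
  have := measurable_ww; unfold ss; fun_prop
theorem measurable_tt (c h : ℝ) : Measurable (tt c h) := by
  have := measurable_kk; unfold tt; fun_prop
theorem measurable_phase (z : ℝ × ℝ × ℝ) : Measurable (phase z) := by
  have := measurable_ww; have := measurable_kk; unfold phase; fun_prop
theorem measurableSet_cap (R ν c h : ℝ) : MeasurableSet (cap R ν c h) := by
  have h1 := measurable_ww; have h2 := measurable_kk
  unfold cap
  refine (measurableSet_lt measurable_const measurable_fst).inter ?_
  refine (measurableSet_le measurable_const h1).inter ?_
  refine (measurableSet_lt h1 measurable_const).inter ?_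
  exact (measurableSet_le measurable_const h2).inter (measurableSet_lt h2 measurable_const)

theorem sm_cap {R ν c h : ℝ} (hR : 0 < R) (hν : 0 < ν) (hh : 0 < h) :
    SM (volume.restrict (cap R ν c h)) (ss R ν) (tt c h) := by
  refine ⟨measurable_ss _ _, measurable_tt _ _, ?_, ?_⟩
  · filter_upwards [ae_restrict_mem (measurableSet_cap R ν c h)] with ξ hξ
    obtain ⟨-, h1, h2, -, -⟩ := hξ
    unfold ss
    have : 0 < ν * R := by positivity
    rw [abs_le]
    constructor
    · have : 0 ≤ (ww ξ - R) / (ν * R) := div_nonneg (by linarith) this.le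
      linarith
    · rw [div_le_one this]; linarith
  · filter_upwards [ae_restrict_mem (measurableSet_cap R ν c h)] with ξ hξ
    obtain ⟨-, -, -, h1, h2⟩ := hξ
    unfold tt
    rw [abs_div, abs_of_pos (show 0 < 2 * h by positivity), div_le_iff₀ (by positivity), abs_le]
    constructor <;> linarith

theorem ww_eq {R ν : ℝ} (hR : 0 < R) (hν : 0 < ν) (ξ : ℝ × ℝ) : ww ξ = R * (1 + ν * ss R ν ξ) := by
  unfold ss; field_simp; ring
theorem kk_eq {c h : ℝ} (hh : 0 < h) (ξ : ℝ × ℝ) : kk ξ = c + 2 * h * tt c h ξ := by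
  unfold tt; field_simp; ring

theorem phase_eq {R ν c h : ℝ} (hR : 0 < R) (hν : 0 < ν) (hh : 0 < h) (v : ℝ × ℝ × ℝ) (ξ : ℝ × ℝ) :
    phase v ξ = (TT R c h v).1 + (ν * (TT R c h v).1 * ss R ν ξ +
      (1 + ν * ss R ν ξ) * ((TT R c h v).2.1 * tt c h ξ + (TT R c h v).2.2 * tt c h ξ ^ 2)) := by
  unfold phase TT
  rw [ww_eq hR hν, kk_eq (c := c) hh]
  ring

theorem phase_add (z v : ℝ × ℝ × ℝ) (ξ : ℝ × ℝ) : phase (z + v) ξ = phase z ξ + phase v ξ := by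
  unfold phase; simp; ring

theorem mb_phase {R ν c h : ℝ} (hR : 0 < R) (hν : 0 < ν) (hh : 0 < h) (v : ℝ × ℝ × ℝ) :
    MB R ν c h (fun ξ => Complex.exp (Complex.I * phase v ξ) *
      Complex.exp (-(Complex.I * (TT R c h v).1)) - 1) (Real.exp (PP ν (TT R c h v)) - 1) := by
  have hst := sm_cap (c := c) hR hν hh
  set y := TT R c h v with hy
  have hs := mulBd_s hst
  have ht := mulBd_t hst
  have h1 := (hs.const_mul (Complex.I * (ν * y.1)))
  have h2 := ((hs.const_mul ν).add hst (mulBd_const 1))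
  have h3 := (ht.const_mul (Complex.I * y.2.1)).add hst ((ht.pow 2).const_mul (Complex.I * y.2.2))
  have h4 := (h1.add hst (h2.mul h3)).exp_sub_one hst
  unfold MB
  have h5 := h4.mono (A' := Real.exp (PP ν y) - 1) (by
    gcongr
    unfold PP
    simp [abs_of_pos hν]
    nlinarith [abs_nonneg y.2.1, abs_nonneg y.2.2])
  refine h5.congr (Filter.Eventually.of_forall fun ξ => ?_)
  simp only
  rw [phase_eq hR hν hh (c := c) v, ← hy, ← Complex.exp_add]
  congr 2
  push_cast
  ring

theorem mb_phase' {R ν c h : ℝ} (hR : 0 < R) (hν : 0 < ν) (hh : 0 < h) (v : ℝ × ℝ × ℝ) :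
    MB R ν c h (fun ξ => Complex.exp (Complex.I * phase v ξ)) (Real.exp (PP ν (TT R c h v))) := by
  have hst := sm_cap (c := c) hR hν hh
  have h1 := ((mb_phase (c := c) hR hν hh v).add hst (mulBd_const 1)).const_mul
    (Complex.exp (Complex.I * (TT R c h v).1))
  have e : ‖Complex.exp (Complex.I * (TT R c h v).1)‖ = 1 := by
    rw [mul_comm]; exact Complex.norm_exp_ofReal_mul_I _
  rw [e] at h1
  have h2 := h1.mono (A' := Real.exp (PP ν (TT R c h v))) (by simp)
  refine h2.congr (Filter.Eventually.of_forall fun ξ => ?_)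
  simp only
  rw [sub_add_cancel, mul_left_comm, ← Complex.exp_add]
  simp

theorem gz_add (G : ℝ × ℝ → ℂ) (z v : ℝ × ℝ × ℝ) (ξ : ℝ × ℝ) :
    gz G (z + v) ξ = gz G z ξ * Complex.exp (Complex.I * phase v ξ) := by
  unfold gz
  rw [phase_add, Complex.ofReal_add, mul_add, Complex.exp_add]; ring

theorem gz_integrable {G : ℝ × ℝ → ℂ} {μ : Measure (ℝ × ℝ)} (hG : Integrable G μ) (z : ℝ × ℝ × ℝ) :
    Integrable (gz G z) μ := by
  refine hG.mul_bdd (c := 1) ?_ ?_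
  · have := measurable_phase z
    exact Measurable.aestronglyMeasurable (by fun_prop)
  · refine Filter.Eventually.of_forall fun ξ => ?_
    rw [mul_comm]; exact (Complex.norm_exp_ofReal_mul_I _).le

theorem HC_shift {R ν c h : ℝ} (hR : 0 < R) (hν : 0 < ν) (hh : 0 < h) {G : ℝ × ℝ → ℂ}
    (hG : IntegrableOn G (cap R ν c h)) {b : ℕ} {z v : ℝ × ℝ × ℝ} {C : ℝ}
    (hC : HC R ν G c h b z C) : HC R ν G c h b (z + v) (Real.exp (PP ν (TT R c h v)) * C) := by
  have := (mb_phase' (c := c) hR hν hh v).bound _ (gz_integrable hG z) b C hC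
  unfold HC
  convert this using 2
  exact gz_add G z v _

/-- affine power multipliers -/
theorem mb_affine_pow {R ν c h a δ : ℝ} (hR : 0 < R) (hν : 0 < ν) (hh : 0 < h)
    (ha : |a| ≤ 1 / 2) (hδ : 0 ≤ δ) (hδ' : δ ≤ 1 / 4) (β : ℕ) :
    MB R ν c h (fun ξ => ((a : ℂ) + δ * tt c h ξ) ^ β) ((3 / 4) ^ β) ∧
    MB R ν c h (fun ξ => ((a : ℂ) + δ * tt c h ξ) ^ β - (a : ℂ) ^ β) (4 * δ) := by
  have hst := sm_cap (c := c) hR hν hh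
  have ht := mulBd_t hst
  have h1 : MB R ν c h (fun ξ => ((a : ℂ) + δ * tt c h ξ)) (3 / 4) := by
    refine ((mulBd_const (a : ℂ)).add hst (ht.const_mul (δ : ℂ))).mono ?_
    simp [abs_of_nonneg hδ]; linarith
  refine ⟨h1.pow β, ?_⟩
  induction β with
  | zero =>
    simpa [MB] using (mulBd_const (μ := volume.restrict (cap R ν c h)) (s := ss R ν) (t := tt c h) 0).mono
      (A' := 4 * δ) (by simpa using hδ)
  | succ β ih =>
    have h2 := (h1.mul ih).add hst ((ht.const_mul (δ : ℂ)).const_mul ((a : ℂ) ^ β))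
    have hp : |a| ^ β ≤ 1 := pow_le_one₀ (abs_nonneg _) (by linarith)
    refine (h2.mono (A' := 4 * δ) ?_).congr (Filter.Eventually.of_forall fun ξ => ?_)
    · simp [abs_of_nonneg hδ]
      nlinarith
    · simp only; ring

/-- combined multiplier -/
theorem mb_comb {R ν c h a δ : ℝ} (hR : 0 < R) (hν : 0 < ν) (hh : 0 < h)
    (ha : |a| ≤ 1 / 2) (hδ : 0 ≤ δ) (hδ' : δ ≤ 1 / 4) (β : ℕ) (v : ℝ × ℝ × ℝ) :
    MB R ν c h (fun ξ => ((a : ℂ) + δ * tt c h ξ) ^ β * (Complex.exp (Complex.I * phase v ξ) *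
      Complex.exp (-(Complex.I * (TT R c h v).1))) - (a : ℂ) ^ β)
      ((Real.exp (PP ν (TT R c h v)) - 1) + 4 * δ) := by
  have hst := sm_cap (c := c) hR hν hh
  obtain ⟨h1, h2⟩ := mb_affine_pow (c := c) hR hν hh ha hδ hδ' β
  have h3 := mb_phase (c := c) hR hν hh v
  refine (((h1.mul h3).add hst h2).mono ?_).congr (Filter.Eventually.of_forall fun ξ => ?_)
  · have : (3 / 4 : ℝ) ^ β ≤ 1 := pow_le_one₀ (by norm_num) (by norm_num)
    nlinarith [h3.nonneg]
  · simp only; ring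

/-- centre (relative) of the `l`-th subcap out of `N` -/
noncomputable def aa (N l : ℕ) : ℝ := (2 * l + 1) / (2 * N) - 1 / 2

theorem aa_abs {N l : ℕ} (hl : l < N) : |aa N l| ≤ 1 / 2 := by
  have hN : (0 : ℝ) < N := by exact_mod_cast (by omega : 0 < N)
  have hl' : (l : ℝ) + 1 ≤ N := by exact_mod_cast hl
  unfold aa
  have h1 : (2 * (l : ℝ) + 1) / (2 * N) ≤ 1 := by rw [div_le_one (by positivity)]; linarith
  have h2 : 0 ≤ (2 * (l : ℝ) + 1) / (2 * N) := by positivity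
  rw [abs_le]; constructor <;> linarith

theorem cap_eq_iUnion {R ν c h : ℝ} {N : ℕ} (hN : 0 < N) (hh : 0 < h) :
    cap R ν c h = ⋃ l ∈ Finset.range N, cap R ν (c + 2 * h * aa N l) (h / N) := by
  have hN' : (0 : ℝ) < N := by exact_mod_cast hN
  ext ξ
  simp only [Set.mem_iUnion, Finset.mem_range, exists_prop]
  have key : ∀ l : ℕ, c + 2 * h * aa N l - h / N = c - h + 2 * h * l / N ∧
      c + 2 * h * aa N l + h / N = c - h + 2 * h * (l + 1) / N := by
    intro l; unfold aa; constructor <;> field_simp <;> ring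
  constructor
  · rintro ⟨h1, h2, h3, h4, h5⟩
    set x := (kk ξ - (c - h)) * N / (2 * h) with hx
    have hx0 : 0 ≤ x := div_nonneg (mul_nonneg (by linarith) hN'.le) (by positivity)
    have hxN : x < N := by
      rw [hx, div_lt_iff₀ (by positivity)]; nlinarith
    refine ⟨⌊x⌋₊, (Nat.floor_lt hx0).2 hxN, h1, h2, h3, ?_, ?_⟩
    · rw [(key _).1]
      have := Nat.floor_le hx0
      have e : kk ξ = c - h + 2 * h * x / N := by rw [hx]; field_simp; ring
      rw [e]; gcongr
    · rw [(key _).2]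
      have := Nat.lt_floor_add_one x
      have e : kk ξ = c - h + 2 * h * x / N := by rw [hx]; field_simp; ring
      rw [e]; gcongr
  · rintro ⟨l, hl, h1, h2, h3, h4, h5⟩
    rw [(key l).1] at h4
    rw [(key l).2] at h5
    refine ⟨h1, h2, h3, ?_, ?_⟩
    · have : 0 ≤ 2 * h * l / N := by positivity
      linarith
    · have hl' : (l : ℝ) + 1 ≤ N := by exact_mod_cast hl
      have : 2 * h * (l + 1) / N ≤ 2 * h := by
        rw [div_le_iff₀ hN']; gcongr
      linarith

theorem cap_disjoint {R ν c h : ℝ} {N : ℕ} (hN : 0 < N) (hh : 0 < h) {l l' : ℕ} (hl : l ≠ l') :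
    Disjoint (cap R ν (c + 2 * h * aa N l) (h / N)) (cap R ν (c + 2 * h * aa N l') (h / N)) := by
  have hN' : (0 : ℝ) < N := by exact_mod_cast hN
  have key : ∀ l : ℕ, c + 2 * h * aa N l - h / N = c - h + 2 * h * l / N ∧
      c + 2 * h * aa N l + h / N = c - h + 2 * h * (l + 1) / N := by
    intro l; unfold aa; constructor <;> field_simp <;> ring
  wlog h' : l < l' generalizing l l'
  · exact (this hl.symm (by omega)).symm
  rw [Set.disjoint_left]
  rintro ξ ⟨-, -, -, -, h5⟩ ⟨-, -, -, h4, -⟩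
  rw [(key _).2] at h5
  rw [(key _).1] at h4
  have : (l : ℝ) + 1 ≤ l' := by exact_mod_cast h'
  have : 2 * h * (l + 1) / N ≤ 2 * h * l' / N := by gcongr
  linarith

theorem tt_sub {c h : ℝ} {N : ℕ} (hN : 0 < N) (hh : 0 < h) (l : ℕ) (ξ : ℝ × ℝ) :
    tt c h ξ = aa N l + (1 / N : ℝ) * tt (c + 2 * h * aa N l) (h / N) ξ := by
  have hN' : (0 : ℝ) < N := by exact_mod_cast hN
  unfold tt; field_simp; ring

theorem cap_sub {R ν c h : ℝ} {N : ℕ} (hN : 0 < N) (hh : 0 < h) {l : ℕ} (hl : l < N) :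
    cap R ν (c + 2 * h * aa N l) (h / N) ⊆ cap R ν c h := by
  rw [cap_eq_iUnion (c := c) hN hh]
  exact Set.subset_biUnion_of_mem (u := fun l => cap R ν (c + 2 * h * aa N l) (h / N))
    (by simpa using hl)

theorem uu_split {R ν c h : ℝ} {N : ℕ} (hR : 0 < R) (hν : 0 < ν) (hN : 0 < N) (hh : 0 < h)
    {G : ℝ × ℝ → ℂ}
    (hG : IntegrableOn G (cap R ν c h)) (b β : ℕ) (z : ℝ × ℝ × ℝ) :
    uu R ν G c h b β z = ∑ l ∈ Finset.range N,
      mom (volume.restrict (cap R ν (c + 2 * h * aa N l) (h / N))) (ss R ν)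
        (tt (c + 2 * h * aa N l) (h / N)) (fun ξ => gz G z ξ *
          ((aa N l : ℂ) + (1 / N : ℝ) * tt (c + 2 * h * aa N l) (h / N) ξ) ^ β) b 0 := by
  have hst := sm_cap (c := c) hR hν hh
  have hi : IntegrableOn (fun x => gz G z x * ((ss R ν x : ℂ) ^ b * (tt c h x : ℂ) ^ β))
    (cap R ν c h) := hst.integrable_mul (gz_integrable hG z) b β
  unfold uu mom
  rw [cap_eq_iUnion (c := c) hN hh, integral_biUnion_finset]
  · refine Finset.sum_congr rfl fun l hl => ?_
    congr 1; ext ξ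
    rw [tt_sub (c := c) hN hh l ξ]
    push_cast
    ring
  · intro l _; exact measurableSet_cap _ _ _ _
  · intro l _ l' _ hll; exact cap_disjoint hN hh hll
  · intro l hl
    exact hi.mono_set (cap_sub hN hh (by simpa using hl))

theorem TT_sub {R c h : ℝ} {N : ℕ} (hN : 0 < N) (l : ℕ) (v : ℝ × ℝ × ℝ) :
    TT R (c + 2 * h * aa N l) (h / N) v =
    ((TT R c h v).1 + (TT R c h v).2.1 * aa N l + (TT R c h v).2.2 * aa N l ^ 2,
      ((TT R c h v).2.1 + 2 * (TT R c h v).2.2 * aa N l) / N, (TT R c h v).2.2 / N ^ 2) := by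
  have hN' : (0 : ℝ) < N := by exact_mod_cast hN
  unfold TT
  ext <;> simp <;> field_simp <;> ring

theorem TT_add (R c h : ℝ) (v w : ℝ × ℝ × ℝ) : TT R c h (v + w) = TT R c h v + TT R c h w := by
  unfold TT; ext <;> simp <;> ring
theorem TT_sub' (R c h : ℝ) (v w : ℝ × ℝ × ℝ) : TT R c h (v - w) = TT R c h v - TT R c h w := by
  unfold TT; ext <;> simp <;> ring

/-- child splitting: `|u_I| ≤ Σ_J sup |u_J|` in the form needed. -/
theorem uu_le_child {R ν c h : ℝ} {N : ℕ} (hR : 0 < R) (hν : 0 < ν) (hN : 0 < N) (hh : 0 < h)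
    {G : ℝ × ℝ → ℂ}
    (hG : IntegrableOn G (cap R ν c h)) (b β : ℕ) (z : ℝ × ℝ × ℝ) {m : ℝ}
    (hN4 : 4 ≤ N) (hm : ∀ l < N, HC R ν G (c + 2 * h * aa N l) (h / N) b z m) :
    ‖uu R ν G c h b β z‖ ≤ N * ((3 / 4) ^ β * m) := by
  have hN' : (0 : ℝ) < N := by exact_mod_cast hN
  rw [uu_split hR hν hN hh hG]
  refine (norm_sum_le _ _).trans ?_
  have : ∀ l ∈ Finset.range N, ‖mom (volume.restrict (cap R ν (c + 2 * h * aa N l) (h / N))) (ss R ν)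
        (tt (c + 2 * h * aa N l) (h / N)) (fun ξ => gz G z ξ *
          ((aa N l : ℂ) + (1 / N : ℝ) * tt (c + 2 * h * aa N l) (h / N) ξ) ^ β) b 0‖ ≤
      (3 / 4) ^ β * m := by
    intro l hl
    rw [Finset.mem_range] at hl
    have h4 : (1 / N : ℝ) ≤ 1 / 4 := by
      have : (4 : ℝ) ≤ N := by exact_mod_cast hN4
      gcongr
    have h1 := (mb_affine_pow (c := c + 2 * h * aa N l) (h := h / N) hR hν (by positivity) (aa_abs hl)
      (δ := 1 / N) (by positivity) h4 β).1
    have h2 := h1.bound _ (gz_integrable (hG.mono_set (cap_sub hN hh hl)) z) b m (hm l hl) 0 0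
    simpa using h2
  refine (Finset.sum_le_sum this).trans ?_
  simp

/-- approximating `u_I(z+v)` by an exponential sum -/
theorem uu_approx {R ν c h : ℝ} {N : ℕ} (hR : 0 < R) (hν : 0 < ν) (hN : 0 < N) (hh : 0 < h)
    {G : ℝ × ℝ → ℂ}
    (hG : IntegrableOn G (cap R ν c h)) (b β : ℕ) (z v : ℝ × ℝ × ℝ) {m ρ : ℝ}
    (hN4 : 4 ≤ N) (hm : ∀ l < N, HC R ν G (c + 2 * h * aa N l) (h / N) b z m)
    (hρ : ∀ l < N, PP ν (TT R (c + 2 * h * aa N l) (h / N) v) ≤ ρ) :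
    ‖uu R ν G c h b β (z + v) - ∑ l ∈ Finset.range N,
      Complex.exp (Complex.I * (TT R (c + 2 * h * aa N l) (h / N) v).1) *
        ((aa N l : ℂ) ^ β * uu R ν G (c + 2 * h * aa N l) (h / N) b 0 z)‖ ≤
      N * (((Real.exp ρ - 1) + 4 / N) * m) := by
  have hN' : (0 : ℝ) < N := by exact_mod_cast hN
  rw [uu_split hR hν hN hh hG, ← Finset.sum_sub_distrib]
  refine (norm_sum_le _ _).trans ?_
  have : ∀ l ∈ Finset.range N, ‖mom (volume.restrict (cap R ν (c + 2 * h * aa N l) (h / N))) (ss R ν)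
        (tt (c + 2 * h * aa N l) (h / N)) (fun ξ => gz G (z + v) ξ *
          ((aa N l : ℂ) + (1 / N : ℝ) * tt (c + 2 * h * aa N l) (h / N) ξ) ^ β) b 0 -
      Complex.exp (Complex.I * (TT R (c + 2 * h * aa N l) (h / N) v).1) *
        ((aa N l : ℂ) ^ β * uu R ν G (c + 2 * h * aa N l) (h / N) b 0 z)‖ ≤
      ((Real.exp ρ - 1) + 4 / N) * m := by
    intro l hl
    rw [Finset.mem_range] at hl
    have h4 : (1 / N : ℝ) ≤ 1 / 4 := by
      have : (4 : ℝ) ≤ N := by exact_mod_cast hN4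
      gcongr
    set c' := c + 2 * h * aa N l
    set h' := h / N with hh'
    have hh'0 : 0 < h' := by positivity
    have hst := sm_cap (c := c') hR hν hh'0
    have hi := gz_integrable (hG.mono_set (cap_sub (R := R) (ν := ν) (c := c) hN hh hl)) z
    have h1 := mb_comb (c := c') (h := h') hR hν hh'0 (aa_abs hl) (δ := 1 / N) (by positivity) h4 β v
    have h1' := h1.mono (A' := (Real.exp ρ - 1) + 4 / N) (by
      have := hρ l hl
      have e : (4 : ℝ) * (1 / N) = 4 / N := by ring
      rw [e]
      gcongr)
    have h2 := h1'.bound _ hi b m (hm l hl) 0 0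
    have h3 := mb_comb (c := c') (h := h') hR hν hh'0 (aa_abs hl) (δ := 1 / N) (by positivity) h4 β v
    have e : mom (volume.restrict (cap R ν c' h')) (ss R ν)
        (tt c' h') (fun ξ => gz G (z + v) ξ *
          ((aa N l : ℂ) + (1 / N : ℝ) * tt c' h' ξ) ^ β) b 0 -
      Complex.exp (Complex.I * (TT R c' h' v).1) *
        ((aa N l : ℂ) ^ β * uu R ν G c' h' b 0 z) =
      Complex.exp (Complex.I * (TT R c' h' v).1) *
      mom (volume.restrict (cap R ν c' h')) (ss R ν) (tt c' h') (fun x => gz G z x *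
        (((aa N l : ℂ) + ((1 / N : ℝ) : ℂ) * tt c' h' x) ^ β * (Complex.exp (Complex.I * phase v x) *
      Complex.exp (-(Complex.I * (TT R c' h' v).1))) - (aa N l : ℂ) ^ β)) (b + 0) 0 := by
      unfold uu mom
      rw [← integral_const_mul, ← integral_const_mul, ← integral_const_mul, ← integral_sub]
      · congr 1; ext ξ
        beta_reduce
        rw [gz_add]
        have : Complex.exp (Complex.I * (TT R c' h' v).1) * Complex.exp (-(Complex.I * (TT R c' h' v).1)) = 1 := by
          rw [← Complex.exp_add]; simp
        rw [add_zero]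
        linear_combination (-(gz G z ξ * ((aa N l : ℂ) + ((1 / N : ℝ) : ℂ) * tt c' h' ξ) ^ β *
          Complex.exp (Complex.I * phase v ξ)) * ((ss R ν ξ : ℂ) ^ b * (tt c' h' ξ : ℂ) ^ 0)) * this
      · refine hst.integrable_mul ?_ b 0
        have h5 := (mb_affine_pow (c := c') (h := h') hR hν hh'0 (aa_abs hl)
          (δ := 1 / N) (by positivity) h4 β).1
        exact h5.integrable (gz_integrable (hG.mono_set (cap_sub (R := R) (ν := ν) (c := c) hN hh hl)) (z + v))
      · exact (((hst.integrable_mul hi b 0).const_mul _).const_mul _)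
    rw [e, norm_mul]
    have e2 : ‖Complex.exp (Complex.I * (TT R c' h' v).1)‖ = 1 := by
      rw [mul_comm]; exact Complex.norm_exp_ofReal_mul_I _
    rw [e2, one_mul]
    simpa using h2
  refine (Finset.sum_le_sum this).trans ?_
  simp

end Wolff

open MeasureTheory Metric

namespace Wolff

theorem tts {ι : Type*} (F : Finset ι) (N : ℕ) (d : ℕ → ℂ) (hd : ∀ l < N, ‖d l‖ ≤ 1)
    (φ : ℕ → ι → ℝ) (A : ℝ) (hA0 : 0 ≤ A)
    (hA : ∀ z ∈ F, A ≤ ‖∑ l ∈ Finset.range N, Complex.exp (Complex.I * φ l z) * d l‖) :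
    (F.card * A) ^ 2 ≤ N * ∑ z ∈ F, ∑ z' ∈ F,
      ‖∑ l ∈ Finset.range N, Complex.exp (Complex.I * (φ l z - φ l z'))‖ := by
  set w : ι → ℂ := fun z => ∑ l ∈ Finset.range N, Complex.exp (Complex.I * φ l z) * d l with hw
  set c : ι → ℂ := fun z => (starRingEnd ℂ) (w z) / ‖w z‖ with hc
  have hc1 : ∀ z, ‖c z‖ ≤ 1 := by
    intro z; simp only [hc, norm_div, RCLike.norm_conj, Complex.norm_real, norm_norm]
    exact div_self_le_one _
  have hcw : ∀ z, c z * w z = ‖w z‖ := by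
    intro z
    by_cases h : w z = 0
    · simp [h]
    · have : (‖w z‖ : ℂ) ≠ 0 := by simpa using h
      simp only [hc]
      rw [div_mul_eq_mul_div, mul_comm, Complex.mul_conj, Complex.normSq_eq_norm_sq]
      field_simp
      push_cast; ring
  set T : ℕ → ℂ := fun l => ∑ z ∈ F, c z * Complex.exp (Complex.I * φ l z) with hT
  have h1 : (F.card * A) ≤ ∑ l ∈ Finset.range N, ‖T l‖ := by
    have e : ((∑ z ∈ F, ‖w z‖ : ℝ) : ℂ) = ∑ l ∈ Finset.range N, d l * T l := by
      rw [Complex.ofReal_sum, Finset.sum_congr rfl fun z _ => (hcw z).symm]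
      simp only [hw, hT, Finset.mul_sum]
      rw [Finset.sum_comm]
      refine Finset.sum_congr rfl fun l _ => Finset.sum_congr rfl fun z _ => ?_
      ring
    calc (F.card * A) = ∑ z ∈ F, A := by simp
      _ ≤ ∑ z ∈ F, ‖w z‖ := Finset.sum_le_sum hA
      _ ≤ ‖((∑ z ∈ F, ‖w z‖ : ℝ) : ℂ)‖ := by
        rw [Complex.norm_real]; exact le_abs_self _
      _ ≤ ∑ l ∈ Finset.range N, ‖d l * T l‖ := by rw [e]; exact norm_sum_le _ _
      _ ≤ _ := by
        refine Finset.sum_le_sum fun l hl => ?_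
        rw [norm_mul]
        exact mul_le_of_le_one_left (norm_nonneg _) (hd l (Finset.mem_range.1 hl))
  have h2 : (∑ l ∈ Finset.range N, ‖T l‖) ^ 2 ≤ N * ∑ l ∈ Finset.range N, ‖T l‖ ^ 2 := by
    have := sq_sum_le_card_mul_sum_sq (s := Finset.range N) (f := fun l => ‖T l‖)
    simpa using this
  have h3 : ((∑ l ∈ Finset.range N, ‖T l‖ ^ 2 : ℝ) : ℂ) = ∑ z ∈ F, ∑ z' ∈ F,
      c z * (starRingEnd ℂ) (c z') * ∑ l ∈ Finset.range N, Complex.exp (Complex.I * (φ l z - φ l z')) := by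
    push_cast
    have : ∀ l, (‖T l‖ : ℂ) ^ 2 = ∑ z ∈ F, ∑ z' ∈ F, c z * (starRingEnd ℂ) (c z') *
        Complex.exp (Complex.I * (φ l z - φ l z')) := by
      intro l
      have e1 : (‖T l‖ : ℂ) ^ 2 = T l * (starRingEnd ℂ) (T l) := by
        rw [Complex.mul_conj, Complex.normSq_eq_norm_sq]; push_cast; ring
      rw [e1]
      simp only [hT, map_sum, map_mul]
      rw [Finset.sum_mul_sum]
      refine Finset.sum_congr rfl fun z _ => Finset.sum_congr rfl fun z' _ => ?_
      rw [← Complex.exp_conj]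
      simp only [map_mul, Complex.conj_I, Complex.conj_ofReal]
      rw [mul_sub, sub_eq_add_neg, Complex.exp_add]
      ring_nf
    simp only [this, Finset.mul_sum]
    rw [Finset.sum_comm]
    refine Finset.sum_congr rfl fun z _ => ?_
    rw [Finset.sum_comm]
  have h4 : (∑ l ∈ Finset.range N, ‖T l‖ ^ 2 : ℝ) ≤ ∑ z ∈ F, ∑ z' ∈ F,
      ‖∑ l ∈ Finset.range N, Complex.exp (Complex.I * (φ l z - φ l z'))‖ := by
    calc (∑ l ∈ Finset.range N, ‖T l‖ ^ 2 : ℝ) ≤ ‖((∑ l ∈ Finset.range N, ‖T l‖ ^ 2 : ℝ) : ℂ)‖ := by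
          rw [Complex.norm_real]; exact le_abs_self _
      _ ≤ _ := by
        rw [h3]
        refine (norm_sum_le _ _).trans (Finset.sum_le_sum fun z _ => ?_)
        refine (norm_sum_le _ _).trans (Finset.sum_le_sum fun z' _ => ?_)
        rw [norm_mul, norm_mul, RCLike.norm_conj]
        exact mul_le_of_le_one_left (norm_nonneg _)
          (mul_le_one₀ (hc1 z) (norm_nonneg _) (hc1 z'))
  calc (F.card * A) ^ 2 ≤ (∑ l ∈ Finset.range N, ‖T l‖) ^ 2 := by gcongr
    _ ≤ _ := h2
    _ ≤ _ := by gcongr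

noncomputable def qe (y1 y2 t : ℝ) : ℂ := Complex.exp (Complex.I * (y1 * t + y2 * t ^ 2))

theorem qe_norm (y1 y2 t : ℝ) : ‖qe y1 y2 t‖ = 1 := by
  unfold qe
  have := Complex.norm_exp_ofReal_mul_I (y1 * t + y2 * t ^ 2)
  rw [mul_comm]; push_cast at this; exact this

theorem qe_cont (y1 y2 : ℝ) : Continuous (qe y1 y2) := by unfold qe; fun_prop

theorem osc_ibp {y1 y2 p q lam : ℝ} (hpq : p ≤ q) (hlam : 0 < lam)
    (hf : ∀ t ∈ Set.Icc p q, lam ≤ |y1 + 2 * y2 * t|) :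
    ‖∫ t in p..q, qe y1 y2 t‖ ≤ 2 / lam + 2 * |y2| * (q - p) / lam ^ 2 := by
  set f' : ℝ → ℂ := fun t => (y1 + 2 * y2 * t : ℝ) with hf'
  have hn : ∀ t ∈ Set.Icc p q, lam ≤ ‖f' t‖ := by
    intro t ht; simp only [hf', Complex.norm_real]; exact hf t ht
  have hne : ∀ t ∈ Set.Icc p q, f' t ≠ 0 := by
    intro t ht h0
    have := hn t ht
    rw [h0, norm_zero] at this; linarith
  have hder : ∀ t ∈ Set.uIcc p q, HasDerivAt (fun t => qe y1 y2 t / (Complex.I * f' t))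
      (qe y1 y2 t - qe y1 y2 t * (2 * y2) / (Complex.I * f' t ^ 2)) t := by
    intro t ht
    rw [Set.uIcc_of_le hpq] at ht
    have h1 : HasDerivAt (fun t : ℝ => (y1 * t + y2 * t ^ 2 : ℝ)) (y1 + 2 * y2 * t) t := by
      have := ((hasDerivAt_id t).const_mul y1).add ((hasDerivAt_pow 2 t).const_mul y2)
      refine this.congr_deriv ?_
      norm_num; ring
    have h2 : HasDerivAt (fun t : ℝ => qe y1 y2 t) (qe y1 y2 t * (Complex.I * f' t)) t := by
      have := (h1.ofReal_comp.const_mul Complex.I).cexp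
      have hq : qe y1 y2 = fun t : ℝ => Complex.exp (Complex.I * ((y1 * t + y2 * t ^ 2 : ℝ) : ℂ)) := by
        ext u; unfold qe; push_cast; rfl
      rw [hq]
      exact this
    have h3 : HasDerivAt (fun t : ℝ => (y1 + 2 * y2 * t : ℝ)) (2 * y2) t := by
      have := ((hasDerivAt_id t).const_mul (2 * y2)).const_add y1
      simpa using this
    have h4 : HasDerivAt (fun t : ℝ => Complex.I * f' t) (Complex.I * ((2 * y2 : ℝ) : ℂ)) t :=
      h3.ofReal_comp.const_mul Complex.I
    have h5 := h2.div h4 (by simpa using hne t ht)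
    refine h5.congr_deriv ?_
    have := hne t ht
    have hI : Complex.I ≠ 0 := Complex.I_ne_zero
    simp only [Complex.ofReal_mul, Complex.ofReal_ofNat]
    field_simp
  have hc2 : ContinuousOn (fun t => qe y1 y2 t * (2 * y2) / (Complex.I * f' t ^ 2)) (Set.uIcc p q) := by
    rw [Set.uIcc_of_le hpq]
    have := qe_cont y1 y2
    refine ContinuousOn.div (by fun_prop) (by simp only [hf']; fun_prop) fun t ht => ?_
    simpa using hne t ht
  have hi1 : IntervalIntegrable (qe y1 y2) volume p q := (qe_cont y1 y2).intervalIntegrable _ _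
  have hi2 := hc2.intervalIntegrable (μ := volume)
  have hIntg := intervalIntegral.integral_eq_sub_of_hasDerivAt hder (hi1.sub hi2)
  rw [intervalIntegral.integral_sub hi1 hi2] at hIntg
  have hb : ∀ t ∈ Set.Icc p q, ‖qe y1 y2 t / (Complex.I * f' t)‖ ≤ 1 / lam := by
    intro t ht
    rw [norm_div, qe_norm, norm_mul, Complex.norm_I, one_mul]
    exact one_div_le_one_div_of_le hlam (hn t ht)
  have hb2 : ‖∫ t in p..q, qe y1 y2 t * (2 * y2) / (Complex.I * f' t ^ 2)‖ ≤
      2 * |y2| / lam ^ 2 * |q - p| := by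
    refine intervalIntegral.norm_integral_le_of_norm_le_const fun t ht => ?_
    rw [Set.uIoc_of_le hpq] at ht
    have ht' := Set.Ioc_subset_Icc_self ht
    rw [norm_div, norm_mul, qe_norm, norm_mul Complex.I, Complex.norm_I, one_mul, one_mul, norm_pow,
      norm_mul, Complex.norm_real]
    have := hn t ht'
    simp only [Complex.norm_ofNat, Real.norm_eq_abs]
    gcongr
  have e : ∫ t in p..q, qe y1 y2 t = (qe y1 y2 q / (Complex.I * f' q) - qe y1 y2 p / (Complex.I * f' p))
      + ∫ t in p..q, qe y1 y2 t * (2 * y2) / (Complex.I * f' t ^ 2) := by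
    rw [← hIntg]; ring
  rw [e]
  refine (norm_add_le _ _).trans ?_
  have h6 := hb q (Set.right_mem_Icc.2 hpq)
  have h7 := hb p (Set.left_mem_Icc.2 hpq)
  have h8 := norm_sub_le (qe y1 y2 q / (Complex.I * f' q)) (qe y1 y2 p / (Complex.I * f' p))
  rw [abs_of_nonneg (show 0 ≤ q - p by linarith)] at hb2
  have e1 : 2 / lam = 1 / lam + 1 / lam := by ring
  have e2 : 2 * |y2| * (q - p) / lam ^ 2 = 2 * |y2| / lam ^ 2 * (q - p) := by ring
  rw [e1, e2]
  linarith

theorem osc_int {y1 y2 δ : ℝ} (hδ : 0 < δ) (hδ1 : δ ≤ 1) (hL : 2 / δ ^ 3 ≤ max |y1| |y2|) :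
    ‖∫ t in (-1 / 2 : ℝ)..(1 / 2), qe y1 y2 t‖ ≤ 8 * δ := by
  have hd3 : 0 < δ ^ 3 := by positivity
  by_cases hcase : 2 * |y2| ≤ |y1|
  · have h1 : 2 / δ ^ 3 ≤ |y1| := by
      refine hL.trans (max_le le_rfl ?_)
      linarith [abs_nonneg y2]
    have hy1 : 0 < |y1| := lt_of_lt_of_le (by positivity) h1
    have := osc_ibp (y1 := y1) (y2 := y2) (p := -1 / 2) (q := 1 / 2) (lam := |y1| / 2) (by norm_num)
      (by positivity) (by
        intro t ht
        have h2 : |t| ≤ 1 / 2 := abs_le.2 ⟨by linarith [ht.1], ht.2⟩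
        have h3 : |2 * y2 * t| ≤ |y2| := by
          rw [abs_mul, abs_mul, abs_two]; nlinarith [abs_nonneg y2]
        have h4 := abs_sub_abs_le_abs_sub y1 (-(2 * y2 * t))
        rw [abs_neg, sub_neg_eq_add] at h4
        linarith)
    refine this.trans ?_
    have e : 2 / (|y1| / 2) + 2 * |y2| * (1 / 2 - -1 / 2) / (|y1| / 2) ^ 2 =
      (4 * |y1| + 4 * (2 * |y2|)) / |y1| ^ 2 := by field_simp; ring
    rw [e, div_le_iff₀ (by positivity)]
    have h5 : 2 ≤ |y1| * δ ^ 3 := by rwa [div_le_iff₀ hd3] at h1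
    have h6 : δ ^ 3 ≤ δ := by nlinarith [mul_nonneg hδ.le (sub_nonneg.2 hδ1), sq_nonneg δ]
    have h7 : 2 ≤ |y1| * δ := h5.trans (by gcongr)
    nlinarith
  · push Not at hcase
    have h1 : 1 / δ ^ 3 ≤ |y2| := by
      rcases le_max_iff.1 hL with h | h
      · have : 2 / δ ^ 3 = 2 * (1 / δ ^ 3) := by ring
        linarith
      · refine le_trans ?_ h; gcongr; norm_num
    have hy2 : 0 < |y2| := lt_of_lt_of_le (by positivity) h1
    have hy2' : y2 ≠ 0 := abs_pos.1 hy2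
    set a0 := -y1 / (2 * y2) with ha0
    have hfa : ∀ t, |y1 + 2 * y2 * t| = 2 * |y2| * |t - a0| := by
      intro t
      rw [← abs_two, ← abs_mul, ← abs_mul, ha0]
      congr 1; simp only [abs_two]; field_simp; ring
    set p := max (-1 / 2) (min (1 / 2) (a0 - δ)) with hp
    set q := max (-1 / 2) (min (1 / 2) (a0 + δ)) with hq
    have hp1 : -1 / 2 ≤ p := le_max_left _ _
    have hp2 : p ≤ 1 / 2 := max_le (by norm_num) (min_le_left _ _)
    have hq1 : -1 / 2 ≤ q := le_max_left _ _
    have hq2 : q ≤ 1 / 2 := max_le (by norm_num) (min_le_left _ _)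
    have hpq : p ≤ q := by
      apply max_le_max le_rfl; apply min_le_min le_rfl; linarith
    have hqp : q - p ≤ 2 * δ := by
      have : q ≤ p + 2 * δ := by
        rw [hq, max_le_iff]
        constructor
        · linarith
        · rcases le_total (1 / 2) (a0 - δ) with h | h
          · have : p = 1 / 2 := by rw [hp, min_eq_left h]; norm_num
            rw [this]; exact (min_le_left _ _).trans (by linarith)
          · have : a0 - δ ≤ p := by rw [hp, min_eq_right h]; exact le_max_right _ _
            exact (min_le_right _ _).trans (by linarith)
      linarith
    have hIntg : ∀ u v : ℝ, IntervalIntegrable (qe y1 y2) volume u v :=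
      fun u v => (qe_cont y1 y2).intervalIntegrable u v
    have hlam : 0 < 2 * |y2| * δ := by positivity
    have hside : ∀ u v : ℝ, u ≤ v → v - u ≤ 1 → (u = v ∨ ∀ t ∈ Set.Icc u v, δ ≤ |t - a0|) →
        ‖∫ t in u..v, qe y1 y2 t‖ ≤ δ ^ 2 + δ / 2 := by
      intro u v huv huv1 h
      rcases h with h | h
      · rw [h, intervalIntegral.integral_same, norm_zero]; positivity
      · refine (osc_ibp huv hlam fun t ht => ?_).trans ?_
        · rw [hfa]; gcongr; exact h t ht
        · have h5 : 1 ≤ |y2| * δ ^ 3 := by rwa [div_le_iff₀ hd3] at h1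
          have e1 : 2 / (2 * |y2| * δ) ≤ δ ^ 2 := by
            rw [div_le_iff₀ hlam]; nlinarith
          have e2 : 2 * |y2| * (v - u) / (2 * |y2| * δ) ^ 2 ≤ δ / 2 := by
            rw [div_le_iff₀ (by positivity)]
            have : 2 * |y2| * (v - u) ≤ 2 * |y2| := by nlinarith
            nlinarith
          linarith
    have hL1 := hside (-1 / 2) p hp1 (by linarith) (by
      rcases hp1.eq_or_lt with h | h
      · left; exact h
      · right
        intro t ht
        have : p ≤ a0 - δ := by
          rcases max_choice (-1 / 2) (min (1 / 2) (a0 - δ)) with h' | h'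
          · rw [hp, h'] at h; linarith
          · rw [hp, h']; exact min_le_right _ _
        rw [abs_sub_comm]
        exact le_trans (by linarith [ht.2]) (le_abs_self _))
    have hL2 := hside q (1 / 2) hq2 (by linarith) (by
      rcases hq2.eq_or_lt with h | h
      · left; exact h
      · right
        intro t ht
        have : a0 + δ ≤ q := by
          rw [hq]
          rcases min_choice (1 / 2) (a0 + δ) with h' | h'
          · rw [hq, h'] at h
            have := le_max_right (-1 / 2 : ℝ) (1 / 2)
            linarith
          · rw [h']; exact le_max_right _ _
        exact le_trans (by linarith [ht.1]) (le_abs_self _))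
    have hM : ‖∫ t in p..q, qe y1 y2 t‖ ≤ 2 * δ := by
      have := intervalIntegral.norm_integral_le_of_norm_le_const (a := p) (b := q) (f := qe y1 y2)
        (C := 1) (fun t _ => (qe_norm y1 y2 t).le)
      rw [abs_of_nonneg (by linarith)] at this
      linarith
    rw [← intervalIntegral.integral_add_adjacent_intervals (hIntg (-1 / 2) p) (hIntg p (1 / 2)),
      ← intervalIntegral.integral_add_adjacent_intervals (hIntg p q) (hIntg q (1 / 2))]
    refine (norm_add_le _ _).trans ?_
    have := norm_add_le (∫ t in p..q, qe y1 y2 t) (∫ t in q..(1 / 2), qe y1 y2 t)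
    have : δ ^ 2 ≤ δ := by nlinarith
    linarith

theorem riemann {y1 y2 : ℝ} {N : ℕ} (hN : 0 < N) :
    ‖∑ l ∈ Finset.range N, qe y1 y2 (aa N l)‖ ≤
      N * ‖∫ t in (-1 / 2 : ℝ)..(1 / 2), qe y1 y2 t‖ + (|y1| + |y2|) := by
  have hN' : (0 : ℝ) < N := by exact_mod_cast hN
  set p : ℕ → ℝ := fun l => l / N - 1 / 2 with hp
  have hs := intervalIntegral.sum_integral_adjacent_intervals (f := qe y1 y2) (a := p) (n := N)
    (μ := volume) (fun k _ => (qe_cont y1 y2).intervalIntegrable _ _)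
  have hp0 : p 0 = -1 / 2 := by simp [hp]; norm_num
  have hpN : p N = 1 / 2 := by simp only [hp]; rw [div_self hN'.ne']; norm_num
  rw [hp0, hpN] at hs
  have hstep : ∀ l, p (l + 1) - p l = 1 / N := by intro l; simp only [hp]; push_cast; ring
  have hcell : ∀ l ∈ Finset.range N, ‖qe y1 y2 (aa N l) - N * ∫ t in p l..p (l + 1), qe y1 y2 t‖ ≤
      (|y1| + |y2|) / N := by
    intro l hl
    rw [Finset.mem_range] at hl
    have hle : p l ≤ p (l + 1) := by have := hstep l; have : (0 : ℝ) < 1 / N := by positivity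
                                     linarith
    have e : qe y1 y2 (aa N l) - N * ∫ t in p l..p (l + 1), qe y1 y2 t =
        N * ∫ t in p l..p (l + 1), (qe y1 y2 (aa N l) - qe y1 y2 t) := by
      rw [intervalIntegral.integral_sub (by simp) ((qe_cont y1 y2).intervalIntegrable _ _),
        intervalIntegral.integral_const, hstep, mul_sub]
      congr 1
      rw [Complex.real_smul]
      have : (N : ℂ) ≠ 0 := by exact_mod_cast hN.ne'
      push_cast
      field_simp
    rw [e, norm_mul, Complex.norm_natCast]
    have := intervalIntegral.norm_integral_le_of_norm_le_const (a := p l) (b := p (l + 1))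
      (f := fun t => qe y1 y2 (aa N l) - qe y1 y2 t) (C := (|y1| + |y2|) / N) (by
        intro t ht
        rw [Set.uIoc_of_le hle] at ht
        have ha := aa_abs hl
        have hl' : (l : ℝ) + 1 ≤ N := by exact_mod_cast hl
        have hta : |aa N l - t| ≤ 1 / N := by
          have e1 : aa N l = p l + 1 / (2 * N) := by simp only [hp]; unfold aa; field_simp; ring
          have e2 : (1 : ℝ) / (2 * N) = (1 / N) / 2 := by field_simp
          have := hstep l
          have h0 : (0 : ℝ) < 1 / N := by positivity
          rw [abs_le]; constructor <;> linarith [ht.1, ht.2]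
        have ht2 : |t| ≤ 1 / 2 := by
          have e1 : p (l + 1) ≤ 1 / 2 := by
            have : ((l : ℝ) + 1) / N ≤ 1 := by rw [div_le_one hN']; exact hl'
            simp only [hp]; push_cast; linarith
          have e2 : -1 / 2 ≤ p l := by
            have : (0 : ℝ) ≤ l / N := by positivity
            simp only [hp]; linarith
          rw [abs_le]; constructor <;> linarith [ht.1, ht.2]
        have hlip : ‖qe y1 y2 (aa N l) - qe y1 y2 t‖ ≤
            |(y1 * aa N l + y2 * aa N l ^ 2) - (y1 * t + y2 * t ^ 2)| := by
          set u := y1 * aa N l + y2 * aa N l ^ 2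
          set v := y1 * t + y2 * t ^ 2
          have e1 : qe y1 y2 (aa N l) - qe y1 y2 t = Complex.exp (Complex.I * v) *
              (Complex.exp (Complex.I * ((u - v : ℝ) : ℂ)) - 1) := by
            rw [mul_sub, ← Complex.exp_add]
            unfold qe
            simp only [u, v]; push_cast; ring_nf
          rw [e1, norm_mul]
          have e2 : ‖Complex.exp (Complex.I * v)‖ = 1 := by
            rw [mul_comm]; exact Complex.norm_exp_ofReal_mul_I _
          rw [e2, one_mul]
          exact Real.norm_exp_I_mul_ofReal_sub_one_le
        refine hlip.trans ?_
        have e3 : (y1 * aa N l + y2 * aa N l ^ 2) - (y1 * t + y2 * t ^ 2) =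
          (y1 + y2 * (aa N l + t)) * (aa N l - t) := by ring
        rw [e3, abs_mul, div_eq_mul_one_div]
        gcongr
        refine (abs_add_le _ _).trans (add_le_add le_rfl ?_)
        rw [abs_mul]
        refine mul_le_of_le_one_right (abs_nonneg _) ?_
        refine (abs_add_le _ _).trans ?_
        linarith)
    rw [hstep, abs_of_pos (show (0 : ℝ) < 1 / N by positivity)] at this
    calc _ ≤ (N : ℝ) * ((|y1| + |y2|) / N * (1 / N)) := by gcongr
      _ = _ := by field_simp
  have e : ∑ l ∈ Finset.range N, qe y1 y2 (aa N l) =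
      ∑ l ∈ Finset.range N, (qe y1 y2 (aa N l) - N * ∫ t in p l..p (l + 1), qe y1 y2 t) +
      N * ∫ t in (-1 / 2 : ℝ)..(1 / 2), qe y1 y2 t := by
    rw [← hs, Finset.sum_sub_distrib, Finset.mul_sum]; ring
  rw [e]
  refine (norm_add_le _ _).trans ?_
  rw [norm_mul, Complex.norm_natCast, add_comm]
  gcongr
  refine (norm_sum_le _ _).trans ((Finset.sum_le_sum hcell).trans ?_)
  simp
  field_simp
  exact le_rfl

/-- the exponential sum bound -/
theorem osc_sum {y0 y1 y2 δ : ℝ} {N : ℕ} (hN : 0 < N) (hδ : 0 < δ) (hδ1 : δ ≤ 1)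
    (hL : 2 / δ ^ 3 ≤ max |y1| |y2|) (hyN : |y1| + |y2| ≤ N * δ) :
    ‖∑ l ∈ Finset.range N, Complex.exp (Complex.I * (y0 + y1 * aa N l + y2 * aa N l ^ 2 : ℝ))‖ ≤
      N * (9 * δ) := by
  have e : ∑ l ∈ Finset.range N, Complex.exp (Complex.I * (y0 + y1 * aa N l + y2 * aa N l ^ 2 : ℝ)) =
      Complex.exp (Complex.I * y0) * ∑ l ∈ Finset.range N, qe y1 y2 (aa N l) := by
    rw [Finset.mul_sum]
    refine Finset.sum_congr rfl fun l _ => ?_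
    unfold qe
    rw [← Complex.exp_add]
    push_cast; ring_nf
  have e2 : ‖Complex.exp (Complex.I * y0)‖ = 1 := by
    rw [mul_comm]; exact Complex.norm_exp_ofReal_mul_I _
  rw [e, norm_mul, e2, one_mul]
  refine (riemann hN).trans ?_
  have := osc_int hδ hδ1 hL
  have : (N : ℝ) * ‖∫ t in (-1 / 2 : ℝ)..(1 / 2), qe y1 y2 t‖ ≤ N * (8 * δ) := by gcongr
  linarith

end Wolff

open MeasureTheory Metric

namespace Wolff

noncomputable def fl (R c h : ℝ) (z : ℝ × ℝ × ℝ) : ℤ × ℤ × ℤ :=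
  (⌊(TT R c h z).1⌋, ⌊(TT R c h z).2.1⌋, ⌊(TT R c h z).2.2⌋)

def near (a N : ℕ) (R ν : ℝ) (G : ℝ × ℝ → ℂ) (c h : ℝ) (b : ℕ) (z : ℝ × ℝ × ℝ) (β : ℕ) : Prop :=
  0 < ‖uu R ν G c h b β z‖ ∧
    ∀ l < N, HC R ν G (c + 2 * h * aa N l) (h / N) b z (a / N * ‖uu R ν G c h b β z‖)

theorem near_beta {a N : ℕ} {R ν : ℝ} {G : ℝ × ℝ → ℂ} {c h : ℝ} {b : ℕ} {z : ℝ × ℝ × ℝ} {β : ℕ}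
    (hR : 0 < R) (hν : 0 < ν) (hN : 4 ≤ N) (hh : 0 < h)
    (hG : IntegrableOn G (cap R ν c h)) (hnear : near a N R ν G c h b z β) : β < 3 * a := by
  obtain ⟨h1, h2⟩ := hnear
  have hN' : (0 : ℝ) < N := by exact_mod_cast (by omega : 0 < N)
  have h3 := uu_le_child hR hν (by omega) hh hG b β z hN h2
  set U := ‖uu R ν G c h b β z‖
  have h4 : 1 ≤ (3 / 4 : ℝ) ^ β * a := by
    have e : (N : ℝ) * ((3 / 4) ^ β * (a / N * U)) = ((3 / 4) ^ β * a) * U := by field_simp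
    rw [e] at h3
    nlinarith
  have h5 : (4 / 3 : ℝ) ^ β ≤ a := by
    have e : (4 / 3 : ℝ) ^ β * (3 / 4 : ℝ) ^ β = 1 := by rw [← mul_pow]; norm_num
    have : 0 < (4 / 3 : ℝ) ^ β := by positivity
    nlinarith
  have h6 := one_add_mul_le_pow (show (-2 : ℝ) ≤ 1 / 3 by norm_num) β
  have e : (1 + 1 / 3 : ℝ) = 4 / 3 := by norm_num
  rw [e] at h6
  have : (β : ℝ) < 3 * a := by linarith
  exact_mod_cast this

theorem floor_sub_abs {x y C : ℝ} (h : |x - y| ≤ C) (n : ℕ) (hn : C + 1 ≤ n) :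
    ⌊x⌋ ∈ Finset.Icc (⌊y⌋ - n) (⌊y⌋ + n) := by
  rw [abs_le] at h
  rw [Finset.mem_Icc]
  have h1 := Int.floor_le x
  have h2 := Int.lt_floor_add_one x
  have h3 := Int.floor_le y
  have h4 := Int.lt_floor_add_one y
  constructor
  · have : ((⌊y⌋ - n : ℤ) : ℝ) < (⌊x⌋ + 1 : ℤ) := by push_cast; linarith
    have := Int.cast_lt.1 this
    omega
  · have : ((⌊x⌋ : ℤ) : ℝ) < (⌊y⌋ + n + 1 : ℤ) := by push_cast; linarith
    have := Int.cast_lt.1 this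
    omega

/-- number of points close to a given one, with distinct cells -/
theorem close_count {R c h : ℝ} (F : Finset (ℝ × ℝ × ℝ)) (hinj : Set.InjOn (fl R c h) F)
    (z : ℝ × ℝ × ℝ) (n : ℕ)
    (hcl : ∀ z' ∈ F, |(TT R c h (z - z')).1| + 1 ≤ n ∧ |(TT R c h (z - z')).2.1| + 1 ≤ n ∧
      |(TT R c h (z - z')).2.2| + 1 ≤ n) : F.card ≤ (2 * n + 1) ^ 3 := by
  set Bx : Finset (ℤ × ℤ × ℤ) :=
    (Finset.Icc ((fl R c h z).1 - n) ((fl R c h z).1 + n)) ×ˢ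
    ((Finset.Icc ((fl R c h z).2.1 - n) ((fl R c h z).2.1 + n)) ×ˢ
    (Finset.Icc ((fl R c h z).2.2 - n) ((fl R c h z).2.2 + n)))
  have hcard : Bx.card = (2 * n + 1) ^ 3 := by
    simp only [Bx, Finset.card_product, Int.card_Icc]
    have : ∀ x : ℤ, (x + n + 1 - (x - n)).toNat = 2 * n + 1 := by intro x; omega
    simp only [this]; ring
  rw [← hcard]
  refine Finset.card_le_card_of_injOn (fl R c h) ?_ hinj
  intro z' hz'
  obtain ⟨h1, h2, h3⟩ := hcl z' hz'
  rw [TT_sub'] at h1 h2 h3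
  simp only [Prod.fst_sub, Prod.snd_sub] at h1 h2 h3
  simp only [Bx, Finset.coe_product, Set.mem_prod, Finset.mem_coe]
  rw [abs_sub_comm] at h1 h2 h3
  exact ⟨floor_sub_abs (le_refl _) n h1, floor_sub_abs (le_refl _) n h2,
    floor_sub_abs (le_refl _) n h3⟩

def LL (a : ℕ) : ℕ := 746496 * a ^ 6
def WW (a : ℕ) : ℕ := (2 * (2 * LL a + 2) + 1) ^ 3

set_option maxHeartbeats 1000000 in
theorem near_count_beta {a K : ℕ} {R : ℝ} {G : ℝ × ℝ → ℂ} {c h : ℝ} {b β : ℕ}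
    (hR : 0 < R) (ha : 1 ≤ a) (hK : 216 * a ^ 2 ≤ K) (hh : 0 < h)
    (hG : IntegrableOn G (cap R (1 / (K : ℝ) ^ 4) c h)) (F : Finset (ℝ × ℝ × ℝ))
    (hF : ∀ z ∈ F, near a (K ^ 3) R (1 / (K : ℝ) ^ 4) G c h b z β)
    (hinj : Set.InjOn (fl R c h) F)
    (hy : ∀ z ∈ F, ∀ z' ∈ F, |(TT R c h (z - z')).2.2| ≤ K ^ 2 ∧ |(TT R c h (z - z')).2.1| ≤ 2 * K ^ 2 ∧
      |(TT R c h (z - z')).1| ≤ 1 + |(TT R c h (z - z')).2.1| + |(TT R c h (z - z')).2.2|) :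
    F.card ≤ 8 * a ^ 2 * WW a := by
  rcases F.eq_empty_or_nonempty with rfl | hne
  · simp
  set ν : ℝ := 1 / (K : ℝ) ^ 4 with hν
  have haR : (1 : ℝ) ≤ a := by exact_mod_cast ha
  have hKR : 216 * (a : ℝ) ^ 2 ≤ K := by exact_mod_cast hK
  have hK216 : (216 : ℝ) ≤ K := by nlinarith
  have hKa : 216 * (a : ℝ) ≤ K := by nlinarith
  have hK0 : (0 : ℝ) < K := by linarith
  have hK0' : 0 < K := by exact_mod_cast hK0
  have hν0 : 0 < ν := by positivity
  set N := K ^ 3 with hNdef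
  have hN0 : 0 < N := by positivity
  have hNR : (N : ℝ) = (K : ℝ) ^ 3 := by rw [hNdef]; push_cast; rfl
  have hN0R : (0 : ℝ) < N := by exact_mod_cast hN0
  have hN4 : 4 ≤ N := by
    have : 1 ≤ K ^ 2 := Nat.one_le_pow _ _ hK0'
    have h216 : 216 ≤ K := by exact_mod_cast hK216
    rw [hNdef]; nlinarith
  obtain ⟨z1, hz1, hmin⟩ := F.exists_min_image (fun z => ‖uu R ν G c h b β z‖) hne
  obtain ⟨hpos, hHC⟩ := hF z1 hz1
  set m := a / N * ‖uu R ν G c h b β z1‖ with hm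
  have hm0 : 0 < m := by positivity
  set ρ : ℝ := 48 / K with hρ
  have hPP : ∀ z ∈ F, ∀ l < N, PP ν (TT R (c + 2 * h * aa N l) (h / N) (z - z1)) ≤ ρ := by
    intro z hz l hl
    obtain ⟨h2, h1, h0⟩ := hy z hz z1 hz1
    rw [TT_sub hN0]
    set y := TT R c h (z - z1)
    have hal := aa_abs hl
    unfold PP
    simp only
    have hA : |y.1 + y.2.1 * aa N l + y.2.2 * aa N l ^ 2| ≤ 7 * K ^ 2 := by
      have e1 := abs_add_three y.1 (y.2.1 * aa N l) (y.2.2 * aa N l ^ 2)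
      have e2 : |y.2.1 * aa N l| ≤ |y.2.1| := by
        rw [abs_mul]; exact mul_le_of_le_one_right (abs_nonneg _) (by linarith)
      have e3 : |y.2.2 * aa N l ^ 2| ≤ |y.2.2| := by
        rw [abs_mul, abs_pow]
        exact mul_le_of_le_one_right (abs_nonneg _) (pow_le_one₀ (abs_nonneg _) (by linarith))
      nlinarith
    have hB : |(y.2.1 + 2 * y.2.2 * aa N l) / N| ≤ 3 / K := by
      rw [abs_div, abs_of_pos hN0R, hNR, div_le_div_iff₀ (by positivity) hK0]
      have e1 := abs_add_le y.2.1 (2 * y.2.2 * aa N l)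
      have e2 : |2 * y.2.2 * aa N l| ≤ |y.2.2| := by
        rw [abs_mul, abs_mul, abs_two]; nlinarith [abs_nonneg y.2.2]
      have : |y.2.1 + 2 * y.2.2 * aa N l| ≤ 3 * K ^ 2 := by linarith
      nlinarith
    have hC : |y.2.2 / (N : ℝ) ^ 2| ≤ 1 / K := by
      rw [abs_div, abs_of_pos (show (0 : ℝ) < (N : ℝ) ^ 2 by positivity), hNR, div_le_div_iff₀ (by positivity) hK0]
      have : (K : ℝ) ^ 2 * K ≤ (K ^ 3) ^ 2 := by
        have : (1 : ℝ) ≤ K ^ 3 := one_le_pow₀ (by linarith)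
        nlinarith
      nlinarith
    have hν1 : 4 * ν * (7 * K ^ 2) ≤ 28 / K := by
      rw [hν, le_div_iff₀ hK0]
      have : 4 * (1 / (K : ℝ) ^ 4) * (7 * K ^ 2) * K = 28 / K := by field_simp; norm_num
      rw [this, div_le_iff₀ hK0]; linarith
    have hν2 : ν ≤ 1 := by
      rw [hν, div_le_one (by positivity)]; exact one_le_pow₀ (by linarith)
    calc _ ≤ 4 * ν * (7 * K ^ 2) + (1 + 4 * 1) * (3 / K + 1 / K) := by gcongr
      _ ≤ 28 / K + (1 + 4 * 1) * (3 / K + 1 / K) := by gcongr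
      _ = ρ := by rw [hρ]; ring
  have herr : (Real.exp ρ - 1) + 4 / N ≤ 1 / (2 * a) := by
    have hρ1 : |ρ| ≤ 1 := by
      rw [abs_of_pos (by positivity), hρ, div_le_one hK0]; linarith
    have h1 := Real.abs_exp_sub_one_le hρ1
    have h2 : Real.exp ρ - 1 ≤ 2 * ρ := by
      have := le_abs_self (Real.exp ρ - 1)
      rw [abs_of_pos (show 0 < ρ by positivity)] at h1
      linarith
    have h3 : (4 : ℝ) / N ≤ 4 / K := by
      have : (K : ℝ) ≤ N := by rw [hNR]; nlinarith [sq_nonneg (K : ℝ)]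
      gcongr
    have h4 : (100 : ℝ) / K ≤ 1 / (2 * a) := by
      rw [div_le_div_iff₀ hK0 (by positivity)]; linarith
    have e : (100 : ℝ) / K = 2 * ρ + 4 / K := by rw [hρ]; ring
    linarith
  set d : ℕ → ℂ := fun l => ((aa N l : ℂ) ^ β * uu R ν G (c + 2 * h * aa N l) (h / N) b 0 z1) / m with hd
  have hd1 : ∀ l < N, ‖d l‖ ≤ 1 := by
    intro l hl
    have h1 := hHC l hl 0 0
    simp only [hd, norm_div, norm_mul, norm_pow, Complex.norm_real, Real.norm_eq_abs, abs_of_pos hm0]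
    rw [div_le_one hm0]
    have h2 : |aa N l| ^ β ≤ 1 := pow_le_one₀ (abs_nonneg _) (by linarith [aa_abs hl])
    have h3 : ‖uu R ν G (c + 2 * h * aa N l) (h / N) b 0 z1‖ ≤ m := by simpa [uu] using h1
    calc _ ≤ 1 * m := by gcongr
      _ = m := one_mul m
  set φ : ℕ → (ℝ × ℝ × ℝ) → ℝ := fun l z => (TT R (c + 2 * h * aa N l) (h / N) (z - z1)).1 with hφ
  have hA : ∀ z ∈ F, (N : ℝ) / (2 * a) ≤ ‖∑ l ∈ Finset.range N, Complex.exp (Complex.I * φ l z) * d l‖ := by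
    intro z hz
    have h1 := uu_approx hR hν0 hN0 hh hG b β z1 (z - z1) hN4 hHC (hPP z hz)
    rw [add_sub_cancel] at h1
    have e : ∑ l ∈ Finset.range N,
      Complex.exp (Complex.I * (TT R (c + 2 * h * aa N l) (h / N) (z - z1)).1) *
        ((aa N l : ℂ) ^ β * uu R ν G (c + 2 * h * aa N l) (h / N) b 0 z1) =
        m * ∑ l ∈ Finset.range N, Complex.exp (Complex.I * φ l z) * d l := by
      rw [Finset.mul_sum]
      refine Finset.sum_congr rfl fun l _ => ?_
      have : (m : ℂ) ≠ 0 := by exact_mod_cast hm0.ne'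
      simp only [hd, hφ]
      field_simp
    rw [e] at h1
    have h2 := norm_sub_norm_le (uu R ν G c h b β z) (m * ∑ l ∈ Finset.range N, Complex.exp (Complex.I * φ l z) * d l)
    rw [norm_mul, Complex.norm_real, Real.norm_eq_abs, abs_of_pos hm0] at h2
    have h3 := hmin z hz
    have h4 : ‖uu R ν G c h b β z1‖ = N / a * m := by rw [hm]; field_simp
    have h5 : (N : ℝ) * (((Real.exp ρ - 1) + 4 / N) * m) ≤ N * (1 / (2 * a) * m) := by gcongr
    have h6 : N / a * m - N * (1 / (2 * a) * m) = m * (N / (2 * a)) := by field_simp; norm_num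
    have h7 : m * (N / (2 * a)) ≤ m * ‖∑ l ∈ Finset.range N, Complex.exp (Complex.I * φ l z) * d l‖ := by
      linarith
    exact le_of_mul_le_mul_left h7 hm0
  have htts := tts F N d hd1 φ _ (by positivity) hA
  set δ : ℝ := 1 / (72 * a ^ 2) with hδ
  have hδ0 : 0 < δ := by positivity
  have hδ1 : δ ≤ 1 := by rw [hδ, div_le_one (by positivity)]; nlinarith
  have hL : 2 / δ ^ 3 = LL a := by rw [hδ]; unfold LL; push_cast; field_simp; norm_num
  have hrow : ∀ z ∈ F, ∑ z' ∈ F,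
      ‖∑ l ∈ Finset.range N, Complex.exp (Complex.I * (φ l z - φ l z'))‖ ≤
      N * WW a + F.card * (N * (9 * δ)) := by
    intro z hz
    have hphi : ∀ z' l, ((φ l z : ℂ) - φ l z') = (((TT R c h (z - z')).1 + (TT R c h (z - z')).2.1 * aa N l +
        (TT R c h (z - z')).2.2 * aa N l ^ 2 : ℝ) : ℂ) := by
      intro z' l
      have e := TT_sub (R := R) (c := c) (h := h) hN0 l (z - z')
      have e2 : z - z' = (z - z1) - (z' - z1) := by abel
      rw [← Complex.ofReal_sub]
      congr 1
      have e3 := congrArg Prod.fst e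
      simp only at e3
      rw [← e3, e2, TT_sub']
      rfl
    rw [← Finset.sum_filter_add_sum_filter_not F (fun z' => max |(TT R c h (z - z')).2.1| |(TT R c h (z - z')).2.2| ≤ LL a)]
    refine add_le_add ?_ ?_
    · have hc1 : (F.filter (fun z' => max |(TT R c h (z - z')).2.1| |(TT R c h (z - z')).2.2| ≤ LL a)).card ≤ WW a := by
        refine close_count (R := R) (c := c) (h := h) _ (hinj.mono (Finset.coe_subset.2 (Finset.filter_subset _ _))) z (2 * LL a + 2) ?_
        intro z' hz'
        rw [Finset.mem_filter, max_le_iff] at hz'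
        obtain ⟨hz'F, h1, h2⟩ := hz'
        obtain ⟨-, -, h0⟩ := hy z hz z' hz'F
        push_cast
        have : (0 : ℝ) ≤ LL a := by positivity
        refine ⟨?_, ?_, ?_⟩ <;> linarith
      have hc2 : ∀ z' ∈ (F.filter (fun z' => max |(TT R c h (z - z')).2.1| |(TT R c h (z - z')).2.2| ≤ LL a)),
          ‖∑ l ∈ Finset.range N, Complex.exp (Complex.I * (φ l z - φ l z'))‖ ≤ N := by
        intro z' _
        refine (norm_sum_le _ _).trans ?_
        have : ∀ l ∈ Finset.range N, ‖Complex.exp (Complex.I * (φ l z - φ l z'))‖ ≤ 1 := by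
          intro l _
          rw [hphi, mul_comm]; exact (Complex.norm_exp_ofReal_mul_I _).le
        refine (Finset.sum_le_sum this).trans ?_
        simp
      refine (Finset.sum_le_card_nsmul _ _ _ hc2).trans ?_
      rw [nsmul_eq_mul, mul_comm]
      gcongr
    · have hc2 : ∀ z' ∈ (F.filter (fun z' => ¬ max |(TT R c h (z - z')).2.1| |(TT R c h (z - z')).2.2| ≤ LL a)),
          ‖∑ l ∈ Finset.range N, Complex.exp (Complex.I * (φ l z - φ l z'))‖ ≤ N * (9 * δ) := by
        intro z' hz'
        rw [Finset.mem_filter, not_le] at hz'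
        obtain ⟨h2, h1, -⟩ := hy z hz z' hz'.1
        simp only [hphi]
        refine osc_sum hN0 hδ0 hδ1 ?_ ?_
        · rw [hL]; exact hz'.2.le
        · rw [hNR, hδ]
          have : (3 : ℝ) * K ^ 2 ≤ K ^ 3 * (1 / (72 * a ^ 2)) := by
            rw [mul_one_div, le_div_iff₀ (by positivity)]
            nlinarith [sq_nonneg (K : ℝ)]
          linarith
      refine (Finset.sum_le_card_nsmul _ _ _ hc2).trans ?_
      rw [nsmul_eq_mul]
      gcongr
      exact Finset.filter_subset _ _
  have hsum := Finset.sum_le_card_nsmul F _ _ hrow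
  rw [nsmul_eq_mul] at hsum
  have hfin : (F.card * (N / (2 * a)) : ℝ) ^ 2 ≤ N * (F.card * (N * WW a + F.card * (N * (9 * δ)))) :=
    htts.trans (by gcongr)
  have hFp : (0 : ℝ) < F.card := by exact_mod_cast hne.card_pos
  have h9 : 9 * δ = 1 / (8 * a ^ 2) := by rw [hδ]; field_simp; norm_num
  rw [h9] at hfin
  have e1 : (F.card * (N / (2 * a)) : ℝ) ^ 2 = (F.card * N ^ 2 / (8 * a ^ 2)) * (2 * F.card) := by field_simp; norm_num
  have e2 : (N : ℝ) * (F.card * (N * WW a + F.card * (N * (1 / (8 * a ^ 2))))) =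
    (F.card * N ^ 2 / (8 * a ^ 2)) * (8 * a ^ 2 * WW a + F.card) := by field_simp
  rw [e1, e2] at hfin
  have := le_of_mul_le_mul_left hfin (by positivity)
  have : (F.card : ℝ) ≤ 8 * a ^ 2 * WW a := by linarith
  exact_mod_cast this

theorem near_count {a K : ℕ} {R : ℝ} {G : ℝ × ℝ → ℂ} {c h : ℝ} {b : ℕ}
    (hR : 0 < R) (ha : 1 ≤ a) (hK : 216 * a ^ 2 ≤ K) (hh : 0 < h)
    (hG : IntegrableOn G (cap R (1 / (K : ℝ) ^ 4) c h)) (F : Finset (ℝ × ℝ × ℝ))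
    (hF : ∀ z ∈ F, ∃ β, near a (K ^ 3) R (1 / (K : ℝ) ^ 4) G c h b z β)
    (hinj : Set.InjOn (fl R c h) F) {l : ℕ} (hl : l < K)
    (hJ : ∀ z ∈ F, ∀ z' ∈ F, fl R (c + 2 * h * aa K l) (h / K) z = fl R (c + 2 * h * aa K l) (h / K) z') :
    F.card ≤ 3 * a * (8 * a ^ 2 * WW a) := by
  classical
  have hK0 : 0 < K := by omega
  have hK0R : (0 : ℝ) < K := by exact_mod_cast hK0
  have hK1R : (1 : ℝ) ≤ K := by exact_mod_cast hK0
  have hy : ∀ z ∈ F, ∀ z' ∈ F, |(TT R c h (z - z')).2.2| ≤ K ^ 2 ∧ |(TT R c h (z - z')).2.1| ≤ 2 * K ^ 2 ∧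
      |(TT R c h (z - z')).1| ≤ 1 + |(TT R c h (z - z')).2.1| + |(TT R c h (z - z')).2.2| := by
    intro z hz z' hz'
    have h1 := hJ z hz z' hz'
    have e := TT_sub (R := R) (c := c) (h := h) hK0 l (z - z')
    rw [TT_sub'] at e
    unfold fl at h1
    simp only [Prod.mk.injEq] at h1
    obtain ⟨f0, f1, f2⟩ := h1
    have g0 := Int.abs_sub_lt_one_of_floor_eq_floor f0
    have g1 := Int.abs_sub_lt_one_of_floor_eq_floor f1
    have g2 := Int.abs_sub_lt_one_of_floor_eq_floor f2
    have e0 := congrArg Prod.fst e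
    have e1 := congrArg (fun p => p.2.1) e
    have e2 := congrArg (fun p => p.2.2) e
    simp only [Prod.fst_sub, Prod.snd_sub] at e0 e1 e2
    rw [e0] at g0; rw [e1] at g1; rw [e2] at g2
    set y := TT R c h (z - z')
    have hal := aa_abs hl
    rw [abs_div, abs_of_pos (show (0 : ℝ) < (K : ℝ) ^ 2 by positivity), div_lt_one (by positivity)] at g2
    rw [abs_div, abs_of_pos hK0R, div_lt_one hK0R] at g1
    have b1 : |2 * y.2.2 * aa K l| ≤ |y.2.2| := by
      rw [abs_mul, abs_mul, abs_two]; nlinarith [abs_nonneg y.2.2]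
    have b2 := abs_sub_abs_le_abs_sub y.2.1 (-(2 * y.2.2 * aa K l))
    rw [abs_neg, sub_neg_eq_add] at b2
    refine ⟨g2.le, by nlinarith, ?_⟩
    have b3 : |y.2.1 * aa K l| ≤ |y.2.1| := by
      rw [abs_mul]; exact mul_le_of_le_one_right (abs_nonneg _) (by linarith)
    have b4 : |y.2.2 * aa K l ^ 2| ≤ |y.2.2| := by
      rw [abs_mul, abs_pow]
      exact mul_le_of_le_one_right (abs_nonneg _) (pow_le_one₀ (abs_nonneg _) (by linarith))
    have b5 := abs_sub_abs_le_abs_sub y.1 (-(y.2.1 * aa K l + y.2.2 * aa K l ^ 2))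
    rw [abs_neg, sub_neg_eq_add, ← add_assoc] at b5
    have b6 := abs_add_le (y.2.1 * aa K l) (y.2.2 * aa K l ^ 2)
    linarith
  choose! βf hβ using hF
  have hN4 : 4 ≤ K ^ 3 := by
    have h1 : 1 ≤ a ^ 2 := Nat.one_le_pow _ _ ha
    have h2 : 216 ≤ K := by omega
    have : 1 ≤ K ^ 2 := Nat.one_le_pow _ _ hK0
    calc 4 ≤ K * 1 := by omega
      _ ≤ K * K ^ 2 := by gcongr
      _ = K ^ 3 := by ring
  have hmaps : ∀ z ∈ F, βf z ∈ Finset.range (3 * a) := fun z hz =>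
    Finset.mem_range.2 (near_beta hR (by positivity) hN4 hh hG (hβ z hz))
  rw [Finset.card_eq_sum_card_fiberwise (f := βf) (t := Finset.range (3 * a)) hmaps]
  refine (Finset.sum_le_card_nsmul _ _ (8 * a ^ 2 * WW a) fun β _ => ?_).trans ?_
  · refine near_count_beta (β := β) (b := b) hR ha hK hh hG _ ?_ (hinj.mono (Finset.coe_subset.2 (Finset.filter_subset _ _))) ?_
    · intro z hz
      rw [Finset.mem_filter] at hz
      rw [← hz.2]; exact hβ z hz.1
    · intro z hz z' hz'
      exact hy z (Finset.mem_filter.1 hz).1 z' (Finset.mem_filter.1 hz').1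
  · simp
end Wolff

open MeasureTheory Metric
open scoped ENNReal

namespace Wolff

theorem enn_pow_sum {ι : Type*} (s : Finset ι) (f : ι → ℝ≥0∞) (hf : ∀ i ∈ s, f i ≠ ⊤) (n : ℕ) :
    (∑ i ∈ s, f i) ^ (n + 1) ≤ (s.card : ℝ≥0∞) ^ n * ∑ i ∈ s, f i ^ (n + 1) := by
  have h := NNReal.rpow_sum_le_const_mul_sum_rpow s (fun i => (f i).toNNReal) (p := (n + 1 : ℕ))
    (by push_cast; linarith [(Nat.cast_nonneg n : (0 : ℝ) ≤ n)])
  have e1 : ((n + 1 : ℕ) : ℝ) - 1 = (n : ℕ) := by push_cast; ring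
  rw [e1] at h
  simp only [NNReal.rpow_natCast] at h
  have h2 : (((∑ i ∈ s, (f i).toNNReal) ^ (n + 1) : NNReal) : ℝ≥0∞) ≤
    (((s.card : NNReal) ^ n * ∑ i ∈ s, (f i).toNNReal ^ (n + 1) : NNReal) : ℝ≥0∞) := by exact_mod_cast h
  push_cast at h2
  have e2 : ∑ i ∈ s, ((f i).toNNReal : ℝ≥0∞) = ∑ i ∈ s, f i :=
    Finset.sum_congr rfl (fun i hi => ENNReal.coe_toNNReal (hf i hi))
  have e3 : ∑ i ∈ s, ((f i).toNNReal : ℝ≥0∞) ^ (n + 1) = ∑ i ∈ s, f i ^ (n + 1) :=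
    Finset.sum_congr rfl (fun i hi => by rw [ENNReal.coe_toNNReal (hf i hi)])
  rwa [e2, e3] at h2

theorem sum_blocks {M : Type*} [AddCommMonoid M] (f : ℕ → M) (N n : ℕ) :
    ∑ l ∈ Finset.range n, ∑ l' ∈ Finset.range N, f (N * l + l') = ∑ l ∈ Finset.range (N * n), f l := by
  induction n with
  | zero => simp
  | succ n ih => rw [Finset.sum_range_succ, ih, Nat.mul_succ, Finset.sum_range_add]

/-- choosing near-maximisers in each cell -/
theorem sup_sum {P A : Type*} (Z : Set P) (f : P → A) (φ : P → ℝ≥0∞) {C : ℝ≥0∞} (hC : C ≠ ⊤)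
    (hφ : ∀ z, φ z ≤ C) (V : ℝ≥0∞)
    (h : ∀ F : Finset P, (F : Set P) ⊆ Z → Set.InjOn f F → ∑ z ∈ F, φ z ≤ V) :
    ∑' Q : A, ⨆ z ∈ Z, ⨆ (_ : f z = Q), φ z ≤ 2 * V := by
  classical
  rcases isEmpty_or_nonempty P with hP | hP
  · simp
  set g : A → ℝ≥0∞ := fun Q => ⨆ z ∈ Z, ⨆ (_ : f z = Q), φ z with hg
  have hgC : ∀ Q, g Q ≤ C := fun Q => iSup₂_le fun z _ => iSup_le fun _ => hφ z
  have hch : ∀ Q, g Q ≠ 0 → ∃ z ∈ Z, f z = Q ∧ g Q ≤ 2 * φ z := by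
    intro Q hQ
    have h1 : g Q / 2 < g Q := ENNReal.half_lt_self hQ (ne_top_of_le_ne_top hC (hgC Q))
    conv_rhs at h1 => rw [hg]
    simp only [lt_iSup_iff] at h1
    obtain ⟨z, hz, hzQ, h2⟩ := h1
    refine ⟨z, hz, hzQ, ?_⟩
    rw [mul_comm]
    exact (ENNReal.div_le_iff_le_mul (by simp) (by simp)).1 h2.le
  rw [ENNReal.tsum_eq_iSup_sum]
  refine iSup_le fun 𝒬 => ?_
  choose! zf h1 h2 h3 using hch
  have e : ∑ Q ∈ 𝒬, g Q = ∑ Q ∈ 𝒬.filter (fun Q => g Q ≠ 0), g Q := (Finset.sum_filter_ne_zero _).symm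
  rw [e]
  have hinj : Set.InjOn zf (↑(𝒬.filter (fun Q => g Q ≠ 0)) : Set A) := by
    intro Q hQ Q' hQ' hh
    have hQ := (Finset.mem_filter.1 (Finset.mem_coe.1 hQ)).2
    have hQ' := (Finset.mem_filter.1 (Finset.mem_coe.1 hQ')).2
    rw [← h2 Q hQ, ← h2 Q' hQ', hh]
  calc ∑ Q ∈ 𝒬.filter (fun Q => g Q ≠ 0), g Q ≤ ∑ Q ∈ 𝒬.filter (fun Q => g Q ≠ 0), 2 * φ (zf Q) :=
        Finset.sum_le_sum fun Q hQ => h3 Q (Finset.mem_filter.1 hQ).2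
    _ = 2 * ∑ z ∈ (𝒬.filter (fun Q => g Q ≠ 0)).image zf, φ z := by
        rw [Finset.sum_image hinj, Finset.mul_sum]
    _ ≤ 2 * V := by
        gcongr
        refine h _ ?_ ?_
        · intro z hz
          simp only [Finset.coe_image, Set.mem_image] at hz
          obtain ⟨Q, hQ, rfl⟩ := hz
          exact h1 Q (Finset.mem_filter.1 (Finset.mem_coe.1 hQ)).2
        · intro z hz z' hz' hh
          simp only [Finset.coe_image, Set.mem_image] at hz hz'
          obtain ⟨Q, hQ, rfl⟩ := hz
          obtain ⟨Q', hQ', rfl⟩ := hz'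
          rw [h2 Q (Finset.mem_filter.1 (Finset.mem_coe.1 hQ)).2,
            h2 Q' (Finset.mem_filter.1 (Finset.mem_coe.1 hQ')).2] at hh
          rw [hh]

theorem mult_sum {P B : Type*} (F : Finset P) (g : P → B) (W : B → ℝ≥0∞) (M : ℕ)
    (h : ∀ F' ⊆ F, (∀ z ∈ F', ∀ z' ∈ F', g z = g z') → F'.card ≤ M) :
    ∑ z ∈ F, W (g z) ≤ M * ∑' Q, W Q := by
  classical
  rw [← Finset.sum_fiberwise_of_maps_to (t := F.image g) (g := g) (fun z hz => Finset.mem_image_of_mem g hz)]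
  calc ∑ j ∈ F.image g, ∑ i ∈ F with g i = j, W (g i) ≤ ∑ j ∈ F.image g, M * W j := by
        refine Finset.sum_le_sum fun j _ => ?_
        have : ∀ i ∈ F.filter (fun i => g i = j), W (g i) ≤ W j := fun i hi => by
          rw [(Finset.mem_filter.1 hi).2]
        refine (Finset.sum_le_card_nsmul _ _ _ this).trans ?_
        rw [nsmul_eq_mul]
        gcongr
        refine h _ (Finset.filter_subset _ _) fun z hz z' hz' => ?_
        rw [(Finset.mem_filter.1 hz).2, (Finset.mem_filter.1 hz').2]
    _ = M * ∑ j ∈ F.image g, W j := by rw [Finset.mul_sum]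
    _ ≤ _ := by gcongr; exact ENNReal.sum_le_tsum _

theorem geom_le_two' (p : ℕ) (hp : 1 ≤ p) : ∑' m : ℕ, ((2 : ℝ≥0∞)⁻¹) ^ (m * p) ≤ 2 := by
  calc ∑' m : ℕ, ((2 : ℝ≥0∞)⁻¹) ^ (m * p) ≤ ∑' m : ℕ, ((2 : ℝ≥0∞)⁻¹) ^ m := by
        refine ENNReal.tsum_le_tsum fun m => ?_
        exact pow_le_pow_of_le_one (by simp) (by simp) (by nlinarith)
    _ = 2 := by rw [ENNReal.tsum_geometric]; simp

/-- double sum with shifted index -/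
theorem shift_sum (p : ℕ) (hp : 1 ≤ p) (A : ℕ → ℝ≥0∞) :
    ∑' b, ((2 : ℝ≥0∞)⁻¹) ^ (b * p) * ∑' m, ((4 : ℝ≥0∞)⁻¹) ^ (m * p) * A (b + m) ≤
      2 * ∑' n, ((2 : ℝ≥0∞)⁻¹) ^ (n * p) * A n := by
  have e4 : (4 : ℝ≥0∞)⁻¹ = 2⁻¹ * 2⁻¹ := by
    rw [← ENNReal.mul_inv (by simp) (by simp)]; norm_num
  simp only [← ENNReal.tsum_mul_left]
  rw [ENNReal.tsum_comm]
  calc _ = ∑' m : ℕ, ((2 : ℝ≥0∞)⁻¹) ^ (m * p) * ∑' b, ((2 : ℝ≥0∞)⁻¹) ^ ((b + m) * p) * A (b + m) := by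
        refine tsum_congr fun m => ?_
        rw [← ENNReal.tsum_mul_left]
        refine tsum_congr fun b => ?_
        rw [e4, mul_pow, add_mul, pow_add]; ring
    _ ≤ ∑' m : ℕ, ((2 : ℝ≥0∞)⁻¹) ^ (m * p) * ∑' n, ((2 : ℝ≥0∞)⁻¹) ^ (n * p) * A n := by
        refine ENNReal.tsum_le_tsum fun m => ?_
        refine mul_le_mul_right ?_ _
        exact ENNReal.tsum_comp_le_tsum_of_injective (add_left_injective m)
          (fun n => ((2 : ℝ≥0∞)⁻¹) ^ (n * p) * A n)
    _ = (∑' m : ℕ, ((2 : ℝ≥0∞)⁻¹) ^ (m * p)) * _ := ENNReal.tsum_mul_right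
    _ ≤ _ := by
        rw [ENNReal.tsum_mul_left (a := 2)]
        exact mul_le_mul_left (geom_le_two' p hp) _

end Wolff

open MeasureTheory Metric
open scoped ENNReal

namespace Wolff

noncomputable def SP (R ν : ℝ) (G : ℝ × ℝ → ℂ) (c h : ℝ) (b : ℕ) (z : ℝ × ℝ × ℝ) : ℝ≥0∞ :=
  ⨆ β, ‖uu R ν G c h b β z‖ₑ
noncomputable def MP (R ν : ℝ) (G : ℝ × ℝ → ℂ) (Ω : Set (ℝ × ℝ × ℝ)) (p : ℕ) (c h : ℝ) (b : ℕ) : ℝ≥0∞ :=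
  ∑' Q : ℤ × ℤ × ℤ, ⨆ z ∈ Ω, ⨆ (_ : fl R c h z = Q), SP R ν G c h b z ^ p

theorem SP_le {R ν c h : ℝ} (hR : 0 < R) (hν : 0 < ν) (hh : 0 < h) (G : ℝ × ℝ → ℂ) (b : ℕ)
    (z : ℝ × ℝ × ℝ) : SP R ν G c h b z ≤ ∫⁻ ξ in cap R ν c h, ‖G ξ‖ₑ := by
  refine iSup_le fun β => ?_
  refine (enorm_integral_le_lintegral_enorm _).trans ?_
  have hst := sm_cap (c := c) hR hν hh
  refine lintegral_mono_ae ?_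
  filter_upwards [hst.bs, hst.bt] with x h1 h2
  rw [← ofReal_norm, ← ofReal_norm]
  refine ENNReal.ofReal_le_ofReal ?_
  unfold gz
  rw [norm_mul, norm_mul, norm_mul, norm_pow, norm_pow, Complex.norm_real, Complex.norm_real, Real.norm_eq_abs,
      Real.norm_eq_abs, mul_comm Complex.I, Complex.norm_exp_ofReal_mul_I, mul_one]
  have h3 : |tt c h x| ≤ 1 := by linarith
  calc ‖G x‖ * (|ss R ν x| ^ b * |tt c h x| ^ β) ≤ ‖G x‖ * (1 * 1) := by
          gcongr
          · exact pow_le_one₀ (abs_nonneg _) h1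
          · exact pow_le_one₀ (abs_nonneg _) h3
      _ = _ := by norm_num

theorem SP_fin {R ν c h : ℝ} (hR : 0 < R) (hν : 0 < ν) (hh : 0 < h) {G : ℝ × ℝ → ℂ}
    (hG : IntegrableOn G (cap R ν c h)) (b : ℕ)
    (z : ℝ × ℝ × ℝ) : SP R ν G c h b z ≠ ⊤ :=
  ne_top_of_le_ne_top hG.2.ne (SP_le hR hν hh G b z)

theorem uu_le_SP (R ν : ℝ) (G : ℝ × ℝ → ℂ) (c h : ℝ) (b β : ℕ) (z : ℝ × ℝ × ℝ) :
    ‖uu R ν G c h b β z‖ₑ ≤ SP R ν G c h b z := le_iSup (fun β => ‖uu R ν G c h b β z‖ₑ) β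

section
variable {α : Type*} [MeasurableSpace α] {μ : Measure α} {s t : α → ℝ}
theorem mom_affine (hst : SM μ s t) {g : α → ℂ} (hg : Integrable g μ) (b : ℕ) {C : ℝ}
    (hC : ∀ β, ‖mom μ s t g b β‖ ≤ C) {a δ : ℝ} (ha : |a| ≤ 1 / 2) (hδ : |δ| ≤ 1 / 2) (β : ℕ) :
    ∀ γ, ‖mom μ s t (fun x => g x * ((a : ℂ) + δ * t x) ^ β) b γ‖ ≤ C := by
  have hb : ∀ β, Integrable (fun x => g x * ((a : ℂ) + δ * t x) ^ β) μ := by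
    intro β
    refine hg.mul_bdd (c := 1) ?_ ?_
    · have := hst.mt
      exact Measurable.aestronglyMeasurable (by fun_prop)
    · filter_upwards [hst.bt] with x h2
      rw [norm_pow]
      refine pow_le_one₀ (norm_nonneg _) ?_
      refine (norm_add_le _ _).trans ?_
      rw [norm_mul, Complex.norm_real, Complex.norm_real, Complex.norm_real, Real.norm_eq_abs,
        Real.norm_eq_abs, Real.norm_eq_abs]
      nlinarith [abs_nonneg δ, abs_nonneg (t x)]
  induction β with
  | zero => intro γ; simpa using hC γ
  | succ β ih =>
    intro γ
    have e : mom μ s t (fun x => g x * ((a : ℂ) + δ * t x) ^ (β + 1)) b γ =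
        a * mom μ s t (fun x => g x * ((a : ℂ) + δ * t x) ^ β) b γ +
        δ * mom μ s t (fun x => g x * ((a : ℂ) + δ * t x) ^ β) b (γ + 1) := by
      unfold mom
      rw [← integral_const_mul, ← integral_const_mul, ← integral_add]
      · congr 1; ext x; ring
      · exact (hst.integrable_mul (hb β) b γ).const_mul _
      · exact (hst.integrable_mul (hb β) b (γ + 1)).const_mul _
    rw [e]
    refine (norm_add_le _ _).trans ?_
    rw [norm_mul, norm_mul, Complex.norm_real, Complex.norm_real, Real.norm_eq_abs, Real.norm_eq_abs]
    have h0 : 0 ≤ C := (norm_nonneg _).trans (ih 0)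
    have h1 := mul_le_mul ha (ih γ) (norm_nonneg _) (by norm_num)
    have h2 := mul_le_mul hδ (ih (γ + 1)) (norm_nonneg _) (by norm_num)
    linarith
end

theorem uu_le_sum_SP {R ν c h : ℝ} {N : ℕ} (hR : 0 < R) (hν : 0 < ν) (hN : 2 ≤ N) (hh : 0 < h)
    {G : ℝ × ℝ → ℂ} (hG : IntegrableOn G (cap R ν c h)) (b : ℕ) (z : ℝ × ℝ × ℝ) :
    SP R ν G c h b z ≤ ∑ l ∈ Finset.range N, SP R ν G (c + 2 * h * aa N l) (h / N) b z := by
  have hN0 : 0 < N := by omega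
  have hN' : (0 : ℝ) < N := by exact_mod_cast hN0
  refine iSup_le fun β => ?_
  rw [uu_split hR hν hN0 hh hG]
  refine (enorm_sum_le _ _).trans (Finset.sum_le_sum fun l hl => ?_)
  rw [Finset.mem_range] at hl
  have hGl := hG.mono_set (cap_sub (c := c) hN0 hh hl)
  have hfin := SP_fin (c := c + 2 * h * aa N l) (h := h / N) hR hν (by positivity) hGl b z
  have hC : ∀ β, ‖uu R ν G (c + 2 * h * aa N l) (h / N) b β z‖ ≤
      (SP R ν G (c + 2 * h * aa N l) (h / N) b z).toReal := by
    intro β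
    have := ENNReal.toReal_mono hfin (uu_le_SP R ν G (c + 2 * h * aa N l) (h / N) b β z)
    simpa using this
  have := mom_affine (sm_cap hR hν (by positivity)) (gz_integrable hGl z) b hC (aa_abs hl) (δ := 1 / N)
    (by rw [abs_of_pos (by positivity)]
        have : (2 : ℝ) ≤ N := by exact_mod_cast hN
        gcongr) β 0
  rw [← ofReal_norm]
  exact ENNReal.ofReal_le_of_le_toReal this

theorem far_pt {R ν c h : ℝ} {a N : ℕ} (ha : 0 < a) (hN : 0 < N) 
    {G : ℝ × ℝ → ℂ} (b : ℕ) (z : ℝ × ℝ × ℝ) {p : ℕ} (hp : p ≠ 0)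
    (hn : ∀ β, ¬ near a N R ν G c h b z β) :
    SP R ν G c h b z ^ p ≤ ((N : ℝ≥0∞) / a) ^ p * ∑ l ∈ Finset.range N, ∑' m,
      ((4 : ℝ≥0∞)⁻¹) ^ (m * p) * SP R ν G (c + 2 * h * aa N l) (h / N) (b + m) z ^ p := by
  unfold SP
  rw [ENNReal.iSup_pow_of_ne_zero hp]
  refine iSup_le fun β => ?_
  have h1 := hn β
  unfold near at h1
  rw [not_and_or] at h1
  rcases h1 with h1 | h1
  · have : uu R ν G c h b β z = 0 := by simpa using h1
    rw [this]; simp [hp]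
  · push Not at h1
    obtain ⟨l, hl, h2⟩ := h1
    unfold HC HB at h2
    push Not at h2
    obtain ⟨m, β', h3⟩ := h2
    have hN' : (0 : ℝ) < N := by exact_mod_cast hN
    have ha' : (0 : ℝ) < a := by exact_mod_cast ha
    have h4 : ‖uu R ν G c h b β z‖ ≤ (N / a) * ((1 / 4) ^ m *
        ‖uu R ν G (c + 2 * h * aa N l) (h / N) (b + m) β' z‖) := by
      unfold uu at h3 ⊢
      set x := ‖mom (volume.restrict (cap R ν c h)) (ss R ν) (tt c h) (gz G z) b β‖
      set y := ‖mom (volume.restrict (cap R ν (c + 2 * h * aa N l) (h / ↑N))) (ss R ν)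
        (tt (c + 2 * h * aa N l) (h / ↑N)) (gz G z) (b + m) β'‖
      have e : x = (N / a) * ((1 / 4) ^ m * (4 ^ m * (a / N * x))) := by
        rw [one_div, inv_pow]
        field_simp
      rw [e]
      gcongr
    have h5 : ‖uu R ν G c h b β z‖ₑ ≤ ((N : ℝ≥0∞) / a) * (((4 : ℝ≥0∞)⁻¹) ^ m *
        ‖uu R ν G (c + 2 * h * aa N l) (h / N) (b + m) β' z‖ₑ) := by
      rw [← ofReal_norm, ← ofReal_norm (uu R ν G (c + 2 * h * aa N l) (h / N) (b + m) β' z)]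
      refine (ENNReal.ofReal_le_ofReal h4).trans (le_of_eq ?_)
      rw [ENNReal.ofReal_mul (by positivity), ENNReal.ofReal_mul (by positivity),
        ENNReal.ofReal_div_of_pos ha', ENNReal.ofReal_natCast, ENNReal.ofReal_natCast,
        ENNReal.ofReal_pow (by positivity), one_div, ENNReal.ofReal_inv_of_pos (by norm_num)]
      norm_num
    calc ‖uu R ν G c h b β z‖ₑ ^ p ≤ (((N : ℝ≥0∞) / a) * (((4 : ℝ≥0∞)⁻¹) ^ m *
        SP R ν G (c + 2 * h * aa N l) (h / N) (b + m) z)) ^ p := by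
          refine pow_le_pow_left₀ (by simp) (h5.trans ?_) p
          refine mul_le_mul_right (mul_le_mul_right ?_ _) _
          exact uu_le_SP _ _ _ _ _ _ _ _
      _ = ((N : ℝ≥0∞) / a) ^ p * (((4 : ℝ≥0∞)⁻¹) ^ (m * p) *
        SP R ν G (c + 2 * h * aa N l) (h / N) (b + m) z ^ p) := by
          rw [mul_pow, mul_pow, pow_mul]
      _ ≤ _ := by
          refine mul_le_mul_right ?_ _
          refine le_trans (ENNReal.le_tsum (f := fun m => ((4 : ℝ≥0∞)⁻¹) ^ (m * p) *
            SP R ν G (c + 2 * h * aa N l) (h / N) (b + m) z ^ p) m) ?_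
          exact Finset.single_le_sum (f := fun l => ∑' m, ((4 : ℝ≥0∞)⁻¹) ^ (m * p) *
            SP R ν G (c + 2 * h * aa N l) (h / N) (b + m) z ^ p) (by simp) (Finset.mem_range.2 hl)

theorem same_child {K : ℕ} {R c h : ℝ} (hK0 : 0 < K) {l : ℕ} (hl : l < K) {z z' : ℝ × ℝ × ℝ}
    (hJ : fl R (c + 2 * h * aa K l) (h / K) z = fl R (c + 2 * h * aa K l) (h / K) z') :
    |(TT R c h (z - z')).2.2| ≤ K ^ 2 ∧ |(TT R c h (z - z')).2.1| ≤ 2 * K ^ 2 ∧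
      |(TT R c h (z - z')).1| ≤ 1 + |(TT R c h (z - z')).2.1| + |(TT R c h (z - z')).2.2| := by
    have hK0R : (0 : ℝ) < K := by exact_mod_cast hK0
    have hK1R : (1 : ℝ) ≤ K := by exact_mod_cast hK0
    have h1 := hJ
    have e := TT_sub (R := R) (c := c) (h := h) hK0 l (z - z')
    rw [TT_sub'] at e
    unfold fl at h1
    simp only [Prod.mk.injEq] at h1
    obtain ⟨f0, f1, f2⟩ := h1
    have g0 := Int.abs_sub_lt_one_of_floor_eq_floor f0
    have g1 := Int.abs_sub_lt_one_of_floor_eq_floor f1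
    have g2 := Int.abs_sub_lt_one_of_floor_eq_floor f2
    have e0 := congrArg Prod.fst e
    have e1 := congrArg (fun p => p.2.1) e
    have e2 := congrArg (fun p => p.2.2) e
    simp only [Prod.fst_sub, Prod.snd_sub] at e0 e1 e2
    rw [e0] at g0; rw [e1] at g1; rw [e2] at g2
    set y := TT R c h (z - z')
    have hal := aa_abs hl
    rw [abs_div, abs_of_pos (show (0 : ℝ) < (K : ℝ) ^ 2 by positivity), div_lt_one (by positivity)] at g2
    rw [abs_div, abs_of_pos hK0R, div_lt_one hK0R] at g1
    have b1 : |2 * y.2.2 * aa K l| ≤ |y.2.2| := by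
      rw [abs_mul, abs_mul, abs_two]; nlinarith [abs_nonneg y.2.2]
    have b2 := abs_sub_abs_le_abs_sub y.2.1 (-(2 * y.2.2 * aa K l))
    rw [abs_neg, sub_neg_eq_add] at b2
    refine ⟨g2.le, by nlinarith, ?_⟩
    have b3 : |y.2.1 * aa K l| ≤ |y.2.1| := by
      rw [abs_mul]; exact mul_le_of_le_one_right (abs_nonneg _) (by linarith)
    have b4 : |y.2.2 * aa K l ^ 2| ≤ |y.2.2| := by
      rw [abs_mul, abs_pow]
      exact mul_le_of_le_one_right (abs_nonneg _) (pow_le_one₀ (abs_nonneg _) (by linarith))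
    have b5 := abs_sub_abs_le_abs_sub y.1 (-(y.2.1 * aa K l + y.2.2 * aa K l ^ 2))
    rw [abs_neg, sub_neg_eq_add, ← add_assoc] at b5
    have b6 := abs_add_le (y.2.1 * aa K l) (y.2.2 * aa K l ^ 2)
    linarith

theorem far_count {N : ℕ} {R c h : ℝ} (hN : 2 ≤ N) {l : ℕ} (hl : l < N) (F : Finset (ℝ × ℝ × ℝ))
    (hinj : Set.InjOn (fl R c h) F)
    (hJ : ∀ z ∈ F, ∀ z' ∈ F, fl R (c + 2 * h * aa N l) (h / N) z = fl R (c + 2 * h * aa N l) (h / N) z') :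
    F.card ≤ 729 * N ^ 6 := by
  rcases F.eq_empty_or_nonempty with rfl | ⟨z, hz⟩
  · simp
  have hNR : (2 : ℝ) ≤ N := by exact_mod_cast hN
  have h1 : F.card ≤ (2 * (4 * N ^ 2) + 1) ^ 3 := by
    refine close_count F hinj z (4 * N ^ 2) ?_
    intro z' hz'
    obtain ⟨h2, h1, h0⟩ := same_child (by omega) hl (hJ z hz z' hz')
    push_cast
    refine ⟨?_, ?_, ?_⟩ <;> nlinarith
  refine h1.trans ?_
  calc (2 * (4 * N ^ 2) + 1) ^ 3 ≤ (9 * N ^ 2) ^ 3 := by gcongr; nlinarith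
    _ = _ := by ring

end Wolff

open MeasureTheory Metric
open scoped ENNReal

namespace Wolff

/-- sum over separated points of a child quantity -/
theorem child_sum {R ν : ℝ} {G : ℝ × ℝ → ℂ} {Ω : Set (ℝ × ℝ × ℝ)} {p : ℕ} {c h : ℝ} {b : ℕ}
    (F : Finset (ℝ × ℝ × ℝ)) (hF : (F : Set _) ⊆ Ω) (M : ℕ)
    (hM : ∀ F' ⊆ F, (∀ z ∈ F', ∀ z' ∈ F', fl R c h z = fl R c h z') → F'.card ≤ M) :
    ∑ z ∈ F, SP R ν G c h b z ^ p ≤ M * MP R ν G Ω p c h b := by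
  refine le_trans ?_ (mult_sum F (fl R c h) (fun Q => ⨆ z ∈ Ω, ⨆ (_ : fl R c h z = Q), SP R ν G c h b z ^ p) M hM)
  refine Finset.sum_le_sum fun z hz => ?_
  exact le_iSup₂_of_le z (hF hz) (le_iSup_of_le rfl le_rfl)

theorem step_cap {a K : ℕ} {R c h : ℝ} {G : ℝ × ℝ → ℂ} {Ω : Set (ℝ × ℝ × ℝ)} {n : ℕ} {b : ℕ}
    (hR : 0 < R) (ha : 1 ≤ a) (hK : 216 * a ^ 2 ≤ K) (hh : 0 < h)
    (hG : IntegrableOn G (cap R (1 / (K : ℝ) ^ 4) c h)) :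
    MP R (1 / (K : ℝ) ^ 4) G Ω (n + 1) c h b ≤
      2 * ((K : ℝ≥0∞) ^ n * ((3 * a * (8 * a ^ 2 * WW a) : ℕ) *
        ∑ l ∈ Finset.range K, MP R (1 / (K : ℝ) ^ 4) G Ω (n + 1) (c + 2 * h * aa K l) (h / K) b)) +
      2 * ((((K ^ 3 : ℕ) : ℝ≥0∞) / a) ^ (n + 1) * ((729 * (K ^ 3) ^ 6 : ℕ) * ∑ l ∈ Finset.range (K ^ 3), ∑' m,
        ((4 : ℝ≥0∞)⁻¹) ^ (m * (n + 1)) *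
          MP R (1 / (K : ℝ) ^ 4) G Ω (n + 1) (c + 2 * h * aa (K ^ 3) l) (h / (K ^ 3 : ℕ)) (b + m))) := by
  classical
  have ha2 : 1 ≤ a ^ 2 := Nat.one_le_pow _ _ ha
  have hK2 : 2 ≤ K := by omega
  have hN2 : 2 ≤ K ^ 3 := by
    calc 2 ≤ K := hK2
      _ = K ^ 1 := (pow_one K).symm
      _ ≤ K ^ 3 := Nat.pow_le_pow_right (by omega) (by norm_num)
  have hK0 : (0 : ℝ) < K := by exact_mod_cast (by omega : 0 < K)
  have hν : (0 : ℝ) < 1 / (K : ℝ) ^ 4 := by positivity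
  set ν : ℝ := 1 / (K : ℝ) ^ 4 with hνdef
  set C := (∫⁻ ξ in cap R ν c h, ‖G ξ‖ₑ) ^ (n + 1) with hC
  have hCt : C ≠ ⊤ := ENNReal.pow_ne_top hG.2.ne
  have hφ : ∀ z, SP R ν G c h b z ^ (n + 1) ≤ C := fun z =>
    pow_le_pow_left₀ (by simp) (SP_le hR hν hh G b z) _
  set Zn : Set (ℝ × ℝ × ℝ) := {z ∈ Ω | ∃ β, near a (K ^ 3) R ν G c h b z β} with hZn
  set Zf : Set (ℝ × ℝ × ℝ) := {z ∈ Ω | ∀ β, ¬ near a (K ^ 3) R ν G c h b z β} with hZf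
  have h1 : MP R ν G Ω (n + 1) c h b ≤
      (∑' Q : ℤ × ℤ × ℤ, ⨆ z ∈ Zn, ⨆ (_ : fl R c h z = Q), SP R ν G c h b z ^ (n + 1)) +
      (∑' Q : ℤ × ℤ × ℤ, ⨆ z ∈ Zf, ⨆ (_ : fl R c h z = Q), SP R ν G c h b z ^ (n + 1)) := by
    rw [← ENNReal.tsum_add]
    refine ENNReal.tsum_le_tsum fun Q => ?_
    refine iSup₂_le fun z hz => iSup_le fun hQ => ?_
    by_cases hn : ∃ β, near a (K ^ 3) R ν G c h b z β
    · refine le_add_right ?_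
      exact le_iSup₂_of_le z ⟨hz, hn⟩ (le_iSup_of_le hQ le_rfl)
    · push Not at hn
      refine le_add_left ?_
      exact le_iSup₂_of_le z ⟨hz, hn⟩ (le_iSup_of_le hQ le_rfl)
  refine h1.trans (add_le_add ?_ ?_)
  · refine sup_sum Zn (fl R c h) _ hCt hφ _ fun F hF hinj => ?_
    calc ∑ z ∈ F, SP R ν G c h b z ^ (n + 1)
        ≤ ∑ z ∈ F, (K : ℝ≥0∞) ^ n * ∑ l ∈ Finset.range K,
          SP R ν G (c + 2 * h * aa K l) (h / K) b z ^ (n + 1) := by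
          refine Finset.sum_le_sum fun z _ => ?_
          refine (pow_le_pow_left₀ (by simp) (uu_le_sum_SP hR hν hK2 hh hG b z) _).trans ?_
          have := enn_pow_sum (Finset.range K) (fun l => SP R ν G (c + 2 * h * aa K l) (h / K) b z)
            (fun l hl => SP_fin hR hν (by positivity)
              (hG.mono_set (cap_sub (by omega) hh (Finset.mem_range.1 hl))) b z) n
          rwa [Finset.card_range] at this
      _ = (K : ℝ≥0∞) ^ n * ∑ l ∈ Finset.range K, ∑ z ∈ F,
          SP R ν G (c + 2 * h * aa K l) (h / K) b z ^ (n + 1) := by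
          rw [← Finset.mul_sum, Finset.sum_comm]
      _ ≤ _ := by
          refine mul_le_mul_right ?_ _
          rw [Finset.mul_sum]
          refine Finset.sum_le_sum fun l hl => ?_
          refine child_sum F (fun z hz => (hF hz).1) _ fun F' hF' hc => ?_
          exact near_count hR ha hK hh hG F' (fun z hz => (hF (hF' hz)).2)
            (hinj.mono (Finset.coe_subset.2 hF')) (Finset.mem_range.1 hl) hc
  · refine sup_sum Zf (fl R c h) _ hCt hφ _ fun F hF hinj => ?_
    calc ∑ z ∈ F, SP R ν G c h b z ^ (n + 1)
        ≤ ∑ z ∈ F, (((K ^ 3 : ℕ) : ℝ≥0∞) / a) ^ (n + 1) * ∑ l ∈ Finset.range (K ^ 3), ∑' m,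
        ((4 : ℝ≥0∞)⁻¹) ^ (m * (n + 1)) *
          SP R ν G (c + 2 * h * aa (K ^ 3) l) (h / (K ^ 3 : ℕ)) (b + m) z ^ (n + 1) := by
          refine Finset.sum_le_sum fun z hz => ?_
          exact far_pt (by omega) (by omega) b z (by omega) (hF hz).2
      _ = (((K ^ 3 : ℕ) : ℝ≥0∞) / a) ^ (n + 1) * ∑ l ∈ Finset.range (K ^ 3), ∑' m, 
        ((4 : ℝ≥0∞)⁻¹) ^ (m * (n + 1)) * ∑ z ∈ F,
          SP R ν G (c + 2 * h * aa (K ^ 3) l) (h / (K ^ 3 : ℕ)) (b + m) z ^ (n + 1) := by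
          rw [← Finset.mul_sum, Finset.sum_comm]
          congr 1
          refine Finset.sum_congr rfl fun l _ => ?_
          rw [← Summable.tsum_finsetSum (fun _ _ => ENNReal.summable)]
          simp only [Finset.mul_sum]
      _ ≤ _ := by
          refine mul_le_mul_right ?_ _
          rw [Finset.mul_sum]
          refine Finset.sum_le_sum fun l hl => ?_
          rw [← ENNReal.tsum_mul_left]
          refine ENNReal.tsum_le_tsum fun m => ?_
          rw [mul_left_comm]
          refine mul_le_mul_right ?_ _
          refine child_sum F (fun z hz => (hF hz).1) _ fun F' hF' hc => ?_
          exact far_count hN2 (Finset.mem_range.1 hl) F' (hinj.mono (Finset.coe_subset.2 hF')) hc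

noncomputable def cc (K j l : ℕ) : ℝ := 2 * aa (K ^ j) l
noncomputable def hj (K j : ℕ) : ℝ := 1 / (K : ℝ) ^ j

theorem cc_child {K : ℕ} (hK : 0 < K) (j i l l' : ℕ) :
    cc K j l + 2 * hj K j * aa (K ^ i) l' = cc K (j + i) (K ^ i * l + l') := by
  have : (0 : ℝ) < K := by exact_mod_cast hK
  unfold cc hj aa
  push_cast
  field_simp
  ring
theorem hj_child {K : ℕ} (hK : 0 < K) (j i : ℕ) : hj K j / (K ^ i : ℕ) = hj K (j + i) := by
  have : (0 : ℝ) < K := by exact_mod_cast hK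
  unfold hj
  push_cast
  rw [pow_add]
  field_simp
theorem hj_pos {K : ℕ} (hK : 0 < K) (j : ℕ) : 0 < hj K j := by
  have : (0 : ℝ) < K := by exact_mod_cast hK
  unfold hj; positivity
theorem cap_level {K : ℕ} (hK : 0 < K) (R ν : ℝ) {j l : ℕ} (hl : l < K ^ j) :
    cap R ν (cc K j l) (hj K j) ⊆ cap R ν 0 1 := by
  have := cap_sub (R := R) (ν := ν) (c := 0) (h := 1) (N := K ^ j) (by positivity) one_pos hl
  unfold cc hj
  convert this using 2
  · ring
  · push_cast; ring

/-- the functional at level `j` -/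
noncomputable def GG (K : ℕ) (R : ℝ) (G : ℝ × ℝ → ℂ) (Ω : Set (ℝ × ℝ × ℝ)) (p j : ℕ) : ℝ≥0∞ :=
  ∑' b, ((2 : ℝ≥0∞)⁻¹) ^ (b * p) * ∑ l ∈ Finset.range (K ^ j),
    MP R (1 / (K : ℝ) ^ 4) G Ω p (cc K j l) (hj K j) b

theorem step {a K : ℕ} {R : ℝ} {G : ℝ × ℝ → ℂ} {Ω : Set (ℝ × ℝ × ℝ)} {n : ℕ}
    (hR : 0 < R) (ha : 1 ≤ a) (hK : 216 * a ^ 2 ≤ K)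
    (hG : IntegrableOn G (cap R (1 / (K : ℝ) ^ 4) 0 1)) (j : ℕ) :
    GG K R G Ω (n + 1) j ≤
      (2 * ((K : ℝ≥0∞) ^ n * ((3 * a * (8 * a ^ 2 * WW a) : ℕ)))) * GG K R G Ω (n + 1) (j + 1) +
      (2 * ((((K ^ 3 : ℕ) : ℝ≥0∞) / a) ^ (n + 1) * (729 * (K ^ 3) ^ 6 : ℕ)) * 2) * GG K R G Ω (n + 1) (j + 3) := by
  have ha2 : 1 ≤ a ^ 2 := Nat.one_le_pow _ _ ha
  have hK0 : 0 < K := by omega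
  set ν : ℝ := 1 / (K : ℝ) ^ 4 with hνdef
  set C1 : ℝ≥0∞ := 2 * ((K : ℝ≥0∞) ^ n * ((3 * a * (8 * a ^ 2 * WW a) : ℕ))) with hC1
  set C2 : ℝ≥0∞ := 2 * ((((K ^ 3 : ℕ) : ℝ≥0∞) / a) ^ (n + 1) * (729 * (K ^ 3) ^ 6 : ℕ)) with hC2
  set MJ : ℕ → ℕ → ℕ → ℝ≥0∞ := fun j l b => MP R ν G Ω (n + 1) (cc K j l) (hj K j) b with hMJ
  have hcap : ∀ b, ∑ l ∈ Finset.range (K ^ j), MJ j l b ≤ C1 * ∑ l ∈ Finset.range (K ^ (j + 1)), MJ (j + 1) l b +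
      C2 * ∑' m, ((4 : ℝ≥0∞)⁻¹) ^ (m * (n + 1)) * ∑ l ∈ Finset.range (K ^ (j + 3)), MJ (j + 3) l (b + m) := by
    intro b
    have h1 : ∀ l ∈ Finset.range (K ^ j), MJ j l b ≤ C1 * ∑ l' ∈ Finset.range K, MJ (j + 1) (K * l + l') b +
      C2 * ∑ l' ∈ Finset.range (K ^ 3), ∑' m, ((4 : ℝ≥0∞)⁻¹) ^ (m * (n + 1)) * MJ (j + 3) (K ^ 3 * l + l') (b + m) := by
      intro l hl
      have h2 := step_cap (Ω := Ω) (n := n) (b := b) hR ha hK (hj_pos hK0 j)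
        (hG.mono_set (cap_level hK0 R ν (Finset.mem_range.1 hl)))
      have e1 : ∀ l', cc K j l + 2 * hj K j * aa K l' = cc K (j + 1) (K * l + l') := by
        intro l'; simpa using cc_child hK0 j 1 l l'
      have e2 : hj K j / K = hj K (j + 1) := by simpa using hj_child hK0 j 1
      simp only [e1, e2, cc_child hK0 j 3, hj_child hK0 j 3] at h2
      refine h2.trans (le_of_eq ?_)
      simp only [hC1, hC2, hMJ, mul_assoc]
      rfl
    refine (Finset.sum_le_sum h1).trans (le_of_eq ?_)
    rw [Finset.sum_add_distrib, ← Finset.mul_sum, ← Finset.mul_sum,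
      sum_blocks (fun l => MJ (j + 1) l b), sum_blocks (fun l => ∑' m, ((4 : ℝ≥0∞)⁻¹) ^ (m * (n + 1)) *
        MJ (j + 3) l (b + m)), ← Summable.tsum_finsetSum (fun _ _ => ENNReal.summable)]
    simp only [Finset.mul_sum]
    rw [show K ^ (j + 1) = K * K ^ j by ring, show K ^ (j + 3) = K ^ 3 * K ^ j by ring]
  calc GG K R G Ω (n + 1) j ≤ ∑' b, ((2 : ℝ≥0∞)⁻¹) ^ (b * (n + 1)) *
        (C1 * ∑ l ∈ Finset.range (K ^ (j + 1)), MJ (j + 1) l b +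
      C2 * ∑' m, ((4 : ℝ≥0∞)⁻¹) ^ (m * (n + 1)) * ∑ l ∈ Finset.range (K ^ (j + 3)), MJ (j + 3) l (b + m)) := by
        refine ENNReal.tsum_le_tsum fun b => mul_le_mul_right (hcap b) _
    _ = C1 * GG K R G Ω (n + 1) (j + 1) + C2 * ∑' b, ((2 : ℝ≥0∞)⁻¹) ^ (b * (n + 1)) *
        ∑' m, ((4 : ℝ≥0∞)⁻¹) ^ (m * (n + 1)) * ∑ l ∈ Finset.range (K ^ (j + 3)), MJ (j + 3) l (b + m) := by
        unfold GG
        rw [← ENNReal.tsum_mul_left, ← ENNReal.tsum_mul_left, ← ENNReal.tsum_add]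
        refine tsum_congr fun b => ?_
        simp only [hMJ]
        rw [mul_add]
        congr 1 <;> rw [mul_left_comm]
    _ ≤ C1 * GG K R G Ω (n + 1) (j + 1) + C2 * (2 * GG K R G Ω (n + 1) (j + 3)) := by
        refine add_le_add le_rfl (mul_le_mul_right ?_ _)
        exact shift_sum (n + 1) (by omega) (fun b => ∑ l ∈ Finset.range (K ^ (j + 3)), MJ (j + 3) l b)
    _ = _ := by rw [← mul_assoc]

theorem le_half_mul {A B : ℝ≥0∞} (h : 2 * A ≤ B) : A ≤ 2⁻¹ * B := by
  calc A = 2⁻¹ * (2 * A) := by rw [← mul_assoc, ENNReal.inv_mul_cancel (by simp) (by simp), one_mul]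
    _ ≤ _ := mul_le_mul_right h _

def a0 : ℕ := 10 ^ 11

theorem step' {q : ℕ} (hq : 3 ≤ q) {R : ℝ} {G : ℝ × ℝ → ℂ} {Ω : Set (ℝ × ℝ × ℝ)}
    (hR : 0 < R) (hG : IntegrableOn G (cap R (1 / ((a0 ^ q : ℕ) : ℝ) ^ 4) 0 1)) (j : ℕ) :
    GG (a0 ^ q) R G Ω (22 * q) j ≤
      2⁻¹ * (((a0 ^ q : ℕ) : ℝ≥0∞) ^ (22 * q - 1) * a0 ^ 23) * GG (a0 ^ q) R G Ω (22 * q) (j + 1) +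
      2⁻¹ * (((a0 ^ q : ℕ) : ℝ≥0∞) ^ (22 * q - 1) * a0 ^ 23) ^ 3 * GG (a0 ^ q) R G Ω (22 * q) (j + 3) := by
  obtain ⟨n, hn⟩ : ∃ n, 22 * q = n + 1 := ⟨22 * q - 1, by omega⟩
  have hpos : 0 < a0 := by unfold a0; norm_num
  have hK : 216 * a0 ^ 2 ≤ a0 ^ q := by
    calc 216 * a0 ^ 2 ≤ a0 * a0 ^ 2 := by gcongr; unfold a0; norm_num
      _ = a0 ^ 3 := by ring
      _ ≤ a0 ^ q := Nat.pow_le_pow_right hpos hq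
  have h1 := step (Ω := Ω) (n := n) hR (by omega) hK hG j
  have hK2 : ((a0 ^ q : ℕ) : ℝ≥0∞) ^ 22 = (a0 : ℝ≥0∞) ^ (n + 1) := by
    push_cast; rw [← pow_mul, ← hn, mul_comm]
  have hK0 : 0 < a0 ^ q := by positivity
  rw [hn, Nat.add_sub_cancel]
  refine h1.trans (add_le_add (mul_le_mul_left ?_ _) (mul_le_mul_left ?_ _))
  · refine le_half_mul ?_
    have : 4 * (3 * a0 * (8 * a0 ^ 2 * WW a0)) ≤ a0 ^ 23 := by
      unfold a0 WW LL; norm_num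
    have h2 : ((4 * (3 * a0 * (8 * a0 ^ 2 * WW a0)) : ℕ) : ℝ≥0∞) ≤ ((a0 ^ 23 : ℕ) : ℝ≥0∞) := by exact_mod_cast this
    calc _ = ((a0 ^ q : ℕ) : ℝ≥0∞) ^ n * ((4 * (3 * a0 * (8 * a0 ^ 2 * WW a0)) : ℕ) : ℝ≥0∞) := by
          push_cast; ring
      _ ≤ ((a0 ^ q : ℕ) : ℝ≥0∞) ^ n * ((a0 ^ 23 : ℕ) : ℝ≥0∞) := mul_le_mul_right h2 _
      _ = _ := by push_cast; rfl
  · refine le_half_mul ?_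
    have ha0 : (a0 : ℝ≥0∞) ≠ 0 := by exact_mod_cast hpos.ne'
    have h3 : (((a0 ^ q) ^ 3 : ℕ) / a0 : ℝ≥0∞) ^ (n + 1) * ((a0 ^ q : ℕ) : ℝ≥0∞) ^ 22 = (((a0 ^ q) ^ 3 : ℕ) : ℝ≥0∞) ^ (n + 1) := by
      rw [hK2, ← mul_pow, ENNReal.div_mul_cancel ha0 (by simp)]
    have h4 : (5832 : ℝ≥0∞) ≤ (a0 : ℝ≥0∞) ^ 69 := by
      have : 5832 ≤ a0 ^ 69 := by unfold a0; norm_num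
      exact_mod_cast this
    set κ : ℝ≥0∞ := ((a0 ^ q : ℕ) : ℝ≥0∞) with hκ
    have hκ1 : 1 ≤ κ := by rw [hκ]; exact_mod_cast hK0
    have hκ0 : κ ≠ 0 := (zero_lt_one.trans_le hκ1).ne'
    have hκt : κ ≠ ⊤ := ENNReal.natCast_ne_top _
    have h5 : (((a0 ^ q) ^ 3 : ℕ) : ℝ≥0∞) = κ ^ 3 := by rw [hκ]; push_cast; rfl
    rw [h5] at h3 ⊢
    have hk22 : κ ^ 22 ≠ 0 := pow_ne_zero _ hκ0
    have hk22t : κ ^ 22 ≠ ⊤ := ENNReal.pow_ne_top hκt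
    refine (ENNReal.mul_le_mul_iff_left hk22 hk22t).1 ?_
    calc _ = 2 * 2 * 2 * 729 * (κ ^ 3) ^ 6 * ((κ ^ 3 / a0) ^ (n + 1) * κ ^ 22) := by
          rw [Nat.cast_mul, Nat.cast_pow, h5]; push_cast; ring
      _ = 5832 * (κ ^ 18 * κ ^ (3 * (n + 1))) := by rw [h3]; ring
      _ ≤ a0 ^ 69 * (κ ^ 19 * κ ^ (3 * (n + 1))) := by
          refine mul_le_mul' h4 (mul_le_mul_left (pow_le_pow_right₀ hκ1 (by norm_num)) _)
      _ = _ := by ring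

theorem recursion {q : ℕ} (hq : 3 ≤ q) {R : ℝ} {G : ℝ × ℝ → ℂ} {Ω : Set (ℝ × ℝ × ℝ)}
    (hR : 0 < R) (hG : IntegrableOn G (cap R (1 / ((a0 ^ q : ℕ) : ℝ) ^ 4) 0 1)) {X : ℝ≥0∞}
    (hX : X = ((a0 ^ q : ℕ) : ℝ≥0∞) ^ (22 * q - 1) * a0 ^ 23) (J : ℕ) {V : ℝ≥0∞}
    (hV : ∀ i < 3, X ^ (J + i) * GG (a0 ^ q) R G Ω (22 * q) (1 + (J + i)) ≤ V) :
    GG (a0 ^ q) R G Ω (22 * q) 1 ≤ V := by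
  have key : ∀ j, (∀ i < 3, X ^ (j + i) * GG (a0 ^ q) R G Ω (22 * q) (1 + (j + i)) ≤ V) →
      (∀ i < 3, X ^ i * GG (a0 ^ q) R G Ω (22 * q) (1 + i) ≤ V) := by
    intro j
    induction j with
    | zero => intro h i hi; simpa using h i hi
    | succ j ih =>
      intro h
      refine ih fun i hi => ?_
      rcases Nat.eq_zero_or_pos i with rfl | hi0
      · have h1 := step' (Ω := Ω) hq hR hG (1 + j)
        rw [← hX] at h1
        have h2 := h 0 (by norm_num)
        have h3 := h 2 (by norm_num)
        rw [add_zero]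
        calc X ^ j * GG (a0 ^ q) R G Ω (22 * q) (1 + j) ≤ X ^ j * (2⁻¹ * X * GG (a0 ^ q) R G Ω (22 * q) (1 + j + 1) +
              2⁻¹ * X ^ 3 * GG (a0 ^ q) R G Ω (22 * q) (1 + j + 3)) := mul_le_mul_right h1 _
          _ = 2⁻¹ * (X ^ (j + 1 + 0) * GG (a0 ^ q) R G Ω (22 * q) (1 + (j + 1 + 0))) +
              2⁻¹ * (X ^ (j + 1 + 2) * GG (a0 ^ q) R G Ω (22 * q) (1 + (j + 1 + 2))) := by
              rw [show 1 + (j + 1 + 0) = 1 + j + 1 by ring, show 1 + (j + 1 + 2) = 1 + j + 3 by ring]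
              ring
          _ ≤ 2⁻¹ * V + 2⁻¹ * V := add_le_add (mul_le_mul_right h2 _) (mul_le_mul_right h3 _)
          _ = V := by rw [← add_mul, ENNReal.inv_two_add_inv_two, one_mul]
      · have := h (i - 1) (by omega)
        rwa [show j + 1 + (i - 1) = j + i by omega] at this
  simpa using key J hV 0 (by norm_num)

end Wolff

open MeasureTheory Metric
open scoped ENNReal

namespace Wolff

noncomputable def dt (x ξ : ℝ × ℝ) : ℝ := x.1 * ξ.1 + x.2 * ξ.2
noncomputable def sq (x : ℝ × ℝ) : ℝ := x.1 ^ 2 + x.2 ^ 2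

theorem cont_sq : Continuous sq := by unfold sq; fun_prop
theorem sq_nonneg' (x : ℝ × ℝ) : 0 ≤ sq x := by unfold sq; positivity

theorem gauss1 {δ : ℝ} (hδ : 0 < δ) (t : ℝ) :
    ∫ x : ℝ, Complex.exp (Complex.I * t * x) * Complex.exp (-δ * x ^ 2) =
      ((√(Real.pi / δ) * Real.exp (-t ^ 2 / (4 * δ)) : ℝ) : ℂ) := by
  have := fourierIntegral_gaussian (b := (δ : ℂ)) (by simpa using hδ) t
  rw [this]
  push_cast
  congr 1
  rw [Real.sqrt_eq_rpow, Complex.ofReal_cpow (by positivity)]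
  push_cast; rfl

theorem gauss2 {δ : ℝ} (hδ : 0 < δ) (η : ℝ × ℝ) :
    ∫ x : ℝ × ℝ, Complex.exp (Complex.I * dt x η) * (Real.exp (-δ * sq x) : ℂ) =
      ((Real.pi / δ * Real.exp (-sq η / (4 * δ)) : ℝ) : ℂ) := by
  have h := integral_prod_mul (μ := (volume : Measure ℝ)) (ν := (volume : Measure ℝ))
    (fun x : ℝ => Complex.exp (Complex.I * η.1 * x) * Complex.exp (-δ * x ^ 2))
    (fun x : ℝ => Complex.exp (Complex.I * η.2 * x) * Complex.exp (-δ * x ^ 2))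
  rw [gauss1 hδ, gauss1 hδ, ← Complex.ofReal_mul] at h
  have e : (√(Real.pi / δ) * Real.exp (-η.1 ^ 2 / (4 * δ))) * (√(Real.pi / δ) * Real.exp (-η.2 ^ 2 / (4 * δ))) =
      Real.pi / δ * Real.exp (-sq η / (4 * δ)) := by
    have h1 : √(Real.pi / δ) * √(Real.pi / δ) = Real.pi / δ := Real.mul_self_sqrt (by positivity)
    have h2 : Real.exp (-sq η / (4 * δ)) = Real.exp (-η.1 ^ 2 / (4 * δ)) * Real.exp (-η.2 ^ 2 / (4 * δ)) := by
      rw [← Real.exp_add]; congr 1; unfold sq; ring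
    rw [h2]
    linear_combination (Real.exp (-η.1 ^ 2 / (4 * δ)) * Real.exp (-η.2 ^ 2 / (4 * δ))) * h1
  rw [e] at h
  rw [← h, Measure.volume_eq_prod]
  congr 1
  ext x
  rw [Complex.ofReal_exp, ← Complex.exp_add, ← Complex.exp_add, ← Complex.exp_add, ← Complex.exp_add]
  congr 1
  unfold dt sq
  push_cast
  ring

theorem integrable_gauss {δ : ℝ} (hδ : 0 < δ) : Integrable (fun x : ℝ × ℝ => Real.exp (-δ * sq x)) := by
  have h := (integrable_exp_neg_mul_sq hδ).mul_prod (integrable_exp_neg_mul_sq hδ)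
  refine Integrable.congr h (Filter.Eventually.of_forall fun x => ?_)
  simp only
  rw [← Real.exp_add]; congr 1; unfold sq; ring

theorem lintegral_gauss {δ : ℝ} (hδ : 0 < δ) :
    ∫⁻ x : ℝ × ℝ, ENNReal.ofReal (Real.exp (-δ * sq x)) = ENNReal.ofReal (Real.pi / δ) := by
  rw [← ofReal_integral_eq_lintegral_ofReal (integrable_gauss hδ) (Filter.Eventually.of_forall fun x => by positivity)]
  congr 1
  have := gauss2 hδ 0
  simp [dt, sq] at this
  have h2 : ((∫ x : ℝ × ℝ, Real.exp (-δ * sq x) : ℝ) : ℂ) = ((Real.pi / δ : ℝ) : ℂ) := by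
    rw [← integral_complex_ofReal]
    push_cast
    rw [← this]
    simp [sq]
  exact_mod_cast h2

theorem enn_two_mul (a b : ℝ≥0∞) : a * b ≤ 2⁻¹ * (a ^ 2 + b ^ 2) := by
  refine le_half_mul ?_
  rcases eq_or_ne a ⊤ with rfl | ha
  · simp
  rcases eq_or_ne b ⊤ with rfl | hb
  · simp
  lift a to NNReal using ha
  lift b to NNReal using hb
  have := two_mul_le_add_sq a b
  rw [← mul_assoc]
  exact_mod_cast this

theorem bessel {δ : ℝ} (hδ : 0 < δ) {f : ℝ × ℝ → ℂ} (hf : Integrable f) :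
    ∫⁻ x : ℝ × ℝ, ENNReal.ofReal (Real.exp (-δ * sq x)) *
      ‖∫ ξ, f ξ * Complex.exp (Complex.I * dt x ξ)‖ₑ ^ 2 ≤
    ENNReal.ofReal (4 * Real.pi ^ 2) * ∫⁻ ξ, ‖f ξ‖ₑ ^ 2 := by
  set F : ℝ × ℝ → ℂ := fun x => ∫ ξ, f ξ * Complex.exp (Complex.I * dt x ξ) with hF
  have hnexp : ∀ x ξ, ‖Complex.exp (Complex.I * dt x ξ)‖ = 1 := fun x ξ => by
    rw [mul_comm]; exact Complex.norm_exp_ofReal_mul_I _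
  set g : (ℝ × ℝ) → (ℝ × ℝ) × (ℝ × ℝ) → ℂ := fun x p =>
    (Real.exp (-δ * sq x) : ℂ) * ((f p.1 * (starRingEnd ℂ) (f p.2)) * Complex.exp (Complex.I * dt x (p.1 - p.2))) with hg
  have hmexp : Continuous (fun z : (ℝ × ℝ) × ((ℝ × ℝ) × (ℝ × ℝ)) => Complex.exp (Complex.I * dt z.1 (z.2.1 - z.2.2))) := by
    unfold dt; fun_prop
  have hfc : Integrable (fun ξ => (starRingEnd ℂ) (f ξ)) := by
    refine ⟨Complex.continuous_conj.comp_aestronglyMeasurable hf.1, ?_⟩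
    have := hf.2
    unfold HasFiniteIntegral at this ⊢
    simpa [← ofReal_norm] using this
  have hff : Integrable (fun p : (ℝ × ℝ) × (ℝ × ℝ) => f p.1 * (starRingEnd ℂ) (f p.2)) := hf.mul_prod hfc
  have hgint : Integrable (Function.uncurry g) (volume.prod volume) := by
    have h1 : Integrable (fun z : (ℝ × ℝ) × ((ℝ × ℝ) × (ℝ × ℝ)) =>
        (Real.exp (-δ * sq z.1) : ℂ) * (f z.2.1 * (starRingEnd ℂ) (f z.2.2))) (volume.prod volume) :=
      ((integrable_gauss hδ).ofReal (𝕜 := ℂ)).mul_prod hff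
    have h2 := h1.mul_bdd (c := 1) hmexp.aestronglyMeasurable
      (Filter.Eventually.of_forall fun z => (hnexp _ _).le)
    convert h2 using 2 with z
    simp only [Function.uncurry, hg]; ring
  have hFF : ∀ x, (Real.exp (-δ * sq x) : ℂ) * (F x * (starRingEnd ℂ) (F x)) = ∫ p, g x p := by
    intro x
    have e1 : (starRingEnd ℂ) (F x) = ∫ ξ, (starRingEnd ℂ) (f ξ * Complex.exp (Complex.I * dt x ξ)) := by
      rw [hF]; exact integral_conj.symm
    rw [e1, hF]
    simp only
    rw [← integral_prod_mul, ← integral_const_mul, Measure.volume_eq_prod (ℝ × ℝ)]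
    congr 1; ext p
    simp only [hg]
    rw [map_mul, ← Complex.exp_conj]
    have : Complex.exp (Complex.I * dt x (p.1 - p.2)) = Complex.exp (Complex.I * dt x p.1) *
        Complex.exp ((starRingEnd ℂ) (Complex.I * dt x p.2)) := by
      rw [← Complex.exp_add]; congr 1
      simp only [map_mul, Complex.conj_I, Complex.conj_ofReal, dt]
      simp; ring
    rw [this]; ring
  have hswap := integral_integral_swap hgint
  have hin : ∀ p : (ℝ × ℝ) × (ℝ × ℝ), ∫ x, g x p = (f p.1 * (starRingEnd ℂ) (f p.2)) *
      ((Real.pi / δ * Real.exp (-sq (p.1 - p.2) / (4 * δ)) : ℝ) : ℂ) := by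
    intro p
    rw [← gauss2 hδ, ← integral_const_mul]
    congr 1; ext x; simp only [hg]; ring
  have hLHSint : Integrable (fun x => Real.exp (-δ * sq x) * ‖F x‖ ^ 2) := by
    have h1 := hgint.integral_prod_left
    have h2 := h1.norm
    refine h2.congr (Filter.Eventually.of_forall fun x => ?_)
    simp only [Function.uncurry]
    rw [← hFF, norm_mul, norm_mul, Complex.norm_real, Complex.norm_conj, Real.norm_of_nonneg (by positivity)]
    ring
  have hLHS : ((∫ x, Real.exp (-δ * sq x) * ‖F x‖ ^ 2 : ℝ) : ℂ) = ∫ p : (ℝ × ℝ) × (ℝ × ℝ),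
      (f p.1 * (starRingEnd ℂ) (f p.2)) * ((Real.pi / δ * Real.exp (-sq (p.1 - p.2) / (4 * δ)) : ℝ) : ℂ) := by
    simp only [← hin]
    rw [← hswap, ← integral_complex_ofReal]
    congr 1; ext x
    rw [← hFF, Complex.mul_conj, Complex.normSq_eq_norm_sq]
    push_cast; rfl
  set k : ℝ × ℝ → ℝ≥0∞ := fun v => ENNReal.ofReal (Real.pi / δ) * ENNReal.ofReal (Real.exp (-(1 / (4 * δ)) * sq v)) with hk
  have hkm : Measurable k := by
    have := cont_sq.measurable
    fun_prop
  have hkint : ∫⁻ v, k v = ENNReal.ofReal (4 * Real.pi ^ 2) := by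
    simp only [hk]
    rw [lintegral_const_mul _ (by have := cont_sq.measurable; fun_prop), lintegral_gauss (by positivity),
      ← ENNReal.ofReal_mul (by positivity)]
    congr 1; field_simp
  have hneg : ∀ v, k (-v) = k v := by intro v; simp [hk, sq]
  calc ∫⁻ x, ENNReal.ofReal (Real.exp (-δ * sq x)) * ‖F x‖ₑ ^ 2
      = ∫⁻ x, ENNReal.ofReal (Real.exp (-δ * sq x) * ‖F x‖ ^ 2) := by
        refine lintegral_congr fun x => ?_
        rw [ENNReal.ofReal_mul (by positivity), ENNReal.ofReal_pow (by positivity), ofReal_norm]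
    _ = ENNReal.ofReal (∫ x, Real.exp (-δ * sq x) * ‖F x‖ ^ 2) :=
        (ofReal_integral_eq_lintegral_ofReal hLHSint (Filter.Eventually.of_forall fun x => by positivity)).symm
    _ ≤ ‖((∫ x, Real.exp (-δ * sq x) * ‖F x‖ ^ 2 : ℝ) : ℂ)‖ₑ := by
        rw [← ofReal_norm, Complex.norm_real]
        exact ENNReal.ofReal_le_ofReal (le_abs_self _)
    _ ≤ ∫⁻ p : (ℝ × ℝ) × (ℝ × ℝ), (‖f p.1‖ₑ * ‖f p.2‖ₑ) * k (p.1 - p.2) := by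
        rw [hLHS]
        refine (enorm_integral_le_lintegral_enorm _).trans (le_of_eq ?_)
        refine lintegral_congr fun p => ?_
        rw [enorm_mul, enorm_mul]
        have : ‖((Real.pi / δ * Real.exp (-sq (p.1 - p.2) / (4 * δ)) : ℝ) : ℂ)‖ₑ = k (p.1 - p.2) := by
          rw [← ofReal_norm, Complex.norm_real, Real.norm_of_nonneg (by positivity), ENNReal.ofReal_mul (by positivity)]
          simp only [hk]
          congr 3; ring
        rw [this]
        congr 2
        rw [← ofReal_norm, Complex.norm_conj, ofReal_norm]
    _ ≤ ∫⁻ p : (ℝ × ℝ) × (ℝ × ℝ), (2⁻¹ * (‖f p.1‖ₑ ^ 2 * k (p.1 - p.2)) + 2⁻¹ * (‖f p.2‖ₑ ^ 2 * k (p.1 - p.2))) := by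
        refine lintegral_mono fun p => ?_
        refine (mul_le_mul_left (enn_two_mul _ _) _).trans (le_of_eq (by ring))
    _ = 2⁻¹ * (∫⁻ p : (ℝ × ℝ) × (ℝ × ℝ), ‖f p.1‖ₑ ^ 2 * k (p.1 - p.2)) +
        2⁻¹ * (∫⁻ p : (ℝ × ℝ) × (ℝ × ℝ), ‖f p.2‖ₑ ^ 2 * k (p.1 - p.2)) := by
        have m1 : AEMeasurable (fun p : (ℝ × ℝ) × (ℝ × ℝ) => ‖f p.1‖ₑ ^ 2 * k (p.1 - p.2)) :=
          ((hf.1.enorm.comp_quasiMeasurePreserving Measure.quasiMeasurePreserving_fst).pow_const 2).mul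
            (by fun_prop : Measurable fun p : (ℝ × ℝ) × (ℝ × ℝ) => k (p.1 - p.2)).aemeasurable
        have m2 : AEMeasurable (fun p : (ℝ × ℝ) × (ℝ × ℝ) => ‖f p.2‖ₑ ^ 2 * k (p.1 - p.2)) :=
          ((hf.1.enorm.comp_quasiMeasurePreserving Measure.quasiMeasurePreserving_snd).pow_const 2).mul
            (by fun_prop : Measurable fun p : (ℝ × ℝ) × (ℝ × ℝ) => k (p.1 - p.2)).aemeasurable
        rw [lintegral_add_left' (m1.const_mul _), lintegral_const_mul'' _ m1, lintegral_const_mul'' _ m2]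
    _ = 2⁻¹ * ((∫⁻ ξ, ‖f ξ‖ₑ ^ 2) * ENNReal.ofReal (4 * Real.pi ^ 2)) +
        2⁻¹ * ((∫⁻ ξ, ‖f ξ‖ₑ ^ 2) * ENNReal.ofReal (4 * Real.pi ^ 2)) := by
        have m1 : AEMeasurable (fun p : (ℝ × ℝ) × (ℝ × ℝ) => ‖f p.1‖ₑ ^ 2 * k (p.1 - p.2)) (volume.prod volume) :=
          ((hf.1.enorm.comp_quasiMeasurePreserving Measure.quasiMeasurePreserving_fst).pow_const 2).mul
            (by fun_prop : Measurable fun p : (ℝ × ℝ) × (ℝ × ℝ) => k (p.1 - p.2)).aemeasurable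
        have m2 : AEMeasurable (fun p : (ℝ × ℝ) × (ℝ × ℝ) => ‖f p.2‖ₑ ^ 2 * k (p.1 - p.2)) (volume.prod volume) :=
          ((hf.1.enorm.comp_quasiMeasurePreserving Measure.quasiMeasurePreserving_snd).pow_const 2).mul
            (by fun_prop : Measurable fun p : (ℝ × ℝ) × (ℝ × ℝ) => k (p.1 - p.2)).aemeasurable
        congr 2
        · rw [Measure.volume_eq_prod (ℝ × ℝ), lintegral_prod _ m1, ← lintegral_mul_const'' _ (hf.1.enorm.pow_const 2)]
          refine lintegral_congr fun ξ => ?_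
          simp only
          rw [lintegral_const_mul _ (by fun_prop), lintegral_sub_left_eq_self k ξ, hkint]
        · rw [Measure.volume_eq_prod (ℝ × ℝ), lintegral_prod_symm _ m2, ← lintegral_mul_const'' _ (hf.1.enorm.pow_const 2)]
          refine lintegral_congr fun ξ => ?_
          simp only
          rw [lintegral_const_mul _ (by fun_prop), lintegral_sub_right_eq_self k ξ, hkint]
    _ = _ := by rw [← add_mul, ENNReal.inv_two_add_inv_two, one_mul, mul_comm]

end Wolff

open MeasureTheory Metric
open scoped ENNReal

namespace Wolff

/-- radial oscillatory integral -/
noncomputable def EE (φ : ℝ → ℝ) (ν : ℝ) (b : ℕ) (x : ℝ) : ℂ :=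
  ∫ s in (0 : ℝ)..1, ((φ s * s ^ b : ℝ) : ℂ) * Complex.exp (Complex.I * ((1 + ν * s) * x : ℝ))

theorem nexp (x : ℝ) : ‖Complex.exp (Complex.I * x)‖ = 1 := by
  rw [mul_comm]; exact Complex.norm_exp_ofReal_mul_I _

theorem int_pow_le (b : ℕ) : ∫ s in (0 : ℝ)..1, (b : ℝ) * s ^ (b - 1) ≤ 1 := by
  rcases Nat.eq_zero_or_pos b with rfl | hb
  · simp
  · rw [intervalIntegral.integral_const_mul, integral_pow]
    obtain ⟨n, rfl⟩ : ∃ n, b = n + 1 := ⟨b - 1, by omega⟩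
    simp
    field_simp
    simp

theorem EE_bd {φ φ' : ℝ → ℝ} {ν : ℝ} (hν : 0 < ν) (hν1 : ν ≤ 1)
    (hφ : ∀ s ∈ Set.Icc (0:ℝ) 1, HasDerivAt φ (φ' s) s) (hφ'c : ContinuousOn φ' (Set.Icc 0 1))
    (h2 : ∀ s ∈ Set.Icc (0:ℝ) 1, |φ s| ≤ 2) (h2' : ∀ s ∈ Set.Icc (0:ℝ) 1, |φ' s| ≤ 2) (b : ℕ) (x : ℝ) :
    ‖EE φ ν b x‖ ≤ 16 / ν / (1 + |x|) := by
  have hI : Set.uIcc (0:ℝ) 1 = Set.Icc 0 1 := Set.uIcc_of_le zero_le_one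
  have hp1 : ∀ s ∈ Set.Icc (0:ℝ) 1, ∀ n : ℕ, |s ^ n| ≤ 1 := fun s hs n => by
    rw [abs_of_nonneg (pow_nonneg hs.1 n)]; exact pow_le_one₀ hs.1 hs.2
  have hφc : ContinuousOn φ (Set.Icc 0 1) := fun s hs => (hφ s hs).continuousAt.continuousWithinAt
  have htriv : ‖EE φ ν b x‖ ≤ 2 := by
    have := intervalIntegral.norm_integral_le_of_norm_le_const (a := (0:ℝ)) (b := 1) (C := 2)
      (f := fun s => ((φ s * s ^ b : ℝ) : ℂ) * Complex.exp (Complex.I * ((1 + ν * s) * x : ℝ))) (by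
        intro s hs
        rw [Set.uIoc_of_le zero_le_one] at hs
        have hs' : s ∈ Set.Icc (0:ℝ) 1 := ⟨hs.1.le, hs.2⟩
        rw [norm_mul, nexp, mul_one, Complex.norm_real, Real.norm_eq_abs, abs_mul]
        calc |φ s| * |s ^ b| ≤ 2 * 1 := by
              gcongr
              · exact h2 s hs'
              · exact hp1 s hs' b
          _ = 2 := by norm_num)
    simpa [EE] using this
  by_cases hx : |x| ≤ 1
  · refine htriv.trans ?_
    rw [div_div, le_div_iff₀ (by positivity)]
    have : 0 ≤ |x| := abs_nonneg x
    nlinarith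
  push Not at hx
  have hx0 : x ≠ 0 := by rintro rfl; simp at hx; linarith
  have hνx : (Complex.I * ((ν * x : ℝ) : ℂ)) ≠ 0 := by
    simp [hν.ne', hx0]
  set u : ℝ → ℂ := fun s => ((φ s * s ^ b : ℝ) : ℂ)
  set u' : ℝ → ℂ := fun s => ((φ' s * s ^ b + φ s * (b * s ^ (b - 1)) : ℝ) : ℂ)
  set v : ℝ → ℂ := fun s => Complex.exp (Complex.I * ((1 + ν * s) * x : ℝ)) / (Complex.I * ((ν * x : ℝ) : ℂ))
  set v' : ℝ → ℂ := fun s => Complex.exp (Complex.I * ((1 + ν * s) * x : ℝ))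
  have hu : ∀ s ∈ Set.uIcc (0:ℝ) 1, HasDerivAt u (u' s) s := by
    intro s hs
    rw [hI] at hs
    exact ((hφ s hs).mul (hasDerivAt_pow b s)).ofReal_comp
  have hv : ∀ s ∈ Set.uIcc (0:ℝ) 1, HasDerivAt v (v' s) s := by
    intro s hs
    have h1 : HasDerivAt (fun s : ℝ => ((1 + ν * s) * x)) (ν * x) s := by
      have := (((hasDerivAt_id s).const_mul ν).const_add 1).mul_const x
      simpa using this
    have h3 := ((h1.ofReal_comp.const_mul Complex.I).cexp).div_const (Complex.I * ((ν * x : ℝ) : ℂ))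
    refine h3.congr_deriv ?_
    exact mul_div_cancel_right₀ _ hνx
  have hu'c : ContinuousOn u' (Set.uIcc 0 1) := by
    rw [hI]
    have : ContinuousOn (fun s => φ' s * s ^ b + φ s * (b * s ^ (b - 1))) (Set.Icc 0 1) := by fun_prop
    exact Complex.continuous_ofReal.comp_continuousOn this
  have hv'c : Continuous v' := by simp only [v']; fun_prop
  have hibp := intervalIntegral.integral_mul_deriv_eq_deriv_mul hu hv (hu'c.intervalIntegrable)
    (hv'c.intervalIntegrable _ _)
  have hE : EE φ ν b x = u 1 * v 1 - u 0 * v 0 - ∫ s in (0:ℝ)..1, u' s * v s := hibp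
  have hvn : ∀ s, ‖v s‖ = 1 / (ν * |x|) := by
    intro s
    simp only [v]
    rw [norm_div, nexp, norm_mul, Complex.norm_I, one_mul, Complex.norm_real, Real.norm_eq_abs, abs_mul, abs_of_pos hν]
  have hun : ∀ s ∈ Set.Icc (0:ℝ) 1, ‖u s‖ ≤ 2 := by
    intro s hs
    simp only [u]
    rw [Complex.norm_real, Real.norm_eq_abs, abs_mul]
    calc |φ s| * |s ^ b| ≤ 2 * 1 := by
          gcongr
          · exact h2 s hs
          · exact hp1 s hs b
      _ = 2 := by norm_num
  have hIntg : ‖∫ s in (0:ℝ)..1, u' s * v s‖ ≤ 4 * (1 / (ν * |x|)) := by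
    calc ‖∫ s in (0:ℝ)..1, u' s * v s‖ ≤ ∫ s in (0:ℝ)..1, (2 + 2 * (b * s ^ (b - 1))) * (1 / (ν * |x|)) := by
          refine intervalIntegral.norm_integral_le_of_norm_le zero_le_one ?_ (by
            apply Continuous.intervalIntegrable; fun_prop)
          refine Filter.Eventually.of_forall fun s hs => ?_
          have hs' : s ∈ Set.Icc (0:ℝ) 1 := ⟨hs.1.le, hs.2⟩
          rw [norm_mul, hvn]
          refine mul_le_mul_of_nonneg_right ?_ (by positivity)
          simp only [u']
          rw [Complex.norm_real, Real.norm_eq_abs]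
          refine (abs_add_le _ _).trans ?_
          rw [abs_mul, abs_mul, abs_of_nonneg (by have := hs'.1; positivity : 0 ≤ (b:ℝ) * s ^ (b - 1))]
          have h5 : |φ' s| * |s ^ b| ≤ 2 * 1 := by
            gcongr
            · exact h2' s hs'
            · exact hp1 s hs' b
          have h6 : |φ s| * ((b:ℝ) * s ^ (b - 1)) ≤ 2 * (b * s ^ (b - 1)) := by
            refine mul_le_mul_of_nonneg_right (h2 s hs') (by have := hs'.1; positivity)
          linarith
      _ = (2 + 2 * ∫ s in (0:ℝ)..1, (b:ℝ) * s ^ (b - 1)) * (1 / (ν * |x|)) := by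
          rw [intervalIntegral.integral_mul_const, intervalIntegral.integral_add (by simp)
            (by apply Continuous.intervalIntegrable; fun_prop), intervalIntegral.integral_const_mul (2:ℝ)]
          simp
      _ ≤ _ := by
          refine mul_le_mul_of_nonneg_right ?_ (by positivity)
          linarith [int_pow_le b]
  rw [hE]
  calc ‖u 1 * v 1 - u 0 * v 0 - ∫ s in (0:ℝ)..1, u' s * v s‖
      ≤ ‖u 1 * v 1‖ + ‖u 0 * v 0‖ + ‖∫ s in (0:ℝ)..1, u' s * v s‖ :=
        (norm_sub_le _ _).trans (by gcongr; exact norm_sub_le _ _)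
    _ ≤ 2 * (1 / (ν * |x|)) + 2 * (1 / (ν * |x|)) + 4 * (1 / (ν * |x|)) := by
        rw [norm_mul, norm_mul, hvn, hvn]
        gcongr
        · exact hun 1 (by simp)
        · exact hun 0 (by simp)
    _ ≤ _ := by
        rw [div_div, ← add_mul, ← add_mul, mul_one_div, div_le_div_iff₀ (by positivity) (by positivity)]
        nlinarith

noncomputable def E0 (ν : ℝ) (b : ℕ) (x : ℝ) : ℂ := EE (fun s => √(1 + ν * s)) ν b x
noncomputable def E1 (ν : ℝ) (b : ℕ) (x : ℝ) : ℂ := -Complex.I * EE (fun s => (√(1 + ν * s))⁻¹) ν b x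

theorem sqrt_deriv {ν s : ℝ} (hν : 0 < ν) (hs : 0 ≤ s) :
    HasDerivAt (fun s => √(1 + ν * s)) (ν / (2 * √(1 + ν * s))) s := by
  have h0 : 1 + ν * s ≠ 0 := by positivity
  have := (((hasDerivAt_id s).const_mul ν).const_add 1).sqrt (by simpa using h0)
  simpa using this

theorem one_le_sqrt' {ν s : ℝ} (hν : 0 < ν) (hs : 0 ≤ s) : 1 ≤ √(1 + ν * s) := by
  rw [Real.one_le_sqrt]; nlinarith [mul_nonneg hν.le hs]

theorem E0_bd {ν : ℝ} (hν : 0 < ν) (hν1 : ν ≤ 1) (b : ℕ) (x : ℝ) : ‖E0 ν b x‖ ≤ 16 / ν / (1 + |x|) := by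
  refine EE_bd hν hν1 (φ' := fun s => ν / (2 * √(1 + ν * s))) (fun s hs => sqrt_deriv hν hs.1) ?_ ?_ ?_ b x
  · refine ContinuousOn.div (by fun_prop) (by fun_prop) fun s hs => ?_
    have := one_le_sqrt' hν hs.1
    positivity
  · intro s hs
    rw [abs_of_nonneg (by positivity), Real.sqrt_le_left (by norm_num)]
    nlinarith [hs.1, hs.2]
  · intro s hs
    have := one_le_sqrt' hν hs.1
    rw [abs_of_nonneg (by positivity), div_le_iff₀ (by positivity)]
    nlinarith

theorem E1_bd {ν : ℝ} (hν : 0 < ν) (hν1 : ν ≤ 1) (b : ℕ) (x : ℝ) : ‖E1 ν b x‖ ≤ 16 / ν / (1 + |x|) := by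
  unfold E1
  rw [norm_mul, norm_neg, Complex.norm_I, one_mul]
  refine EE_bd hν hν1 (φ := fun s => (√(1 + ν * s))⁻¹) (φ' := fun s => -(ν / (2 * √(1 + ν * s))) / √(1 + ν * s) ^ 2)
    (fun s hs => (sqrt_deriv hν hs.1).inv (by have := one_le_sqrt' hν hs.1; positivity)) ?_ ?_ ?_ b x
  · refine ContinuousOn.div (ContinuousOn.neg (ContinuousOn.div (by fun_prop) (by fun_prop) fun s hs => ?_)) (by fun_prop) fun s hs => ?_
    all_goals
      have := one_le_sqrt' hν hs.1
      positivity
  · intro s hs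
    have := one_le_sqrt' hν hs.1
    rw [abs_of_nonneg (by positivity)]
    have := inv_le_one_of_one_le₀ this
    linarith
  · intro s hs
    have := one_le_sqrt' hν hs.1
    rw [abs_div, abs_neg, abs_of_nonneg (by positivity), abs_of_nonneg (by positivity), div_div, div_le_iff₀ (by positivity)]
    have h3 : 1 ≤ √(1 + ν * s) ^ 2 := one_le_pow₀ this
    have : 1 ≤ √(1 + ν * s) * √(1 + ν * s) ^ 2 := by nlinarith
    nlinarith

theorem E1_deriv {ν : ℝ} (hν : 0 < ν) (hν1 : ν ≤ 1) (b : ℕ) (x : ℝ) : HasDerivAt (E1 ν b) (E0 ν b x) x := by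
  have key := intervalIntegral.hasDerivAt_integral_of_dominated_loc_of_deriv_le
    (μ := volume) (a := (0:ℝ)) (b := 1) (x₀ := x) (s := Set.univ) (bound := fun _ => 2)
    (F := fun x s => (((√(1 + ν * s))⁻¹ * s ^ b : ℝ) : ℂ) * Complex.exp (Complex.I * ((1 + ν * s) * x : ℝ)))
    (F' := fun x s => (((√(1 + ν * s))⁻¹ * s ^ b : ℝ) : ℂ) * (Complex.exp (Complex.I * ((1 + ν * s) * x : ℝ)) * (Complex.I * ((1 + ν * s : ℝ) : ℂ))))
    Filter.univ_mem
    (Filter.Eventually.of_forall fun x => Measurable.aestronglyMeasurable (by fun_prop))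
    ?_ (Measurable.aestronglyMeasurable (by fun_prop)) ?_ (by simp) ?_
  · have h2 := (key.2.const_mul (-Complex.I))
    refine h2.congr_deriv ?_
    unfold E0 EE
    rw [← intervalIntegral.integral_const_mul]
    refine intervalIntegral.integral_congr fun s hs => ?_
    rw [Set.uIcc_of_le zero_le_one] at hs
    have h3 := one_le_sqrt' hν hs.1
    have h4 : √(1 + ν * s) = (√(1 + ν * s))⁻¹ * (1 + ν * s) := by
      have : √(1 + ν * s) ^ 2 = 1 + ν * s := Real.sq_sqrt (by nlinarith [mul_nonneg hν.le hs.1])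
      field_simp
      exact this
    simp only
    conv_rhs => rw [h4]
    push_cast
    linear_combination (-(Complex.exp (Complex.I * ((1 + ν * s) * x)) * ((√(1 + ν * s) : ℂ))⁻¹ * s ^ b * (1 + ν * s))) * Complex.I_mul_I
  · apply ContinuousOn.intervalIntegrable
    rw [Set.uIcc_of_le zero_le_one]
    have : ContinuousOn (fun s : ℝ => (√(1 + ν * s))⁻¹ * s ^ b) (Set.Icc 0 1) := by
      refine ContinuousOn.mul (ContinuousOn.inv₀ (by fun_prop) fun s hs => ?_) (by fun_prop)
      have := one_le_sqrt' hν hs.1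
      positivity
    refine ContinuousOn.mul (Complex.continuous_ofReal.comp_continuousOn this) (by fun_prop)
  · refine Filter.Eventually.of_forall fun s hs y _ => ?_
    rw [Set.uIoc_of_le zero_le_one] at hs
    have h3 := one_le_sqrt' hν hs.1.le
    rw [norm_mul, norm_mul, nexp, norm_mul, Complex.norm_I, Complex.norm_real, Complex.norm_real, Real.norm_eq_abs, Real.norm_eq_abs,
      abs_of_nonneg (by have := hs.1.le; positivity), abs_of_nonneg (by have := hs.1.le; positivity)]
    have h5 := inv_le_one_of_one_le₀ h3
    have h6 : s ^ b ≤ 1 := pow_le_one₀ hs.1.le hs.2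
    have h7 : (√(1 + ν * s))⁻¹ * s ^ b ≤ 1 * 1 := by
      have := hs.1.le
      gcongr
    have h8 : 1 + ν * s ≤ 2 := by nlinarith [hs.1, hs.2]
    calc (√(1 + ν * s))⁻¹ * s ^ b * (1 * (1 * (1 + ν * s))) ≤ 1 * 1 * (1 * (1 * 2)) := by
          have := hs.1.le
          gcongr
      _ = 2 := by norm_num
  · refine Filter.Eventually.of_forall fun s hs y _ => ?_
    have h1 : HasDerivAt (fun y : ℝ => ((1 + ν * s) * y)) (1 + ν * s) y := by
      simpa using (hasDerivAt_id y).const_mul (1 + ν * s)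
    exact ((h1.ofReal_comp.const_mul Complex.I).cexp).const_mul _

/-- the one dimensional nonstationary phase bound in the angular variable -/
theorem I_bd {τ τ' : ℝ → ℝ} {e0 e1 : ℝ → ℂ} {C0 A a0 a1 a2 : ℝ} (hC0 : 0 ≤ C0)
    (hτ : ∀ t ∈ Set.Icc (-1/2 : ℝ) (1/2), HasDerivAt τ (τ' t) t) (hτ'c : ContinuousOn τ' (Set.Icc (-1/2 : ℝ) (1/2)))
    (h2 : ∀ t ∈ Set.Icc (-1/2 : ℝ) (1/2), |τ t| ≤ 2) (h6 : ∀ t ∈ Set.Icc (-1/2 : ℝ) (1/2), |τ' t| ≤ 6)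
    (he0c : Continuous e0) (he0 : ∀ x, ‖e0 x‖ ≤ C0 / (1 + |x|)) (he1 : ∀ x, ‖e1 x‖ ≤ C0 / (1 + |x|))
    (hd : ∀ x, HasDerivAt e1 (e0 x) x) (hA : |a2| ≤ A) :
    ‖∫ t in (-1/2 : ℝ)..(1/2), (τ t : ℂ) * e0 (a0 + a1 * t + a2 * t ^ 2)‖ ≤
      C0 * (44 + 4 * A) / (1 + |a1|) * (1 / (1 + |a0 + a1 * (-1/2) + a2 * (-1/2) ^ 2|) + 1 / (1 + |a0 + a1 * (1/2) + a2 * (1/2) ^ 2|) +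
        ∫ t in (-1/2 : ℝ)..(1/2), 1 / (1 + |a0 + a1 * t + a2 * t ^ 2|)) := by
  set f : ℝ → ℝ := fun t => a0 + a1 * t + a2 * t ^ 2 with hf
  have hle : (-1/2 : ℝ) ≤ 1/2 := by norm_num
  have hI : Set.uIcc (-1/2 : ℝ) (1/2) = Set.Icc (-1/2) (1/2) := Set.uIcc_of_le hle
  have hτc : ContinuousOn τ (Set.Icc (-1/2 : ℝ) (1/2)) := fun s hs => (hτ s hs).continuousAt.continuousWithinAt
  have hA0 : 0 ≤ A := (abs_nonneg _).trans hA
  have hfc : Continuous f := by simp only [hf]; fun_prop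
  have hgc : Continuous (fun t => 1 / (1 + |f t|)) := by
    refine Continuous.div (by fun_prop) (by fun_prop) fun t => by positivity
  set S := ∫ t in (-1/2 : ℝ)..(1/2), 1 / (1 + |f t|) with hS
  have hS0 : 0 ≤ S := intervalIntegral.integral_nonneg hle fun t _ => by positivity
  change ‖∫ t in (-1/2 : ℝ)..(1/2), (τ t : ℂ) * e0 (f t)‖ ≤
      C0 * (44 + 4 * A) / (1 + |a1|) * (1 / (1 + |f (-1/2)|) + 1 / (1 + |f (1/2)|) + S)
  have p1 : 0 ≤ 1 / (1 + |f (-1/2)|) := by positivity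
  have p2 : 0 ≤ 1 / (1 + |f (1/2)|) := by positivity
  have gen : ∀ (σ : ℝ → ℂ) (e : ℝ → ℂ) (B : ℝ), 0 ≤ B → (∀ t ∈ Set.Icc (-1/2 : ℝ) (1/2), ‖σ t‖ ≤ B) →
      (∀ x, ‖e x‖ ≤ C0 / (1 + |x|)) → ‖∫ t in (-1/2 : ℝ)..(1/2), σ t * e (f t)‖ ≤ B * C0 * S := by
    intro σ e B hB hσ he
    rw [hS, ← intervalIntegral.integral_const_mul]
    refine intervalIntegral.norm_integral_le_of_norm_le hle ?_ (Continuous.intervalIntegrable (by fun_prop) _ _)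
    refine Filter.Eventually.of_forall fun t ht => ?_
    rw [norm_mul]
    calc ‖σ t‖ * ‖e (f t)‖ ≤ B * (C0 / (1 + |f t|)) := by
          gcongr
          · exact hσ t ⟨ht.1.le, ht.2⟩
          · exact he _
      _ = _ := by ring
  by_cases hcase : |a1| ≤ 2 * A + 1
  · have := gen (fun t => τ t) e0 2 (by norm_num) (fun t ht => by
      rw [Complex.norm_real]; exact h2 t ht) he0
    refine this.trans ?_
    rw [div_mul_eq_mul_div, le_div_iff₀ (by positivity)]
    have : 2 * C0 * S * (1 + |a1|) ≤ 2 * C0 * S * (2 + 2 * A) :=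
      mul_le_mul_of_nonneg_left (by linarith) (by positivity)
    have q1 : 0 ≤ C0 * S := by positivity
    have q2 : 0 ≤ C0 * (44 + 4 * A) * (1 / (1 + |f (-1/2)|) + 1 / (1 + |f (1/2)|)) := by positivity
    nlinarith
  push Not at hcase
  have ha1 : 1 < |a1| := by linarith
  set f' : ℝ → ℝ := fun t => a1 + 2 * a2 * t with hf'
  have hf'b : ∀ t ∈ Set.Icc (-1/2 : ℝ) (1/2), |a1| / 2 ≤ |f' t| := by
    intro t ht
    have ht' : |t| ≤ 1/2 := abs_le.2 ⟨by linarith [ht.1], ht.2⟩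
    have h3 : |2 * a2 * t| ≤ A := by
      rw [abs_mul, abs_mul, abs_two]
      nlinarith [abs_nonneg a2, abs_nonneg t]
    have h4 : |a1| - |2 * a2 * t| ≤ |f' t| := by
      have := abs_sub_abs_le_abs_sub a1 (-(2 * a2 * t))
      rw [abs_neg, sub_neg_eq_add] at this
      exact this
    linarith
  have hf'0 : ∀ t ∈ Set.Icc (-1/2 : ℝ) (1/2), f' t ≠ 0 := fun t ht h0 => by
    have := hf'b t ht; rw [h0] at this; simp at this; linarith
  set u : ℝ → ℂ := fun t => ((τ t / f' t : ℝ) : ℂ)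
  set u' : ℝ → ℂ := fun t => (((τ' t * f' t - τ t * (2 * a2)) / f' t ^ 2 : ℝ) : ℂ)
  set v : ℝ → ℂ := fun t => e1 (f t)
  set v' : ℝ → ℂ := fun t => (f' t : ℂ) * e0 (f t)
  have hf'd : ∀ t, HasDerivAt f' (2 * a2) t := fun t => by
    exact (((hasDerivAt_id t).const_mul (2 * a2)).const_add a1).congr_deriv (by simp)
  have hfd : ∀ t, HasDerivAt f (f' t) t := fun t => by
    have h3 := (((hasDerivAt_id t).const_mul a1).const_add a0).add (((hasDerivAt_id t).pow 2).const_mul a2)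
    refine h3.congr_deriv ?_
    simp [hf']; ring
  have hu : ∀ s ∈ Set.uIcc (-1/2 : ℝ) (1/2), HasDerivAt u (u' s) s := by
    intro s hs
    rw [hI] at hs
    exact ((hτ s hs).div (hf'd s) (hf'0 s hs)).ofReal_comp
  have hv : ∀ s ∈ Set.uIcc (-1/2 : ℝ) (1/2), HasDerivAt v (v' s) s := by
    intro s hs
    have := (hd (f s)).scomp s (hfd s)
    simpa [v, v', Function.comp_def] using this
  have hf'c : Continuous f' := by simp only [hf']; fun_prop
  have hu'c : ContinuousOn u' (Set.uIcc (-1/2 : ℝ) (1/2)) := by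
    rw [hI]
    have : ContinuousOn (fun t => (τ' t * f' t - τ t * (2 * a2)) / f' t ^ 2) (Set.Icc (-1/2 : ℝ) (1/2)) := by
      refine ContinuousOn.div (by fun_prop) (by fun_prop) fun t ht => pow_ne_zero 2 (hf'0 t ht)
    exact Complex.continuous_ofReal.comp_continuousOn this
  have hv'c : Continuous v' := by simp only [v']; fun_prop
  have hibp := intervalIntegral.integral_mul_deriv_eq_deriv_mul hu hv (hu'c.intervalIntegrable)
    (hv'c.intervalIntegrable _ _)
  have hE : ∫ t in (-1/2 : ℝ)..(1/2), (τ t : ℂ) * e0 (f t) = ∫ t in (-1/2 : ℝ)..(1/2), u t * v' t := by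
    refine intervalIntegral.integral_congr fun t ht => ?_
    rw [hI] at ht
    have := hf'0 t ht
    have h3 : ((f' t : ℝ) : ℂ) ≠ 0 := by exact_mod_cast this
    simp only [u, v']
    push_cast
    field_simp
  have hub : ∀ t ∈ Set.Icc (-1/2 : ℝ) (1/2), ‖u t‖ ≤ 4 / |a1| := by
    intro t ht
    have h3 := hf'b t ht
    simp only [u]
    rw [Complex.norm_real, Real.norm_eq_abs, abs_div, div_le_div_iff₀ (by linarith) (by linarith)]
    nlinarith [h2 t ht]
  have hu'b : ∀ t ∈ Set.Icc (-1/2 : ℝ) (1/2), ‖u' t‖ ≤ 20 / |a1| := by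
    intro t ht
    have h3 := hf'b t ht
    have hpos : 0 < |f' t| := by linarith
    simp only [u']
    rw [Complex.norm_real, Real.norm_eq_abs, abs_div, abs_pow, div_le_div_iff₀ (by positivity) (by linarith)]
    have h4 : |τ' t * f' t - τ t * (2 * a2)| ≤ 6 * |f' t| + 4 * A := by
      refine (abs_sub _ _).trans ?_
      rw [abs_mul, abs_mul, abs_mul, abs_two]
      have : |τ' t| * |f' t| ≤ 6 * |f' t| := by gcongr; exact h6 t ht
      have : |τ t| * (2 * |a2|) ≤ 2 * (2 * A) := by
        gcongr
        exact h2 t ht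
      linarith
    have h5 : |τ' t * f' t - τ t * (2 * a2)| ≤ 10 * |f' t| := by linarith
    calc |τ' t * f' t - τ t * (2 * a2)| * |a1| ≤ (10 * |f' t|) * (2 * |f' t|) := by
          gcongr; linarith
      _ = _ := by ring
  rw [hE, hibp]
  have b1 : ‖u (1/2) * v (1/2)‖ ≤ 4 / |a1| * (C0 * (1 / (1 + |f (1/2)|))) := by
    rw [norm_mul]
    gcongr
    · exact hub _ ⟨by norm_num, by norm_num⟩
    · rw [mul_one_div]; exact he1 _
  have b2 : ‖u (-1/2) * v (-1/2)‖ ≤ 4 / |a1| * (C0 * (1 / (1 + |f (-1/2)|))) := by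
    rw [norm_mul]
    gcongr
    · exact hub _ ⟨by norm_num, by norm_num⟩
    · rw [mul_one_div]; exact he1 _
  have b3 := gen u' e1 (20 / |a1|) (by positivity) hu'b he1
  have hr : 1 / |a1| ≤ 2 / (1 + |a1|) := by
    rw [div_le_div_iff₀ (by linarith) (by linarith)]; linarith
  calc _ ≤ ‖u (1/2) * v (1/2)‖ + ‖u (-1/2) * v (-1/2)‖ + ‖∫ t in (-1/2 : ℝ)..(1/2), u' t * v t‖ :=
        (norm_sub_le _ _).trans (by gcongr; exact norm_sub_le _ _)
    _ ≤ 4 / |a1| * (C0 * (1 / (1 + |f (1/2)|))) + 4 / |a1| * (C0 * (1 / (1 + |f (-1/2)|))) + 20 / |a1| * C0 * S := by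
        gcongr
    _ ≤ (20 * C0 * (1 / (1 + |f (-1/2)|) + 1 / (1 + |f (1/2)|) + S)) * (1 / |a1|) := by
        have e : ∀ y : ℝ, y / |a1| = y * (1 / |a1|) := fun y => by ring
        rw [e 4, e 20]
        have q1 : 0 ≤ C0 * (1 / (1 + |f (-1/2)|)) * (1 / |a1|) := by positivity
        have q2 : 0 ≤ C0 * (1 / (1 + |f (1/2)|)) * (1 / |a1|) := by positivity
        nlinarith
    _ ≤ (20 * C0 * (1 / (1 + |f (-1/2)|) + 1 / (1 + |f (1/2)|) + S)) * (2 / (1 + |a1|)) := by gcongr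
    _ ≤ _ := by
        have q : 0 ≤ C0 / (1 + |a1|) * (1 / (1 + |f (-1/2)|) + 1 / (1 + |f (1/2)|) + S) := by positivity
        have e : (20 * C0 * (1 / (1 + |f (-1/2)|) + 1 / (1 + |f (1/2)|) + S)) * (2 / (1 + |a1|)) =
          40 * (C0 / (1 + |a1|) * (1 / (1 + |f (-1/2)|) + 1 / (1 + |f (1/2)|) + S)) := by ring
        have e2 : C0 * (44 + 4 * A) / (1 + |a1|) * (1 / (1 + |f (-1/2)|) + 1 / (1 + |f (1/2)|) + S) =
          (44 + 4 * A) * (C0 / (1 + |a1|) * (1 / (1 + |f (-1/2)|) + 1 / (1 + |f (1/2)|) + S)) := by ring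
        rw [e, e2]
        refine mul_le_mul_of_nonneg_right (by linarith) q

end Wolff

open MeasureTheory Metric
open scoped ENNReal

namespace Wolff

noncomputable def Uh (U : Set (ℝ × ℝ)) (ξ : ℝ × ℝ) : ℂ := ∫ y in U, Complex.exp (Complex.I * dt y ξ)
noncomputable def GU (U : Set (ℝ × ℝ)) (ξ : ℝ × ℝ) : ℂ := Uh U ξ * (((√(nrm ξ))⁻¹ : ℝ) : ℂ)
noncomputable def zy (y : ℝ × ℝ) : ℝ × ℝ × ℝ := (y.1, 2 * y.2, -y.1)
noncomputable def psi (R ν c h : ℝ) (p : ℝ × ℝ) : ℝ × ℝ :=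
  (R * (1 + ν * p.2) * (1 - (c + 2 * h * p.1) ^ 2), 2 * (R * (1 + ν * p.2)) * (c + 2 * h * p.1))

theorem nrm_sq (ξ : ℝ × ℝ) : nrm ξ ^ 2 = ξ.1 ^ 2 + ξ.2 ^ 2 := Real.sq_sqrt (by positivity)
theorem nrm_nonneg (ξ : ℝ × ℝ) : 0 ≤ nrm ξ := Real.sqrt_nonneg _
theorem le_nrm (ξ : ℝ × ℝ) : |ξ.1| ≤ nrm ξ := Real.abs_le_sqrt (by nlinarith [sq_nonneg ξ.2])
theorem le_nrm2 (ξ : ℝ × ℝ) : |ξ.2| ≤ nrm ξ := Real.abs_le_sqrt (by nlinarith [sq_nonneg ξ.1])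

theorem phase_zy {ξ : ℝ × ℝ} (hξ : 0 < ξ.1) (y : ℝ × ℝ) : phase (zy y) ξ = dt y ξ := by
  have h0 : nrm ξ + ξ.1 ≠ 0 := by have := nrm_nonneg ξ; positivity
  have h1 : ww ξ * kk ξ = ξ.2 / 2 := by unfold ww kk; field_simp
  have h2 : ww ξ * (1 - kk ξ ^ 2) = ξ.1 := by
    unfold ww kk
    have := nrm_sq ξ
    field_simp
    linear_combination this
  unfold phase zy dt
  simp only
  linear_combination y.1 * h2 + 2 * y.2 * h1

theorem nrm_psi {R ν c h : ℝ} {p : ℝ × ℝ} (hw : 0 ≤ R * (1 + ν * p.2)) :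
    nrm (psi R ν c h p) = R * (1 + ν * p.2) * (1 + (c + 2 * h * p.1) ^ 2) := by
  unfold nrm psi
  simp only
  rw [Real.sqrt_eq_iff_mul_self_eq (by positivity) (by positivity)]
  ring

theorem ww_psi {R ν c h : ℝ} {p : ℝ × ℝ} (hw : 0 ≤ R * (1 + ν * p.2)) :
    ww (psi R ν c h p) = R * (1 + ν * p.2) := by
  unfold ww
  rw [nrm_psi hw]; unfold psi; ring

theorem kk_psi {R ν c h : ℝ} {p : ℝ × ℝ} (hw : 0 < R * (1 + ν * p.2)) :
    kk (psi R ν c h p) = c + 2 * h * p.1 := by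
  unfold kk
  rw [nrm_psi hw.le]; unfold psi
  have := hw.ne'
  simp only
  rw [show R * (1 + ν * p.2) * (1 + (c + 2 * h * p.1) ^ 2) + R * (1 + ν * p.2) * (1 - (c + 2 * h * p.1) ^ 2) =
    2 * (R * (1 + ν * p.2)) by ring]
  exact mul_div_cancel_left₀ _ (by positivity)

theorem cap_pos {R ν c h : ℝ} {ξ : ℝ × ℝ} (hξ : ξ ∈ cap R ν c h) : R ≤ nrm ξ := by
  obtain ⟨h0, h1, -⟩ := hξ
  have := le_nrm ξ
  rw [abs_of_pos h0] at this
  unfold ww at h1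
  linarith

theorem psi_image {R ν c h : ℝ} (hR : 0 < R) (hν : 0 < ν) (hh : 0 < h) :
    cap R ν c h = psi R ν c h '' ((Set.Ico (-1/2) (1/2) ∩ {t | |c + 2 * h * t| < 1}) ×ˢ Set.Ico 0 1) := by
  ext ξ
  constructor
  · intro hξ
    refine ⟨(tt c h ξ, ss R ν ξ), ?_, ?_⟩
    · obtain ⟨h0, h1, h2, h3, h4⟩ := hξ
      refine ⟨⟨⟨?_, ?_⟩, ?_⟩, ?_, ?_⟩
      · unfold tt; rw [le_div_iff₀ (by positivity)]; linarith
      · unfold tt; rw [div_lt_iff₀ (by positivity)]; linarith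
      · simp only [Set.mem_ofPred_eq]
        rw [← kk_eq hh]
        unfold kk
        have h5 : 0 < nrm ξ + ξ.1 := by have := nrm_nonneg ξ; positivity
        rw [abs_div, abs_of_pos h5, div_lt_one h5]
        linarith [le_nrm2 ξ]
      · unfold ss
        exact div_nonneg (by linarith) (by positivity)
      · unfold ss
        rw [div_lt_one (by positivity)]; linarith
    · unfold psi
      simp only
      rw [← kk_eq hh, ← ww_eq hR hν]
      have h0 : nrm ξ + ξ.1 ≠ 0 := by have := nrm_nonneg ξ; have := hξ.1; positivity
      have h1 : 2 * ww ξ * kk ξ = ξ.2 := by unfold ww kk; field_simp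
      have h2 : ww ξ * (1 - kk ξ ^ 2) = ξ.1 := by
        unfold ww kk
        have := nrm_sq ξ
        field_simp
        linear_combination this
      exact Prod.ext h2 h1
  · rintro ⟨p, ⟨⟨⟨h1, h2⟩, h3⟩, h4, h5⟩, rfl⟩
    have hw : 0 < R * (1 + ν * p.2) := by positivity
    have h3' : |c + 2 * h * p.1| < 1 := h3
    refine ⟨?_, ?_, ?_, ?_, ?_⟩
    · unfold psi; simp only
      have := (sq_lt_one_iff_abs_lt_one _).2 h3'
      apply mul_pos hw; linarith
    · rw [ww_psi hw.le]; nlinarith [mul_nonneg hR.le (mul_nonneg hν.le h4)]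
    · rw [ww_psi hw.le, mul_comm]
      have : ν * p.2 < ν := by nlinarith
      gcongr
    · rw [kk_psi hw]; nlinarith
    · rw [kk_psi hw]; nlinarith

noncomputable def dpsi (R ν c h : ℝ) (p : ℝ × ℝ) : ℝ × ℝ →L[ℝ] ℝ × ℝ :=
  (Matrix.toLin (.finTwoProd ℝ) (.finTwoProd ℝ)
    !![R * (1 + ν * p.2) * (-(4 * h * (c + 2 * h * p.1))), R * ν * (1 - (c + 2 * h * p.1) ^ 2);
      4 * h * (R * (1 + ν * p.2)), 2 * R * ν * (c + 2 * h * p.1)]).toContinuousLinearMap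

theorem hasFDerivAt_psi (R ν c h : ℝ) (p : ℝ × ℝ) : HasFDerivAt (psi R ν c h) (dpsi R ν c h p) p := by
  unfold dpsi
  rw [Matrix.toLin_finTwoProd_toContinuousLinearMap]
  have hw : HasFDerivAt (fun p : ℝ × ℝ => R * (1 + ν * p.2)) ((R * ν) • ContinuousLinearMap.snd ℝ ℝ ℝ) p := by
    have := ((hasFDerivAt_snd (𝕜 := ℝ) (p := p) (E := ℝ) (F := ℝ)).const_mul ν |>.const_add 1).const_mul R
    simpa [smul_smul] using this
  have hk : HasFDerivAt (fun p : ℝ × ℝ => c + 2 * h * p.1) ((2 * h) • ContinuousLinearMap.fst ℝ ℝ ℝ) p := by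
    exact ((hasFDerivAt_fst (𝕜 := ℝ) (p := p) (E := ℝ) (F := ℝ)).const_mul (2 * h) |>.const_add c)
  have h1 := HasFDerivAt.prodMk (hw.mul ((hk.pow 2).const_sub 1)) ((hw.const_mul 2).mul hk)
  refine h1.congr_fderiv ?_
  ext <;> simp [-mul_eq_mul_left_iff, -mul_eq_mul_right_iff] <;> ring

theorem det_dpsi (R ν c h : ℝ) (p : ℝ × ℝ) :
    (dpsi R ν c h p).det = -(4 * ν * h * R * (R * (1 + ν * p.2)) * (1 + (c + 2 * h * p.1) ^ 2)) := by
  unfold dpsi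
  simp only [LinearMap.det_toContinuousLinearMap, LinearMap.det_toLin, Matrix.det_fin_two_of]
  ring

theorem cov_cap {R ν c h : ℝ} (hR : 0 < R) (hν : 0 < ν) (hh : 0 < h) (hc : |c| + h ≤ 1) (F : ℝ × ℝ → ℂ) :
    ∫ ξ in cap R ν c h, F ξ = ∫ p in Set.Ioc (-1/2 : ℝ) (1/2) ×ˢ Set.Ioc (0:ℝ) 1,
      (4 * ν * h * R * (R * (1 + ν * p.2)) * (1 + (c + 2 * h * p.1) ^ 2)) • F (psi R ν c h p) := by
  have hT : MeasurableSet (Set.Ico (-1/2 : ℝ) (1/2) ∩ {t | |c + 2 * h * t| < 1}) :=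
    measurableSet_Ico.inter (measurableSet_lt (by fun_prop) measurable_const)
  rw [psi_image hR hν hh, integral_image_eq_integral_abs_det_fderiv_smul volume (hT.prod measurableSet_Ico)
    (fun p _ => (hasFDerivAt_psi R ν c h p).hasFDerivWithinAt)]
  · have hae : ((Set.Ico (-1/2 : ℝ) (1/2) ∩ {t | |c + 2 * h * t| < 1}) ×ˢ Set.Ico (0:ℝ) 1 : Set (ℝ × ℝ)) =ᵐ[volume]
        (Set.Ioc (-1/2 : ℝ) (1/2) ×ˢ Set.Ioc (0:ℝ) 1 : Set (ℝ × ℝ)) := by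
      rw [Measure.volume_eq_prod]
      refine Measure.set_prod_ae_eq ?_ (Ico_ae_eq_Ioc)
      have h1 : (Set.Ico (-1/2 : ℝ) (1/2) ∩ {t | |c + 2 * h * t| < 1} : Set ℝ) =ᵐ[volume] Set.Ico (-1/2 : ℝ) (1/2) := by
        refine Filter.EventuallyLE.antisymm (Filter.Eventually.of_forall fun t ht => ht.1) ?_
        refine (Ioo_ae_eq_Ico (μ := volume)).symm.le.trans (Filter.Eventually.of_forall fun t ht => ?_)
        refine ⟨⟨ht.1.le, ht.2⟩, ?_⟩
        have h3 : |t| < 1/2 := abs_lt.2 ⟨by linarith [ht.1], ht.2⟩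
        calc |c + 2 * h * t| ≤ |c| + |2 * h * t| := abs_add_le _ _
          _ = |c| + 2 * h * |t| := by rw [abs_mul, abs_of_pos (by positivity : 0 < 2 * h)]
          _ < |c| + h := by nlinarith
          _ ≤ 1 := hc
      exact h1.trans Ico_ae_eq_Ioc
    rw [setIntegral_congr_set hae]
    refine setIntegral_congr_fun (measurableSet_Ioc.prod measurableSet_Ioc) fun p hp => ?_
    have := hp.2.1
    rw [det_dpsi, abs_neg, abs_of_nonneg (by positivity)]
  · rintro p ⟨-, hp, -⟩ p' ⟨-, hp', -⟩ heq
    have hw : 0 < R * (1 + ν * p.2) := by positivity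
    have hw' : 0 < R * (1 + ν * p'.2) := by positivity
    have e1 := ww_psi (c := c) (h := h) hw.le
    have e2 := kk_psi (c := c) (h := h) hw
    rw [heq, ww_psi hw'.le] at e1
    rw [heq, kk_psi hw'] at e2
    refine Prod.ext ?_ ?_
    · have := hh.ne'
      have h3 : (2 * h) * p'.1 = (2 * h) * p.1 := by linarith
      exact (mul_left_cancel₀ (by positivity) h3).symm
    · have h3 : (R * ν) * p'.2 = (R * ν) * p.2 := by linarith
      exact (mul_left_cancel₀ (by positivity) h3).symm

theorem aux_e4 (n : ℝ) {x y z : ℝ} (hx : x ≠ 0) (hy : y ≠ 0) (hz : z ≠ 0) :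
    (n * (x ^ 2 * y ^ 2) * z ^ 2) * (x * y * z)⁻¹ = n * x * z * y := by
  field_simp

/-- the kernel of a cap -/
noncomputable def ker (R ν c h : ℝ) (b β : ℕ) (v : ℝ × ℝ × ℝ) : ℂ :=
  ∫ ξ in cap R ν c h, (((√(nrm ξ))⁻¹ : ℝ) : ℂ) * Complex.exp (Complex.I * phase v ξ) *
    ((ss R ν ξ : ℂ) ^ b * (tt c h ξ : ℂ) ^ β)

theorem ker_eq {R ν c h : ℝ} (hR : 0 < R) (hν : 0 < ν) (hh : 0 < h) (hc : |c| + h ≤ 1) (b β : ℕ) (v : ℝ × ℝ × ℝ) :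
    ker R ν c h b β v = ((4 * ν * h * R * √R : ℝ) : ℂ) * ∫ t in (-1/2 : ℝ)..(1/2),
      ((√(1 + (c + 2 * h * t) ^ 2) * t ^ β : ℝ) : ℂ) *
        E0 ν b ((TT R c h v).1 + (TT R c h v).2.1 * t + (TT R c h v).2.2 * t ^ 2) := by
  unfold ker
  rw [cov_cap hR hν hh hc]
  have e : ∀ p ∈ Set.Ioc (-1/2 : ℝ) (1/2) ×ˢ Set.Ioc (0:ℝ) 1,
      (4 * ν * h * R * (R * (1 + ν * p.2)) * (1 + (c + 2 * h * p.1) ^ 2)) •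
        ((((√(nrm (psi R ν c h p)))⁻¹ : ℝ) : ℂ) * Complex.exp (Complex.I * phase v (psi R ν c h p)) *
    ((ss R ν (psi R ν c h p) : ℂ) ^ b * (tt c h (psi R ν c h p) : ℂ) ^ β)) =
      ((4 * ν * h * R * √R : ℝ) : ℂ) * (((√(1 + (c + 2 * h * p.1) ^ 2) * p.1 ^ β : ℝ) : ℂ) *
        (((√(1 + ν * p.2) * p.2 ^ b : ℝ) : ℂ) * Complex.exp (Complex.I *
          ((1 + ν * p.2) * ((TT R c h v).1 + (TT R c h v).2.1 * p.1 + (TT R c h v).2.2 * p.1 ^ 2) : ℝ)))) := by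
    intro p hp
    have hp0 := hp.2.1
    have hw : 0 < R * (1 + ν * p.2) := by positivity
    have e1 : ss R ν (psi R ν c h p) = p.2 := by
      unfold ss; rw [ww_psi hw.le]; field_simp; ring
    have e2 : tt c h (psi R ν c h p) = p.1 := by
      unfold tt; rw [kk_psi hw]; field_simp; ring
    have e3 : phase v (psi R ν c h p) = (1 + ν * p.2) * ((TT R c h v).1 + (TT R c h v).2.1 * p.1 + (TT R c h v).2.2 * p.1 ^ 2) := by
      rw [phase_eq (c := c) hR hν hh, e1, e2]; ring
    have e4 : (4 * ν * h * R * (R * (1 + ν * p.2)) * (1 + (c + 2 * h * p.1) ^ 2)) * (√(nrm (psi R ν c h p)))⁻¹ =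
        (4 * ν * h * R * √R) * √(1 + (c + 2 * h * p.1) ^ 2) * √(1 + ν * p.2) := by
      rw [nrm_psi hw.le, Real.sqrt_mul hw.le, Real.sqrt_mul hR.le]
      have q1 : √R ^ 2 = R := Real.sq_sqrt hR.le
      have q2 : √(1 + ν * p.2) ^ 2 = 1 + ν * p.2 := Real.sq_sqrt (by positivity)
      have q3 : √(1 + (c + 2 * h * p.1) ^ 2) ^ 2 = 1 + (c + 2 * h * p.1) ^ 2 := Real.sq_sqrt (by positivity)
      have r1 : √R ≠ 0 := by positivity
      have r2 : √(1 + ν * p.2) ≠ 0 := by positivity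
      have r3 : √(1 + (c + 2 * h * p.1) ^ 2) ≠ 0 := by positivity
      have := aux_e4 (4 * ν * h * R) r1 r2 r3
      rw [q1, q2, q3] at this
      exact this
    rw [e1, e2, e3, Complex.real_smul]
    have e4' := congrArg (fun x : ℝ => (x : ℂ)) e4
    push_cast at e4' ⊢
    linear_combination (Complex.exp (Complex.I * ((1 + ν * p.2) * ((TT R c h v).1 + (TT R c h v).2.1 * p.1 + (TT R c h v).2.2 * p.1 ^ 2))) *
      p.2 ^ b * p.1 ^ β) * e4'
  rw [setIntegral_congr_fun (measurableSet_Ioc.prod measurableSet_Ioc) e, integral_const_mul]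
  congr 1
  rw [Measure.volume_eq_prod, setIntegral_prod, intervalIntegral.integral_of_le (by norm_num)]
  · refine setIntegral_congr_fun measurableSet_Ioc fun t ht => ?_
    simp only
    rw [integral_const_mul]
    congr 1
    unfold E0 EE
    rw [intervalIntegral.integral_of_le (by norm_num)]
  · refine (ContinuousOn.integrableOn_compact (K := Set.Icc (-1/2 : ℝ) (1/2) ×ˢ Set.Icc (0:ℝ) 1) (isCompact_Icc.prod isCompact_Icc) ?_).mono_set
      (Set.prod_mono Set.Ioc_subset_Icc_self Set.Ioc_subset_Icc_self)
    exact Continuous.continuousOn (by fun_prop)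

end Wolff

open MeasureTheory Metric
open scoped ENNReal

namespace Wolff

def bx (M : ℝ) : Set (ℝ × ℝ) := Set.Icc (-M) M ×ˢ Set.Icc (-M) M

theorem bx_meas (M : ℝ) : MeasurableSet (bx M) := measurableSet_Icc.prod measurableSet_Icc
theorem bx_compact (M : ℝ) : IsCompact (bx M) := isCompact_Icc.prod isCompact_Icc
theorem bx_fin (M : ℝ) : volume (bx M) < ⊤ := (bx_compact M).measure_lt_top

theorem cap_bx {R ν c h : ℝ} (hR : 0 < R) (hν1 : ν ≤ 1) : cap R ν c h ⊆ bx (4 * R) := by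
  rintro ξ ⟨h0, h1, h2, -, -⟩
  have h3 : nrm ξ ≤ 4 * R := by
    unfold ww at h2
    nlinarith
  have := abs_le.1 ((le_nrm ξ).trans h3)
  have := abs_le.1 ((le_nrm2 ξ).trans h3)
  exact ⟨⟨by linarith, by linarith⟩, ⟨by linarith, by linarith⟩⟩

theorem cap_fin {R ν c h : ℝ} (hR : 0 < R) (hν1 : ν ≤ 1) : volume (cap R ν c h) < ⊤ :=
  (measure_mono (cap_bx hR hν1)).trans_lt (bx_fin _)

theorem cont_Uh {U : Set (ℝ × ℝ)} (hU : volume U < ⊤) : Continuous (Uh U) := by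
  unfold Uh
  have : IsFiniteMeasure (volume.restrict U) := ⟨by simpa using hU⟩
  refine continuous_of_dominated (bound := fun _ => 1) (fun ξ => ?_) (fun ξ => Filter.Eventually.of_forall fun y => ?_)
    (integrable_const _) (Filter.Eventually.of_forall fun y => ?_)
  · exact Continuous.aestronglyMeasurable (by unfold dt; fun_prop)
  · exact (nexp _).le
  · unfold dt; fun_prop

theorem Uh_le {U : Set (ℝ × ℝ)} (hU : volume U < ⊤) (ξ : ℝ × ℝ) : ‖Uh U ξ‖ ≤ (volume U).toReal := by
  have : IsFiniteMeasure (volume.restrict U) := ⟨by simpa using hU⟩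
  unfold Uh
  refine (norm_integral_le_integral_norm _).trans ?_
  simp only [nexp]
  simp [Measure.real]

theorem meas_GU {U : Set (ℝ × ℝ)} (hU : volume U < ⊤) : Measurable (GU U) := by
  have := (cont_Uh hU).measurable
  have := measurable_nrm
  unfold GU
  fun_prop

theorem GU_int {U : Set (ℝ × ℝ)} (hU : volume U < ⊤) {R ν c h : ℝ} (hR : 0 < R) (hν1 : ν ≤ 1) :
    IntegrableOn (GU U) (cap R ν c h) := by
  refine Measure.integrableOn_of_bounded (M := (volume U).toReal * (√R)⁻¹) (cap_fin hR hν1).ne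
    (meas_GU hU).aestronglyMeasurable ?_
  filter_upwards [ae_restrict_mem (measurableSet_cap R ν c h)] with ξ hξ
  unfold GU
  rw [norm_mul, Complex.norm_real, Real.norm_of_nonneg (by positivity)]
  have := cap_pos hξ
  gcongr
  exact Uh_le hU ξ

theorem uu_GU {R ν c h : ℝ} (hR : 0 < R) (hν : 0 < ν) (hν1 : ν ≤ 1) (hh : 0 < h) {U : Set (ℝ × ℝ)} (hU : volume U < ⊤) (b β : ℕ)
    (z : ℝ × ℝ × ℝ) : uu R ν (GU U) c h b β z = ∫ y in U, ker R ν c h b β (z + zy y) := by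
  have i1 : IsFiniteMeasure (volume.restrict U) := ⟨by simpa using hU⟩
  have i2 : IsFiniteMeasure (volume.restrict (cap R ν c h)) := ⟨by simpa using cap_fin hR hν1⟩
  have m1 := measurable_nrm
  have m2 := measurable_phase z
  have m3 := measurable_ss R ν
  have m4 := measurable_tt c h
  set F : (ℝ × ℝ) → (ℝ × ℝ) → ℂ := fun y ξ => Complex.exp (Complex.I * dt y ξ) *
    ((((√(nrm ξ))⁻¹ : ℝ) : ℂ) * Complex.exp (Complex.I * phase z ξ) * ((ss R ν ξ : ℂ) ^ b * (tt c h ξ : ℂ) ^ β)) with hF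
  have hFm : Measurable (Function.uncurry F) := by
    have : Measurable (fun p : (ℝ × ℝ) × (ℝ × ℝ) => dt p.1 p.2) := by unfold dt; fun_prop
    simp only [hF, Function.uncurry_def]
    fun_prop
  have hFi : Integrable (Function.uncurry F) ((volume.restrict U).prod (volume.restrict (cap R ν c h))) := by
    refine Integrable.of_bound hFm.aestronglyMeasurable ((√R)⁻¹) ?_
    have h1 : ∀ᵐ p ∂((volume.restrict U).prod (volume.restrict (cap R ν c h))), p.2 ∈ cap R ν c h :=
      Measure.quasiMeasurePreserving_snd.ae (ae_restrict_mem (measurableSet_cap R ν c h))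
    have h2 := Measure.quasiMeasurePreserving_snd (μ := volume.restrict U) |>.ae (sm_cap (c := c) hR hν hh).bs
    have h3 := Measure.quasiMeasurePreserving_snd (μ := volume.restrict U) |>.ae (sm_cap (c := c) hR hν hh).bt
    filter_upwards [h1, h2, h3] with p q1 q2 q3
    simp only [hF, Function.uncurry]
    rw [norm_mul, norm_mul, norm_mul, nexp, nexp, norm_mul, norm_pow, norm_pow, Complex.norm_real, Complex.norm_real, Complex.norm_real,
      Real.norm_of_nonneg (by positivity), Real.norm_eq_abs, Real.norm_eq_abs, one_mul, mul_one]
    have q4 : |ss R ν p.2| ^ b ≤ 1 := pow_le_one₀ (abs_nonneg _) q2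
    have q5 : |tt c h p.2| ^ β ≤ 1 := pow_le_one₀ (abs_nonneg _) (q3.trans (by norm_num))
    have q6 := cap_pos q1
    calc (√(nrm p.2))⁻¹ * (|ss R ν p.2| ^ b * |tt c h p.2| ^ β) ≤ (√R)⁻¹ * (1 * 1) := by gcongr
      _ = _ := by ring
  have e := integral_integral_swap hFi
  unfold uu mom
  calc ∫ ξ in cap R ν c h, gz (GU U) z ξ * ((ss R ν ξ : ℂ) ^ b * (tt c h ξ : ℂ) ^ β)
      = ∫ ξ in cap R ν c h, ∫ y in U, F y ξ := by
        congr 1; ext ξ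
        simp only [hF]
        rw [integral_mul_const]
        unfold gz GU Uh
        ring
    _ = _ := e.symm
    _ = _ := by
        congr 1; ext y
        unfold ker
        refine setIntegral_congr_fun (measurableSet_cap R ν c h) fun ξ hξ => ?_
        simp only [hF]
        rw [phase_add, phase_zy hξ.1]
        push_cast
        rw [mul_add, Complex.exp_add]
        ring

theorem int_log {a X : ℝ} (ha : 0 < a) (hX : 0 ≤ X) :
    ∫⁻ x in Set.Icc (-X) X, ENNReal.ofReal (1 / (1 + |a * x|)) ≤ ENNReal.ofReal (2 / a * Real.log (1 + a * X)) := by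
  have hc : Continuous fun x : ℝ => 1 / (1 + |a * x|) :=
    Continuous.div (by fun_prop) (by fun_prop) fun x => by positivity
  have h1 : ∫ x in (0:ℝ)..X, 1 / (1 + |a * x|) = Real.log (1 + a * X) / a := by
    have := intervalIntegral.integral_eq_sub_of_hasDerivAt (a := 0) (b := X) (f := fun x => Real.log (1 + a * x) / a)
      (f' := fun x => 1 / (1 + |a * x|)) (fun x hx => ?_) (hc.intervalIntegrable _ _)
    · rw [this]; simp
    · rw [Set.uIcc_of_le hX] at hx
      have hp : 0 ≤ a * x := mul_nonneg ha.le hx.1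
      have h2 := ((((hasDerivAt_id x).const_mul a).const_add 1).log (by simp; positivity)).div_const a
      refine h2.congr_deriv ?_
      rw [abs_of_nonneg hp]
      simp
      field_simp
  have h2 : ∫ x in (-X)..X, 1 / (1 + |a * x|) = 2 / a * Real.log (1 + a * X) := by
    rw [← intervalIntegral.integral_add_adjacent_intervals (b := 0) (hc.intervalIntegrable _ _) (hc.intervalIntegrable _ _), h1]
    have := intervalIntegral.integral_comp_neg (a := 0) (b := X) (fun x => 1 / (1 + |a * x|))
    simp only [mul_neg, abs_neg, neg_zero] at this
    rw [← this, h1]; ring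
  rw [← h2, intervalIntegral.integral_of_le (by linarith), ← integral_Icc_eq_integral_Ioc,
    ofReal_integral_eq_lintegral_ofReal (hc.continuousOn.integrableOn_compact isCompact_Icc)
      (Filter.Eventually.of_forall fun x => by positivity)]

theorem int_log' {a X Y α : ℝ} (ha : 0 < a) (hX : 0 ≤ X) (hα : |α| ≤ Y) :
    ∫⁻ x in Set.Icc (-X) X, ENNReal.ofReal (1 / (1 + |a * (x + α)|)) ≤ ENNReal.ofReal (2 / a * Real.log (1 + a * (X + Y))) := by
  have hY : 0 ≤ Y := (abs_nonneg _).trans hα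
  refine le_trans ?_ (int_log ha (by linarith : 0 ≤ X + Y))
  rw [← lintegral_indicator measurableSet_Icc, ← lintegral_indicator measurableSet_Icc,
    ← lintegral_add_right_eq_self (μ := volume) (fun x => (Set.Icc (-(X + Y)) (X + Y)).indicator (fun x => ENNReal.ofReal (1 / (1 + |a * x|))) x) α]
  refine lintegral_mono fun x => ?_
  by_cases hx : x ∈ Set.Icc (-X) X
  · have hx' : x + α ∈ Set.Icc (-(X + Y)) (X + Y) := by
      have := abs_le.1 hα
      exact ⟨by linarith [hx.1], by linarith [hx.2]⟩
    rw [Set.indicator_of_mem hx, Set.indicator_of_mem hx']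
  · rw [Set.indicator_of_notMem hx]; exact zero_le

theorem lin_cov {p q r s : ℝ} (hd : p * s - q * r ≠ 0) {F : ℝ × ℝ → ℝ≥0∞} (hF : Measurable F) :
    ∫⁻ y : ℝ × ℝ, F (p * y.1 + q * y.2, r * y.1 + s * y.2) = ENNReal.ofReal |(p * s - q * r)⁻¹| * ∫⁻ y, F y := by
  set L : ℝ × ℝ →ₗ[ℝ] ℝ × ℝ := Matrix.toLin (.finTwoProd ℝ) (.finTwoProd ℝ) !![p, q; r, s] with hL
  have hdet : LinearMap.det L = p * s - q * r := by
    rw [hL, LinearMap.det_toLin, Matrix.det_fin_two_of]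
  have h := Measure.map_linearMap_addHaar_eq_smul_addHaar (volume : Measure (ℝ × ℝ)) (f := L) (by rw [hdet]; exact hd)
  have hLm : Measurable L := (LinearMap.continuous_of_finiteDimensional L).measurable
  have h2 := congrArg (fun μ => ∫⁻ y, F y ∂μ) h
  rw [lintegral_map hF hLm, lintegral_smul_measure, hdet] at h2
  rw [smul_eq_mul] at h2
  rw [← h2]
  refine lintegral_congr fun y => ?_
  congr 1
  rw [hL, Matrix.toLin_finTwoProd_apply]

theorem int2 {M R a c κ α α' : ℝ} (hM : 0 < M) (hR : 0 < R) (ha : 0 < a) (hκ : |κ| ≤ 1) (hc : |c| ≤ 1)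
    (hd : 1 ≤ 2 * (1 - κ ^ 2) + 4 * c * κ) (hα : |α| ≤ 3 * M) (hα' : |α'| ≤ 3 * M) :
    ∫⁻ y in bx M, ENNReal.ofReal (1 / (1 + |a * (-2 * c * y.1 + 2 * y.2 + α')|)) *
      ENNReal.ofReal (1 / (1 + |R * ((1 - κ ^ 2) * y.1 + 2 * κ * y.2 + α)|)) ≤
    ENNReal.ofReal (2 / a * Real.log (1 + a * (7 * M))) * ENNReal.ofReal (2 / R * Real.log (1 + R * (7 * M))) := by
  set f1 : ℝ → ℝ≥0∞ := fun x => (Set.Icc (-(4*M)) (4*M)).indicator (fun x => ENNReal.ofReal (1 / (1 + |R * (x + α)|))) x with hf1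
  set f2 : ℝ → ℝ≥0∞ := fun x => (Set.Icc (-(4*M)) (4*M)).indicator (fun x => ENNReal.ofReal (1 / (1 + |a * (x + α')|))) x with hf2
  have m1 : Measurable f1 := Measurable.indicator (by fun_prop) measurableSet_Icc
  have m2 : Measurable f2 := Measurable.indicator (by fun_prop) measurableSet_Icc
  have hdet : (1 - κ ^ 2) * 2 - (2 * κ) * (-2 * c) = 2 * (1 - κ ^ 2) + 4 * c * κ := by ring
  have hcov := lin_cov (p := 1 - κ ^ 2) (q := 2 * κ) (r := -2 * c) (s := 2) (by rw [hdet]; linarith)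
    (F := fun y => f1 y.1 * f2 y.2) (by fun_prop)
  have hk := abs_le.1 hκ
  have hk2 : κ ^ 2 ≤ 1 := by nlinarith
  have hc' := abs_le.1 hc
  calc _ ≤ ∫⁻ y : ℝ × ℝ, f1 ((1 - κ ^ 2) * y.1 + 2 * κ * y.2) * f2 (-2 * c * y.1 + 2 * y.2) := by
        rw [← lintegral_indicator (bx_meas M)]
        refine lintegral_mono fun y => ?_
        by_cases hy : y ∈ bx M
        · have hy' := hy
          obtain ⟨⟨y1, y2⟩, ⟨y3, y4⟩⟩ := hy
          have g1 : |y.1| ≤ M := abs_le.2 ⟨y1, y2⟩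
          have g2 : |y.2| ≤ M := abs_le.2 ⟨y3, y4⟩
          have k1 : (1 - κ ^ 2) * y.1 + 2 * κ * y.2 ∈ Set.Icc (-(4*M)) (4*M) := by
            refine abs_le.1 ?_
            calc |(1 - κ ^ 2) * y.1 + 2 * κ * y.2| ≤ |(1 - κ ^ 2) * y.1| + |2 * κ * y.2| := abs_add_le _ _
              _ = (1 - κ ^ 2) * |y.1| + 2 * |κ| * |y.2| := by
                  rw [abs_mul, abs_mul, abs_mul, abs_two, abs_of_nonneg (by linarith : 0 ≤ 1 - κ ^ 2)]
              _ ≤ 1 * M + 2 * 1 * M := by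
                  gcongr
                  nlinarith
              _ ≤ 4 * M := by linarith
          have k2 : -2 * c * y.1 + 2 * y.2 ∈ Set.Icc (-(4*M)) (4*M) := by
            refine abs_le.1 ?_
            calc |-2 * c * y.1 + 2 * y.2| ≤ |-2 * c * y.1| + |2 * y.2| := abs_add_le _ _
              _ = 2 * |c| * |y.1| + 2 * |y.2| := by
                  rw [abs_mul, abs_mul, abs_mul, abs_neg, abs_two]
              _ ≤ 2 * 1 * M + 2 * M := by gcongr
              _ = 4 * M := by ring
          rw [Set.indicator_of_mem hy']
          simp only [hf1, hf2]
          rw [Set.indicator_of_mem k1, Set.indicator_of_mem k2, mul_comm]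
        · rw [Set.indicator_of_notMem hy]; exact zero_le
    _ ≤ 1 * ∫⁻ y : ℝ × ℝ, f1 y.1 * f2 y.2 := by
        rw [hcov]
        gcongr
        rw [ENNReal.ofReal_le_one, hdet, abs_inv, abs_of_pos (by linarith)]
        exact inv_le_one_of_one_le₀ hd
    _ = (∫⁻ x, f1 x) * ∫⁻ x, f2 x := by
        rw [one_mul, Measure.volume_eq_prod, lintegral_prod_mul m1.aemeasurable m2.aemeasurable]
    _ ≤ _ := by
        rw [mul_comm]
        have e1 := int_log' (X := 4 * M) ha (by positivity) hα'
        have e2 := int_log' (X := 4 * M) hR (by positivity) hα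
        rw [show 4 * M + 3 * M = 7 * M by ring] at e1 e2
        gcongr
        · simp only [hf2]; rw [lintegral_indicator measurableSet_Icc]; exact e1
        · simp only [hf1]; rw [lintegral_indicator measurableSet_Icc]; exact e2

end Wolff

open MeasureTheory Metric
open scoped ENNReal

namespace Wolff

theorem E0_cont (ν : ℝ) (b : ℕ) : Continuous (E0 ν b) := by
  unfold E0 EE
  exact intervalIntegral.continuous_parametric_intervalIntegral_of_continuous' (by fun_prop) _ _

/-- bilinear kernel weight -/
noncomputable def PH (R c h : ℝ) (z : ℝ × ℝ × ℝ) (t : ℝ) (y : ℝ × ℝ) : ℝ≥0∞ :=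
  ENNReal.ofReal (1 / (1 + |2 * R * h * (-2 * c * y.1 + 2 * y.2 + (z.2.1 + 2 * c * z.2.2))|)) *
      ENNReal.ofReal (1 / (1 + |R * ((1 - (c + 2 * h * t) ^ 2) * y.1 + 2 * (c + 2 * h * t) * y.2 +
        (z.1 + z.2.1 * (c + 2 * h * t) + z.2.2 * (c + 2 * h * t) ^ 2))|))

theorem PH_meas (R c h : ℝ) (z : ℝ × ℝ × ℝ) : Measurable (Function.uncurry (PH R c h z)) := by
  unfold PH Function.uncurry
  fun_prop

theorem kappa_le {c h t : ℝ} (hh : 0 < h) (hc : |c| + h ≤ 1) (ht : t ∈ Set.Icc (-1/2 : ℝ) (1/2)) : |c + 2 * h * t| ≤ 1 := by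
  have h1 : |t| ≤ 1/2 := abs_le.2 ⟨by linarith [ht.1], ht.2⟩
  calc _ ≤ |c| + |2 * h * t| := abs_add_le _ _
    _ = |c| + 2 * h * |t| := by rw [abs_mul, abs_of_pos (by positivity : 0 < 2 * h)]
    _ ≤ |c| + 2 * h * (1/2) := by gcongr
    _ ≤ 1 := by linarith

theorem ker_le {R ν c h M A : ℝ} (hR : 0 < R) (hν : 0 < ν) (hν1 : ν ≤ 1) (hh : 0 < h) (hc : |c| + h ≤ 1)
    (hA : 8 * M * R * h ^ 2 ≤ A) {z : ℝ × ℝ × ℝ} (hz : |z.2.2| ≤ M) {y : ℝ × ℝ} (hy : y ∈ bx M) (b β : ℕ) :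
    ‖ker R ν c h b β (z + zy y)‖ₑ ≤ ENNReal.ofReal (4 * ν * h * R * √R * (16 / ν * (44 + 4 * A))) *
      (PH R c h z (-1/2) y + PH R c h z (1/2) y + ∫⁻ t in Set.Icc (-1/2 : ℝ) (1/2), PH R c h z t y) := by
  rw [ker_eq hR hν hh hc, enorm_mul]
  have hy1 : |y.1| ≤ M := abs_le.2 hy.1
  have hM : 0 ≤ M := (abs_nonneg _).trans hy1
  have hA0 : 0 ≤ A := le_trans (by positivity) hA
  have hder : ∀ t ∈ Set.Icc (-1/2 : ℝ) (1/2), HasDerivAt (fun t => √(1 + (c + 2 * h * t) ^ 2) * t ^ β)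
      (((2 * h * (c + 2 * h * t)) / √(1 + (c + 2 * h * t) ^ 2)) * t ^ β + √(1 + (c + 2 * h * t) ^ 2) * (β * t ^ (β - 1))) t := by
    intro t ht
    have h0 : 1 + (c + 2 * h * t) ^ 2 ≠ 0 := by positivity
    have d1 : HasDerivAt (fun t => 1 + (c + 2 * h * t) ^ 2) (4 * h * (c + 2 * h * t)) t := by
      have := ((((hasDerivAt_id t).const_mul (2 * h)).const_add c).pow 2).const_add 1
      refine this.congr_deriv ?_
      simp; ring
    refine ((d1.sqrt h0).mul (hasDerivAt_pow β t)).congr_deriv ?_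
    congr 2
    field_simp
    ring
  have hsq : ∀ t ∈ Set.Icc (-1/2 : ℝ) (1/2), √(1 + (c + 2 * h * t) ^ 2) ≤ 2 := by
    intro t ht
    rw [Real.sqrt_le_left (by norm_num)]
    have := kappa_le hh hc ht
    have := (sq_le_one_iff_abs_le_one (c + 2 * h * t)).2 this
    linarith
  have hsq1 : ∀ t : ℝ, 1 ≤ √(1 + (c + 2 * h * t) ^ 2) := by
    intro t
    rw [Real.one_le_sqrt]; nlinarith [sq_nonneg (c + 2 * h * t)]
  have hta : ∀ t ∈ Set.Icc (-1/2 : ℝ) (1/2), |t| ≤ 1/2 := fun t ht => abs_le.2 ⟨by linarith [ht.1], ht.2⟩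
  have htb : ∀ t ∈ Set.Icc (-1/2 : ℝ) (1/2), |t ^ β| ≤ 1 := by
    intro t ht
    rw [abs_pow]
    exact pow_le_one₀ (abs_nonneg _) (by linarith [hta t ht])
  have htc : ∀ t ∈ Set.Icc (-1/2 : ℝ) (1/2), |β * t ^ (β - 1)| ≤ 2 := by
    intro t ht
    rcases Nat.eq_zero_or_pos β with h0 | h0
    · simp [h0]
    rw [abs_mul, abs_pow, Nat.abs_cast]
    have e1 : |t| ^ (β - 1) ≤ (1/2) ^ (β - 1) := by gcongr; exact hta t ht
    have e2 : (β : ℝ) ≤ 2 ^ β := by exact_mod_cast (Nat.lt_two_pow_self).le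
    have e3 : (2:ℝ) ^ β = 2 * 2 ^ (β - 1) := by rw [← pow_succ']; congr 1; omega
    calc (β : ℝ) * |t| ^ (β - 1) ≤ (2 * 2 ^ (β - 1)) * (1/2) ^ (β - 1) := by rw [e3] at e2; gcongr
      _ = 2 := by rw [mul_assoc, ← mul_pow]; norm_num
  have hbd := I_bd (C0 := 16 / ν) (A := A) (e0 := E0 ν b) (e1 := E1 ν b) (a0 := (TT R c h (z + zy y)).1)
    (a1 := (TT R c h (z + zy y)).2.1) (a2 := (TT R c h (z + zy y)).2.2) (by positivity) hder ?_ ?_ ?_ (E0_cont ν b)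
    (E0_bd hν hν1 b) (E1_bd hν hν1 b) (E1_deriv hν hν1 b) ?_
  rotate_left
  · refine ContinuousOn.add (ContinuousOn.mul (ContinuousOn.div (by fun_prop) (by fun_prop) fun t _ => ?_) (by fun_prop)) (by fun_prop)
    have := hsq1 t; positivity
  · intro t ht
    rw [abs_mul, abs_of_nonneg (Real.sqrt_nonneg _)]
    have e1 := hsq t ht
    have e2 := htb t ht
    nlinarith [abs_nonneg (t ^ β), Real.sqrt_nonneg (1 + (c + 2 * h * t) ^ 2)]
  · intro t ht
    calc _ ≤ |((2 * h * (c + 2 * h * t)) / √(1 + (c + 2 * h * t) ^ 2)) * t ^ β| + |√(1 + (c + 2 * h * t) ^ 2) * (β * t ^ (β - 1))| := abs_add_le _ _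
      _ ≤ 2 * 1 + 2 * 2 := by
          rw [abs_mul, abs_mul]
          gcongr
          · rw [abs_div, abs_mul, abs_of_pos (by positivity : 0 < 2 * h), abs_of_nonneg (Real.sqrt_nonneg _),
              div_le_iff₀ (by have := hsq1 t; positivity)]
            have h1 : h ≤ 1 := by linarith [abs_nonneg c]
            calc 2 * h * |c + 2 * h * t| ≤ 2 * 1 * 1 := by gcongr; exact kappa_le hh hc ht
              _ ≤ 2 * √(1 + (c + 2 * h * t) ^ 2) := by linarith [hsq1 t]
          · exact htb t ht
          · rw [abs_of_nonneg (Real.sqrt_nonneg _)]; exact hsq t ht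
          · exact htc t ht
      _ = 6 := by norm_num
  · refine le_trans ?_ hA
    have : (TT R c h (z + zy y)).2.2 = 4 * R * h ^ 2 * (z.2.2 - y.1) := by simp only [TT, zy, Prod.snd_add, Prod.fst_add]; ring
    rw [this, abs_mul, abs_of_pos (by positivity)]
    calc 4 * R * h ^ 2 * |z.2.2 - y.1| ≤ 4 * R * h ^ 2 * (M + M) := by
          gcongr; exact (abs_sub _ _).trans (add_le_add hz hy1)
      _ = _ := by ring
  have ef : ∀ t : ℝ, (TT R c h (z + zy y)).1 + (TT R c h (z + zy y)).2.1 * t + (TT R c h (z + zy y)).2.2 * t ^ 2 =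
      R * ((1 - (c + 2 * h * t) ^ 2) * y.1 + 2 * (c + 2 * h * t) * y.2 +
        (z.1 + z.2.1 * (c + 2 * h * t) + z.2.2 * (c + 2 * h * t) ^ 2)) := by
    intro t; simp only [TT, zy, Prod.snd_add, Prod.fst_add]; ring
  have e1 : (TT R c h (z + zy y)).2.1 = 2 * R * h * (-2 * c * y.1 + 2 * y.2 + (z.2.1 + 2 * c * z.2.2)) := by
    simp only [TT, zy, Prod.snd_add, Prod.fst_add]; ring
  set g : ℝ → ℝ := fun t => 1 / (1 + |R * ((1 - (c + 2 * h * t) ^ 2) * y.1 + 2 * (c + 2 * h * t) * y.2 +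
        (z.1 + z.2.1 * (c + 2 * h * t) + z.2.2 * (c + 2 * h * t) ^ 2))|) with hg
  have hgc : Continuous g := Continuous.div (by fun_prop) (by fun_prop) fun t => by positivity
  have hg0 : ∀ t, 0 ≤ g t := fun t => by positivity
  set w : ℝ := 1 / (1 + |2 * R * h * (-2 * c * y.1 + 2 * y.2 + (z.2.1 + 2 * c * z.2.2))|) with hw
  have hw0 : 0 ≤ w := by positivity
  simp only [ef] at hbd ⊢
  rw [e1] at hbd
  have hbd2 : ‖∫ t in (-1/2 : ℝ)..(1/2), ((√(1 + (c + 2 * h * t) ^ 2) * t ^ β : ℝ) : ℂ) *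
      E0 ν b (R * ((1 - (c + 2 * h * t) ^ 2) * y.1 + 2 * (c + 2 * h * t) * y.2 +
        (z.1 + z.2.1 * (c + 2 * h * t) + z.2.2 * (c + 2 * h * t) ^ 2)))‖ ≤
      16 / ν * (44 + 4 * A) * (w * (g (-1/2) + g (1/2) + ∫ t in (-1/2 : ℝ)..(1/2), g t)) := by
    refine hbd.trans (le_of_eq ?_)
    simp only [hg, hw]
    ring
  have hPH : ∀ t, PH R c h z t y = ENNReal.ofReal w * ENNReal.ofReal (g t) := fun t => rfl
  have hIntg : ENNReal.ofReal (∫ t in (-1/2 : ℝ)..(1/2), g t) = ∫⁻ t in Set.Icc (-1/2 : ℝ) (1/2), ENNReal.ofReal (g t) := by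
    rw [intervalIntegral.integral_of_le (by norm_num), ← integral_Icc_eq_integral_Ioc,
      ofReal_integral_eq_lintegral_ofReal (hgc.continuousOn.integrableOn_compact isCompact_Icc)
      (Filter.Eventually.of_forall fun x => hg0 x)]
  have hint0 : 0 ≤ ∫ t in (-1/2 : ℝ)..(1/2), g t := intervalIntegral.integral_nonneg (by norm_num) fun t _ => hg0 t
  have e3 : ‖((4 * ν * h * R * √R : ℝ) : ℂ)‖ₑ = ENNReal.ofReal (4 * ν * h * R * √R) := by
    rw [← ofReal_norm, Complex.norm_real, Real.norm_of_nonneg (by positivity)]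
  rw [e3, ENNReal.ofReal_mul (p := 4 * ν * h * R * √R) (q := 16 / ν * (44 + 4 * A)) (by positivity),
    mul_assoc (ENNReal.ofReal (4 * ν * h * R * √R))]
  refine mul_le_mul_right ?_ _
  rw [← ofReal_norm]
  refine (ENNReal.ofReal_le_ofReal hbd2).trans (le_of_eq ?_)
  rw [ENNReal.ofReal_mul (by positivity), ENNReal.ofReal_mul hw0, ENNReal.ofReal_add (add_nonneg (hg0 _) (hg0 _)) hint0,
    ENNReal.ofReal_add (hg0 _) (hg0 _), hIntg]
  simp only [hPH]
  rw [lintegral_const_mul _ (by fun_prop)]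
  ring

theorem PH_int {R c h M t : ℝ} (hM : 0 < M) (hR : 0 < R) (hh : 0 < h) (hh2 : h ≤ 1/2) (hc : |c| + h ≤ 1)
    {z : ℝ × ℝ × ℝ} (h1 : |z.1| ≤ M) (h2 : |z.2.1| ≤ M) (h3 : |z.2.2| ≤ M) (ht : t ∈ Set.Icc (-1/2 : ℝ) (1/2)) :
    ∫⁻ y in bx M, PH R c h z t y ≤ ENNReal.ofReal (2 / (2 * R * h) * Real.log (1 + (2 * R * h) * (7 * M))) *
      ENNReal.ofReal (2 / R * Real.log (1 + R * (7 * M))) := by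
  have hk := kappa_le hh hc ht
  set κ := c + 2 * h * t with hκ
  have hc1 : |c| ≤ 1 := by linarith
  have hk2 := (sq_le_one_iff_abs_le_one κ).2 hk
  refine int2 hM hR (by positivity) hk hc1 ?_ ?_ ?_
  · have e : 2 * (1 - κ ^ 2) + 4 * c * κ = 2 + 2 * κ ^ 2 - 4 * (2 * h * t * κ) := by rw [hκ]; ring
    have hth : |2 * h * t| ≤ 1/2 := by
      rw [abs_mul, abs_of_pos (by positivity)]
      have : |t| ≤ 1/2 := abs_le.2 ⟨by linarith [ht.1], ht.2⟩
      nlinarith [abs_nonneg t]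
    rw [e]
    have := abs_le.1 hth
    nlinarith [sq_nonneg (κ - 2 * h * t), sq_nonneg (κ - 2 * (h * t)), sq_nonneg (κ - 2*(2 * h * t)), mul_nonneg (by linarith : 0 ≤ 1/2 - 2 * h * t) (by linarith : 0 ≤ 1/2 + 2 * h * t)]
  · calc _ ≤ |z.1| + |z.2.1 * κ| + |z.2.2 * κ ^ 2| := abs_add_three _ _ _
      _ = |z.1| + |z.2.1| * |κ| + |z.2.2| * |κ| ^ 2 := by rw [abs_mul, abs_mul, abs_pow]
      _ ≤ M + M * 1 + M * 1 ^ 2 := by gcongr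
      _ = 3 * M := by ring
  · calc _ ≤ |z.2.1| + |2 * c * z.2.2| := abs_add_le _ _
      _ = |z.2.1| + 2 * |c| * |z.2.2| := by rw [abs_mul, abs_mul, abs_two]
      _ ≤ M + 2 * 1 * M := by gcongr
      _ = 3 * M := by ring

noncomputable def CB1 (M A : ℝ) : ℝ := 384 * (44 + 4 * A) * (1 + Real.log (1 + 14 * M)) ^ 2

theorem B1 {R ν c h M A : ℝ} (hM : 0 < M) (hR : 1 ≤ R) (hν : 0 < ν) (hν1 : ν ≤ 1) (hh : 0 < h) (hh2 : h ≤ 1/2) (hc : |c| + h ≤ 1)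
    (hA : 8 * M * R * h ^ 2 ≤ A) {z : ℝ × ℝ × ℝ} (h1 : |z.1| ≤ M) (h2 : |z.2.1| ≤ M) (h3 : |z.2.2| ≤ M)
    {U : Set (ℝ × ℝ)} (hUm : MeasurableSet U) (hU : U ⊆ bx M) (b β : ℕ) :
    ‖uu R ν (GU U) c h b β z‖ₑ ≤ ENNReal.ofReal (CB1 M A * (1 + Real.log R) ^ 2 / √R) := by
  have hR0 : 0 < R := by linarith
  have hA0 : 0 ≤ A := le_trans (by positivity) hA
  have hUf : volume U < ⊤ := (measure_mono hU).trans_lt (bx_fin M)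
  rw [uu_GU hR0 hν hν1 hh hUf]
  set L := ENNReal.ofReal (2 / (2 * R * h) * Real.log (1 + (2 * R * h) * (7 * M))) *
      ENNReal.ofReal (2 / R * Real.log (1 + R * (7 * M))) with hL
  set P := ENNReal.ofReal (4 * ν * h * R * √R * (16 / ν * (44 + 4 * A))) with hP
  have mP : ∀ t, Measurable (PH R c h z t) := fun t => (PH_meas R c h z).of_uncurry_left
  have mI : Measurable fun y => ∫⁻ t in Set.Icc (-1/2 : ℝ) (1/2), PH R c h z t y :=
    (PH_meas R c h z).lintegral_prod_left
  have key : ∀ t ∈ Set.Icc (-1/2 : ℝ) (1/2), ∫⁻ y in bx M, PH R c h z t y ≤ L := fun t ht =>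
    PH_int hM hR0 hh hh2 hc h1 h2 h3 ht
  have l1 : Real.log (1 + (2 * R * h) * (7 * M)) ≤ (1 + Real.log (1 + 14 * M)) * (1 + Real.log R) := by
    have a1 : 0 ≤ Real.log (1 + 14 * M) := Real.log_nonneg (by linarith)
    have a2 : 0 ≤ Real.log R := Real.log_nonneg hR
    calc _ ≤ Real.log ((1 + 14 * M) * R) := by
            apply Real.log_le_log (by positivity)
            have : R * h ≤ R * (1/2) := by gcongr
            nlinarith [mul_le_mul_of_nonneg_right this hM.le, mul_pos hR0 hM]
      _ = Real.log (1 + 14 * M) + Real.log R := Real.log_mul (by positivity) (by positivity)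
      _ ≤ _ := by nlinarith [mul_nonneg a1 a2]
  have l2 : Real.log (1 + R * (7 * M)) ≤ (1 + Real.log (1 + 14 * M)) * (1 + Real.log R) := by
    have a1 : 0 ≤ Real.log (1 + 14 * M) := Real.log_nonneg (by linarith)
    have a2 : 0 ≤ Real.log R := Real.log_nonneg hR
    calc _ ≤ Real.log ((1 + 14 * M) * R) := by
            apply Real.log_le_log (by positivity)
            nlinarith [mul_pos hR0 hM]
      _ = Real.log (1 + 14 * M) + Real.log R := Real.log_mul (by positivity) (by positivity)
      _ ≤ _ := by nlinarith [mul_nonneg a1 a2]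
  have q1 : 0 ≤ Real.log (1 + (2 * R * h) * (7 * M)) := Real.log_nonneg (by nlinarith [mul_pos (mul_pos hR0 hh) hM])
  have q2 : 0 ≤ Real.log (1 + R * (7 * M)) := Real.log_nonneg (by nlinarith [mul_pos hR0 hM])
  calc _ ≤ ∫⁻ y in U, ‖ker R ν c h b β (z + zy y)‖ₑ := enorm_integral_le_lintegral_enorm _
    _ ≤ ∫⁻ y in U, P * (PH R c h z (-1/2) y + PH R c h z (1/2) y + ∫⁻ t in Set.Icc (-1/2 : ℝ) (1/2), PH R c h z t y) :=
        setLIntegral_mono' hUm fun y hy => ker_le hR0 hν hν1 hh hc hA h3 (hU hy) b β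
    _ ≤ ∫⁻ y in bx M, P * (PH R c h z (-1/2) y + PH R c h z (1/2) y + ∫⁻ t in Set.Icc (-1/2 : ℝ) (1/2), PH R c h z t y) :=
        lintegral_mono_set hU
    _ = P * ((∫⁻ y in bx M, PH R c h z (-1/2) y) + (∫⁻ y in bx M, PH R c h z (1/2) y) +
          ∫⁻ t in Set.Icc (-1/2 : ℝ) (1/2), ∫⁻ y in bx M, PH R c h z t y) := by
        have m2 : Measurable fun y => PH R c h z (-1/2) y + PH R c h z (1/2) y := (mP _).add (mP _)
        have m3 : Measurable fun y => PH R c h z (-1/2) y + PH R c h z (1/2) y + ∫⁻ t in Set.Icc (-1/2 : ℝ) (1/2), PH R c h z t y := m2.add mI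
        rw [lintegral_const_mul _ m3, lintegral_add_left m2, lintegral_add_left (mP _),
          lintegral_lintegral_swap (PH_meas R c h z).aemeasurable]
    _ ≤ P * (L + L + ∫⁻ t in Set.Icc (-1/2 : ℝ) (1/2), L) := by
        refine mul_le_mul_right (add_le_add (add_le_add ?_ ?_) ?_) _
        · exact key _ ⟨le_refl _, by norm_num⟩
        · exact key _ ⟨by norm_num, le_refl _⟩
        · exact setLIntegral_mono' measurableSet_Icc fun t ht => key t ht
    _ = 3 * (P * L) := by
        rw [setLIntegral_const, Real.volume_Icc]
        norm_num
        ring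
    _ ≤ _ := by
        rw [hL, hP, ← ENNReal.ofReal_mul (by positivity), ← ENNReal.ofReal_mul (by positivity),
          show (3 : ℝ≥0∞) = ENNReal.ofReal 3 by simp, ← ENNReal.ofReal_mul (by norm_num)]
        apply ENNReal.ofReal_le_ofReal
        have hs : √R * √R = R := Real.mul_self_sqrt hR0.le
        have hs0 : 0 < √R := Real.sqrt_pos.2 hR0
        have e : 3 * (4 * ν * h * R * √R * (16 / ν * (44 + 4 * A)) * (2 / (2 * R * h) * Real.log (1 + (2 * R * h) * (7 * M)) * (2 / R * Real.log (1 + R * (7 * M)))))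
          = 384 * (44 + 4 * A) * (Real.log (1 + (2 * R * h) * (7 * M)) * Real.log (1 + R * (7 * M))) / √R := by
          set X := Real.log (1 + (2 * R * h) * (7 * M))
          set Y := Real.log (1 + R * (7 * M))
          rw [eq_div_iff hs0.ne']
          field_simp
          rw [show √R ^ 2 = R by rw [pow_two]; exact hs]
          ring
        rw [e]
        unfold CB1
        gcongr ?_ / _
        calc 384 * (44 + 4 * A) * (Real.log (1 + (2 * R * h) * (7 * M)) * Real.log (1 + R * (7 * M)))
            ≤ 384 * (44 + 4 * A) * (((1 + Real.log (1 + 14 * M)) * (1 + Real.log R)) * ((1 + Real.log (1 + 14 * M)) * (1 + Real.log R))) := by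
              refine mul_le_mul_of_nonneg_left (mul_le_mul l1 l2 q2 (q1.trans l1)) (by positivity)
          _ = _ := by ring

end Wolff

open MeasureTheory Metric
open scoped ENNReal

namespace Wolff

theorem cont_four {f : ℝ × ℝ → ℂ} (hf : Integrable f) : Continuous fun x : ℝ × ℝ => ∫ ξ, f ξ * Complex.exp (Complex.I * dt x ξ) := by
  refine continuous_of_dominated (bound := fun ξ => ‖f ξ‖) (fun x => ?_) (fun x => Filter.Eventually.of_forall fun ξ => ?_)
    hf.norm (Filter.Eventually.of_forall fun y => ?_)
  · exact hf.1.mul (Continuous.aestronglyMeasurable (by unfold dt; fun_prop))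
  · rw [norm_mul, nexp, mul_one]
  · unfold dt; fun_prop

noncomputable def FF (R ν : ℝ) (G : ℝ × ℝ → ℂ) (c h : ℝ) (b β : ℕ) : ℝ × ℝ → ℂ :=
  (cap R ν c h).indicator (fun ξ => G ξ * ((ss R ν ξ : ℂ) ^ b * (tt c h ξ : ℂ) ^ β))

theorem uu_zy (R ν : ℝ) (G : ℝ × ℝ → ℂ) (c h : ℝ) (b β : ℕ) (x : ℝ × ℝ) :
    uu R ν G c h b β (zy x) = ∫ ξ, FF R ν G c h b β ξ * Complex.exp (Complex.I * dt x ξ) := by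
  have e : (fun ξ => FF R ν G c h b β ξ * Complex.exp (Complex.I * dt x ξ)) =
      (cap R ν c h).indicator (fun ξ => G ξ * ((ss R ν ξ : ℂ) ^ b * (tt c h ξ : ℂ) ^ β) * Complex.exp (Complex.I * dt x ξ)) := by
    ext ξ
    unfold FF
    by_cases hξ : ξ ∈ cap R ν c h
    · rw [Set.indicator_of_mem hξ, Set.indicator_of_mem hξ]
    · rw [Set.indicator_of_notMem hξ, Set.indicator_of_notMem hξ, zero_mul]
  rw [e, integral_indicator (measurableSet_cap R ν c h)]
  unfold uu mom
  refine setIntegral_congr_fun (measurableSet_cap R ν c h) fun ξ hξ => ?_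
  simp only [gz]
  rw [phase_zy hξ.1]
  ring

theorem st_le {R ν c h : ℝ} (hR : 0 < R) (hν : 0 < ν) (hh : 0 < h) (b β : ℕ) {ξ : ℝ × ℝ} (hξ : ξ ∈ cap R ν c h) :
    ‖((ss R ν ξ : ℂ) ^ b * (tt c h ξ : ℂ) ^ β)‖ ≤ (1/2) ^ β := by
  obtain ⟨h0, h1, h2, h3, h4⟩ := hξ
  have s1 : |ss R ν ξ| ≤ 1 := by
    unfold ss
    rw [abs_div, abs_of_pos (by positivity : 0 < ν * R), div_le_one (by positivity), abs_of_nonneg (by linarith)]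
    linarith
  have t1 : |tt c h ξ| ≤ 1 / 2 := by
    unfold tt
    rw [abs_div, abs_of_pos (by positivity : 0 < 2 * h), div_le_iff₀ (by positivity)]
    exact abs_le.2 ⟨by linarith, by linarith⟩
  rw [norm_mul, norm_pow, norm_pow, Complex.norm_real, Complex.norm_real, Real.norm_eq_abs, Real.norm_eq_abs]
  calc _ ≤ 1 ^ b * (1/2 : ℝ) ^ β := by gcongr
    _ = _ := by simp

theorem FF_int {R ν c h : ℝ} (hR : 0 < R) (hν : 0 < ν) (hh : 0 < h) {G : ℝ × ℝ → ℂ}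
    (hG : IntegrableOn G (cap R ν c h)) (b β : ℕ) : Integrable (FF R ν G c h b β) := by
  unfold FF
  rw [integrable_indicator_iff (measurableSet_cap R ν c h)]
  have m3 := measurable_ss R ν
  have m4 := measurable_tt c h
  refine Integrable.mul_bdd (c := 1) hG (Measurable.aestronglyMeasurable (by fun_prop)) ?_
  filter_upwards [ae_restrict_mem (measurableSet_cap R ν c h)] with ξ hξ
  refine (st_le hR hν hh b β hξ).trans (pow_le_one₀ (by norm_num) (by norm_num))

theorem bess1 {R ν c h : ℝ} (hR : 0 < R) (hν : 0 < ν) (hh : 0 < h) {G : ℝ × ℝ → ℂ}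
    (hG : IntegrableOn G (cap R ν c h)) (b β : ℕ) :
    ∫⁻ x, ENNReal.ofReal (Real.exp (-1 * sq x)) * ‖uu R ν G c h b β (zy x)‖ₑ ^ 2 ≤
      ENNReal.ofReal (4 * Real.pi ^ 2) * ((2⁻¹ : ℝ≥0∞) ^ β * ∫⁻ ξ in cap R ν c h, ‖G ξ‖ₑ ^ 2) := by
  have := bessel one_pos (FF_int hR hν hh hG b β)
  simp only [← uu_zy] at this
  refine this.trans (mul_le_mul_right ?_ _)
  have e : (fun ξ => ‖FF R ν G c h b β ξ‖ₑ ^ 2) = (cap R ν c h).indicator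
      (fun ξ => ‖G ξ * ((ss R ν ξ : ℂ) ^ b * (tt c h ξ : ℂ) ^ β)‖ₑ ^ 2) := by
    ext ξ
    unfold FF
    by_cases hξ : ξ ∈ cap R ν c h
    · rw [Set.indicator_of_mem hξ, Set.indicator_of_mem hξ]
    · rw [Set.indicator_of_notMem hξ, Set.indicator_of_notMem hξ]; simp
  rw [e, lintegral_indicator (measurableSet_cap R ν c h), ← lintegral_const_mul' _ _ (by simp)]
  refine setLIntegral_mono' (measurableSet_cap R ν c h) fun ξ hξ => ?_
  rw [enorm_mul, mul_pow, mul_comm]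
  refine mul_le_mul_left ?_ _
  have h1 := st_le hR hν hh b β hξ
  have h2 : ‖((ss R ν ξ : ℂ) ^ b * (tt c h ξ : ℂ) ^ β)‖ₑ ≤ (2⁻¹ : ℝ≥0∞) ^ β := by
    rw [← ofReal_norm]
    refine (ENNReal.ofReal_le_ofReal h1).trans (le_of_eq ?_)
    rw [ENNReal.ofReal_pow (by norm_num)]
    congr 1
    rw [one_div, ENNReal.ofReal_inv_of_pos (by norm_num)]; simp
  calc _ ≤ ((2⁻¹ : ℝ≥0∞) ^ β) ^ 2 := by gcongr
    _ ≤ ((2⁻¹ : ℝ≥0∞) ^ β) ^ 1 := pow_le_pow_of_le_one (by simp) (pow_le_one' (by simp) _) (by norm_num)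
    _ = _ := pow_one _

noncomputable def HH (R ν : ℝ) (G : ℝ × ℝ → ℂ) (c h : ℝ) (b : ℕ) (x : ℝ × ℝ) : ℝ≥0∞ :=
  ∑' m : ℕ, ∑' β : ℕ, (16⁻¹ : ℝ≥0∞) ^ m * ‖uu R ν G c h (b + m) β (zy x)‖ₑ ^ 2

theorem uu_zy_meas {R ν c h : ℝ} (hR : 0 < R) (hν : 0 < ν) (hh : 0 < h) {G : ℝ × ℝ → ℂ}
    (hG : IntegrableOn G (cap R ν c h)) (b β : ℕ) : Measurable fun x => uu R ν G c h b β (zy x) := by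
  simp only [uu_zy]
  exact (cont_four (FF_int hR hν hh hG b β)).measurable

theorem tsum_geo2 : ∑' n : ℕ, (2⁻¹ : ℝ≥0∞) ^ n = 2 := by
  rw [ENNReal.tsum_geometric, ENNReal.one_sub_inv_two, inv_inv]

theorem tsum_geo16 : ∑' n : ℕ, (16⁻¹ : ℝ≥0∞) ^ n ≤ 2 := by
  rw [← tsum_geo2]
  refine ENNReal.tsum_le_tsum fun n => ?_
  gcongr
  norm_num

theorem bess2 {R ν c h : ℝ} (hR : 0 < R) (hν : 0 < ν) (hh : 0 < h) {G : ℝ × ℝ → ℂ}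
    (hG : IntegrableOn G (cap R ν c h)) (b : ℕ) :
    ∫⁻ x, ENNReal.ofReal (Real.exp (-1 * sq x)) * HH R ν G c h b x ≤
      ENNReal.ofReal (4 * Real.pi ^ 2) * (4 * ∫⁻ ξ in cap R ν c h, ‖G ξ‖ₑ ^ 2) := by
  have mu := fun m β => uu_zy_meas hR hν hh hG (b + m) β
  have ms := cont_sq.measurable
  unfold HH
  simp only [← ENNReal.tsum_mul_left]
  rw [lintegral_tsum fun m => (Measurable.aemeasurable (by fun_prop))]
  set I := ∫⁻ ξ in cap R ν c h, ‖G ξ‖ₑ ^ 2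
  calc _ ≤ ∑' m : ℕ, ∑' β : ℕ, (16⁻¹ : ℝ≥0∞) ^ m * (ENNReal.ofReal (4 * Real.pi ^ 2) * ((2⁻¹ : ℝ≥0∞) ^ β * I)) := by
        refine ENNReal.tsum_le_tsum fun m => ?_
        rw [lintegral_tsum fun m => (Measurable.aemeasurable (by fun_prop))]
        refine ENNReal.tsum_le_tsum fun β => ?_
        refine le_trans (le_of_eq ?_) (mul_le_mul_right (bess1 hR hν hh hG (b + m) β) _)
        rw [← lintegral_const_mul' _ _ (by simp)]
        refine lintegral_congr fun x => ?_
        ring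
    _ = (∑' m : ℕ, (16⁻¹ : ℝ≥0∞) ^ m) * (ENNReal.ofReal (4 * Real.pi ^ 2) * ((∑' β : ℕ, (2⁻¹ : ℝ≥0∞) ^ β) * I)) := by
        simp only [ENNReal.tsum_mul_left, ENNReal.tsum_mul_right]
    _ ≤ 2 * (ENNReal.ofReal (4 * Real.pi ^ 2) * (2 * I)) := by
        rw [tsum_geo2]
        gcongr
        exact tsum_geo16
    _ = _ := by ring

theorem SP_le_HH {R ν c h P : ℝ} (hR : 0 < R) (hν : 0 < ν) (hh : 0 < h) {G : ℝ × ℝ → ℂ}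
    (hG : IntegrableOn G (cap R ν c h)) (b : ℕ) {z : ℝ × ℝ × ℝ} {x : ℝ × ℝ} (hP : PP ν (TT R c h (z - zy x)) ≤ P) :
    SP R ν G c h b z ^ 2 ≤ ENNReal.ofReal (Real.exp P) ^ 2 * HH R ν G c h b x := by
  by_cases hT : HH R ν G c h b x = ⊤
  · rw [hT, ENNReal.mul_top]
    · exact le_top
    · have : ENNReal.ofReal (Real.exp P) ≠ 0 := by simp [Real.exp_pos]
      exact pow_ne_zero _ this
  set C := √(HH R ν G c h b x).toReal with hC
  have hC2 : ENNReal.ofReal C ^ 2 = HH R ν G c h b x := by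
    rw [← ENNReal.ofReal_pow (Real.sqrt_nonneg _), Real.sq_sqrt ENNReal.toReal_nonneg, ENNReal.ofReal_toReal hT]
  have h1 : HC R ν G c h b (zy x) C := by
    intro m β
    have e1 : (16⁻¹ : ℝ≥0∞) ^ m * ‖uu R ν G c h (b + m) β (zy x)‖ₑ ^ 2 ≤ HH R ν G c h b x :=
      (ENNReal.le_tsum β).trans (ENNReal.le_tsum (f := fun m => ∑' β : ℕ, (16⁻¹ : ℝ≥0∞) ^ m * ‖uu R ν G c h (b + m) β (zy x)‖ₑ ^ 2) m)
    have e2 := ENNReal.toReal_mono hT e1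
    rw [ENNReal.toReal_mul, ENNReal.toReal_pow, ENNReal.toReal_pow, toReal_enorm, ENNReal.toReal_inv] at e2
    have e3 : ‖uu R ν G c h (b + m) β (zy x)‖ ^ 2 ≤ (4 ^ m * C) ^ 2 := by
      rw [mul_pow, hC, Real.sq_sqrt ENNReal.toReal_nonneg]
      have e4 : ((ENNReal.toReal 16)⁻¹ : ℝ) ^ m = ((4:ℝ) ^ m)⁻¹ ^ 2 := by
        rw [← inv_pow, ← pow_mul, mul_comm, pow_mul]; norm_num
      rw [e4] at e2
      have : (0:ℝ) < 4 ^ m := by positivity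
      rw [inv_pow, inv_mul_le_iff₀ (by positivity)] at e2
      exact e2
    exact abs_le_of_sq_le_sq' e3 (by positivity) |>.2
  have h2 := HC_shift hR hν hh hG (v := z - zy x) h1
  rw [add_sub_cancel] at h2
  have h3 : SP R ν G c h b z ≤ ENNReal.ofReal (Real.exp P * C) := by
    refine iSup_le fun β => ?_
    rw [← ofReal_norm]
    apply ENNReal.ofReal_le_ofReal
    have := h2 0 β
    rw [pow_zero, one_mul, add_zero] at this
    refine this.trans ?_
    gcongr
  calc _ ≤ ENNReal.ofReal (Real.exp P * C) ^ 2 := by gcongr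
    _ = _ := by rw [ENNReal.ofReal_mul (Real.exp_pos _).le, mul_pow, hC2]

def NN (R c h : ℝ) (a : ℤ × ℤ) : Set (ℝ × ℝ) :=
  {x | ⌊(TT R c h (zy x)).1⌋ = a.1 ∧ ⌊(TT R c h (zy x)).2.1⌋ = a.2}

theorem NN_meas (R c h : ℝ) (a : ℤ × ℤ) : MeasurableSet (NN R c h a) := by
  have e1 : Measurable fun x => ⌊(TT R c h (zy x)).1⌋ := Int.measurable_floor.comp (by unfold TT zy; fun_prop)
  have e2 : Measurable fun x => ⌊(TT R c h (zy x)).2.1⌋ := Int.measurable_floor.comp (by unfold TT zy; fun_prop)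
  exact (e1 (measurableSet_singleton a.1)).inter (e2 (measurableSet_singleton a.2))

theorem NN_vol {R c h : ℝ} (hR : 0 < R) (hh : 0 < h) (hc : |c| ≤ 1) (a : ℤ × ℤ) :
    1 ≤ ENNReal.ofReal (8 * R ^ 2 * h) * volume (NN R c h a) := by
  have hd : R * (1 - c ^ 2) * (4 * R * h) - 2 * R * c * (-4 * R * h * c) = 4 * R ^ 2 * h * (1 + c ^ 2) := by ring
  have hd0 : 0 < 4 * R ^ 2 * h * (1 + c ^ 2) := by positivity
  have key := lin_cov (p := R * (1 - c ^ 2)) (q := 2 * R * c) (r := -4 * R * h * c) (s := 4 * R * h)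
    (by rw [hd]; exact hd0.ne')
    (F := (Set.Ico (a.1 : ℝ) (a.1 + 1) ×ˢ Set.Ico (a.2 : ℝ) (a.2 + 1)).indicator 1)
    (measurable_one.indicator (measurableSet_Ico.prod measurableSet_Ico))
  rw [lintegral_indicator_one (measurableSet_Ico.prod measurableSet_Ico), hd] at key
  have e : (fun y : ℝ × ℝ => (Set.Ico (a.1 : ℝ) (a.1 + 1) ×ˢ Set.Ico (a.2 : ℝ) (a.2 + 1)).indicator (1 : ℝ × ℝ → ℝ≥0∞)
      (R * (1 - c ^ 2) * y.1 + 2 * R * c * y.2, -4 * R * h * c * y.1 + 4 * R * h * y.2)) = (NN R c h a).indicator 1 := by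
    ext y
    unfold Set.indicator
    congr 1
    refine propext ?_
    unfold NN
    simp only [Set.mem_prod, Set.mem_Ico, Set.mem_ofPred_eq, Int.floor_eq_iff]
    have e1 : (TT R c h (zy y)).1 = R * (1 - c ^ 2) * y.1 + 2 * R * c * y.2 := by simp only [TT, zy]; ring
    have e2 : (TT R c h (zy y)).2.1 = -4 * R * h * c * y.1 + 4 * R * h * y.2 := by simp only [TT, zy]; ring
    rw [e1, e2]
  rw [e, lintegral_indicator_one (NN_meas R c h a), Measure.volume_eq_prod, Measure.prod_prod, Real.volume_Ico, Real.volume_Ico] at key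
  simp only [add_sub_cancel_left, ENNReal.ofReal_one, mul_one] at key
  rw [← Measure.volume_eq_prod] at key
  rw [key, ← ENNReal.ofReal_mul (by positivity), ← ENNReal.ofReal_one]
  apply ENNReal.ofReal_le_ofReal
  rw [abs_of_pos (by positivity), ← div_eq_mul_inv, one_le_div hd0]
  have : c ^ 2 ≤ 1 := (sq_le_one_iff_abs_le_one c).2 hc
  have : 0 < 4 * R ^ 2 * h := by positivity
  nlinarith

end Wolff

open MeasureTheory Metric
open scoped ENNReal

namespace Wolff

def OM (M : ℝ) : Set (ℝ × ℝ × ℝ) := {z | |z.1| ≤ M ∧ |z.2.1| ≤ M ∧ |z.2.2| ≤ M}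

theorem near_x {R c h M A : ℝ} (hM : 1 ≤ M) (hR : 1 ≤ R) (hh : 0 < h) (hc : |c| ≤ 1) (hA : 8 * M * R * h ^ 2 ≤ A)
    (h1 : 1 ≤ 2 * R * h) {z : ℝ × ℝ × ℝ} (hz : z ∈ OM M) {x : ℝ × ℝ} (hx : x ∈ NN R c h ((fl R c h z).1, (fl R c h z).2.1)) :
    sq x ≤ 2 * (6 * M + 2) ^ 2 ∧ |(TT R c h (z - zy x)).1| ≤ 1 ∧ |(TT R c h (z - zy x)).2.1| ≤ 1 ∧ |(TT R c h (z - zy x)).2.2| ≤ 5 * A := by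
  have hR0 : 0 < R := by linarith
  obtain ⟨z1, z2, z3⟩ := hz
  obtain ⟨x1, x2⟩ := hx
  simp only [fl] at x1 x2
  have d1 := Int.abs_sub_lt_one_of_floor_eq_floor x1.symm
  have d2 := Int.abs_sub_lt_one_of_floor_eq_floor x2.symm
  have c2 : c ^ 2 ≤ 1 := (sq_le_one_iff_abs_le_one c).2 hc
  have e1 : (TT R c h (z - zy x)).1 = (TT R c h z).1 - (TT R c h (zy x)).1 := by rw [TT_sub']; rfl
  have e2 : (TT R c h (z - zy x)).2.1 = (TT R c h z).2.1 - (TT R c h (zy x)).2.1 := by rw [TT_sub']; rfl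
  set u := (1 - c ^ 2) * x.1 + 2 * c * x.2 with hu
  set v := -2 * c * x.1 + 2 * x.2 with hv
  set α := z.1 + z.2.1 * c + z.2.2 * c ^ 2 with hα
  set α' := z.2.1 + 2 * c * z.2.2 with hα'
  have f1 : (TT R c h z).1 - (TT R c h (zy x)).1 = R * (α - u) := by simp only [TT, zy, hu, hα]; ring
  have f2 : (TT R c h z).2.1 - (TT R c h (zy x)).2.1 = 2 * R * h * (α' - v) := by simp only [TT, zy, hv, hα']; ring
  have a1 : |α| ≤ 3 * M := by
    calc _ ≤ |z.1| + |z.2.1 * c| + |z.2.2 * c ^ 2| := abs_add_three _ _ _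
      _ = |z.1| + |z.2.1| * |c| + |z.2.2| * |c| ^ 2 := by rw [abs_mul, abs_mul, abs_pow]
      _ ≤ M + M * 1 + M * 1 ^ 2 := by gcongr
      _ = 3 * M := by ring
  have a2 : |α'| ≤ 3 * M := by
    calc _ ≤ |z.2.1| + |2 * c * z.2.2| := abs_add_le _ _
      _ = |z.2.1| + 2 * |c| * |z.2.2| := by rw [abs_mul, abs_mul, abs_two]
      _ ≤ M + 2 * 1 * M := by gcongr
      _ = 3 * M := by ring
  have b1 : |α - u| ≤ 1 := by
    rw [f1, abs_mul, abs_of_pos hR0] at d1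
    nlinarith [abs_nonneg (α - u)]
  have b2 : |α' - v| ≤ 1 := by
    rw [f2, abs_mul, abs_of_pos (by positivity)] at d2
    nlinarith [abs_nonneg (α' - v)]
  have u1 : |u| ≤ 3 * M + 1 := by
    calc |u| = |α - (α - u)| := by ring_nf
      _ ≤ |α| + |α - u| := abs_sub _ _
      _ ≤ _ := by linarith
  have v1 : |v| ≤ 3 * M + 1 := by
    calc |v| = |α' - (α' - v)| := by ring_nf
      _ ≤ |α'| + |α' - v| := abs_sub _ _
      _ ≤ _ := by linarith
  have hd : 0 < 2 + 2 * c ^ 2 := by positivity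
  have g1 : x.1 * (2 + 2 * c ^ 2) = 2 * u - 2 * c * v := by rw [hu, hv]; ring
  have g2 : x.2 * (2 + 2 * c ^ 2) = 2 * c * u + (1 - c ^ 2) * v := by rw [hu, hv]; ring
  have k1 : |x.1| ≤ 6 * M + 2 := by
    have : |x.1| * (2 + 2 * c ^ 2) ≤ 2 * (6 * M + 2) := by
      rw [← abs_of_pos hd, ← abs_mul, g1]
      calc _ ≤ |2 * u| + |2 * c * v| := abs_sub _ _
        _ = 2 * |u| + 2 * |c| * |v| := by rw [abs_mul, abs_mul, abs_mul, abs_two]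
        _ ≤ 2 * (3 * M + 1) + 2 * 1 * (3 * M + 1) := by gcongr
        _ = _ := by ring
    have t := mul_nonneg (abs_nonneg x.1) (sq_nonneg c)
    rw [mul_add] at this
    linarith
  have k2 : |x.2| ≤ 6 * M + 2 := by
    have : |x.2| * (2 + 2 * c ^ 2) ≤ 2 * (6 * M + 2) := by
      rw [← abs_of_pos hd, ← abs_mul, g2]
      calc _ ≤ |2 * c * u| + |(1 - c ^ 2) * v| := abs_add_le _ _
        _ = 2 * |c| * |u| + (1 - c ^ 2) * |v| := by rw [abs_mul, abs_mul, abs_mul, abs_two, abs_of_nonneg (by linarith : 0 ≤ 1 - c ^ 2)]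
        _ ≤ 2 * 1 * (3 * M + 1) + 1 * (3 * M + 1) := by
            gcongr; nlinarith [sq_nonneg c]
        _ ≤ _ := by linarith
    have t := mul_nonneg (abs_nonneg x.2) (sq_nonneg c)
    rw [mul_add] at this
    linarith
  refine ⟨?_, by rw [e1]; exact d1.le, by rw [e2]; exact d2.le, ?_⟩
  · unfold sq
    have := sq_le_sq' (abs_le.1 k1).1 (abs_le.1 k1).2
    have := sq_le_sq' (abs_le.1 k2).1 (abs_le.1 k2).2
    linarith
  · have e3 : (TT R c h (z - zy x)).2.2 = 4 * R * h ^ 2 * (z.2.2 + x.1) := by simp [TT, zy]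
    rw [e3, abs_mul, abs_of_pos (by positivity)]
    calc _ ≤ 4 * R * h ^ 2 * (M + (6 * M + 2)) := by
          gcongr
          exact (abs_add_le _ _).trans (add_le_add z3 k1)
      _ ≤ 4 * R * h ^ 2 * (10 * M) := by gcongr; linarith
      _ = 5 * (8 * M * R * h ^ 2) := by ring
      _ ≤ 5 * A := by gcongr

noncomputable def CD (M A : ℝ) : ℝ≥0∞ := ENNReal.ofReal (Real.exp (9 + 25 * A)) ^ 2 * ENNReal.ofReal (Real.exp (2 * (6 * M + 2) ^ 2))

theorem SP2_le {R ν c h M A : ℝ} (hM : 1 ≤ M) (hR : 1 ≤ R) (hν : 0 < ν) (hν1 : ν ≤ 1) (hh : 0 < h) (hc : |c| ≤ 1) (hA : 8 * M * R * h ^ 2 ≤ A)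
    (h1 : 1 ≤ 2 * R * h) {G : ℝ × ℝ → ℂ} (hG : IntegrableOn G (cap R ν c h)) (b : ℕ) {z : ℝ × ℝ × ℝ} (hz : z ∈ OM M) :
    SP R ν G c h b z ^ 2 ≤ ENNReal.ofReal (8 * R ^ 2 * h) * (CD M A *
      ∫⁻ x in NN R c h ((fl R c h z).1, (fl R c h z).2.1), ENNReal.ofReal (Real.exp (-1 * sq x)) * HH R ν G c h b x) := by
  have hR0 : 0 < R := by linarith
  have hA0 : 0 ≤ A := le_trans (by positivity) hA
  set N := NN R c h ((fl R c h z).1, (fl R c h z).2.1) with hN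
  calc SP R ν G c h b z ^ 2 ≤ (ENNReal.ofReal (8 * R ^ 2 * h) * volume N) * SP R ν G c h b z ^ 2 :=
        le_mul_of_one_le_left zero_le (NN_vol hR0 hh hc _)
    _ = ENNReal.ofReal (8 * R ^ 2 * h) * ∫⁻ x in N, SP R ν G c h b z ^ 2 := by
        rw [setLIntegral_const]; ring
    _ ≤ ENNReal.ofReal (8 * R ^ 2 * h) * ∫⁻ x in N, CD M A * (ENNReal.ofReal (Real.exp (-1 * sq x)) * HH R ν G c h b x) := by
        refine mul_le_mul_right (setLIntegral_mono' (NN_meas R c h _) fun x hx => ?_) _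
        obtain ⟨a1, a2, a3, a4⟩ := near_x hM hR hh hc hA h1 hz hx
        have hP : PP ν (TT R c h (z - zy x)) ≤ 9 + 25 * A := by
          unfold PP
          calc _ ≤ 4 * 1 * 1 + (1 + 4 * 1) * (1 + 5 * A) := by gcongr
            _ = _ := by ring
        refine (SP_le_HH hR0 hν hh hG b hP).trans ?_
        unfold CD
        rw [mul_assoc, ← mul_assoc (ENNReal.ofReal (Real.exp (2 * (6 * M + 2) ^ 2))), ← ENNReal.ofReal_mul (Real.exp_pos _).le, ← Real.exp_add]
        refine mul_le_mul_right (le_mul_of_one_le_left zero_le ?_) _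
        rw [← ENNReal.ofReal_one]
        apply ENNReal.ofReal_le_ofReal
        rw [Real.one_le_exp_iff]
        linarith
    _ = _ := by
        rw [lintegral_const_mul']
        unfold CD
        finiteness

theorem MP2_le {R ν c h M A : ℝ} (hM : 1 ≤ M) (hR : 1 ≤ R) (hν : 0 < ν) (hν1 : ν ≤ 1) (hh : 0 < h) (hc : |c| ≤ 1) (hA : 8 * M * R * h ^ 2 ≤ A)
    (h1 : 1 ≤ 2 * R * h) {G : ℝ × ℝ → ℂ} (hG : IntegrableOn G (cap R ν c h)) (b : ℕ) :
    MP R ν G (OM M) 2 c h b ≤ ((2 * (⌈A⌉₊ + 1) + 1 : ℕ) : ℝ≥0∞) * (ENNReal.ofReal (8 * R ^ 2 * h) * (CD M A *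
      (ENNReal.ofReal (4 * Real.pi ^ 2) * (4 * ∫⁻ ξ in cap R ν c h, ‖G ξ‖ₑ ^ 2)))) := by
  have hR0 : 0 < R := by linarith
  have hA0 : 0 ≤ A := le_trans (by positivity) hA
  set n : ℕ := ⌈A⌉₊ + 1 with hn
  set I : ℤ × ℤ → ℝ≥0∞ := fun a => ∫⁻ x in NN R c h a, ENNReal.ofReal (Real.exp (-1 * sq x)) * HH R ν G c h b x with hI
  set D := ENNReal.ofReal (8 * R ^ 2 * h) with hD
  have key : ∀ Q : ℤ × ℤ × ℤ, (⨆ z ∈ OM M, ⨆ (_ : fl R c h z = Q), SP R ν G c h b z ^ 2) ≤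
      (fun (a0 : ℤ) (r : ℤ × ℤ) => if r.2 ∈ Finset.Icc (-(n:ℤ)) n then D * (CD M A * I (a0, r.1)) else 0) Q.1 Q.2 := by
    intro Q
    refine iSup₂_le fun z hz => iSup_le fun hQ => ?_
    subst hQ
    have hm : (fl R c h z).2.2 ∈ Finset.Icc (-(n:ℤ)) n := by
      have h3 : |(TT R c h z).2.2| ≤ A := by
        simp only [TT]
        rw [abs_mul, abs_of_pos (by positivity)]
        calc _ ≤ 4 * R * h ^ 2 * M := by gcongr; exact hz.2.2
          _ ≤ 8 * M * R * h ^ 2 := by nlinarith [show 0 < R * h ^ 2 * M by positivity]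
          _ ≤ A := hA
      have h4 := abs_le.1 h3
      have h5 : A ≤ ⌈A⌉₊ := Nat.le_ceil A
      rw [Finset.mem_Icc]
      simp only [fl, hn]
      constructor
      · rw [Int.le_floor]; push_cast; linarith
      · rw [Int.floor_le_iff]; push_cast; linarith
    simp only [hm, if_true]
    exact SP2_le hM hR hν hν1 hh hc hA h1 hG b hz
  unfold MP
  refine (ENNReal.tsum_le_tsum key).trans ?_
  have e0 := ENNReal.tsum_prod (f := fun (a0 : ℤ) (r : ℤ × ℤ) => if r.2 ∈ Finset.Icc (-(n:ℤ)) n then D * (CD M A * I (a0, r.1)) else 0)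
  rw [e0]
  have e1 : ∀ a : ℤ, ∑' r : ℤ × ℤ, (if r.2 ∈ Finset.Icc (-(n:ℤ)) n then D * (CD M A * I (a, r.1)) else 0) =
      ((2 * n + 1 : ℕ) : ℝ≥0∞) * (D * (CD M A * ∑' r, I (a, r))) := by
    intro a
    have := ENNReal.tsum_prod (f := fun r r' : ℤ => if r' ∈ Finset.Icc (-(n:ℤ)) n then D * (CD M A * I (a, r)) else 0)
    rw [this]
    have e2 : ∀ r : ℤ, ∑' r' : ℤ, (if r' ∈ Finset.Icc (-(n:ℤ)) n then D * (CD M A * I (a, r)) else 0) =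
        ((2 * n + 1 : ℕ) : ℝ≥0∞) * (D * (CD M A * I (a, r))) := by
      intro r
      rw [tsum_eq_sum (s := Finset.Icc (-(n:ℤ)) n) (fun r' hr' => by rw [if_neg hr']),
        Finset.sum_congr rfl (fun r' hr' => if_pos hr'), Finset.sum_const, Int.card_Icc, nsmul_eq_mul]
      congr 2
      omega
    simp only [e2, ENNReal.tsum_mul_left]
  simp only [e1, ENNReal.tsum_mul_left]
  refine mul_le_mul_right (mul_le_mul_right (mul_le_mul_right ?_ _) _) _
  rw [← ENNReal.tsum_prod (f := fun a r => I (a, r))]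
  refine le_trans ?_ (bess2 hR0 hν hh hG b)
  simp only [hI]
  rw [← lintegral_iUnion (fun a => NN_meas R c h a)]
  · exact setLIntegral_le_lintegral _ _
  · intro a a' haa
    refine Set.disjoint_left.2 fun x hx hx' => haa ?_
    exact Prod.ext (hx.1.symm.trans hx'.1) (hx.2.symm.trans hx'.2)

theorem shell_int {R ν : ℝ} (hR : 1 ≤ R) (hν1 : ν ≤ 1) {U : Set (ℝ × ℝ)} (hUm : MeasurableSet U) (hU : volume U < ⊤) :
    ∫⁻ ξ in cap R ν 0 1, ‖Uh U ξ‖ₑ ^ 2 ≤ ENNReal.ofReal (Real.exp 32) * (ENNReal.ofReal (4 * Real.pi ^ 2) * volume U) := by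
  have hR0 : 0 < R := by linarith
  have hf : Integrable (U.indicator fun _ => (1:ℂ)) := by
    rw [integrable_indicator_iff hUm]; exact integrableOn_const hU.ne
  have hb := bessel (δ := 1 / R ^ 2) (by positivity) hf
  have e : ∀ x, ∫ ξ, U.indicator (fun _ => (1:ℂ)) ξ * Complex.exp (Complex.I * dt x ξ) = Uh U x := by
    intro x
    unfold Uh
    rw [← integral_indicator hUm]
    congr 1; ext ξ
    by_cases hξ : ξ ∈ U
    · rw [Set.indicator_of_mem hξ, Set.indicator_of_mem hξ, one_mul]
      simp only [dt]; congr 3; ring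
    · rw [Set.indicator_of_notMem hξ, Set.indicator_of_notMem hξ, zero_mul]
  simp only [e] at hb
  have e2 : ∫⁻ ξ, ‖U.indicator (fun _ => (1:ℂ)) ξ‖ₑ ^ 2 = volume U := by
    rw [← lintegral_indicator_one hUm]
    congr 1; ext ξ
    by_cases hξ : ξ ∈ U
    · simp [hξ]
    · simp [hξ]
  rw [e2] at hb
  refine le_trans ?_ (mul_le_mul_right hb _)
  rw [← lintegral_const_mul' _ _ (by simp)]
  refine (setLIntegral_mono' (measurableSet_cap R ν 0 1) fun ξ hξ => ?_).trans (setLIntegral_le_lintegral _ _)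
  rw [← mul_assoc, ← ENNReal.ofReal_mul (Real.exp_pos _).le, ← Real.exp_add]
  refine le_mul_of_one_le_left zero_le ?_
  rw [← ENNReal.ofReal_one]
  apply ENNReal.ofReal_le_ofReal
  rw [Real.one_le_exp_iff]
  obtain ⟨⟨y1, y2⟩, ⟨y3, y4⟩⟩ := cap_bx hR0 hν1 hξ
  have q1 := sq_le_sq' y1 y2
  have q2 := sq_le_sq' y3 y4
  have : sq ξ ≤ 32 * R ^ 2 := by unfold sq; nlinarith
  have : 1 / R ^ 2 * sq ξ ≤ 32 := by
    rw [one_div, inv_mul_le_iff₀ (by positivity)]; linarith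
  linarith

theorem shell_GU {R ν : ℝ} (hR : 1 ≤ R) (hν1 : ν ≤ 1) {U : Set (ℝ × ℝ)} (hUm : MeasurableSet U) (hU : volume U < ⊤) :
    ∫⁻ ξ in cap R ν 0 1, ‖GU U ξ‖ₑ ^ 2 ≤ ENNReal.ofReal (1 / R) * (ENNReal.ofReal (Real.exp 32) * (ENNReal.ofReal (4 * Real.pi ^ 2) * volume U)) := by
  have hR0 : 0 < R := by linarith
  refine le_trans ?_ (mul_le_mul_right (shell_int hR hν1 hUm hU) _)
  rw [← lintegral_const_mul' _ _ (by simp)]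
  refine setLIntegral_mono' (measurableSet_cap R ν 0 1) fun ξ hξ => ?_
  unfold GU
  rw [enorm_mul, mul_pow, mul_comm]
  refine mul_le_mul_left ?_ _
  have hn : R ≤ nrm ξ := cap_pos hξ
  rw [← ofReal_norm, Complex.norm_real, Real.norm_of_nonneg (by positivity), ← ENNReal.ofReal_pow (by positivity)]
  apply ENNReal.ofReal_le_ofReal
  rw [inv_pow, Real.sq_sqrt (nrm_nonneg _), one_div]
  gcongr

theorem caps_sum {K : ℕ} (hK : 0 < K) (R ν : ℝ) (j : ℕ) (F : ℝ × ℝ → ℝ≥0∞) :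
    ∑ l ∈ Finset.range (K ^ j), ∫⁻ ξ in cap R ν (cc K j l) (hj K j), F ξ = ∫⁻ ξ in cap R ν 0 1, F ξ := by
  have e : ∀ l, cap R ν (cc K j l) (hj K j) = cap R ν (0 + 2 * 1 * aa (K ^ j) l) (1 / (K ^ j : ℕ)) := by
    intro l
    unfold cc hj
    push_cast
    ring_nf
  simp only [e]
  rw [cap_eq_iUnion (N := K ^ j) (by positivity) one_pos]
  rw [lintegral_biUnion_finset _ (fun l _ => measurableSet_cap _ _ _ _)]
  intro l _ l' _ hl
  exact cap_disjoint (by positivity) one_pos hl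

end Wolff

open MeasureTheory Metric
open scoped ENNReal

namespace Wolff

theorem cc_abs {K j l : ℕ} (hK : 0 < K) (hl : l < K ^ j) : |cc K j l| + hj K j ≤ 1 := by
  have hK' : (0 : ℝ) < K := by exact_mod_cast hK
  have h1 : (l : ℝ) + 1 ≤ K ^ j := by exact_mod_cast hl
  have hN : (0:ℝ) < (K:ℝ) ^ j := by positivity
  have e : cc K j l = (2 * l + 1) / (K:ℝ) ^ j - 1 := by
    unfold cc aa; push_cast; field_simp
  have l0 : (0:ℝ) ≤ l := by positivity
  unfold hj
  have a1 : |cc K j l| ≤ 1 - 1 / (K:ℝ) ^ j := by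
    rw [e, abs_le]
    constructor
    · have : 1 / (K:ℝ) ^ j ≤ (2 * l + 1) / (K:ℝ) ^ j := by gcongr; linarith
      linarith
    · have : (2 * l + 1) / (K:ℝ) ^ j + 1 / (K:ℝ) ^ j ≤ 2 := by
        rw [← add_div, div_le_iff₀ hN]; linarith
      linarith
  linarith

noncomputable def CE (M : ℝ) : ℝ≥0∞ := ((2 * (⌈8 * M⌉₊ + 1) + 1 : ℕ) : ℝ≥0∞) * (8 * (CD M (8 * M) *
      (ENNReal.ofReal (4 * Real.pi ^ 2) * (4 * (ENNReal.ofReal (Real.exp 32) * (ENNReal.ofReal (4 * Real.pi ^ 2) * volume (bx M)))))))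

theorem CE_fin (M : ℝ) : CE M ≠ ⊤ := by
  have := (bx_fin M).ne
  unfold CE CD
  finiteness

theorem GG_base {K j p : ℕ} {M R : ℝ} (hK : 2 ≤ K) (hM : 1 ≤ M) (hR : 1 ≤ R) (hp : 2 ≤ p) (h2 : hj K j ≤ 1/2) (hRh : R * hj K j ^ 2 ≤ 1)
    (h1 : 1 ≤ 2 * R * hj K j) {U : Set (ℝ × ℝ)} (hUm : MeasurableSet U) (hU : U ⊆ bx M) :
    GG K R (GU U) (OM M) p j ≤ 2 * (ENNReal.ofReal (CB1 M (8 * M) * (1 + Real.log R) ^ 2 / √R) ^ (p - 2) * (ENNReal.ofReal √R * CE M)) := by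
  have hK0 : 0 < K := by omega
  have hK' : (1 : ℝ) ≤ K := by exact_mod_cast (by omega : 1 ≤ K)
  have hR0 : 0 < R := by linarith
  have hUf : volume U < ⊤ := (measure_mono hU).trans_lt (bx_fin M)
  set ν : ℝ := 1 / (K:ℝ) ^ 4 with hν
  have hν0 : 0 < ν := by positivity
  have hν1 : ν ≤ 1 := by rw [hν, div_le_one (by positivity)]; exact one_le_pow₀ hK'
  set h := hj K j with hh
  have hh0 : 0 < h := hj_pos hK0 j
  have hA : 8 * M * R * h ^ 2 ≤ 8 * M := by nlinarith
  set B := ENNReal.ofReal (CB1 M (8 * M) * (1 + Real.log R) ^ 2 / √R) with hB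
  have s1 : ∀ b, ∀ l ∈ Finset.range (K ^ j), MP R ν (GU U) (OM M) p (cc K j l) h b ≤
      B ^ (p - 2) * MP R ν (GU U) (OM M) 2 (cc K j l) h b := by
    intro b l hl
    have hc := cc_abs hK0 (Finset.mem_range.1 hl)
    unfold MP
    rw [← ENNReal.tsum_mul_left]
    refine ENNReal.tsum_le_tsum fun Q => ?_
    refine iSup₂_le fun z hz => iSup_le fun hQ => ?_
    calc SP R ν (GU U) (cc K j l) h b z ^ p = SP R ν (GU U) (cc K j l) h b z ^ (p - 2) * SP R ν (GU U) (cc K j l) h b z ^ 2 := by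
          rw [← pow_add]; congr 1; omega
      _ ≤ _ := by
          refine mul_le_mul' (pow_le_pow_left' ?_ _) ?_
          · exact iSup_le fun β => B1 (by linarith) hR hν0 hν1 hh0 h2 hc hA hz.1 hz.2.1 hz.2.2 hUm hU b β
          · exact le_iSup₂_of_le z hz (le_iSup_of_le hQ le_rfl)
  have s2 : ∀ b, ∑ l ∈ Finset.range (K ^ j), MP R ν (GU U) (OM M) 2 (cc K j l) h b ≤ ENNReal.ofReal √R * CE M := by
    intro b
    calc _ ≤ ∑ l ∈ Finset.range (K ^ j), ((2 * (⌈8 * M⌉₊ + 1) + 1 : ℕ) : ℝ≥0∞) * (ENNReal.ofReal (8 * R ^ 2 * h) * (CD M (8 * M) *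
      (ENNReal.ofReal (4 * Real.pi ^ 2) * (4 * ∫⁻ ξ in cap R ν (cc K j l) h, ‖GU U ξ‖ₑ ^ 2)))) := by
          refine Finset.sum_le_sum fun l hl => ?_
          have hc := cc_abs hK0 (Finset.mem_range.1 hl)
          exact MP2_le hM hR hν0 hν1 hh0 (by linarith) hA h1 (GU_int hUf hR0 hν1) b
      _ = ((2 * (⌈8 * M⌉₊ + 1) + 1 : ℕ) : ℝ≥0∞) * (ENNReal.ofReal (8 * R ^ 2 * h) * (CD M (8 * M) *
      (ENNReal.ofReal (4 * Real.pi ^ 2) * (4 * ∫⁻ ξ in cap R ν 0 1, ‖GU U ξ‖ₑ ^ 2)))) := by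
          simp only [← Finset.mul_sum]
          rw [caps_sum hK0]
      _ ≤ ((2 * (⌈8 * M⌉₊ + 1) + 1 : ℕ) : ℝ≥0∞) * (ENNReal.ofReal (8 * R ^ 2 * h) * (CD M (8 * M) *
      (ENNReal.ofReal (4 * Real.pi ^ 2) * (4 * (ENNReal.ofReal (1 / R) * (ENNReal.ofReal (Real.exp 32) * (ENNReal.ofReal (4 * Real.pi ^ 2) * volume (bx M)))))))) := by
          have := (shell_GU hR hν1 hUm hUf).trans (mul_le_mul_right (mul_le_mul_right (mul_le_mul_right (measure_mono hU) _) _) _)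
          gcongr
      _ = (ENNReal.ofReal (8 * R ^ 2 * h) * ENNReal.ofReal (1 / R)) * (((2 * (⌈8 * M⌉₊ + 1) + 1 : ℕ) : ℝ≥0∞) * (CD M (8 * M) *
      (ENNReal.ofReal (4 * Real.pi ^ 2) * (4 * (ENNReal.ofReal (Real.exp 32) * (ENNReal.ofReal (4 * Real.pi ^ 2) * volume (bx M))))))) := by ring
      _ ≤ (8 * ENNReal.ofReal √R) * (((2 * (⌈8 * M⌉₊ + 1) + 1 : ℕ) : ℝ≥0∞) * (CD M (8 * M) *
      (ENNReal.ofReal (4 * Real.pi ^ 2) * (4 * (ENNReal.ofReal (Real.exp 32) * (ENNReal.ofReal (4 * Real.pi ^ 2) * volume (bx M))))))) := by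
          refine mul_le_mul_left ?_ _
          rw [← ENNReal.ofReal_mul (by positivity), show (8 : ℝ≥0∞) = ENNReal.ofReal 8 by simp, ← ENNReal.ofReal_mul (by norm_num)]
          apply ENNReal.ofReal_le_ofReal
          have e : 8 * R ^ 2 * h * (1 / R) = 8 * (R * h) := by field_simp
          rw [e]
          gcongr
          apply Real.le_sqrt_of_sq_le
          nlinarith
      _ = _ := by unfold CE; ring
  unfold GG
  calc _ ≤ ∑' b, (2⁻¹ : ℝ≥0∞) ^ (b * p) * (B ^ (p - 2) * (ENNReal.ofReal √R * CE M)) := by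
        refine ENNReal.tsum_le_tsum fun b => mul_le_mul_right ?_ _
        refine (Finset.sum_le_sum (s1 b)).trans ?_
        rw [← Finset.mul_sum]
        exact mul_le_mul_right (s2 b) _
    _ = (∑' b, (2⁻¹ : ℝ≥0∞) ^ (b * p)) * (B ^ (p - 2) * (ENNReal.ofReal √R * CE M)) := by rw [ENNReal.tsum_mul_right]
    _ ≤ _ := mul_le_mul_left (geom_le_two' p (by omega)) _

theorem GG1_bd {q : ℕ} (hq : 3 ≤ q) {M : ℝ} (hM : 1 ≤ M) : ∃ C : ℝ, 0 ≤ C ∧ ∀ R : ℝ, ((a0 ^ q : ℕ) : ℝ) ^ 6 ≤ R →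
    ∀ U : Set (ℝ × ℝ), MeasurableSet U → U ⊆ bx M →
    GG (a0 ^ q) R (GU U) (OM M) (22 * q) 1 ≤ ENNReal.ofReal (C * (1 + Real.log R) ^ (44 * q) * (R * R ^ (23 / (2 * q : ℝ)))) := by
  set K := a0 ^ q with hKd
  have hK2 : 2 ≤ K := by
    calc 2 ≤ a0 := by unfold a0; norm_num
      _ = a0 ^ 1 := (pow_one _).symm
      _ ≤ K := Nat.pow_le_pow_right (by unfold a0; norm_num) (by omega)
  have hK1 : (1:ℝ) ≤ K := by exact_mod_cast (by omega : 1 ≤ K)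
  have hK0 : (0:ℝ) < K := by linarith
  have hKt : (2:ℝ) ≤ K := by exact_mod_cast hK2
  have ha1 : (1:ℝ) ≤ a0 := by unfold a0; norm_num
  set Xr : ℝ := (K:ℝ) ^ (22 * q - 1) * (a0:ℝ) ^ 23 with hXr
  have hX1 : 1 ≤ Xr := one_le_mul_of_one_le_of_one_le (one_le_pow₀ hK1) (one_le_pow₀ ha1)
  set n := 22 * q - 2 with hn
  set B := CB1 M (8 * M) with hB
  have hB0 : 0 ≤ B := by rw [hB]; unfold CB1; positivity
  refine ⟨Xr ^ 2 * (2 * (B ^ n * (CE M).toReal)), by positivity, fun R hR U hUm hU => ?_⟩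
  have hR1 : 1 ≤ R := le_trans (one_le_pow₀ hK1) hR
  have hR0 : 0 < R := by linarith
  have hs0 : 0 < √R := Real.sqrt_pos.2 hR0
  have hs2 : √R ^ 2 = R := Real.sq_sqrt hR0.le
  have hUf : volume U < ⊤ := (measure_mono hU).trans_lt (bx_fin M)
  have hν1 : 1 / (K:ℝ) ^ 4 ≤ 1 := by rw [div_le_one (by positivity)]; exact one_le_pow₀ hK1
  obtain ⟨J, hJ1, hJ2⟩ := exists_nat_pow_near (x := √R) (y := (K:ℝ)) (Real.one_le_sqrt.2 hR1) (by linarith)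
  set L := 1 + Real.log R with hL
  have hL1 : 1 ≤ L := by have := Real.log_nonneg hR1; linarith
  refine recursion hq hR0 (GU_int hUf hR0 hν1) (X := ENNReal.ofReal Xr) ?_ J ?_
  · rw [hXr, ENNReal.ofReal_mul (by positivity), ENNReal.ofReal_pow (by positivity), ENNReal.ofReal_pow (by positivity),
      ENNReal.ofReal_natCast, ENNReal.ofReal_natCast]
  intro i hi
  have hh : hj K (1 + (J + i)) = 1 / (K:ℝ) ^ (1 + (J + i)) := rfl
  have hp0 : 0 < hj K (1 + (J + i)) := hj_pos (by omega) _
  have c1 : hj K (1 + (J + i)) ≤ 1 / √R := by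
    rw [hh]
    gcongr
    calc √R ≤ (K:ℝ) ^ (J + 1) := hJ2.le
      _ ≤ _ := pow_le_pow_right₀ hK1 (by omega)
  have c2 : hj K (1 + (J + i)) ≤ 1 / 2 := by
    rw [hh]
    gcongr
    calc (2:ℝ) ≤ K := hKt
      _ = (K:ℝ) ^ 1 := (pow_one _).symm
      _ ≤ _ := pow_le_pow_right₀ hK1 (by omega)
  have c3 : R * hj K (1 + (J + i)) ^ 2 ≤ 1 := by
    calc R * hj K (1 + (J + i)) ^ 2 ≤ R * (1 / √R) ^ 2 := by gcongr
      _ = 1 := by rw [div_pow, hs2]; field_simp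
  have c4 : 1 ≤ 2 * R * hj K (1 + (J + i)) := by
    have k1 : (K:ℝ) ^ (1 + (J + i)) ≤ √R * K ^ 3 := by
      calc (K:ℝ) ^ (1 + (J + i)) ≤ (K:ℝ) ^ (J + 3) := pow_le_pow_right₀ hK1 (by omega)
        _ = (K:ℝ) ^ J * K ^ 3 := pow_add _ _ _
        _ ≤ _ := by gcongr
    have k2 : (K:ℝ) ^ 3 ≤ √R := by
      apply Real.le_sqrt_of_sq_le
      rw [← pow_mul]; exact hR
    have k3 : (K:ℝ) ^ (1 + (J + i)) ≤ R := by
      calc _ ≤ √R * K ^ 3 := k1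
        _ ≤ √R * √R := by gcongr
        _ = R := by rw [← pow_two, hs2]
    rw [hh, mul_one_div, one_le_div (by positivity)]
    linarith
  have hb := GG_base (p := 22 * q) hK2 hM hR1 (by omega) c2 c3 c4 hUm hU
  have hXJ : Xr ^ (J + i) ≤ √R ^ (22 * q - 1) * R ^ (23 / (2 * q : ℝ)) * Xr ^ 2 := by
    calc Xr ^ (J + i) ≤ Xr ^ (J + 2) := pow_le_pow_right₀ hX1 (by omega)
      _ = Xr ^ J * Xr ^ 2 := pow_add _ _ _
      _ ≤ _ := by
        refine mul_le_mul_of_nonneg_right ?_ (by positivity)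
        have e1 : Xr ^ J = ((K:ℝ) ^ J) ^ (22 * q - 1) * ((a0:ℝ) ^ J) ^ 23 := by
          rw [hXr, mul_pow, ← pow_mul, ← pow_mul, ← pow_mul, ← pow_mul, mul_comm J, mul_comm J]
        rw [e1]
        have e2 : (a0:ℝ) ^ J ≤ R ^ (1 / (2 * q : ℝ)) := by
          have hq0 : (q : ℝ) ≠ 0 := by positivity
          have e3 : ((a0:ℝ) ^ J) ^ q = (K:ℝ) ^ J := by
            rw [hKd, ← pow_mul, mul_comm, pow_mul]; push_cast; rfl
          calc (a0:ℝ) ^ J = (((a0:ℝ) ^ J) ^ q) ^ ((q:ℝ)⁻¹) := by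
                rw [Real.pow_rpow_inv_natCast (by positivity) (by omega)]
            _ ≤ √R ^ ((q:ℝ)⁻¹) := by
                rw [e3]
                exact Real.rpow_le_rpow (by positivity) hJ1 (by positivity)
            _ = R ^ (1 / (2 * q : ℝ)) := by
                rw [Real.sqrt_eq_rpow, ← Real.rpow_mul hR0.le]
                congr 1
                field_simp
        have e4 : (R ^ (1 / (2 * q : ℝ))) ^ 23 = R ^ (23 / (2 * q : ℝ)) := by
          rw [← Real.rpow_natCast, ← Real.rpow_mul hR0.le]
          congr 1
          push_cast; ring
        rw [← e4]
        gcongr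
  calc ENNReal.ofReal Xr ^ (J + i) * GG K R (GU U) (OM M) (22 * q) (1 + (J + i))
      ≤ ENNReal.ofReal (√R ^ (22 * q - 1) * R ^ (23 / (2 * q : ℝ)) * Xr ^ 2) *
        (2 * (ENNReal.ofReal (B * L ^ 2 / √R) ^ n * (ENNReal.ofReal √R * CE M))) := by
        refine mul_le_mul' ?_ hb
        rw [← ENNReal.ofReal_pow (by linarith)]
        exact ENNReal.ofReal_le_ofReal hXJ
    _ = ENNReal.ofReal ((√R ^ (22 * q - 1) * R ^ (23 / (2 * q : ℝ)) * Xr ^ 2) * (2 * ((B * L ^ 2 / √R) ^ n * (√R * (CE M).toReal)))) := by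
        rw [ENNReal.ofReal_mul (p := √R ^ (22 * q - 1) * R ^ (23 / (2 * q : ℝ)) * Xr ^ 2) (by positivity),
          ENNReal.ofReal_mul (p := 2) (by norm_num), ENNReal.ofReal_mul (p := (B * L ^ 2 / √R) ^ n) (by positivity),
          ENNReal.ofReal_mul (p := √R) (by positivity), ENNReal.ofReal_pow (by positivity), ENNReal.ofReal_toReal (CE_fin M)]
        simp
    _ ≤ _ := by
        apply ENNReal.ofReal_le_ofReal
        have e5 : √R ^ (22 * q - 1) * √R = √R ^ n * R := by
          calc √R ^ (22 * q - 1) * √R = √R ^ n * √R ^ 2 := by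
                rw [← pow_succ, ← pow_add]; congr 1; omega
            _ = _ := by rw [hs2]
        have e6 : L ^ (2 * n) ≤ L ^ (44 * q) := pow_le_pow_right₀ hL1 (by omega)
        calc (√R ^ (22 * q - 1) * R ^ (23 / (2 * q : ℝ)) * Xr ^ 2) * (2 * ((B * L ^ 2 / √R) ^ n * (√R * (CE M).toReal)))
            = (√R ^ (22 * q - 1) * √R) * R ^ (23 / (2 * q : ℝ)) * Xr ^ 2 * (2 * (B * L ^ 2 / √R) ^ n * (CE M).toReal) := by ring
          _ = Xr ^ 2 * (2 * (B ^ n * (CE M).toReal)) * L ^ (2 * n) * (R * R ^ (23 / (2 * q : ℝ))) := by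
              rw [e5, div_pow, mul_pow B, ← pow_mul L]
              field_simp
          _ ≤ _ := by gcongr

end Wolff

open MeasureTheory Metric
open scoped ENNReal
namespace Wolff

theorem lim_of_deriv {f f' : ℝ → ℝ} {c : ℝ} (hc : 0 ≤ c) (hf : ∀ t, 1 ≤ t → HasDerivAt f (f' t) t)
    (hb : ∀ t, 1 ≤ t → |f' t| ≤ c / t ^ 2) : ∃ a, ∀ t, 1 ≤ t → |f t - a| ≤ c / t := by
  have hd : ∀ t : ℝ, 1 ≤ t → HasDerivAt (fun t => c / t) (-(c / t ^ 2)) t := by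
    intro t ht
    have := (hasDerivAt_inv (show t ≠ 0 by linarith)).const_mul c
    refine (this.congr_deriv (by ring)).congr_of_eventuallyEq ?_
    exact Filter.Eventually.of_forall fun x => by simp [div_eq_mul_inv]
  have h1 : AntitoneOn (fun t => f t + c / t) (Set.Ici 1) := by
    refine antitoneOn_of_hasDerivWithinAt_nonpos (convex_Ici 1)
      (fun x hx => ((hf x hx).add (hd x hx)).continuousAt.continuousWithinAt)
      (fun x hx => ((hf x (interior_subset hx)).add (hd x (interior_subset hx))).hasDerivWithinAt) fun x hx => ?_
    have := (abs_le.1 (hb x (interior_subset hx))).2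
    linarith
  have h2 : MonotoneOn (fun t => f t - c / t) (Set.Ici 1) := by
    refine monotoneOn_of_hasDerivWithinAt_nonneg (convex_Ici 1)
      (fun x hx => ((hf x hx).sub (hd x hx)).continuousAt.continuousWithinAt)
      (fun x hx => ((hf x (interior_subset hx)).sub (hd x (interior_subset hx))).hasDerivWithinAt) fun x hx => ?_
    have := (abs_le.1 (hb x (interior_subset hx))).1
    linarith
  have h3 : ∀ s t : ℝ, 1 ≤ s → 1 ≤ t → f s - c / s ≤ f t + c / t := by
    intro s t hs ht
    have hu : 1 ≤ max s t := le_trans hs (le_max_left _ _)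
    have e1 := h2 (show s ∈ Set.Ici 1 from hs) (show max s t ∈ Set.Ici 1 from hu) (le_max_left _ _)
    have e2 := h1 (show t ∈ Set.Ici 1 from ht) (show max s t ∈ Set.Ici 1 from hu) (le_max_right _ _)
    have : 0 ≤ c / max s t := by positivity
    simp only at e1 e2
    linarith
  refine ⟨sSup ((fun t => f t - c / t) '' Set.Ici 1), fun t ht => ?_⟩
  have hbd : BddAbove ((fun t => f t - c / t) '' Set.Ici 1) := by
    refine ⟨f 1 + c / 1, ?_⟩
    rintro _ ⟨s, hs, rfl⟩
    exact h3 s 1 hs le_rfl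
  have e1 : f t - c / t ≤ sSup ((fun t => f t - c / t) '' Set.Ici 1) := le_csSup hbd ⟨t, ht, rfl⟩
  have e2 : sSup ((fun t => f t - c / t) '' Set.Ici 1) ≤ f t + c / t := by
    refine csSup_le ⟨_, 1, Set.mem_Ici.2 le_rfl, rfl⟩ ?_
    rintro _ ⟨s, hs, rfl⟩
    exact h3 s t hs ht
  rw [abs_le]; constructor <;> linarith

noncomputable def JJ (t : ℝ) : ℝ := ∫ φ in (0:ℝ)..(2 * Real.pi), Real.cos (t * Real.cos φ)
noncomputable def JJ1 (t : ℝ) : ℝ := ∫ φ in (0:ℝ)..(2 * Real.pi), -(Real.sin (t * Real.cos φ) * Real.cos φ)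
noncomputable def JJ2 (t : ℝ) : ℝ := ∫ φ in (0:ℝ)..(2 * Real.pi), -(Real.cos (t * Real.cos φ) * Real.cos φ ^ 2)

theorem deriv_param {F F' : ℝ → ℝ → ℝ} (hF : Continuous fun p : ℝ × ℝ => F p.1 p.2)
    (hF' : Continuous fun p : ℝ × ℝ => F' p.1 p.2) (hb : ∀ t φ, ‖F' t φ‖ ≤ 1)
    (hd : ∀ t φ, HasDerivAt (fun t => F t φ) (F' t φ) t) (t : ℝ) :
    HasDerivAt (fun t => ∫ φ in (0:ℝ)..(2 * Real.pi), F t φ) (∫ φ in (0:ℝ)..(2 * Real.pi), F' t φ) t := by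
  have c1 : ∀ t, Continuous (F t) := fun t => hF.comp (Continuous.prodMk_right t)
  have c2 : ∀ t, Continuous (F' t) := fun t => hF'.comp (Continuous.prodMk_right t)
  exact (intervalIntegral.hasDerivAt_integral_of_dominated_loc_of_deriv_le (s := Set.univ) (bound := fun _ => 1) Filter.univ_mem
    (Filter.Eventually.of_forall fun t => (c1 t).aestronglyMeasurable)
    ((c1 t).intervalIntegrable _ _) (c2 t).aestronglyMeasurable
    (Filter.Eventually.of_forall fun φ _ t _ => hb t φ) (by simp)
    (Filter.Eventually.of_forall fun φ _ t _ => hd t φ)).2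

theorem JJ_deriv (t : ℝ) : HasDerivAt JJ (JJ1 t) t := by
  unfold JJ JJ1
  refine deriv_param (F := fun t φ => Real.cos (t * Real.cos φ)) (F' := fun t φ => -(Real.sin (t * Real.cos φ) * Real.cos φ))
    (by fun_prop) (by fun_prop) ?_ ?_ t
  · intro t φ
    rw [norm_neg, norm_mul]
    exact mul_le_one₀ (Real.abs_sin_le_one _) (norm_nonneg _) (Real.abs_cos_le_one _)
  · intro t φ
    have := ((hasDerivAt_id t).mul_const (Real.cos φ)).cos
    simpa using this

theorem JJ1_deriv (t : ℝ) : HasDerivAt JJ1 (JJ2 t) t := by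
  unfold JJ1 JJ2
  refine deriv_param (F := fun t φ => -(Real.sin (t * Real.cos φ) * Real.cos φ)) (F' := fun t φ => -(Real.cos (t * Real.cos φ) * Real.cos φ ^ 2))
    (by fun_prop) (by fun_prop) ?_ ?_ t
  · intro t φ
    rw [norm_neg, norm_mul, norm_pow]
    exact mul_le_one₀ (Real.abs_cos_le_one _) (by positivity) (pow_le_one₀ (norm_nonneg _) (Real.abs_cos_le_one _))
  · intro t φ
    have := ((((hasDerivAt_id t).mul_const (Real.cos φ)).sin).mul_const (Real.cos φ)).neg
    simp only [id] at this
    exact this.congr_deriv (by ring)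

theorem JJ_ode (t : ℝ) : JJ1 t = - t * (JJ2 t + JJ t) := by
  have h : ∫ φ in (0:ℝ)..(2 * Real.pi), (Real.cos φ * Real.sin (t * Real.cos φ) - t * (Real.sin φ ^ 2 * Real.cos (t * Real.cos φ))) = 0 := by
    have hd : ∀ φ ∈ Set.uIcc 0 (2 * Real.pi), HasDerivAt (fun φ => Real.sin φ * Real.sin (t * Real.cos φ))
        (Real.cos φ * Real.sin (t * Real.cos φ) - t * (Real.sin φ ^ 2 * Real.cos (t * Real.cos φ))) φ := by
      intro φ _
      have := (Real.hasDerivAt_sin φ).mul (((Real.hasDerivAt_cos φ).const_mul t).sin)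
      exact this.congr_deriv (by ring)
    rw [intervalIntegral.integral_eq_sub_of_hasDerivAt hd (Continuous.intervalIntegrable (by fun_prop) _ _)]
    simp
  have e : JJ2 t + JJ t = ∫ φ in (0:ℝ)..(2 * Real.pi), Real.sin φ ^ 2 * Real.cos (t * Real.cos φ) := by
    unfold JJ2 JJ
    rw [← intervalIntegral.integral_add (Continuous.intervalIntegrable (by fun_prop) _ _) (Continuous.intervalIntegrable (by fun_prop) _ _)]
    congr 1
    ext φ
    rw [Real.sin_sq]; ring
  rw [intervalIntegral.integral_sub (Continuous.intervalIntegrable (by fun_prop) _ _) (Continuous.intervalIntegrable (by fun_prop) _ _),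
    intervalIntegral.integral_const_mul, ← e] at h
  have e1 : JJ1 t = - ∫ φ in (0:ℝ)..(2 * Real.pi), Real.cos φ * Real.sin (t * Real.cos φ) := by
    unfold JJ1
    rw [← intervalIntegral.integral_neg]
    congr 1; ext φ; ring
  rw [e1]; linarith

/-- Bessel asymptotics -/
theorem JJ_asymp : ∃ a b c : ℝ, 0 ≤ c ∧ ∀ t, 1 ≤ t →
    |JJ t - (a * Real.cos t + b * Real.sin t) / √t| ≤ c / (t * √t) := by
  set w : ℝ → ℝ := fun t => √t * JJ t with hw
  set w1 : ℝ → ℝ := fun t => JJ t / (2 * √t) + √t * JJ1 t with hw1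
  have hs : ∀ t : ℝ, 1 ≤ t → HasDerivAt (fun t => √t) (1 / (2 * √t)) t := fun t ht =>
    Real.hasDerivAt_sqrt (by linarith)
  have hwd : ∀ t, 1 ≤ t → HasDerivAt w (w1 t) t := by
    intro t ht
    exact ((hs t ht).mul (JJ_deriv t)).congr_deriv (by simp only [hw1]; ring)
  have hw1d : ∀ t, 1 ≤ t → HasDerivAt w1 (-(1 + 1 / (4 * t ^ 2)) * w t) t := by
    intro t ht
    have hp : 0 < √t := Real.sqrt_pos.2 (by linarith)
    have h2 : √t ^ 2 = t := Real.sq_sqrt (by linarith)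
    have := ((JJ_deriv t).div ((hs t ht).const_mul 2) (by positivity)).add ((hs t ht).mul (JJ1_deriv t))
    refine this.congr_deriv ?_
    have e : JJ2 t = -JJ t - JJ1 t / t := by
      rw [JJ_ode]
      have : t ≠ 0 := by linarith
      field_simp; ring
    simp only [hw]
    rw [e]
    generalize √t = s at *
    subst h2
    field_simp
    ring
  set N : ℝ → ℝ := fun t => w t ^ 2 + w1 t ^ 2 with hN
  have hNd : ∀ t, 1 ≤ t → HasDerivAt N (-(w t * w1 t) / (2 * t ^ 2)) t := by
    intro t ht
    have ht0 : t ≠ 0 := by linarith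
    have := ((hwd t ht).pow 2).add ((hw1d t ht).pow 2)
    refine this.congr_deriv ?_
    simp only [Nat.cast_ofNat]
    field_simp
    ring
  have hed : ∀ t : ℝ, 1 ≤ t → HasDerivAt (fun t => Real.exp ((4 * t)⁻¹)) (Real.exp ((4 * t)⁻¹) * (-(4 / (4 * t) ^ 2))) t := by
    intro t ht
    have : HasDerivAt (fun t : ℝ => 4 * t) 4 t := by simpa using (hasDerivAt_id t).const_mul 4
    exact ((this.inv (by linarith)).exp).congr_deriv (by simp only [Pi.inv_apply]; ring)
  have hant : AntitoneOn (fun t => N t * Real.exp ((4 * t)⁻¹)) (Set.Ici 1) := by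
    refine antitoneOn_of_hasDerivWithinAt_nonpos (convex_Ici 1)
      (fun x hx => ((hNd x hx).mul (hed x hx)).continuousAt.continuousWithinAt)
      (fun x hx => ((hNd x (interior_subset hx)).mul (hed x (interior_subset hx))).hasDerivWithinAt) fun t ht => ?_
    have ht1 : (1:ℝ) ≤ t := interior_subset ht
    have : -(w t * w1 t) / (2 * t ^ 2) * Real.exp ((4 * t)⁻¹) + N t * (Real.exp ((4 * t)⁻¹) * (-(4 / (4 * t) ^ 2)))
      = -((w t + w1 t) ^ 2 * Real.exp ((4 * t)⁻¹) / (4 * t ^ 2)) := by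
      simp only [hN]
      field_simp
      ring
    rw [this]
    have : 0 ≤ (w t + w1 t) ^ 2 * Real.exp ((4 * t)⁻¹) / (4 * t ^ 2) := by positivity
    linarith
  set c0 := √(N 1 * Real.exp ((4 * 1)⁻¹)) with hc0
  have hN0 : ∀ t, 0 ≤ N t := fun t => by simp only [hN]; positivity
  have hwb : ∀ t, 1 ≤ t → |w t| ≤ c0 := by
    intro t ht
    apply Real.abs_le_sqrt
    have e := hant (show (1:ℝ) ∈ Set.Ici 1 from Set.mem_Ici.2 le_rfl) (show t ∈ Set.Ici 1 from ht) ht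
    have e1 : (1:ℝ) ≤ Real.exp ((4 * t)⁻¹) := Real.one_le_exp (by positivity)
    have e2 : N t ≤ N t * Real.exp ((4 * t)⁻¹) := le_mul_of_one_le_right (hN0 t) e1
    have e3 : w t ^ 2 ≤ N t := by simp only [hN]; nlinarith [sq_nonneg (w1 t)]
    simp only at e
    linarith
  have hc0' : 0 ≤ c0 := Real.sqrt_nonneg _
  have key : ∀ (v : ℝ → ℝ), (∀ t, |v t| ≤ 1) → ∀ t, 1 ≤ t → |w t * v t / (4 * t ^ 2)| ≤ c0 / t ^ 2 := by
    intro v hv t ht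
    have ht0 : 0 < t := by linarith
    rw [abs_div, abs_mul, abs_of_pos (show 0 < 4 * t ^ 2 by positivity)]
    calc |w t| * |v t| / (4 * t ^ 2) ≤ c0 * 1 / (1 * t ^ 2) := by
          gcongr
          · exact hwb t ht
          · exact hv t
          · norm_num
      _ = _ := by ring
  obtain ⟨a, ha⟩ := lim_of_deriv (f := fun t => w t * Real.cos t - w1 t * Real.sin t)
    (f' := fun t => w t * Real.sin t / (4 * t ^ 2)) hc0' (fun t ht => by
      have := ((hwd t ht).mul (Real.hasDerivAt_cos t)).sub ((hw1d t ht).mul (Real.hasDerivAt_sin t))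
      refine this.congr_deriv ?_
      have ht0 : t ≠ 0 := by linarith
      field_simp
      ring) (key _ Real.abs_sin_le_one)
  obtain ⟨b, hb⟩ := lim_of_deriv (f := fun t => w t * Real.sin t + w1 t * Real.cos t)
    (f' := fun t => w t * (-Real.cos t) / (4 * t ^ 2)) hc0' (fun t ht => by
      have := ((hwd t ht).mul (Real.hasDerivAt_sin t)).add ((hw1d t ht).mul (Real.hasDerivAt_cos t))
      refine this.congr_deriv ?_
      have ht0 : t ≠ 0 := by linarith
      field_simp
      ring) (key _ (fun t => by rw [abs_neg]; exact Real.abs_cos_le_one t))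
  refine ⟨a, b, 2 * c0, by positivity, fun t ht => ?_⟩
  have ht0 : 0 < t := by linarith
  have hp : 0 < √t := Real.sqrt_pos.2 ht0
  have e1 := ha t ht
  have e2 := hb t ht
  set A := w t * Real.cos t - w1 t * Real.sin t
  set B := w t * Real.sin t + w1 t * Real.cos t
  have e3 : w t = A * Real.cos t + B * Real.sin t := by
    have := Real.sin_sq_add_cos_sq t
    simp only [A, B]
    linear_combination (-(w t)) * this
  have e4 : JJ t - (a * Real.cos t + b * Real.sin t) / √t = ((A - a) * Real.cos t + (B - b) * Real.sin t) / √t := by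
    have : JJ t = w t / √t := by simp only [hw]; field_simp
    rw [this, e3]
    ring
  rw [e4, abs_div, abs_of_pos hp, div_le_div_iff₀ hp (by positivity)]
  have e5 : |(A - a) * Real.cos t + (B - b) * Real.sin t| ≤ c0 / t + c0 / t := by
    refine (abs_add_le _ _).trans ?_
    rw [abs_mul, abs_mul]
    have := Real.abs_cos_le_one t
    have := Real.abs_sin_le_one t
    have : 0 ≤ c0 / t := by positivity
    gcongr <;> nlinarith [abs_nonneg (A - a), abs_nonneg (B - b), abs_nonneg (Real.cos t), abs_nonneg (Real.sin t)]
  calc _ ≤ (c0 / t + c0 / t) * (t * √t) := by gcongr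
    _ = _ := by field_simp; ring

end Wolff

open MeasureTheory Metric
open scoped ENNReal
namespace Wolff

theorem caps_sum_int {K : ℕ} (hK : 0 < K) (R ν : ℝ) (j : ℕ) {F : ℝ × ℝ → ℂ} (hF : IntegrableOn F (cap R ν 0 1)) :
    ∫ ξ in cap R ν 0 1, F ξ = ∑ l ∈ Finset.range (K ^ j), ∫ ξ in cap R ν (cc K j l) (hj K j), F ξ := by
  have e : ∀ l, cap R ν (cc K j l) (hj K j) = cap R ν (0 + 2 * 1 * aa (K ^ j) l) (1 / (K ^ j : ℕ)) := by
    intro l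
    unfold cc hj
    push_cast
    congr 1
    ring
  have hN : 0 < K ^ j := by positivity
  simp_rw [e]
  rw [cap_eq_iUnion (c := 0) hN one_pos]
  refine integral_biUnion_finset _ (fun l _ => measurableSet_cap _ _ _ _) ?_ ?_
  · intro l _ l' _ hl
    exact cap_disjoint hN one_pos hl
  · intro l hl
    exact hF.mono_set (cap_sub hN one_pos (by simpa using hl))

theorem nrm_eq {ξ : ℝ × ℝ} (hξ : 0 < ξ.1) : nrm ξ = ww ξ * (1 + kk ξ ^ 2) := by
  have h0 : nrm ξ + ξ.1 ≠ 0 := by have := nrm_nonneg ξ; positivity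
  have := nrm_sq ξ
  unfold ww kk
  field_simp
  nlinarith

theorem mb_gauss {R ν c h lam : ℝ} (hR : 0 < R) (hν : 0 < ν) (hh : 0 < h) (hν1 : ν ≤ 1 / 64) (hh1 : h ≤ 1 / 64)
    (hc : |c| ≤ 1) (hl : 0 ≤ lam) : MB R ν c h (fun ξ => ((Real.exp (-lam * sq ξ) : ℝ) : ℂ)) 1 := by
  have hst := sm_cap (c := c) hR hν hh
  have hs := mulBd_s hst
  have ht := mulBd_t hst
  have hn : ‖(ν : ℂ)‖ = ν := by simp [abs_of_pos hν]
  have h1 : MB R ν c h (fun ξ => (ν : ℂ) * ss R ν ξ) (1 / 16) := (hs.const_mul (ν : ℂ)).mono (by rw [hn]; linarith)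
  have hc1 : 1 ≤ 1 + c ^ 2 := by nlinarith [sq_nonneg c]
  have hd1 : ‖((4 * h * c / (1 + c ^ 2) : ℝ) : ℂ)‖ ≤ 1 / 16 := by
    rw [Complex.norm_real, Real.norm_eq_abs, abs_div, abs_mul, abs_of_pos (show 0 < 4 * h by positivity), abs_of_pos (show 0 < 1 + c ^ 2 by positivity),
      div_le_iff₀ (by positivity)]
    nlinarith [abs_nonneg c]
  have hd2 : ‖((4 * h ^ 2 / (1 + c ^ 2) : ℝ) : ℂ)‖ ≤ 1 / 1024 := by
    rw [Complex.norm_real, Real.norm_eq_abs, abs_of_nonneg (by positivity), div_le_iff₀ (by positivity)]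
    nlinarith
  have h2 : MB R ν c h (fun ξ => ((4 * h * c / (1 + c ^ 2) : ℝ) : ℂ) * tt c h ξ + ((4 * h ^ 2 / (1 + c ^ 2) : ℝ) : ℂ) * (tt c h ξ : ℂ) ^ 2) (1 / 16 + 1 / 1024) :=
    ((ht.const_mul _).add hst ((ht.pow 2).const_mul _)).mono (by linarith)
  have h3 := (h1.add hst h2).add hst (h1.mul h2)
  have h4 := (h3.pow 2).add hst (h3.const_mul 2)
  set X : ℝ := lam * (R * (1 + c ^ 2)) ^ 2 with hX
  have hX0 : 0 ≤ X := by positivity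
  have h5 := ((h4.const_mul ((-X : ℝ) : ℂ)).exp hst).const_mul ((Real.exp (-X) : ℝ) : ℂ)
  refine (MulBd.congr h5 ?_).mono ?_
  · filter_upwards [ae_restrict_mem (measurableSet_cap R ν c h)] with ξ hξ
    have e : sq ξ = (R * (1 + ν * ss R ν ξ) * (1 + (c + 2 * h * tt c h ξ) ^ 2)) ^ 2 := by
      rw [← ww_eq hR hν, ← kk_eq hh, ← nrm_eq hξ.1, nrm_sq]; rfl
    rw [e]
    push_cast
    rw [← Complex.exp_add]
    congr 1
    have hc2 : (1 + (c:ℂ) ^ 2) ≠ 0 := by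
      exact_mod_cast (by positivity : (1 + c ^ 2) ≠ 0)
    rw [hX]
    push_cast
    field_simp
    ring
  · rw [Complex.norm_real, Complex.norm_real, Real.norm_eq_abs, Real.norm_eq_abs, abs_of_pos (Real.exp_pos _), abs_neg, abs_of_nonneg hX0, ← Real.exp_add]
    refine Real.exp_le_one_iff.2 ?_
    have : (1 / 16 + (1 / 16 + 1 / 1024) + 1 / 16 * (1 / 16 + 1 / 1024)) ^ 2 + ‖(2:ℂ)‖ * (1 / 16 + (1 / 16 + 1 / 1024) + 1 / 16 * (1 / 16 + 1 / 1024) : ℝ) ≤ 1 := by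
      norm_num
    nlinarith

theorem HC_main {R ν c h lam : ℝ} (hR : 0 < R) (hν : 0 < ν) (hh : 0 < h) (hν1 : ν ≤ 1 / 64) (hh1 : h ≤ 1 / 64)
    (hc : |c| ≤ 1) (hl : 0 ≤ lam) {G : ℝ × ℝ → ℂ} (hG : IntegrableOn G (cap R ν c h)) {z : ℝ × ℝ × ℝ} {C : ℝ}
    (hC : HC R ν G c h 0 z C) : ‖∫ ξ in cap R ν c h, gz G z ξ * ((Real.exp (-lam * sq ξ) : ℝ) : ℂ)‖ ≤ C := by
  have := (mb_gauss hR hν hh hν1 hh1 hc hl).bound _ (gz_integrable hG z) 0 C hC 0 0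
  simpa [mom] using this

end Wolff

open MeasureTheory Metric
open scoped ENNReal
namespace Wolff

theorem vol_bx {M : ℝ} (hM : 0 ≤ M) : (volume (bx M)).toReal = (2 * M) ^ 2 := by
  unfold bx
  rw [Measure.volume_eq_prod, Measure.prod_prod, Real.volume_Icc, ENNReal.toReal_mul, ENNReal.toReal_ofReal (by linarith)]
  ring

noncomputable def EC : ℝ := Real.exp 32 * (4 * Real.pi ^ 2)

theorem shell_L1 {R ν : ℝ} (hR : 1 ≤ R) (hν1 : ν ≤ 1) {U : Set (ℝ × ℝ)} (hUm : MeasurableSet U) (hU : volume U < ⊤) :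
    ∫ ξ in cap R ν 0 1, ‖Uh U ξ‖ ≤ R * (EC * (volume U).toReal + 64) := by
  have hR0 : 0 < R := by linarith
  have hfin := cap_fin (c := 0) (h := 1) hR0 hν1
  have i2 : IsFiniteMeasure (volume.restrict (cap R ν 0 1)) := ⟨by simpa using hfin⟩
  have hc := cont_Uh hU
  have i1 : IntegrableOn (fun ξ => ‖Uh U ξ‖ ^ 2) (cap R ν 0 1) := by
    refine Measure.integrableOn_of_bounded (M := (volume U).toReal ^ 2) hfin.ne (by fun_prop) ?_
    refine Filter.Eventually.of_forall fun ξ => ?_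
    rw [norm_pow, norm_norm]
    exact pow_le_pow_left₀ (norm_nonneg _) (Uh_le hU ξ) 2
  have i0 : IntegrableOn (fun ξ => ‖Uh U ξ‖) (cap R ν 0 1) := by
    refine Measure.integrableOn_of_bounded (M := (volume U).toReal) hfin.ne (by fun_prop) ?_
    refine Filter.Eventually.of_forall fun ξ => ?_
    rw [norm_norm]
    exact Uh_le hU ξ
  have e1 : ∫ ξ in cap R ν 0 1, ‖Uh U ξ‖ ^ 2 ≤ EC * (volume U).toReal := by
    rw [integral_eq_lintegral_of_nonneg_ae (Filter.Eventually.of_forall fun ξ => by positivity) (by fun_prop)]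
    refine ENNReal.toReal_le_of_le_ofReal (by unfold EC; positivity) ?_
    have := shell_int hR hν1 hUm hU
    rw [EC, ENNReal.ofReal_mul (by positivity), ENNReal.ofReal_mul (by positivity), ENNReal.ofReal_toReal hU.ne, mul_assoc]
    refine le_trans (le_of_eq ?_) this
    congr 1; ext ξ
    rw [ENNReal.ofReal_pow (norm_nonneg _), ofReal_norm]
  have e2 : (volume (cap R ν 0 1)).toReal ≤ 64 * R ^ 2 := by
    calc _ ≤ (volume (bx (4 * R))).toReal := ENNReal.toReal_mono (bx_fin _).ne (measure_mono (cap_bx hR0 hν1))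
      _ = _ := by rw [vol_bx (by positivity)]; ring
  calc ∫ ξ in cap R ν 0 1, ‖Uh U ξ‖ ≤ ∫ ξ in cap R ν 0 1, (R * ‖Uh U ξ‖ ^ 2 + R⁻¹) := by
        refine integral_mono i0 ((i1.const_mul R).add (integrable_const _)) fun ξ => ?_
        have : 0 ≤ (R * ‖Uh U ξ‖ - 1) ^ 2 := sq_nonneg _
        have h0 : ‖Uh U ξ‖ ≤ (R ^ 2 * ‖Uh U ξ‖ ^ 2 + 1) / R := by
          rw [le_div_iff₀ hR0]; nlinarith [norm_nonneg (Uh U ξ)]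
        calc _ ≤ _ := h0
          _ = _ := by field_simp
    _ = R * (∫ ξ in cap R ν 0 1, ‖Uh U ξ‖ ^ 2) + R⁻¹ * (volume (cap R ν 0 1)).toReal := by
        rw [integral_add (i1.const_mul R) (integrable_const _), integral_const_mul, integral_const]
        simp [Measure.real, mul_comm]
    _ ≤ R * (EC * (volume U).toReal) + R⁻¹ * (64 * R ^ 2) := by gcongr
    _ = _ := by field_simp

noncomputable def zs (σ : ℝ) (x : ℝ × ℝ) (r : ℝ) : ℝ × ℝ × ℝ := (-x.1 + σ * r, -2 * x.2, x.1 + σ * r)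

theorem phase_zs {ξ : ℝ × ℝ} (hξ : 0 < ξ.1) (σ : ℝ) (x : ℝ × ℝ) (r : ℝ) : phase (zs σ x r) ξ = -dt x ξ + σ * r * nrm ξ := by
  rw [← phase_zy hξ, nrm_eq hξ]
  unfold phase zs zy
  ring

/-- integrand -/
noncomputable def AI (U : Set (ℝ × ℝ)) (lam : ℝ) (x : ℝ × ℝ) (r : ℝ) (ξ : ℝ × ℝ) : ℂ :=
  Uh U ξ * ((Real.exp (-lam * sq ξ) : ℝ) : ℂ) * Complex.exp (-(Complex.I * dt x ξ)) * ((JJ (r * nrm ξ) : ℝ) : ℂ)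

theorem JJ_cont : Continuous JJ := continuous_iff_continuousAt.2 fun t => (JJ_deriv t).continuousAt

theorem JJ_le (t : ℝ) : |JJ t| ≤ 2 * Real.pi := by
  have := intervalIntegral.norm_integral_le_of_norm_le_const (a := 0) (b := 2 * Real.pi) (f := fun φ => Real.cos (t * Real.cos φ)) (C := 1)
    (fun φ _ => Real.abs_cos_le_one _)
  rw [Real.norm_eq_abs, sub_zero, abs_of_pos (show 0 < 2 * Real.pi by positivity), one_mul] at this
  exact this

theorem nexp' (x : ℝ) : ‖Complex.exp (-(Complex.I * x))‖ = 1 := by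
  have := nexp (-x)
  push_cast at this
  rwa [mul_neg] at this

theorem AI_le {U : Set (ℝ × ℝ)} (hU : volume U < ⊤) (lam : ℝ) (x : ℝ × ℝ) (r : ℝ) (ξ : ℝ × ℝ) :
    ‖AI U lam x r ξ‖ ≤ (volume U).toReal * (2 * Real.pi) * Real.exp (-lam * sq ξ) := by
  unfold AI
  rw [norm_mul, norm_mul, norm_mul, nexp', Complex.norm_real, Complex.norm_real, Real.norm_eq_abs, Real.norm_eq_abs, Real.abs_exp, mul_one]
  have := Uh_le hU ξ
  have := JJ_le (r * nrm ξ)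
  calc _ ≤ (volume U).toReal * Real.exp (-lam * sq ξ) * (2 * Real.pi) := by gcongr
    _ = _ := by ring

theorem AI_cont {U : Set (ℝ × ℝ)} (hU : volume U < ⊤) (lam : ℝ) (x : ℝ × ℝ) (r : ℝ) : Continuous (AI U lam x r) := by
  have := cont_Uh hU
  have := JJ_cont
  have := continuous_nrm
  have := cont_sq
  have : Continuous (dt x) := by unfold dt; fun_prop
  unfold AI
  fun_prop

theorem AI_int {U : Set (ℝ × ℝ)} (hU : volume U < ⊤) {lam : ℝ} (hl : 0 < lam) (x : ℝ × ℝ) (r : ℝ) : Integrable (AI U lam x r) := by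
  refine Integrable.mono' ((integrable_gauss hl).const_mul ((volume U).toReal * (2 * Real.pi))) (AI_cont hU lam x r).aestronglyMeasurable ?_
  exact Filter.Eventually.of_forall fun ξ => AI_le hU lam x r ξ

theorem shell_bd : ∃ C0 : ℝ, 0 ≤ C0 ∧ ∀ (K : ℕ), 64 ≤ K → ∀ R r : ℝ, 1 ≤ R → 0 < r → 1 ≤ r * R → ∀ U : Set (ℝ × ℝ), MeasurableSet U → volume U < ⊤ →
    ∀ lam, 0 < lam → ∀ x C, (∀ l < K, ∀ σ : ℝ, (σ = 1 ∨ σ = -1) → HC R (1 / (K:ℝ) ^ 4) (GU U) (cc K 1 l) (hj K 1) 0 (zs σ x r) C) →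
    ‖∫ ξ in cap R (1 / (K:ℝ) ^ 4) 0 1, AI U lam x r ξ‖ ≤ C0 * (K * C / √r + (EC * (volume U).toReal + 64) / (r * √r * √R)) := by
  obtain ⟨a, b, c, hc, hJ⟩ := JJ_asymp
  refine ⟨|a| + |b| + c, by positivity, fun K hK R r hR hr hrR U hUm hU lam hl x C hH => ?_⟩
  have hKr : (64:ℝ) ≤ K := by exact_mod_cast hK
  have hK0 : (0:ℝ) < K := by linarith
  set ν : ℝ := 1 / (K:ℝ) ^ 4 with hν
  have hν0 : 0 < ν := by positivity
  have hh1 : hj K 1 ≤ 1 / 64 := by unfold hj; rw [pow_one]; gcongr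
  have hν1 : ν ≤ 1 / 64 := by
    rw [hν]
    gcongr
    calc (64:ℝ) ≤ K := hKr
      _ = (K:ℝ) ^ 1 := (pow_one _).symm
      _ ≤ _ := pow_le_pow_right₀ (by linarith) (by norm_num)
  have hν1' : ν ≤ 1 := by linarith
  have hR0 : 0 < R := by linarith
  have hfin := cap_fin (c := 0) (h := 1) hR0 hν1'
  have hG : IntegrableOn (GU U) (cap R ν 0 1) := GU_int hU hR0 hν1'
  have hexpc : Continuous fun ξ : ℝ × ℝ => ((Real.exp (-lam * sq ξ) : ℝ) : ℂ) := by have := cont_sq; fun_prop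
  have hexp1 : ∀ ξ : ℝ × ℝ, ‖((Real.exp (-lam * sq ξ) : ℝ) : ℂ)‖ ≤ 1 := by
    intro ξ
    rw [Complex.norm_real, Real.norm_eq_abs, Real.abs_exp]
    refine Real.exp_le_one_iff.2 ?_
    have := mul_nonneg hl.le (sq_nonneg' ξ)
    linarith
  set T : ℝ → ℝ × ℝ → ℂ := fun σ ξ => gz (GU U) (zs σ x r) ξ * ((Real.exp (-lam * sq ξ) : ℝ) : ℂ) with hT
  have hTi : ∀ σ, IntegrableOn (T σ) (cap R ν 0 1) := by
    intro σ
    exact (gz_integrable hG _).mul_bdd (c := 1) hexpc.aestronglyMeasurable (Filter.Eventually.of_forall hexp1)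
  have hTb : ∀ σ : ℝ, (σ = 1 ∨ σ = -1) → ‖∫ ξ in cap R ν 0 1, T σ ξ‖ ≤ K * C := by
    intro σ hσ
    rw [caps_sum_int (K := K) (by omega) R ν 1 (hTi σ)]
    refine (norm_sum_le _ _).trans ?_
    calc _ ≤ ∑ l ∈ Finset.range (K ^ 1), C := by
          refine Finset.sum_le_sum fun l hl' => ?_
          have hl2 : l < K ^ 1 := by simpa using hl'
          have h3 := cc_abs (by omega) hl2
          have hp := hj_pos (K := K) (by omega) 1
          exact HC_main hR0 hν0 hp hν1 hh1 (by linarith) hl.le (GU_int hU hR0 hν1') (hH l (by simpa using hl2) σ hσ)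
      _ = _ := by simp
  set E : ℝ × ℝ → ℂ := fun ξ => Uh U ξ * ((Real.exp (-lam * sq ξ) : ℝ) : ℂ) * Complex.exp (-(Complex.I * dt x ξ)) *
    ((JJ (r * nrm ξ) - (a * Real.cos (r * nrm ξ) + b * Real.sin (r * nrm ξ)) / √(r * nrm ξ) : ℝ) : ℂ) with hE
  have hr0 : 0 < √r := Real.sqrt_pos.2 hr
  have hEb : ∀ ξ ∈ cap R ν 0 1, ‖E ξ‖ ≤ c / (r * R * √(r * R)) * ‖Uh U ξ‖ := by
    intro ξ hξ
    have h1 := cap_pos hξ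
    simp only [hE]
    rw [norm_mul, norm_mul, norm_mul, nexp', mul_one, Complex.norm_real (JJ _ - _), Real.norm_eq_abs]
    have h2 : r * R ≤ r * nrm ξ := by gcongr
    have h3 := hJ (r * nrm ξ) (by linarith)
    have hp : 0 < √(r * R) := Real.sqrt_pos.2 (by positivity)
    have hnn := nrm_nonneg ξ
    calc _ ≤ ‖Uh U ξ‖ * 1 * (c / (r * nrm ξ * √(r * nrm ξ))) := by
          have h4 := hexp1 ξ
          gcongr
      _ ≤ ‖Uh U ξ‖ * 1 * (c / (r * R * √(r * R))) := by
          gcongr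
      _ = _ := by ring
  have hdec : ∀ ξ ∈ cap R ν 0 1, AI U lam x r ξ = ((a - b * Complex.I) / 2 / √r) * T 1 ξ + ((a + b * Complex.I) / 2 / √r) * T (-1) ξ + E ξ := by
    intro ξ hξ
    have hn : 0 < nrm ξ := lt_of_lt_of_le hR0 (cap_pos hξ)
    simp only [hT, hE, AI, gz, GU]
    rw [phase_zs hξ.1, phase_zs hξ.1, Real.sqrt_mul hr.le]
    have hsn : 0 < √(nrm ξ) := Real.sqrt_pos.2 hn
    have hsn' : ((√(nrm ξ) : ℝ) : ℂ) ≠ 0 := by exact_mod_cast hsn.ne'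
    have hsr' : ((√r : ℝ) : ℂ) ≠ 0 := by exact_mod_cast hr0.ne'
    set θ := r * nrm ξ with hθ
    have e1 : Complex.exp (Complex.I * ((-dt x ξ + 1 * r * nrm ξ : ℝ) : ℂ)) = Complex.exp (-(Complex.I * dt x ξ)) * (Complex.cos θ + Complex.sin θ * Complex.I) := by
      rw [← Complex.exp_mul_I, ← Complex.exp_add]
      congr 1
      rw [hθ]; push_cast; ring
    have e2 : Complex.exp (Complex.I * ((-dt x ξ + -1 * r * nrm ξ : ℝ) : ℂ)) = Complex.exp (-(Complex.I * dt x ξ)) * (Complex.cos θ - Complex.sin θ * Complex.I) := by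
      have : Complex.cos θ - Complex.sin θ * Complex.I = Complex.exp (-θ * Complex.I) := by
        rw [Complex.exp_mul_I]; simp [sub_eq_add_neg]
      rw [this, ← Complex.exp_add]
      congr 1
      rw [hθ]; push_cast; ring
    rw [e1, e2]
    push_cast
    field_simp
    ring_nf
    rw [Complex.I_sq]
    ring
  have hEi : IntegrableOn E (cap R ν 0 1) := by
    have : IntegrableOn (fun ξ => AI U lam x r ξ - (((a - b * Complex.I) / 2 / √r) * T 1 ξ + ((a + b * Complex.I) / 2 / √r) * T (-1) ξ)) (cap R ν 0 1) :=
      (AI_int hU hl x r).integrableOn.sub (((hTi 1).const_mul _).add ((hTi (-1)).const_mul _))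
    refine this.congr_fun ?_ (measurableSet_cap _ _ _ _)
    intro ξ hξ
    simp only
    rw [hdec ξ hξ]; ring
  have hEI : ‖∫ ξ in cap R ν 0 1, E ξ‖ ≤ c / (r * R * √(r * R)) * (R * (EC * (volume U).toReal + 64)) := by
    have i0 : IntegrableOn (fun ξ => ‖Uh U ξ‖) (cap R ν 0 1) := by
      have hcU := cont_Uh hU
      refine Measure.integrableOn_of_bounded (M := (volume U).toReal) hfin.ne (by fun_prop) ?_
      refine Filter.Eventually.of_forall fun ξ => ?_
      rw [norm_norm]
      exact Uh_le hU ξ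
    calc ‖∫ ξ in cap R ν 0 1, E ξ‖ ≤ ∫ ξ in cap R ν 0 1, c / (r * R * √(r * R)) * ‖Uh U ξ‖ := by
          refine norm_integral_le_of_norm_le (i0.const_mul _) ?_
          filter_upwards [ae_restrict_mem (measurableSet_cap R ν 0 1)] with ξ hξ
          exact hEb ξ hξ
      _ = c / (r * R * √(r * R)) * ∫ ξ in cap R ν 0 1, ‖Uh U ξ‖ := integral_const_mul _ _
      _ ≤ _ := by
          have := shell_L1 hR hν1' hUm hU
          gcongr
  have hI : ∫ ξ in cap R ν 0 1, AI U lam x r ξ = ((a - b * Complex.I) / 2 / √r) * (∫ ξ in cap R ν 0 1, T 1 ξ) +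
      ((a + b * Complex.I) / 2 / √r) * (∫ ξ in cap R ν 0 1, T (-1) ξ) + ∫ ξ in cap R ν 0 1, E ξ := by
    have i12 : IntegrableOn (fun ξ => ((a - b * Complex.I) / 2 / √r) * T 1 ξ + ((a + b * Complex.I) / 2 / √r) * T (-1) ξ) (cap R ν 0 1) :=
      ((hTi 1).const_mul _).add ((hTi (-1)).const_mul _)
    rw [setIntegral_congr_fun (measurableSet_cap _ _ _ _) hdec, integral_add i12 hEi,
      integral_add ((hTi 1).const_mul _) ((hTi (-1)).const_mul _), integral_const_mul, integral_const_mul]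
  have hC : 0 ≤ C := (hH 0 (by omega) 1 (Or.inl rfl)).nonneg
  have hab : ∀ s : ℝ, |s| = 1 → ‖((a + s * b * Complex.I) / 2 / √r : ℂ)‖ ≤ (|a| + |b|) / 2 / √r := by
    intro s hs
    rw [norm_div, norm_div, Complex.norm_real, Real.norm_eq_abs, abs_of_pos hr0]
    gcongr
    · refine (norm_add_le _ _).trans ?_
      rw [norm_mul, norm_mul, Complex.norm_I, Complex.norm_real, Complex.norm_real, Complex.norm_real]
      simp [hs]
    · simp
  have ha1 := hab (-1) (by simp)
  have ha2 := hab 1 (by simp)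
  have s1 : ((a:ℂ) + ((-1:ℝ):ℂ) * b * Complex.I) = a - b * Complex.I := by push_cast; ring
  have s2 : ((a:ℂ) + ((1:ℝ):ℂ) * b * Complex.I) = a + b * Complex.I := by push_cast; ring
  rw [s1] at ha1
  rw [s2] at ha2
  have hsR : 0 < √R := Real.sqrt_pos.2 hR0
  have hV : 0 ≤ EC * (volume U).toReal + 64 := by unfold EC; positivity
  rw [hI]
  calc _ ≤ (|a| + |b|) / 2 / √r * (K * C) + (|a| + |b|) / 2 / √r * (K * C) + c / (r * R * √(r * R)) * (R * (EC * (volume U).toReal + 64)) := by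
        refine (norm_add_le _ _).trans (add_le_add ((norm_add_le _ _).trans (add_le_add ?_ ?_)) hEI)
        · rw [norm_mul]
          exact mul_le_mul ha1 (hTb 1 (Or.inl rfl)) (norm_nonneg _) (by positivity)
        · rw [norm_mul]
          exact mul_le_mul ha2 (hTb (-1) (Or.inr rfl)) (norm_nonneg _) (by positivity)
    _ = (|a| + |b|) * (K * C / √r) + c * ((EC * (volume U).toReal + 64) / (r * √r * √R)) := by
        rw [Real.sqrt_mul hr.le]
        field_simp
        ring
    _ ≤ _ := by
        have t1 : 0 ≤ K * C / √r := by positivity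
        have t2 : 0 ≤ (EC * (volume U).toReal + 64) / (r * √r * √R) := by positivity
        nlinarith [mul_nonneg hc t1, mul_nonneg (add_nonneg (abs_nonneg a) (abs_nonneg b)) t2]

end Wolff

open MeasureTheory Metric
open scoped ENNReal
namespace Wolff

noncomputable def pt (x : ℝ × ℝ) (r φ : ℝ) : ℝ × ℝ := (x.1 + r * Real.cos φ, x.2 + r * Real.sin φ)

theorem cont_pt (x : ℝ × ℝ) (r : ℝ) : Continuous (pt x r) := by unfold pt; fun_prop

theorem cos_shift (f : ℝ → ℝ) (hf : Continuous f) (θ : ℝ) :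
    ∫ φ in (0:ℝ)..(2 * Real.pi), f (Real.cos (φ - θ)) = ∫ φ in (0:ℝ)..(2 * Real.pi), f (Real.cos φ) := by
  rw [intervalIntegral.integral_comp_sub_right (fun φ => f (Real.cos φ)) θ]
  have hp : Function.Periodic (fun φ => f (Real.cos φ)) (2 * Real.pi) := fun φ => by simp
  have := hp.intervalIntegral_add_eq (0 - θ) 0
  rw [show 2 * Real.pi - θ = 0 - θ + 2 * Real.pi by ring, this, zero_add]

theorem sin_zero (t : ℝ) : ∫ φ in (0:ℝ)..(2 * Real.pi), Real.sin (t * Real.cos φ) = 0 := by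
  have h := cos_shift (fun u => Real.sin (t * u)) (by fun_prop) Real.pi
  simp only [Real.cos_sub_pi, mul_neg, Real.sin_neg, intervalIntegral.integral_neg] at h
  linarith

theorem JJ_circ (r : ℝ) (ξ : ℝ × ℝ) : ((JJ (r * nrm ξ) : ℝ) : ℂ) =
    ∫ φ in (0:ℝ)..(2 * Real.pi), Complex.exp (-(Complex.I * (r * (Real.cos φ * ξ.1 + Real.sin φ * ξ.2) : ℝ))) := by
  obtain ⟨θ, h1, h2⟩ : ∃ θ, ξ.1 = nrm ξ * Real.cos θ ∧ ξ.2 = nrm ξ * Real.sin θ := by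
    refine ⟨Complex.arg ⟨ξ.1, ξ.2⟩, ?_, ?_⟩
    · have : nrm ξ = ‖(⟨ξ.1, ξ.2⟩ : ℂ)‖ := by
        rw [Complex.norm_eq_sqrt_sq_add_sq]; rfl
      rw [this, Complex.norm_mul_cos_arg]
    · have : nrm ξ = ‖(⟨ξ.1, ξ.2⟩ : ℂ)‖ := by
        rw [Complex.norm_eq_sqrt_sq_add_sq]; rfl
      rw [this, Complex.norm_mul_sin_arg]
  have e : ∀ φ : ℝ, Complex.exp (-(Complex.I * (r * (Real.cos φ * ξ.1 + Real.sin φ * ξ.2) : ℝ))) =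
      ((Real.cos (r * nrm ξ * Real.cos (φ - θ)) : ℝ) : ℂ) - ((Real.sin (r * nrm ξ * Real.cos (φ - θ)) : ℝ) : ℂ) * Complex.I := by
    intro φ
    have : r * (Real.cos φ * ξ.1 + Real.sin φ * ξ.2) = r * nrm ξ * Real.cos (φ - θ) := by
      rw [Real.cos_sub]; linear_combination r * Real.cos φ * h1 + r * Real.sin φ * h2
    rw [this]
    generalize r * nrm ξ * Real.cos (φ - θ) = u
    rw [show -(Complex.I * (u:ℂ)) = ((-u : ℝ) : ℂ) * Complex.I by push_cast; ring, Complex.exp_mul_I]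
    push_cast
    simp [sub_eq_add_neg]
  simp_rw [e]
  rw [intervalIntegral.integral_sub (Continuous.intervalIntegrable (by fun_prop) _ _) (Continuous.intervalIntegrable (by fun_prop) _ _),
    intervalIntegral.integral_mul_const, intervalIntegral.integral_ofReal, intervalIntegral.integral_ofReal,
    cos_shift (fun u => Real.cos (r * nrm ξ * u)) (by fun_prop), cos_shift (fun u => Real.sin (r * nrm ξ * u)) (by fun_prop), sin_zero]
  simp [JJ]

theorem cont_dt : Continuous fun p : (ℝ × ℝ) × (ℝ × ℝ) => dt p.1 p.2 := by unfold dt; fun_prop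

theorem four_id {U : Set (ℝ × ℝ)} (hU : volume U < ⊤) {lam : ℝ} (hl : 0 < lam) (x : ℝ × ℝ) (r : ℝ) :
    ∫ ξ, AI U lam x r ξ = ((∫ p : ℝ × (ℝ × ℝ), Real.pi / lam * Real.exp (-sq (p.2 - pt x r p.1) / (4 * lam))
      ∂((volume.restrict (Set.Ioc 0 (2 * Real.pi))).prod (volume.restrict U)) : ℝ) : ℂ) := by
  have i1 : IsFiniteMeasure (volume.restrict U) := ⟨by simpa using hU⟩
  set κ := (volume.restrict (Set.Ioc 0 (2 * Real.pi))).prod (volume.restrict U) with hκ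
  have e1 : ∀ ξ, AI U lam x r ξ = ∫ p, Complex.exp (Complex.I * dt ξ (p.2 - pt x r p.1)) * (Real.exp (-lam * sq ξ) : ℂ) ∂κ := by
    intro ξ
    unfold AI
    rw [JJ_circ, intervalIntegral.integral_of_le (by positivity)]
    have := integral_prod_mul (μ := volume.restrict (Set.Ioc 0 (2 * Real.pi))) (ν := volume.restrict U)
      (fun φ : ℝ => Complex.exp (-(Complex.I * (r * (Real.cos φ * ξ.1 + Real.sin φ * ξ.2) : ℝ)))) (fun y => Complex.exp (Complex.I * dt y ξ))
    rw [Uh]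
    calc _ = ((Real.exp (-lam * sq ξ) : ℝ) : ℂ) * Complex.exp (-(Complex.I * dt x ξ)) * ((∫ φ in Set.Ioc 0 (2 * Real.pi), Complex.exp (-(Complex.I * (r * (Real.cos φ * ξ.1 + Real.sin φ * ξ.2) : ℝ)))) *
          ∫ y in U, Complex.exp (Complex.I * dt y ξ)) := by ring
      _ = _ := by
        rw [← this, ← integral_const_mul]
        refine integral_congr_ae (Filter.Eventually.of_forall fun p => ?_)
        simp only
        rw [← Complex.exp_add, mul_assoc, ← Complex.exp_add, mul_comm]
        congr 2
        unfold dt pt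
        simp only [Prod.fst_sub, Prod.snd_sub]
        push_cast
        ring
  simp_rw [e1]
  have hc : Continuous fun p : (ℝ × ℝ) × (ℝ × (ℝ × ℝ)) => Complex.exp (Complex.I * dt p.1 (p.2.2 - pt x r p.2.1)) * (Real.exp (-lam * sq p.1) : ℂ) := by
    have := cont_pt x r
    have := cont_sq
    unfold dt
    fun_prop
  have hIntg : Integrable (fun p : (ℝ × ℝ) × (ℝ × (ℝ × ℝ)) => Complex.exp (Complex.I * dt p.1 (p.2.2 - pt x r p.2.1)) * (Real.exp (-lam * sq p.1) : ℂ))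
      (volume.prod κ) := by
    refine Integrable.mono' ((integrable_gauss hl).mul_prod (integrable_const (μ := κ) (1:ℝ))) hc.aestronglyMeasurable ?_
    refine Filter.Eventually.of_forall fun p => ?_
    rw [norm_mul, nexp, Complex.norm_real, Real.norm_eq_abs, Real.abs_exp]
    simp
  rw [integral_integral_swap hIntg, ← integral_complex_ofReal]
  refine integral_congr_ae (Filter.Eventually.of_forall fun p => ?_)
  simp only
  rw [gauss2 hl]

theorem gauss_total {lam : ℝ} (hl : 0 < lam) (p : ℝ × ℝ) :
    ∫⁻ y, ENNReal.ofReal (Real.pi / lam * Real.exp (-sq (y - p) / (4 * lam))) = ENNReal.ofReal (4 * Real.pi ^ 2) := by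
  have h := lintegral_gauss (δ := 1 / (4 * lam)) (by positivity)
  rw [lintegral_sub_right_eq_self (fun y => ENNReal.ofReal (Real.pi / lam * Real.exp (-sq y / (4 * lam)))) p]
  calc _ = ∫⁻ y, ENNReal.ofReal (Real.pi / lam) * ENNReal.ofReal (Real.exp (-(1 / (4 * lam)) * sq y)) := by
        congr 1; ext y
        rw [ENNReal.ofReal_mul (by positivity)]
        congr 3
        ring
    _ = _ := by
        rw [lintegral_const_mul' _ _ (by simp), h, ← ENNReal.ofReal_mul (by positivity)]
        congr 1
        field_simp

theorem gauss_tail {lam ε : ℝ} (hl : 0 < lam) (hε : Real.exp (-ε ^ 2 / (8 * lam)) ≤ 1 / 4) (p : ℝ × ℝ) {V : Set (ℝ × ℝ)} (hVm : MeasurableSet V)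
    (hV : ∀ y ∈ V, ε ^ 2 ≤ sq (y - p)) :
    ∫⁻ y in V, ENNReal.ofReal (Real.pi / lam * Real.exp (-sq (y - p) / (4 * lam))) ≤ ENNReal.ofReal (2 * Real.pi ^ 2) := by
  have h := gauss_total (lam := 2 * lam) (by positivity) p
  calc _ ≤ ∫⁻ y in V, ENNReal.ofReal (1 / 2) * ENNReal.ofReal (Real.pi / (2 * lam) * Real.exp (-sq (y - p) / (4 * (2 * lam)))) := by
        refine setLIntegral_mono' hVm fun y hy => ?_
        rw [← ENNReal.ofReal_mul (by norm_num)]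
        apply ENNReal.ofReal_le_ofReal
        have e1 : Real.exp (-sq (y - p) / (4 * lam)) = Real.exp (-sq (y - p) / (8 * lam)) * Real.exp (-sq (y - p) / (4 * (2 * lam))) := by
          rw [← Real.exp_add]; congr 1; field_simp; ring
        have e2 : Real.exp (-sq (y - p) / (8 * lam)) ≤ 1 / 4 := by
          refine le_trans (Real.exp_le_exp.2 ?_) hε
          gcongr
          exact hV y hy
        rw [e1]
        calc _ ≤ Real.pi / lam * (1 / 4 * Real.exp (-sq (y - p) / (4 * (2 * lam)))) := by gcongr
          _ = _ := by field_simp; norm_num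
    _ ≤ ∫⁻ y, ENNReal.ofReal (1 / 2) * ENNReal.ofReal (Real.pi / (2 * lam) * Real.exp (-sq (y - p) / (4 * (2 * lam)))) := setLIntegral_le_lintegral _ _
    _ = _ := by
        rw [lintegral_const_mul' _ _ (by simp), h, ← ENNReal.ofReal_mul (by positivity)]
        congr 1; ring

theorem low_bd {U : Set (ℝ × ℝ)} (hUo : IsOpen U) (hU : volume U < ⊤) (x : ℝ × ℝ) (r : ℝ) {τ : ℝ} (hτ : 0 ≤ τ)
    (hA : ENNReal.ofReal τ < volume {φ ∈ Set.Ioc 0 (2 * Real.pi) | pt x r φ ∈ U}) :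
    ∃ lam, 0 < lam ∧ 2 * Real.pi ^ 2 * τ ≤ ‖∫ ξ, AI U lam x r ξ‖ := by
  have i1 : IsFiniteMeasure (volume.restrict U) := ⟨by simpa using hU⟩
  have hUm := hUo.measurableSet
  set S : ℕ → Set ℝ := fun n => {φ ∈ Set.Ioc 0 (2 * Real.pi) | ((n:ℝ≥0∞) + 1)⁻¹ ≤ Metric.infEDist (pt x r φ) Uᶜ} with hS
  have hSm : ∀ n, MeasurableSet (S n) := by
    intro n
    refine measurableSet_Ioc.inter ?_
    have hc : Continuous fun φ => Metric.infEDist (pt x r φ) Uᶜ := continuous_infEDist.comp (cont_pt x r)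
    exact measurableSet_le measurable_const hc.measurable
  have hmono : Monotone S := by
    intro n m hnm φ hφ
    refine ⟨hφ.1, le_trans ?_ hφ.2⟩
    gcongr
  have hun : {φ ∈ Set.Ioc 0 (2 * Real.pi) | pt x r φ ∈ U} ⊆ ⋃ n, S n := by
    rintro φ ⟨h1, h2⟩
    have h3 : Metric.infEDist (pt x r φ) Uᶜ ≠ 0 := by
      intro h0
      have := Metric.mem_closure_iff_infEDist_zero.2 h0
      rw [hUo.isClosed_compl.closure_eq] at this
      exact this h2
    obtain ⟨n, hn⟩ := ENNReal.exists_inv_nat_lt h3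
    refine Set.mem_iUnion.2 ⟨n, h1, le_trans ?_ hn.le⟩
    gcongr
    exact le_self_add
  have h5 := hA.trans_le (measure_mono hun)
  rw [hmono.measure_iUnion] at h5
  obtain ⟨n, hn⟩ := lt_iSup_iff.1 h5
  set ε : ℝ := ((n:ℝ) + 1)⁻¹ with hε
  have hε0 : 0 < ε := by positivity
  obtain ⟨lam, hl, hl2⟩ : ∃ lam : ℝ, 0 < lam ∧ Real.exp (-ε ^ 2 / (8 * lam)) ≤ 1 / 4 := by
    refine ⟨ε ^ 2 / 32, by positivity, ?_⟩
    have : -ε ^ 2 / (8 * (ε ^ 2 / 32)) = -4 := by field_simp; norm_num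
    rw [this, Real.exp_neg, inv_eq_one_div]
    have := Real.add_one_le_exp 4
    gcongr
    linarith
  refine ⟨lam, hl, ?_⟩
  set f : ℝ × (ℝ × ℝ) → ℝ := fun p => Real.pi / lam * Real.exp (-sq (p.2 - pt x r p.1) / (4 * lam)) with hf
  have hf0 : ∀ p, 0 ≤ f p := fun p => by simp only [hf]; positivity
  have hfc : Continuous f := by
    have := cont_pt x r
    have := cont_sq
    simp only [hf]
    fun_prop
  have hfi : Integrable f ((volume.restrict (Set.Ioc 0 (2 * Real.pi))).prod (volume.restrict U)) := by
    refine Integrable.of_bound hfc.aestronglyMeasurable (Real.pi / lam) (Filter.Eventually.of_forall fun p => ?_)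
    rw [Real.norm_eq_abs, abs_of_nonneg (hf0 p)]
    simp only [hf]
    refine mul_le_of_le_one_right (by positivity) (Real.exp_le_one_iff.2 ?_)
    have := sq_nonneg' (p.2 - pt x r p.1)
    rw [neg_div]
    have : 0 ≤ sq (p.2 - pt x r p.1) / (4 * lam) := by positivity
    linarith
  rw [four_id hU hl, Complex.norm_real, Real.norm_eq_abs, abs_of_nonneg (integral_nonneg hf0), ← ENNReal.ofReal_le_ofReal_iff (integral_nonneg hf0),
    ofReal_integral_eq_lintegral_ofReal hfi (Filter.Eventually.of_forall hf0), lintegral_prod _ (by fun_prop)]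
  have key : ∀ φ ∈ S n, ENNReal.ofReal (2 * Real.pi ^ 2) ≤ ∫⁻ y in U, ENNReal.ofReal (f (φ, y)) := by
    intro φ hφ
    have t1 := gauss_total hl (pt x r φ)
    rw [← lintegral_add_compl _ hUm] at t1
    have t2 := gauss_tail hl hl2 (pt x r φ) hUm.compl (fun y hy => by
      have h6 : ((n:ℝ≥0∞) + 1)⁻¹ ≤ edist (pt x r φ) y := hφ.2.trans (Metric.infEDist_le_edist_of_mem hy)
      have h7 : ENNReal.ofReal ε ≤ edist (pt x r φ) y := by
        refine le_trans (le_of_eq ?_) h6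
        rw [hε, ENNReal.ofReal_inv_of_pos (by positivity), ENNReal.ofReal_add (by positivity) (by norm_num)]
        simp
      rw [edist_dist, ENNReal.ofReal_le_ofReal_iff dist_nonneg, Prod.dist_eq, le_max_iff, Real.dist_eq, Real.dist_eq] at h7
      unfold sq
      simp only [Prod.fst_sub, Prod.snd_sub]
      rcases h7 with h7 | h7
      · have := pow_le_pow_left₀ hε0.le h7 2
        rw [sq_abs] at this
        nlinarith [sq_nonneg (y.2 - (pt x r φ).2)]
      · have := pow_le_pow_left₀ hε0.le h7 2
        rw [sq_abs] at this
        nlinarith [sq_nonneg (y.1 - (pt x r φ).1)])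
    refine (ENNReal.add_le_add_iff_right (a := ENNReal.ofReal (2 * Real.pi ^ 2)) ENNReal.ofReal_ne_top).1 ?_
    rw [← ENNReal.ofReal_add (by positivity) (by positivity), show 2 * Real.pi ^ 2 + 2 * Real.pi ^ 2 = 4 * Real.pi ^ 2 by ring, ← t1]
    exact add_le_add le_rfl t2
  calc ENNReal.ofReal (2 * Real.pi ^ 2 * τ) = ENNReal.ofReal (2 * Real.pi ^ 2) * ENNReal.ofReal τ := ENNReal.ofReal_mul (by positivity)
    _ ≤ ENNReal.ofReal (2 * Real.pi ^ 2) * volume (S n) := mul_le_mul_right hn.le _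
    _ = ∫⁻ φ in S n, ENNReal.ofReal (2 * Real.pi ^ 2) := by rw [setLIntegral_const]
    _ ≤ ∫⁻ φ in S n, ∫⁻ y in U, ENNReal.ofReal (f (φ, y)) := setLIntegral_mono' (hSm n) key
    _ ≤ _ := lintegral_mono_set fun φ hφ => hφ.1

end Wolff

open MeasureTheory Metric
open scoped ENNReal
namespace Wolff

theorem Uh_neg (U : Set (ℝ × ℝ)) (ξ : ℝ × ℝ) : Uh U (-ξ) = (starRingEnd ℂ) (Uh U ξ) := by
  unfold Uh
  rw [← integral_conj]
  congr 1
  ext y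
  rw [← Complex.exp_conj]
  congr 1
  simp only [dt, Prod.fst_neg, Prod.snd_neg, map_mul, Complex.conj_I, Complex.conj_ofReal]
  push_cast
  ring

theorem AI_neg (U : Set (ℝ × ℝ)) (lam : ℝ) (x : ℝ × ℝ) (r : ℝ) (ξ : ℝ × ℝ) :
    AI U lam x r (-ξ) = (starRingEnd ℂ) (AI U lam x r ξ) := by
  unfold AI
  rw [Uh_neg]
  have h1 : sq (-ξ) = sq ξ := by simp [sq]
  have h2 : nrm (-ξ) = nrm ξ := by simp [nrm]
  have h3 : dt x (-ξ) = -dt x ξ := by simp only [dt, Prod.fst_neg, Prod.snd_neg]; ring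
  rw [h1, h2, h3]
  simp only [map_mul, ← Complex.exp_conj, Complex.conj_ofReal, map_neg, Complex.conj_I]
  congr 2
  congr 1
  push_cast
  ring

theorem AI_half {U : Set (ℝ × ℝ)} (hU : volume U < ⊤) {lam : ℝ} (hl : 0 < lam) (x : ℝ × ℝ) (r : ℝ) :
    ‖∫ ξ, AI U lam x r ξ‖ ≤ 2 * ‖∫ ξ in {ξ : ℝ × ℝ | 0 < ξ.1}, AI U lam x r ξ‖ := by
  have hS : MeasurableSet {ξ : ℝ × ℝ | 0 < ξ.1} := measurableSet_lt measurable_const measurable_fst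
  have hS' : MeasurableSet {ξ : ℝ × ℝ | ξ.1 < 0} := measurableSet_lt measurable_fst measurable_const
  have hi := AI_int hU hl x r
  have e1 : ∫ ξ in {ξ : ℝ × ℝ | ξ.1 < 0}, AI U lam x r ξ = (starRingEnd ℂ) (∫ ξ in {ξ : ℝ × ℝ | 0 < ξ.1}, AI U lam x r ξ) := by
    have := (Measure.measurePreserving_neg (volume : Measure (ℝ × ℝ))).setIntegral_preimage_emb
      (MeasurableEquiv.neg (ℝ × ℝ)).measurableEmbedding (AI U lam x r) {ξ : ℝ × ℝ | ξ.1 < 0}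
    rw [← this, ← integral_conj]
    have e : (Neg.neg : ℝ × ℝ → ℝ × ℝ) ⁻¹' {ξ : ℝ × ℝ | ξ.1 < 0} = {ξ : ℝ × ℝ | 0 < ξ.1} := by
      ext ξ; simp
    rw [e]
    simp only [AI_neg]
  have hnull : volume {ξ : ℝ × ℝ | ξ.1 = 0} = 0 := by
    have : {ξ : ℝ × ℝ | ξ.1 = 0} = ({0} : Set ℝ) ×ˢ Set.univ := by ext ξ; simp
    rw [this, Measure.volume_eq_prod, Measure.prod_prod]
    simp
  have e2 : ∫ ξ in {ξ : ℝ × ℝ | 0 < ξ.1}ᶜ, AI U lam x r ξ = ∫ ξ in {ξ : ℝ × ℝ | ξ.1 < 0}, AI U lam x r ξ := by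
    apply setIntegral_congr_set
    have : ∀ᵐ ξ : ℝ × ℝ, ξ.1 ≠ 0 := by
      rw [ae_iff]; simpa using hnull
    filter_upwards [this] with ξ hξ
    apply propext
    show ¬ (0 < ξ.1) ↔ ξ.1 < 0
    constructor
    · intro h; exact lt_of_le_of_ne (not_lt.1 h) hξ
    · intro h; exact not_lt.2 h.le
  rw [← integral_add_compl hS hi, e2, e1]
  refine (norm_add_le _ _).trans ?_
  rw [RCLike.norm_conj, two_mul]

theorem kk_abs {ξ : ℝ × ℝ} (h : 0 < ξ.1) : |kk ξ| < 1 := by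
  unfold kk
  have h2 := le_nrm2 ξ
  have h0 := nrm_nonneg ξ
  rw [abs_div, abs_of_pos (by linarith : 0 < nrm ξ + ξ.1), div_lt_one (by linarith)]
  linarith

theorem shell_sum {U : Set (ℝ × ℝ)} (hU : volume U < ⊤) {lam : ℝ} (hl : 0 < lam) (x : ℝ × ℝ) (r : ℝ) {ν : ℝ} (hν : 0 < ν) (k0 : ℕ)
    (f : ℕ → ℝ) (hf : Summable fun k => f (k + k0)) (h : ∀ k ≥ k0, ‖∫ ξ in cap ((1 + ν) ^ k) ν 0 1, AI U lam x r ξ‖ ≤ f k) :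
    ‖∫ ξ in {ξ : ℝ × ℝ | 0 < ξ.1}, AI U lam x r ξ‖ ≤
      (volume U).toReal * (2 * Real.pi) * (4 * (1 + ν) ^ k0) ^ 2 + ∑' k, f (k + k0) := by
  set L : Set (ℝ × ℝ) := {ξ | 0 < ξ.1 ∧ ww ξ < (1 + ν) ^ k0} with hL
  have hi := AI_int hU hl x r
  have hcm : ∀ k, MeasurableSet (cap ((1 + ν) ^ (k + k0)) ν 0 1) := fun k => measurableSet_cap _ _ _ _
  have hww : ∀ ξ : ℝ × ℝ, 0 < ξ.1 → nrm ξ ≤ 2 * ww ξ := fun ξ hξ => by unfold ww; linarith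
  have hLm : MeasurableSet L :=
    (measurableSet_lt measurable_const measurable_fst).inter (measurableSet_lt measurable_ww measurable_const)
  have hS : {ξ : ℝ × ℝ | 0 < ξ.1} = L ∪ ⋃ k : ℕ, cap ((1 + ν) ^ (k + k0)) ν 0 1 := by
    ext ξ
    simp only [Set.mem_union, Set.mem_iUnion, Set.mem_ofPred_eq, hL, cap]
    constructor
    · intro hξ
      by_cases hw : ww ξ < (1 + ν) ^ k0
      · exact Or.inl ⟨hξ, hw⟩
      · right
        push Not at hw
        have h1 : 1 ≤ ww ξ / (1 + ν) ^ k0 := by rw [le_div_iff₀ (by positivity)]; linarith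
        obtain ⟨n, hn1, hn2⟩ := exists_nat_pow_near h1 (by linarith : 1 < 1 + ν)
        rw [le_div_iff₀ (by positivity), ← pow_add] at hn1
        rw [div_lt_iff₀ (by positivity), ← pow_add] at hn2
        have hk := abs_lt.1 (kk_abs hξ)
        refine ⟨n, hξ, hn1, ?_, by linarith, by linarith⟩
        rw [← pow_succ']
        have e : n + k0 + 1 = n + 1 + k0 := by omega
        rw [e]; exact hn2
    · rintro (h | ⟨k, h⟩)
      · exact h.1
      · exact h.1
  have hd : Pairwise (Function.onFun Disjoint fun k : ℕ => cap ((1 + ν) ^ (k + k0)) ν 0 1) := by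
    have key : ∀ i j : ℕ, i < j → Disjoint (cap ((1 + ν) ^ (i + k0)) ν 0 1) (cap ((1 + ν) ^ (j + k0)) ν 0 1) := by
      intro i j hij
      rw [Set.disjoint_left]
      rintro ξ ⟨-, -, h1, -⟩ ⟨-, h2, -⟩
      rw [← pow_succ'] at h1
      have : (1 + ν) ^ (i + k0 + 1) ≤ (1 + ν) ^ (j + k0) := pow_le_pow_right₀ (by linarith) (by omega)
      linarith
    intro i j hij
    rcases lt_or_gt_of_ne hij with h | h
    · exact key i j h
    · exact (key j i h).symm
  have hd2 : Disjoint L (⋃ k : ℕ, cap ((1 + ν) ^ (k + k0)) ν 0 1) := by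
    rw [Set.disjoint_left]
    rintro ξ ⟨-, h1⟩ h2
    obtain ⟨k, -, h2, -⟩ := Set.mem_iUnion.1 h2
    have : (1 + ν) ^ k0 ≤ (1 + ν) ^ (k + k0) := pow_le_pow_right₀ (by linarith) (by omega)
    linarith
  rw [hS, setIntegral_union hd2 (MeasurableSet.iUnion hcm) hi.integrableOn hi.integrableOn]
  refine (norm_add_le _ _).trans (add_le_add ?_ ?_)
  · have hLb : L ⊆ bx (2 * (1 + ν) ^ k0) := by
      rintro ξ ⟨h1, h2⟩
      have a1 := le_nrm ξ
      have a2 := le_nrm2 ξ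
      have a3 := hww ξ h1
      exact ⟨abs_le.1 (by linarith), abs_le.1 (by linarith)⟩
    have hLf : volume L < ⊤ := (measure_mono hLb).trans_lt (bx_fin _)
    have hLv : (volume L).toReal ≤ (4 * (1 + ν) ^ k0) ^ 2 := by
      refine (ENNReal.toReal_mono (bx_fin _).ne (measure_mono hLb)).trans ?_
      rw [vol_bx (by positivity)]
      apply le_of_eq; ring
    refine (norm_setIntegral_le_of_norm_le_const (C := (volume U).toReal * (2 * Real.pi)) hLf ?_).trans ?_
    · intro ξ _
      refine (AI_le hU lam x r ξ).trans ?_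
      refine mul_le_of_le_one_right (by positivity) ?_
      rw [Real.exp_le_one_iff]
      have := sq_nonneg' ξ
      nlinarith
    · exact mul_le_mul_of_nonneg_left hLv (by positivity)
  · rw [integral_iUnion hcm hd hi.integrableOn]
    exact tsum_of_norm_bounded hf.hasSum fun k => h _ (by omega)

theorem bad_exists {K : ℕ} (hK : 64 ≤ K) {r0 τ : ℝ} (hr0 : 0 < r0) (hτ : 0 < τ) (n0 : ℕ) :
    ∃ k0 ≥ n0, 1 ≤ k0 ∧ ∃ ε : ℝ, 0 < ε ∧ ∀ U : Set (ℝ × ℝ), IsOpen U → volume U ≤ ENNReal.ofReal ε → ∀ x r, r0 ≤ r →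
      ENNReal.ofReal τ < volume {φ ∈ Set.Ioc 0 (2 * Real.pi) | pt x r φ ∈ U} →
      ∃ k ≥ k0, ∃ σ : ℝ, (σ = 1 ∨ σ = -1) ∧ ∃ l < K,
        ¬ HC ((1 + 1 / (K : ℝ) ^ 4) ^ k) (1 / (K : ℝ) ^ 4) (GU U) (cc K 1 l) (hj K 1) 0 (zs σ x r) (1 / (k : ℝ) ^ 2) := by
  obtain ⟨C0, hC0, hsh⟩ := shell_bd
  have hKp : (0 : ℝ) < K := by exact_mod_cast (by omega : 0 < K)
  set ν : ℝ := 1 / (K : ℝ) ^ 4 with hνd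
  have hν : 0 < ν := by positivity
  have hEC : 0 ≤ EC := by unfold EC; positivity
  set ρ : ℝ := (√(1 + ν))⁻¹ with hρ
  have hs1 : 1 < √(1 + ν) := by
    rw [Real.lt_sqrt (by norm_num)]; linarith
  have hρ0 : 0 ≤ ρ := by positivity
  have hρ1 : ρ < 1 := inv_lt_one_of_one_lt₀ hs1
  set f : ℕ → ℝ := fun k => C0 * (K * (1 / (k : ℝ) ^ 2) / √r0 + (EC + 64) / (r0 * √r0) * ρ ^ k) with hf
  have hfs : Summable f := by
    apply Summable.mul_left
    apply Summable.add
    · apply Summable.div_const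
      apply Summable.mul_left
      exact Real.summable_one_div_nat_pow.2 (by norm_num)
    · exact (summable_geometric_of_lt_one hρ0 hρ1).mul_left _
  have ht := tendsto_sum_nat_add f
  have hpt : (0:ℝ) < Real.pi ^ 2 * τ / 2 := by positivity
  have ev1 := ht.eventually (gt_mem_nhds hpt)
  have ev2 : ∀ᶠ k : ℕ in Filter.atTop, 1 / r0 ≤ (1 + ν) ^ k :=
    (tendsto_pow_atTop_atTop_of_one_lt (by linarith : 1 < 1 + ν)).eventually_ge_atTop _
  obtain ⟨k0, ⟨h1, h2⟩, h3⟩ := ((ev1.and ev2).and (Filter.eventually_ge_atTop (max n0 1))).exists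
  refine ⟨k0, le_trans (le_max_left _ _) h3, le_trans (le_max_right _ _) h3, ?_⟩
  set W : ℝ := 2 * Real.pi * (4 * (1 + ν) ^ k0) ^ 2 with hW
  have hWp : 0 < W := by positivity
  refine ⟨min 1 (Real.pi ^ 2 * τ / 2 / W), lt_min one_pos (by positivity), ?_⟩
  intro U hUo hUε x r hr hA
  by_contra hcon
  push Not at hcon
  have hU : volume U < ⊤ := hUε.trans_lt ENNReal.ofReal_lt_top
  have hUr : (volume U).toReal ≤ min 1 (Real.pi ^ 2 * τ / 2 / W) :=
    ENNReal.toReal_le_of_le_ofReal (by positivity) hUε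
  obtain ⟨lam, hl, hlow⟩ := low_bd hUo hU x r hτ.le hA
  have hrp : 0 < r := hr0.trans_le hr
  have hsr : √r0 ≤ √r := Real.sqrt_le_sqrt hr
  have hsr0 : 0 < √r0 := Real.sqrt_pos.2 hr0
  have hfb : ∀ k ≥ k0, ‖∫ ξ in cap ((1 + ν) ^ k) ν 0 1, AI U lam x r ξ‖ ≤ f k := by
    intro k hk
    have hR1 : 1 ≤ (1 + ν) ^ k := one_le_pow₀ (by linarith)
    have hR2 : (1 + ν) ^ k0 ≤ (1 + ν) ^ k := pow_le_pow_right₀ (by linarith) hk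
    have hrR : 1 ≤ r * (1 + ν) ^ k := by
      have : 1 ≤ r0 * (1 + ν) ^ k0 := by rw [div_le_iff₀ hr0] at h2; linarith
      exact this.trans (mul_le_mul hr hR2 (by positivity) hrp.le)
    refine (hsh K hK _ r hR1 hrp hrR U hUo.measurableSet hU lam hl x (1 / (k:ℝ) ^ 2) ?_).trans ?_
    · intro l hlK σ hσ
      exact hcon k hk σ hσ l hlK
    · rw [hf]
      refine mul_le_mul_of_nonneg_left (add_le_add ?_ ?_) hC0
      · exact div_le_div_of_nonneg_left (by positivity) hsr0 hsr
      · have e : √((1 + ν) ^ k) = ρ⁻¹ ^ k := by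
          rw [hρ, inv_inv, Real.sqrt_eq_iff_mul_self_eq (by positivity) (by positivity), ← mul_pow,
            Real.mul_self_sqrt (by positivity)]
        have hρp : 0 < ρ := by positivity
        rw [e]
        calc (EC * (volume U).toReal + 64) / (r * √r * ρ⁻¹ ^ k) ≤ (EC + 64) / (r0 * √r0 * ρ⁻¹ ^ k) := by
              have : (volume U).toReal ≤ 1 := hUr.trans (min_le_left _ _)
              gcongr
              nlinarith
          _ = _ := by rw [inv_pow]; field_simp
  have hss := shell_sum hU hl x r hν k0 f ((summable_nat_add_iff k0).2 hfs) hfb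
  have hh := AI_half hU hl x r
  have hv : (volume U).toReal * (2 * Real.pi) * (4 * (1 + ν) ^ k0) ^ 2 ≤ Real.pi ^ 2 * τ / 2 := by
    have := hUr.trans (min_le_right _ _)
    rw [le_div_iff₀ hWp, hW] at this
    linarith
  have hp : 0 < Real.pi ^ 2 * τ := by positivity
  linarith
end Wolff

open MeasureTheory Metric
open scoped ENNReal
namespace Wolff

/-- a plate is bad if it contains a point with large moments -/
def BQ (R ν : ℝ) (G : ℝ × ℝ → ℂ) (Ω : Set (ℝ × ℝ × ℝ)) (c h C : ℝ) (Q : ℤ × ℤ × ℤ) : Prop :=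
  ∃ z ∈ Ω, fl R c h z = Q ∧ ¬ HC R ν G c h 0 z C

open Classical in
theorem ind_le {R ν : ℝ} {G : ℝ × ℝ → ℂ} {Ω : Set (ℝ × ℝ × ℝ)} {c h C : ℝ} (hC : 0 < C) (p : ℕ) (Q : ℤ × ℤ × ℤ) :
    (if BQ R ν G Ω c h C Q then (1 : ℝ≥0∞) else 0) ≤ ENNReal.ofReal (1 / C) ^ p *
      ∑' b : ℕ, ((2 : ℝ≥0∞)⁻¹) ^ (b * p) * ⨆ z ∈ Ω, ⨆ (_ : fl R c h z = Q), SP R ν G c h b z ^ p := by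
  split_ifs with hb
  · obtain ⟨z, hz, hQ, hH⟩ := hb
    unfold HC HB at hH
    push Not at hH
    obtain ⟨m, β, hm⟩ := hH
    rw [zero_add] at hm
    change _ < ‖uu R ν G c h m β z‖ at hm
    have h1 : (1 : ℝ≥0∞) ≤ ENNReal.ofReal (1 / C) * (2⁻¹ ^ m * SP R ν G c h m z) := by
      have e : (2⁻¹ : ℝ≥0∞) ^ m = ENNReal.ofReal ((1 / 2) ^ m) := by
        rw [ENNReal.ofReal_pow (by norm_num), one_div, ENNReal.ofReal_inv_of_pos (by norm_num)]; simp
      calc (1 : ℝ≥0∞) = ENNReal.ofReal 1 := by simp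
        _ ≤ ENNReal.ofReal (1 / C * ((1 / 2) ^ m * ‖uu R ν G c h m β z‖)) := by
          apply ENNReal.ofReal_le_ofReal
          have h2 : (1 / 2 : ℝ) ^ m * (4 ^ m * C) = 2 ^ m * C := by
            rw [← mul_assoc, ← mul_pow]; norm_num
          have h3 : (1 : ℝ) ≤ 2 ^ m := one_le_pow₀ (by norm_num)
          have h4 : (1 / 2 : ℝ) ^ m * (4 ^ m * C) ≤ (1 / 2 : ℝ) ^ m * ‖uu R ν G c h m β z‖ :=
            mul_le_mul_of_nonneg_left hm.le (by positivity)
          rw [one_div, ← div_eq_inv_mul, le_div_iff₀ hC]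
          nlinarith
        _ = ENNReal.ofReal (1 / C) * (2⁻¹ ^ m * ‖uu R ν G c h m β z‖ₑ) := by
          rw [ENNReal.ofReal_mul (by positivity), ENNReal.ofReal_mul (by positivity), e, ofReal_norm]
        _ ≤ _ := by gcongr; exact uu_le_SP _ _ _ _ _ _ _ _
    calc (1 : ℝ≥0∞) ≤ (ENNReal.ofReal (1 / C) * (2⁻¹ ^ m * SP R ν G c h m z)) ^ p := one_le_pow₀ h1
      _ = ENNReal.ofReal (1 / C) ^ p * (2⁻¹ ^ (m * p) * SP R ν G c h m z ^ p) := by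
        rw [mul_pow, mul_pow, ← pow_mul]
      _ ≤ ENNReal.ofReal (1 / C) ^ p * (2⁻¹ ^ (m * p) * ⨆ z ∈ Ω, ⨆ (_ : fl R c h z = Q), SP R ν G c h m z ^ p) := by
        gcongr
        exact le_iSup₂_of_le z hz (le_iSup_of_le hQ le_rfl)
      _ ≤ _ := by
        gcongr
        exact ENNReal.le_tsum (f := fun b : ℕ => ((2 : ℝ≥0∞)⁻¹) ^ (b * p) * ⨆ z ∈ Ω, ⨆ (_ : fl R c h z = Q), SP R ν G c h b z ^ p) m
  · exact zero_le

open Classical in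
theorem count_le {K : ℕ} {R : ℝ} {G : ℝ × ℝ → ℂ} {Ω : Set (ℝ × ℝ × ℝ)} {C : ℝ} (hC : 0 < C) (p : ℕ) :
    ∑ l ∈ Finset.range K, ∑' Q, (if BQ R (1 / (K : ℝ) ^ 4) G Ω (cc K 1 l) (hj K 1) C Q then (1 : ℝ≥0∞) else 0) ≤
      ENNReal.ofReal (1 / C) ^ p * GG K R G Ω p 1 := by
  calc _ ≤ ∑ l ∈ Finset.range K, ∑' Q, ENNReal.ofReal (1 / C) ^ p *
      ∑' b : ℕ, ((2 : ℝ≥0∞)⁻¹) ^ (b * p) * ⨆ z ∈ Ω, ⨆ (_ : fl R (cc K 1 l) (hj K 1) z = Q), SP R (1 / (K : ℝ) ^ 4) G (cc K 1 l) (hj K 1) b z ^ p :=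
        Finset.sum_le_sum fun l _ => ENNReal.tsum_le_tsum fun Q => ind_le hC p Q
    _ = ENNReal.ofReal (1 / C) ^ p * ∑ l ∈ Finset.range K, ∑' b : ℕ, ((2 : ℝ≥0∞)⁻¹) ^ (b * p) * MP R (1 / (K : ℝ) ^ 4) G Ω p (cc K 1 l) (hj K 1) b := by
        rw [Finset.mul_sum]
        refine Finset.sum_congr rfl fun l _ => ?_
        rw [ENNReal.tsum_mul_left, ENNReal.tsum_comm]
        simp only [ENNReal.tsum_mul_left, MP]
    _ ≤ _ := by
        apply le_of_eq
        unfold GG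
        rw [pow_one, ← Summable.tsum_finsetSum fun _ _ => ENNReal.summable]
        simp only [Finset.mul_sum]

theorem plate_diam {K : ℕ} (hK : 1 ≤ K) {R c : ℝ} (hR : 0 < R) (hc : |c| ≤ 1) {σ : ℝ} (hσ : σ = 1 ∨ σ = -1)
    {p p' : (ℝ × ℝ) × ℝ} (h : fl R c (hj K 1) (zs σ p.1 p.2) = fl R c (hj K 1) (zs σ p'.1 p'.2)) :
    dist p p' ≤ 2 * K ^ 2 / R := by
  have hK1 : (1 : ℝ) ≤ K := by exact_mod_cast hK
  have hKp : (0 : ℝ) < K := by linarith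
  simp only [fl, Prod.mk.injEq] at h
  obtain ⟨h1, h2, h3⟩ := h
  have g1 := Int.abs_sub_lt_one_of_floor_eq_floor h1
  have g2 := Int.abs_sub_lt_one_of_floor_eq_floor h2
  have g3 := Int.abs_sub_lt_one_of_floor_eq_floor h3
  simp only [TT, zs, hj, pow_one] at g1 g2 g3
  set a := p.1.1 - p'.1.1 with ha
  set b := p.1.2 - p'.1.2 with hb
  set e := σ * (p.2 - p'.2) with he
  have f3 : |a + e| ≤ K ^ 2 / (4 * R) := by
    rw [le_div_iff₀ (by positivity)]
    have : 4 * R * (1 / (K:ℝ)) ^ 2 * (p.1.1 + σ * p.2) - 4 * R * (1 / (K:ℝ)) ^ 2 * (p'.1.1 + σ * p'.2) = (a + e) * (4 * R) / K ^ 2 := by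
      rw [ha, he]; field_simp; ring
    rw [this, abs_div, abs_mul, abs_of_pos (by positivity : (0:ℝ) < 4 * R), abs_of_pos (by positivity : (0:ℝ) < K ^ 2), div_lt_one (by positivity)] at g3
    exact g3.le
  have f2 : |-(2 * b) + 2 * c * (a + e)| ≤ K / (2 * R) := by
    rw [le_div_iff₀ (by positivity)]
    have : 2 * R * (1 / (K:ℝ)) * (-2 * p.1.2 + 2 * c * (p.1.1 + σ * p.2)) - 2 * R * (1 / (K:ℝ)) * (-2 * p'.1.2 + 2 * c * (p'.1.1 + σ * p'.2)) = (-(2 * b) + 2 * c * (a + e)) * (2 * R) / K := by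
      rw [ha, hb, he]; field_simp; ring
    rw [this, abs_div, abs_mul, abs_of_pos (by positivity : (0:ℝ) < 2 * R), abs_of_pos hKp, div_lt_one hKp] at g2
    exact g2.le
  have f1 : |(-a + e) + (-(2 * b)) * c + (a + e) * c ^ 2| ≤ 1 / R := by
    rw [le_div_iff₀ (by positivity)]
    have : R * (-p.1.1 + σ * p.2 + -2 * p.1.2 * c + (p.1.1 + σ * p.2) * c ^ 2) - R * (-p'.1.1 + σ * p'.2 + -2 * p'.1.2 * c + (p'.1.1 + σ * p'.2) * c ^ 2) = ((-a + e) + (-(2 * b)) * c + (a + e) * c ^ 2) * R := by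
      rw [ha, hb, he]; ring
    rw [this, abs_mul, abs_of_pos hR] at g1
    exact g1.le
  set Z := (K:ℝ) ^ 2 / R with hZ
  have i3 : |a + e| ≤ Z / 4 := f3.trans (le_of_eq (by rw [hZ]; field_simp))
  have iK : (K:ℝ) ≤ K ^ 2 := by nlinarith
  have i2 : |-(2 * b) + 2 * c * (a + e)| ≤ Z / 2 := by
    refine f2.trans ?_
    rw [hZ, div_div, mul_comm R 2]
    gcongr
  have i1 : |(-a + e) + (-(2 * b)) * c + (a + e) * c ^ 2| ≤ Z := by
    refine f1.trans ?_
    rw [hZ]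
    gcongr
    nlinarith
  have j1 : |c * (a + e)| ≤ Z / 4 := by
    rw [abs_mul]; nlinarith [abs_nonneg c, abs_nonneg (a + e)]
  have j2 : |2 * b| ≤ Z := by
    rw [abs_le] at *
    constructor <;> linarith
  have j3 : |2 * b * c| ≤ Z := by
    rw [abs_mul]; nlinarith [abs_nonneg c, abs_nonneg (2 * b)]
  have j4 : |(a + e) * c ^ 2| ≤ Z / 4 := by
    rw [abs_mul, abs_of_nonneg (by positivity : 0 ≤ c ^ 2)]
    have : c ^ 2 ≤ 1 := by rw [← sq_abs]; nlinarith [abs_nonneg c]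
    nlinarith [abs_nonneg (a + e)]
  have k1 : |-a + e| ≤ 9 / 4 * Z := by
    rw [abs_le] at *
    constructor <;> linarith
  have hZ0 : 0 ≤ Z := by positivity
  have l1 : |a| ≤ 2 * Z := by
    rw [abs_le] at *
    constructor <;> linarith
  have l2 : |b| ≤ 2 * Z := by
    rw [abs_le] at *
    constructor <;> linarith
  have l3 : |e| ≤ 2 * Z := by
    rw [abs_le] at *
    constructor <;> linarith
  have l4 : |p.2 - p'.2| ≤ 2 * Z := by
    have : |σ| = 1 := by rcases hσ with h | h <;> simp [h]
    rwa [he, abs_mul, this, one_mul] at l3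
  have e0 : 2 * (K:ℝ) ^ 2 / R = 2 * Z := by rw [hZ]; ring
  rw [e0, Prod.dist_eq, Prod.dist_eq, Real.dist_eq, Real.dist_eq, Real.dist_eq]
  exact max_le (max_le l1 l2) l4

noncomputable def sg (b : Bool) : ℝ := if b then 1 else -1

theorem sg_pm (b : Bool) : sg b = 1 ∨ sg b = -1 := by cases b <;> simp [sg]

/-- covering sets -/
def TS (K : ℕ) (M : ℝ) (U : Set (ℝ × ℝ)) (k : ℕ) (b : Bool) (l : ℕ) (Q : ℤ × ℤ × ℤ) : Set ((ℝ × ℝ) × ℝ) :=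
  {p | zs (sg b) p.1 p.2 ∈ OM M ∧ fl ((1 + 1 / (K : ℝ) ^ 4) ^ k) (cc K 1 l) (hj K 1) (zs (sg b) p.1 p.2) = Q ∧
    ¬ HC ((1 + 1 / (K : ℝ) ^ 4) ^ k) (1 / (K : ℝ) ^ 4) (GU U) (cc K 1 l) (hj K 1) 0 (zs (sg b) p.1 p.2) (1 / (k : ℝ) ^ 2)}

theorem TS_diam {K : ℕ} (hK : 1 ≤ K) {M : ℝ} {U : Set (ℝ × ℝ)} {k : ℕ} {b : Bool} {l : ℕ} (hl : l < K) {Q : ℤ × ℤ × ℤ} :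
    ediam (TS K M U k b l Q) ≤ ENNReal.ofReal (2 * K ^ 2 / (1 + 1 / (K : ℝ) ^ 4) ^ k) := by
  apply Metric.ediam_le
  intro p hp p' hp'
  rw [edist_dist]
  apply ENNReal.ofReal_le_ofReal
  have h1 := cc_abs (K := K) (j := 1) (l := l) (by omega) (by simpa using hl)
  have h2 : 0 < hj K 1 := hj_pos (by omega) 1
  exact plate_diam hK (by positivity) (by linarith) (sg_pm b) (hp.2.1.trans hp'.2.1.symm)

open Classical in
theorem TS_diam_ind {K : ℕ} (hK : 1 ≤ K) {M : ℝ} {U : Set (ℝ × ℝ)} {k : ℕ} {b : Bool} {l : ℕ} (hl : l < K) {Q : ℤ × ℤ × ℤ} {s : ℝ} (hs : 0 < s) :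
    ediam (TS K M U k b l Q) ^ s ≤ ENNReal.ofReal (2 * K ^ 2 / (1 + 1 / (K : ℝ) ^ 4) ^ k) ^ s *
      (if BQ ((1 + 1 / (K : ℝ) ^ 4) ^ k) (1 / (K : ℝ) ^ 4) (GU U) (OM M) (cc K 1 l) (hj K 1) (1 / (k : ℝ) ^ 2) Q then (1 : ℝ≥0∞) else 0) := by
  split_ifs with h
  · rw [mul_one]
    exact ENNReal.rpow_le_rpow (TS_diam hK hl) hs.le
  · have : TS K M U k b l Q = ∅ := by
      rw [Set.eq_empty_iff_forall_notMem]
      intro p hp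
      exact h ⟨_, hp.1, hp.2.1, hp.2.2⟩
    rw [this, Metric.ediam_empty, ENNReal.zero_rpow_of_pos hs, mul_zero]

theorem level_sum {K : ℕ} (hK : 1 ≤ K) {M : ℝ} {U : Set (ℝ × ℝ)} {k : ℕ} (hk : 1 ≤ k) {s : ℝ} (hs : 0 < s) (p : ℕ) :
    ∑' i : Bool × Fin K × (ℤ × ℤ × ℤ), ediam (TS K M U k i.1 i.2.1 i.2.2) ^ s ≤
     2 * (ENNReal.ofReal (2 * K ^ 2 / (1 + 1 / (K : ℝ) ^ 4) ^ k) ^ s *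
      (ENNReal.ofReal ((k:ℝ) ^ 2) ^ p * GG K ((1 + 1 / (K : ℝ) ^ 4) ^ k) (GU U) (OM M) p 1)) := by
  classical
  have hkp : (0:ℝ) < k := by exact_mod_cast hk
  have hC : (0:ℝ) < 1 / (k : ℝ) ^ 2 := by positivity
  have hcount := count_le (K := K) (R := (1 + 1 / (K : ℝ) ^ 4) ^ k) (G := GU U) (Ω := OM M) hC p
  rw [one_div_one_div] at hcount
  set dd := ENNReal.ofReal (2 * K ^ 2 / (1 + 1 / (K : ℝ) ^ 4) ^ k) ^ s with hdd
  calc _ ≤ ∑' i : Bool × Fin K × (ℤ × ℤ × ℤ), dd * (if BQ ((1 + 1 / (K : ℝ) ^ 4) ^ k) (1 / (K : ℝ) ^ 4) (GU U) (OM M) (cc K 1 i.2.1) (hj K 1) (1 / (k : ℝ) ^ 2) i.2.2 then (1 : ℝ≥0∞) else 0) :=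
        ENNReal.tsum_le_tsum fun i => TS_diam_ind hK i.2.1.2 hs
    _ = 2 * (dd * ∑ l ∈ Finset.range K, ∑' Q, (if BQ ((1 + 1 / (K : ℝ) ^ 4) ^ k) (1 / (K : ℝ) ^ 4) (GU U) (OM M) (cc K 1 l) (hj K 1) (1 / (k : ℝ) ^ 2) Q then (1 : ℝ≥0∞) else 0)) := by
        rw [ENNReal.tsum_mul_left, ENNReal.tsum_prod', tsum_fintype, Fintype.sum_bool]
        simp only [ENNReal.tsum_prod', tsum_fintype]
        rw [Finset.sum_range]
        ring
    _ ≤ _ := by gcongr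

end Wolff

open MeasureTheory Metric
open scoped ENNReal
namespace Wolff

/-- the dominating sequence -/
theorem dom_seq {K : ℕ} (hK : 64 ≤ K) {q : ℕ} {C s δ : ℝ} (hC : 0 ≤ C) (hs : 1 + δ < s) (p : ℕ) :
    ∃ g : ℕ → ℝ≥0∞, ∑' k, g k ≠ ⊤ ∧ ∀ k : ℕ, 
     2 * (ENNReal.ofReal (2 * K ^ 2 / (1 + 1 / (K : ℝ) ^ 4) ^ k) ^ s *
      (ENNReal.ofReal ((k:ℝ) ^ 2) ^ p * ENNReal.ofReal (C * (1 + Real.log ((1 + 1 / (K : ℝ) ^ 4) ^ k)) ^ q * (((1 + 1 / (K : ℝ) ^ 4) ^ k) * ((1 + 1 / (K : ℝ) ^ 4) ^ k) ^ δ)))) ≤ g k := by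
  have hKp : (1 : ℝ) ≤ K := by exact_mod_cast (by omega : 1 ≤ K)
  set ν : ℝ := 1 / (K : ℝ) ^ 4 with hν
  have hν0 : 0 < ν := by positivity
  have hν1 : ν ≤ 1 := by
    rw [hν, div_le_one (by positivity)]; exact one_le_pow₀ hKp
  set A : ℝ := 2 * (2 * (K:ℝ) ^ 2) ^ s * C with hA
  have hA0 : 0 ≤ A := by positivity
  set θ : ℝ := (1 + ν) ^ (1 + δ - s) with hθ
  have hθ0 : 0 < θ := by positivity
  have hθ1 : θ < 1 := Real.rpow_lt_one_of_one_lt_of_neg (by linarith) (by linarith)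
  have hsum : Summable fun k : ℕ => A * (((k:ℝ) + 1) ^ (2 * p + q) * θ ^ k) := by
    apply Summable.mul_left
    have h1 := summable_pow_mul_geometric_of_norm_lt_one (2 * p + q) (r := θ) (by rwa [Real.norm_eq_abs, abs_of_pos hθ0])
    have h2 := ((summable_nat_add_iff 1).2 h1).mul_right θ⁻¹
    refine h2.congr fun k => ?_
    push_cast
    rw [pow_succ]
    field_simp
  refine ⟨fun k => ENNReal.ofReal (A * (((k:ℝ) + 1) ^ (2 * p + q) * θ ^ k)), hsum.tsum_ofReal_ne_top, ?_⟩
  intro k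
  have hRk : 0 < (1 + ν) ^ k := by positivity
  have hlog : Real.log ((1 + ν) ^ k) ≤ k := by
    rw [Real.log_pow]
    have : Real.log (1 + ν) ≤ 1 := by
      have := Real.log_le_sub_one_of_pos (by linarith : 0 < 1 + ν)
      linarith
    exact mul_le_of_le_one_right (by positivity) this
  have hlog0 : 0 ≤ Real.log ((1 + ν) ^ k) := Real.log_nonneg (one_le_pow₀ (by linarith))
  have h2 : (2 : ℝ≥0∞) = ENNReal.ofReal 2 := by simp
  have hs0 : ENNReal.ofReal (2 * K ^ 2 / (1 + ν) ^ k) ^ s = ENNReal.ofReal ((2 * K ^ 2 / (1 + ν) ^ k) ^ s) :=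
    ENNReal.ofReal_rpow_of_pos (by positivity)
  rw [hs0, ← ENNReal.ofReal_pow (by positivity), ← ENNReal.ofReal_mul (by positivity), ← ENNReal.ofReal_mul (by positivity), h2, ← ENNReal.ofReal_mul (by norm_num)]
  apply ENNReal.ofReal_le_ofReal
  have e1 : (2 * (K:ℝ) ^ 2 / (1 + ν) ^ k) ^ s = (2 * (K:ℝ) ^ 2) ^ s / ((1 + ν) ^ k) ^ s := Real.div_rpow (by positivity) (by positivity) _
  have e2 : θ ^ k = (1 + ν) ^ k * ((1 + ν) ^ k) ^ δ / ((1 + ν) ^ k) ^ s := by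
    rw [hθ, ← Real.rpow_natCast, ← Real.rpow_mul (by positivity), mul_comm, Real.rpow_mul (by positivity), Real.rpow_natCast,
      Real.rpow_sub hRk, Real.rpow_add hRk, Real.rpow_one]
  rw [e1]
  calc _ = A * (((k:ℝ) ^ 2) ^ p * (1 + Real.log ((1 + ν) ^ k)) ^ q * θ ^ k) := by rw [e2, hA]; ring
    _ ≤ A * (((k:ℝ) + 1) ^ (2 * p) * ((k:ℝ) + 1) ^ q * θ ^ k) := by
        rw [← pow_mul]
        have i1 : (k:ℝ) ^ (2 * p) ≤ ((k:ℝ) + 1) ^ (2 * p) := pow_le_pow_left₀ (by positivity) (by linarith) _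
        have i2 : (1 + Real.log ((1 + ν) ^ k)) ^ q ≤ ((k:ℝ) + 1) ^ q := pow_le_pow_left₀ (by linarith) (by linarith) _
        exact mul_le_mul_of_nonneg_left (mul_le_mul_of_nonneg_right (mul_le_mul i1 i2 (by positivity) (by positivity)) (by positivity)) hA0
    _ = _ := by rw [← pow_add]

theorem core {q : ℕ} (hq : 3 ≤ q) {M r0 τ s : ℝ} (hM : 1 ≤ M) (hr0 : 0 < r0) (hτ : 0 < τ) (hs : 1 + 23 / (2 * q : ℝ) < s)
    {D : Set ((ℝ × ℝ) × ℝ)} (hD : ∀ p ∈ D, |p.1.1| + p.2 ≤ M ∧ 2 * |p.1.2| ≤ M ∧ r0 ≤ p.2)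
    (hU : ∀ ε : ℝ, 0 < ε → ∃ U : Set (ℝ × ℝ), IsOpen U ∧ U ⊆ bx M ∧ volume U ≤ ENNReal.ofReal ε ∧
      ∀ p ∈ D, ENNReal.ofReal τ < volume {φ ∈ Set.Ioc 0 (2 * Real.pi) | pt p.1 p.2 φ ∈ U}) :
    μH[s] D = 0 := by
  obtain ⟨C, hC, hGG⟩ := GG1_bd hq hM
  set K : ℕ := a0 ^ q with hKd
  have hK : 64 ≤ K := by
    have : a0 ≤ a0 ^ q := Nat.le_self_pow (by omega) _
    have h2 : 64 ≤ a0 := by unfold a0; norm_num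
    omega
  clear_value K
  have hs0 : 0 < s := by
    have : (0:ℝ) ≤ 23 / (2 * q : ℝ) := by positivity
    linarith
  have hKp : (1 : ℝ) ≤ K := by exact_mod_cast (by omega : 1 ≤ K)
  have hν0 : (0:ℝ) < 1 / (K:ℝ) ^ 4 := by positivity
  have htop := tendsto_pow_atTop_atTop_of_one_lt (by linarith : 1 < 1 + 1 / (K:ℝ) ^ 4)
  obtain ⟨N0, hN0⟩ := (htop.eventually_ge_atTop ((K:ℝ) ^ 6)).exists
  have hRge : ∀ k ≥ N0, (K:ℝ) ^ 6 ≤ (1 + 1 / (K:ℝ) ^ 4) ^ k := fun k hk => hN0.trans (pow_le_pow_right₀ (by linarith) hk)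
  have hex : ∀ n : ℕ, ∃ U : Set (ℝ × ℝ), IsOpen U ∧ U ⊆ bx M ∧ ∀ p ∈ D, ∃ k ≥ n, ∃ σ : ℝ, (σ = 1 ∨ σ = -1) ∧ ∃ l < K,
        ¬ HC ((1 + 1 / (K : ℝ) ^ 4) ^ k) (1 / (K : ℝ) ^ 4) (GU U) (cc K 1 l) (hj K 1) 0 (zs σ p.1 p.2) (1 / (k : ℝ) ^ 2) := by
    intro n
    obtain ⟨k0, hk0, -, ε, hε, hb⟩ := bad_exists hK hr0 hτ n
    obtain ⟨U, hUo, hUb, hUε, hUa⟩ := hU ε hε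
    refine ⟨U, hUo, hUb, fun p hp => ?_⟩
    obtain ⟨k, hk, h⟩ := hb U hUo hUε p.1 p.2 (hD p hp).2.2 (hUa p hp)
    exact ⟨k, hk0.le.trans hk, h⟩
  choose U hUo hUb hUc using hex
  obtain ⟨g, hg, hgk⟩ := dom_seq hK (q := 44 * q) hC hs (22 * q)
  set N1 := N0 + 1 with hN1
  let t : ∀ n : ℕ, (ℕ × (Bool × Fin K × (ℤ × ℤ × ℤ))) → Set ((ℝ × ℝ) × ℝ) := fun n i =>
    TS K M (U (n + N1)) (i.1 + (n + N1)) i.2.1 i.2.2.1 i.2.2.2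
  have hcov : ∀ n, D ⊆ ⋃ i, t n i := by
    intro n p hp
    obtain ⟨k, hk, σ, hσ, l, hl, hH⟩ := hUc (n + N1) p hp
    obtain ⟨b, hb⟩ : ∃ b : Bool, sg b = σ := by
      rcases hσ with h | h
      · exact ⟨true, by simp [sg, h]⟩
      · exact ⟨false, by simp [sg, h]⟩
    obtain ⟨j, rfl⟩ : ∃ j, k = j + (n + N1) := ⟨k - (n + N1), by omega⟩
    refine Set.mem_iUnion.2 ⟨(j, b, ⟨l, hl⟩, fl ((1 + 1 / (K : ℝ) ^ 4) ^ (j + (n + N1))) (cc K 1 l) (hj K 1) (zs σ p.1 p.2)), ?_⟩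
    refine ⟨?_, ?_, ?_⟩
    · obtain ⟨h1, h2, h3⟩ := hD p hp
      have hs1 : |sg b| = 1 := by rcases sg_pm b with h | h <;> simp [h]
      have hs2 : |sg b * p.2| = p.2 := by rw [abs_mul, hs1, one_mul, abs_of_pos (hr0.trans_le h3)]
      refine ⟨?_, ?_, ?_⟩
      · simp only [zs]
        refine (abs_add_le _ _).trans ?_
        rw [abs_neg, hs2]; exact h1
      · simp only [zs]
        rw [abs_mul]; norm_num; exact h2
      · simp only [zs]
        refine (abs_add_le _ _).trans ?_
        rw [hs2]; exact h1
    · simp only [hb]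
    · simp only [hb]; exact hH
  have hdiam : ∀ n i, ediam (t n i) ≤ ENNReal.ofReal (2 * K ^ 2 / (1 + 1 / (K : ℝ) ^ 4) ^ n) := by
    intro n i
    refine (TS_diam (by omega) i.2.2.1.2).trans ?_
    apply ENNReal.ofReal_le_ofReal
    apply div_le_div_of_nonneg_left (by positivity) (by positivity)
    exact pow_le_pow_right₀ (by linarith) (by omega)
  have hr : Filter.Tendsto (fun n : ℕ => ENNReal.ofReal (2 * K ^ 2 / (1 + 1 / (K : ℝ) ^ 4) ^ n)) Filter.atTop (nhds 0) := by
    have := ENNReal.tendsto_ofReal (Filter.Tendsto.const_div_atTop htop (2 * (K:ℝ) ^ 2))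
    simpa using this
  have hsumb : ∀ n, ∑' i, ediam (t n i) ^ s ≤ ∑' k, g (k + (n + N1)) := by
    intro n
    rw [ENNReal.tsum_prod']
    refine ENNReal.tsum_le_tsum fun k => ?_
    have hG := hGG _ (hRge (k + (n + N1)) (by omega)) _ (hUo (n + N1)).measurableSet (hUb (n + N1))
    refine (level_sum (U := U (n + N1)) (M := M) (k := k + (n + N1)) (by omega) (by omega) hs0 (22 * q)).trans (le_trans ?_ (hgk (k + (n + N1))))
    exact mul_le_mul_right (mul_le_mul_right (mul_le_mul_right hG _) _) _
  have hlim : Filter.Tendsto (fun n => ∑' i, ediam (t n i) ^ s) Filter.atTop (nhds 0) := by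
    have h0 := (ENNReal.tendsto_sum_nat_add g hg).comp (Filter.tendsto_add_atTop_nat N1)
    exact tendsto_of_tendsto_of_tendsto_of_le_of_le tendsto_const_nhds h0 (fun _ => zero_le) hsumb
  have := Measure.hausdorffMeasure_le_liminf_tsum s D _ hr t (Filter.Eventually.of_forall hdiam) (Filter.Eventually.of_forall hcov)
  rw [hlim.liminf_eq] at this
  exact le_antisymm this zero_le
end Wolff

open MeasureTheory Metric
open scoped ENNReal
namespace Wolff

noncomputable def planeEquiv : EuclideanSpace ℝ (Fin 2) ≃L[ℝ] ℝ × ℝ :=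
  (EuclideanSpace.equiv (Fin 2) ℝ).trans (ContinuousLinearEquiv.finTwoArrow ℝ ℝ)

theorem planeEquiv_apply (v : EuclideanSpace ℝ (Fin 2)) : planeEquiv v = (v 0, v 1) := rfl

theorem planeEquiv_mp : MeasurePreserving (planeEquiv : EuclideanSpace ℝ (Fin 2) → ℝ × ℝ) :=
  (volume_preserving_finTwoArrow ℝ).comp (PiLp.volume_preserving_ofLp (Fin 2))

theorem pt_lip (x : ℝ × ℝ) {r : ℝ} (hr : 0 ≤ r) : LipschitzWith r.toNNReal (pt x r) := by
  apply LipschitzWith.of_dist_le_mul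
  intro a b
  rw [Prod.dist_eq, Real.dist_eq, Real.dist_eq, Real.dist_eq, Real.coe_toNNReal _ hr]
  simp only [pt]
  apply max_le
  · rw [add_sub_add_left_eq_sub, ← mul_sub, abs_mul, abs_of_nonneg hr]
    exact mul_le_mul_of_nonneg_left (Real.abs_cos_sub_cos_le a b) hr
  · rw [add_sub_add_left_eq_sub, ← mul_sub, abs_mul, abs_of_nonneg hr]
    exact mul_le_mul_of_nonneg_left (Real.abs_sin_sub_sin_le a b) hr

theorem exists_angle {u v : ℝ} (h : u ^ 2 + v ^ 2 = 1) : ∃ φ ∈ Set.Ioc 0 (2 * Real.pi), Real.cos φ = u ∧ Real.sin φ = v := by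
  set z : ℂ := ⟨u, v⟩ with hz
  have hn : ‖z‖ = 1 := by
    rw [Complex.norm_def, Complex.normSq_mk, Real.sqrt_eq_one]; linarith
  have hz0 : z ≠ 0 := by intro h0; rw [h0] at hn; simp at hn
  have hc := Complex.cos_arg hz0
  have hs := Complex.sin_arg z
  rw [hn, div_one] at hc hs
  have h1 := Complex.neg_pi_lt_arg z
  have h2 := Complex.arg_le_pi z
  have hp := Real.pi_pos
  rcases lt_or_ge 0 z.arg with h3 | h3
  · exact ⟨z.arg, ⟨h3, by linarith⟩, hc, hs⟩
  · exact ⟨z.arg + 2 * Real.pi, ⟨by linarith, by linarith⟩, by rw [Real.cos_add_two_pi, hc], by rw [Real.sin_add_two_pi, hs]⟩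

theorem arc_pos {B : Set (EuclideanSpace ℝ (Fin 2))} {x : EuclideanSpace ℝ (Fin 2)} {r : ℝ} (hr : 0 < r)
    (h : 0 < μH[1] (B ∩ Metric.sphere x r)) :
    0 < volume {φ ∈ Set.Ioc 0 (2 * Real.pi) | pt (planeEquiv x) r φ ∈ planeEquiv.symm ⁻¹' B} := by
  by_contra hcon
  have h0 := le_antisymm (not_lt.1 hcon) zero_le
  set A := {φ ∈ Set.Ioc 0 (2 * Real.pi) | pt (planeEquiv x) r φ ∈ planeEquiv.symm ⁻¹' B} with hA
  have hsub : B ∩ Metric.sphere x r ⊆ (fun φ => planeEquiv.symm (pt (planeEquiv x) r φ)) '' A := by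
    rintro y ⟨hyB, hy⟩
    rw [mem_sphere, EuclideanSpace.dist_eq, Fin.sum_univ_two, Real.dist_eq, Real.dist_eq, sq_abs, sq_abs] at hy
    have hy2 : (y 0 - x 0) ^ 2 + (y 1 - x 1) ^ 2 = r ^ 2 := by
      rw [← hy, Real.sq_sqrt (by positivity)]
    obtain ⟨φ, hφ, hc, hs⟩ := exists_angle (u := (y 0 - x 0) / r) (v := (y 1 - x 1) / r) (by
      field_simp; exact hy2)
    have e : pt (planeEquiv x) r φ = planeEquiv y := by
      rw [pt, planeEquiv_apply, planeEquiv_apply, hc, hs]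
      simp only [Prod.mk.injEq]
      constructor <;> field_simp <;> ring
    refine ⟨φ, ⟨hφ, ?_⟩, ?_⟩
    · rw [e]; simpa using hyB
    · simp only [e]; simp
  have hlip := planeEquiv.symm.lipschitz.comp (pt_lip (planeEquiv x) hr.le)
  have h1 := hlip.hausdorffMeasure_image_le (d := 1) (by norm_num) A
  rw [hausdorffMeasure_real, h0, mul_zero] at h1
  have h2 := (measure_mono hsub).trans h1
  exact absurd h (not_lt.2 h2)

theorem dim_step {B : Set (EuclideanSpace ℝ (Fin 2))} (hB : volume B = 0) {L : ℝ} (hL : 1 ≤ L) {D : Set (EuclideanSpace ℝ (Fin 2) × ℝ)}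
    (hD : ∀ p ∈ D, |p.1 0| ≤ L ∧ |p.1 1| ≤ L ∧ 1 / L ≤ p.2 ∧ p.2 ≤ L ∧
      ENNReal.ofReal (1 / L) < volume {φ ∈ Set.Ioc 0 (2 * Real.pi) | pt (planeEquiv p.1) p.2 φ ∈ planeEquiv.symm ⁻¹' B}) : dimH D ≤ 1 := by
  have hLp : 0 < L := by linarith
  have hB' : volume (planeEquiv.symm ⁻¹' B) = 0 := by
    have hE : (planeEquiv : EuclideanSpace ℝ (Fin 2) → ℝ × ℝ) ⁻¹' (planeEquiv.symm ⁻¹' B) = B := by ext; simp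
    have := planeEquiv_mp.measure_preimage_emb planeEquiv.toHomeomorph.measurableEmbedding (planeEquiv.symm ⁻¹' B)
    rw [← this, hE, hB]
  set F : (EuclideanSpace ℝ (Fin 2) × ℝ) ≃L[ℝ] ((ℝ × ℝ) × ℝ) := planeEquiv.prodCongr (ContinuousLinearEquiv.refl ℝ ℝ) with hF
  rw [← F.dimH_image D]
  apply le_of_forall_gt_imp_ge_of_dense
  intro s hs
  rcases eq_or_ne s ⊤ with rfl | hst
  · exact le_top
  lift s to NNReal using hst
  have hs1 : (1:ℝ) < s := by exact_mod_cast hs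
  apply dimH_le_of_hausdorffMeasure_ne_top
  obtain ⟨q0, hq0⟩ := exists_nat_gt (23 / (s - 1 : ℝ))
  have hsp : (0:ℝ) < s - 1 := by linarith
  have hq : 1 + 23 / (2 * ((q0 + 3 : ℕ) : ℝ)) < s := by
    rw [div_lt_iff₀ hsp] at hq0
    have : 23 / (2 * ((q0 + 3 : ℕ) : ℝ)) < s - 1 := by
      rw [div_lt_iff₀ (by positivity)]
      push_cast
      have : 0 ≤ (q0:ℝ) * (s - 1) := by positivity
      nlinarith
    linarith
  have := core (D := F '' D) (q := q0 + 3) (by omega) (M := 4 * L) (r0 := 1 / L) (τ := 1 / L) (by linarith) (by positivity) (by positivity) hq ?_ ?_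
  · rw [this]; simp
  · rintro _ ⟨p, hp, rfl⟩
    obtain ⟨h1, h2, h3, h4, -⟩ := hD p hp
    change |p.1 0| + p.2 ≤ 4 * L ∧ 2 * |p.1 1| ≤ 4 * L ∧ 1 / L ≤ p.2
    exact ⟨by linarith, by linarith, h3⟩
  · intro ε hε
    have hlt : volume (planeEquiv.symm ⁻¹' B) < ENNReal.ofReal ε := by rw [hB']; exact ENNReal.ofReal_pos.2 hε
    obtain ⟨U, hBU, hUo, hUε⟩ := Set.exists_isOpen_lt_of_lt _ _ hlt
    refine ⟨U ∩ (Set.Ioo (-(4 * L)) (4 * L) ×ˢ Set.Ioo (-(4 * L)) (4 * L)), hUo.inter (isOpen_Ioo.prod isOpen_Ioo), ?_, ?_, ?_⟩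
    · intro y hy
      exact ⟨Set.Ioo_subset_Icc_self hy.2.1, Set.Ioo_subset_Icc_self hy.2.2⟩
    · exact (measure_mono Set.inter_subset_left).trans hUε.le
    · rintro _ ⟨p, hp, rfl⟩
      obtain ⟨h1, h2, h3, h4, h5⟩ := hD p hp
      refine h5.trans_le (measure_mono ?_)
      rintro φ ⟨hφ, hφB⟩
      refine ⟨hφ, hBU hφB, ?_⟩
      have hr : 0 < p.2 := lt_of_lt_of_le (by positivity) h3
      have key : ∀ a t : ℝ, |a| ≤ L → |t| ≤ 1 → a + p.2 * t ∈ Set.Ioo (-(4 * L)) (4 * L) := by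
        intro a t ha ht
        rw [Set.mem_Ioo, ← abs_lt]
        refine (abs_add_le _ _).trans_lt ?_
        rw [abs_mul, abs_of_pos hr]
        nlinarith [abs_nonneg t]
      exact ⟨key _ _ h1 (Real.abs_cos_le_one φ), key _ _ h2 (Real.abs_sin_le_one φ)⟩

end Wolff

theorem wolff_circles
    (D : Set (EuclideanSpace ℝ (Fin 2) × ℝ))
    (hDpos : ∀ p ∈ D, 0 < p.2)
    (hDdim : 1 < dimH D)
    (B : Set (EuclideanSpace ℝ (Fin 2)))
    (hBmeas : MeasurableSet B)
    (hB : ∀ p ∈ D, 0 < μH[1] (B ∩ Metric.sphere p.1 p.2)) :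
    0 < volume B := by
  by_contra hcon
  have hB0 : volume B = 0 := le_antisymm (not_lt.1 hcon) zero_le
  let E : ℕ → Set (EuclideanSpace ℝ (Fin 2) × ℝ) := fun m => {p ∈ D | |p.1 0| ≤ (m:ℝ) + 1 ∧ |p.1 1| ≤ (m:ℝ) + 1 ∧ 1 / ((m:ℝ) + 1) ≤ p.2 ∧ p.2 ≤ (m:ℝ) + 1 ∧
      ENNReal.ofReal (1 / ((m:ℝ) + 1)) < volume {φ ∈ Set.Ioc 0 (2 * Real.pi) | Wolff.pt (Wolff.planeEquiv p.1) p.2 φ ∈ Wolff.planeEquiv.symm ⁻¹' B}}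
  have hDE : D ⊆ ⋃ m, E m := by
    intro p hp
    have hr := hDpos p hp
    have hpos := Wolff.arc_pos hr (hB p hp)
    have t1 : Filter.Tendsto (fun m : ℕ => (m:ℝ) + 1) Filter.atTop Filter.atTop :=
      Filter.tendsto_atTop_add_const_right _ _ tendsto_natCast_atTop_atTop
    have t2 : Filter.Tendsto (fun m : ℕ => 1 / ((m:ℝ) + 1)) Filter.atTop (nhds 0) := tendsto_one_div_add_atTop_nhds_zero_nat
    have t3 : Filter.Tendsto (fun m : ℕ => ENNReal.ofReal (1 / ((m:ℝ) + 1))) Filter.atTop (nhds 0) := by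
      simpa using ENNReal.tendsto_ofReal t2
    obtain ⟨m, h1, h2, h3, h4, h5⟩ := ((t1.eventually_ge_atTop |p.1 0|).and ((t1.eventually_ge_atTop |p.1 1|).and
      ((t2.eventually_le_const hr).and ((t1.eventually_ge_atTop p.2).and (t3.eventually (gt_mem_nhds hpos)))))).exists
    exact Set.mem_iUnion.2 ⟨m, hp, h1, h2, h3, h4, h5⟩
  have hE : ∀ m, dimH (E m) ≤ 1 := fun m =>
    Wolff.dim_step hB0 (L := (m:ℝ) + 1) (by linarith [(Nat.cast_nonneg m : (0:ℝ) ≤ m)]) fun p hp => hp.2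
  have : dimH D ≤ 1 := (dimH_mono hDE).trans (by rw [dimH_iUnion]; exact iSup_le hE)
  exact absurd hDdim (not_lt.2 this)
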